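/- Define f : ℕ → ℕ by f(2m) = m, f(4m+1) = 3m and f(4m−1) = 3m−3 for integers m ≥ 1. There exists a positive integer n₀ such that for every n ≥ n₀ the following holds: if P is a set of n points in the real projective plane ℝP², not all lying on one line, then P spans at least f(n) ordinary lines. -/

import Mathlib

/-- The real projective plane: one-dimensional subspaces of `ℝ³`. -/
abbrev RP2 := Projectivization ℝ (Fin 3 → ℝ)

/-- A line in `ℝP²`: the set of points contained in a fixed
two-dimensional linear subspace of `ℝ³`. -/
def IsProjLine (L : Set RP2) : Prop :=
  ∃ W : Submodule ℝ (Fin 3 → ℝ), Module.finrank ℝ W = 2 ∧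
    L = {x : RP2 | x.submodule ≤ W}

/-- The number of ordinary lines of `P`: lines containing exactly two points of `P`. -/
noncomputable def numOrdinaryLines (P : Set RP2) : ℕ :=
  {L : Set RP2 | IsProjLine L ∧ (P ∩ L).ncard = 2}.ncard

/-- The sharp lower bound function for the Dirac–Motzkin problem:
`f (2m) = m`, `f (4m+1) = 3m`, `f (4m-1) = 3m - 3`. -/
def dmBound (n : ℕ) : ℕ :=
  if n % 2 = 0 then n / 2
  else if n % 4 = 1 then 3 * (n / 4)
  else 3 * ((n + 1) / 4) - 3

noncomputable section
open List (nodup_cons nodup_nil not_mem_nil)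
open Finset (card_insert_of_notMem card_singleton mem_insert mem_singleton sum_le_card_nsmul range sum_range_succ sum_range_zero card_union_le mem_union mem_union_left mem_union_right Ico card_image_le card_biUnion_le_card_mul mem_image mem_biUnion mem_image_of_mem mem_range mem_Ico sum_const Icc mem_sdiff mem_Icc mem_filter card_le_card_of_injOn mem_coe card_sdiff_of_subset filter_subset card_range mem_sigma card_sigma card_nsmul_le_sum card_product mem_product card_le_card card_filter_add_card_filter_not card_filter_le card_union_of_disjoint card_image_of_injOn coe_Ico disjoint_left sum_le_sum mul_sum sum_add_distrib sum_le_sum_of_subset card_pos card_le_one two_lt_card_iff one_lt_card card_filter sum_congr card_image_of_injective eq_of_subset_of_card_le filter_congr card_empty card_le_card_of_forall_subsingleton mem_erase card_eq_one mem_singleton_self mem_powersetCard)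

/-- finite sets of reals -/
notation "Fr" => Finset ℝ
/-- functions whose graphs carry the points -/
notation "Fn" => ℝ → ℝ
/-- the set of the two components of a pair -/
notation "PR(" r ")" => ({Prod.fst r, Prod.snd r} : Finset ℝ)

namespace GT
open Finset

/-- cyclic successor in a finite set of reals -/
def nxt (s : Fr) (a : ℝ) : ℝ :=
  if h : (s.filter (fun y => a < y)).Nonempty then (s.filter (fun y => a < y)).min' h
  else if h : s.Nonempty then s.min' h else a

/-- cyclic predecessor in a finite set of reals -/
def prv (s : Fr) (a : ℝ) : ℝ :=
  if h : (s.filter (fun y => y < a)).Nonempty then (s.filter (fun y => y < a)).max' h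
  else if h : s.Nonempty then s.max' h else a

lemma nxt_cases (s : Fr) (a : ℝ) (ha : a ∈ s) :
    nxt s a ∈ s ∧ ((a < nxt s a ∧ ∀ y ∈ s, a < y → nxt s a ≤ y) ∨
      (nxt s a ≤ a ∧ (∀ y ∈ s, y ≤ a) ∧ ∀ y ∈ s, nxt s a ≤ y)) := by
  unfold nxt
  split_ifs with h h'
  · have := min'_mem _ h
    rw [mem_filter] at this
    exact ⟨this.1, Or.inl ⟨this.2, fun y hy hay => min'_le _ _ (mem_filter.2 ⟨hy, hay⟩)⟩⟩
  · refine ⟨min'_mem _ h', Or.inr ⟨min'_le _ _ ha, fun y hy => ?_, fun y hy => min'_le _ _ hy⟩⟩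
    by_contra hc
    exact h ⟨y, mem_filter.2 ⟨hy, not_le.1 hc⟩⟩
  · exact absurd ⟨a, ha⟩ h'

lemma prv_cases (s : Fr) (a : ℝ) (ha : a ∈ s) :
    prv s a ∈ s ∧ ((prv s a < a ∧ ∀ y ∈ s, y < a → y ≤ prv s a) ∨
      (a ≤ prv s a ∧ (∀ y ∈ s, a ≤ y) ∧ ∀ y ∈ s, y ≤ prv s a)) := by
  unfold prv
  split_ifs with h h'
  · have := max'_mem _ h
    rw [mem_filter] at this
    exact ⟨this.1, Or.inl ⟨this.2, fun y hy hay => le_max' _ _ (mem_filter.2 ⟨hy, hay⟩)⟩⟩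
  · refine ⟨max'_mem _ h', Or.inr ⟨le_max' _ _ ha, fun y hy => ?_, fun y hy => le_max' _ _ hy⟩⟩
    by_contra hc
    exact h ⟨y, mem_filter.2 ⟨hy, not_le.1 hc⟩⟩
  · exact absurd ⟨a, ha⟩ h'

lemma nxt_mem {s : Fr} {a : ℝ} (ha : a ∈ s) : nxt s a ∈ s := (nxt_cases s a ha).1
lemma prv_mem {s : Fr} {a : ℝ} (ha : a ∈ s) : prv s a ∈ s := (prv_cases s a ha).1

lemma nxt_eq_of_lt {s : Fr} {a b : ℝ} (ha : a ∈ s) (hb : b ∈ s) (hab : a < b)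
    (h : ∀ y ∈ s, a < y → b ≤ y) : nxt s a = b := by
  obtain ⟨h1, ⟨h2, h3⟩ | ⟨h2, h3, h4⟩⟩ := nxt_cases s a ha
  · exact le_antisymm (h3 b hb hab) (h _ h1 h2)
  · exact absurd (h3 b hb) (not_le.2 hab)

lemma nxt_eq_of_max {s : Fr} {a b : ℝ} (ha : a ∈ s) (hb : b ∈ s) (hmax : ∀ y ∈ s, y ≤ a)
    (h : ∀ y ∈ s, b ≤ y) : nxt s a = b := by
  obtain ⟨h1, ⟨h2, h3⟩ | ⟨h2, h3, h4⟩⟩ := nxt_cases s a ha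
  · exact absurd (hmax _ h1) (not_le.2 h2)
  · exact le_antisymm (h4 b hb) (h _ h1)

lemma prv_eq_of_lt {s : Fr} {a b : ℝ} (ha : a ∈ s) (hb : b ∈ s) (hab : b < a)
    (h : ∀ y ∈ s, y < a → y ≤ b) : prv s a = b := by
  obtain ⟨h1, ⟨h2, h3⟩ | ⟨h2, h3, h4⟩⟩ := prv_cases s a ha
  · exact le_antisymm (h _ h1 h2) (h3 b hb hab)
  · exact absurd (h3 b hb) (not_le.2 hab)

lemma prv_eq_of_min {s : Fr} {a b : ℝ} (ha : a ∈ s) (hb : b ∈ s) (hmin : ∀ y ∈ s, a ≤ y)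
    (h : ∀ y ∈ s, y ≤ b) : prv s a = b := by
  obtain ⟨h1, ⟨h2, h3⟩ | ⟨h2, h3, h4⟩⟩ := prv_cases s a ha
  · exact absurd (hmin _ h1) (not_le.2 h2)
  · exact le_antisymm (h _ h1) (h4 b hb)

lemma prv_nxt {s : Fr} {a : ℝ} (ha : a ∈ s) : prv s (nxt s a) = a := by
  obtain ⟨h1, ⟨h2, h3⟩ | ⟨h2, h3, h4⟩⟩ := nxt_cases s a ha
  · refine prv_eq_of_lt h1 ha h2 fun y hy hlt => ?_
    by_contra hc
    exact absurd (h3 y hy (not_le.1 hc)) (not_le.2 hlt)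
  · exact prv_eq_of_min h1 ha h4 h3

lemma nxt_prv {s : Fr} {a : ℝ} (ha : a ∈ s) : nxt s (prv s a) = a := by
  obtain ⟨h1, ⟨h2, h3⟩ | ⟨h2, h3, h4⟩⟩ := prv_cases s a ha
  · refine nxt_eq_of_lt h1 ha h2 fun y hy hlt => ?_
    by_contra hc
    exact absurd (h3 y hy (not_le.1 hc)) (not_le.2 hlt)
  · exact nxt_eq_of_max h1 ha h4 h3

lemma nxt_neg {s : Fr} {a : ℝ} (ha : a ∈ s) :
    nxt (s.image (fun y => -y)) (-a) = - prv s a := by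
  have key : ∀ y, y ∈ s → -y ∈ s.image (fun y => -y) := fun y hy => mem_image_of_mem _ hy
  obtain ⟨h1, ⟨h2, h3⟩ | ⟨h2, h3, h4⟩⟩ := prv_cases s a ha
  · refine nxt_eq_of_lt (key _ ha) (key _ h1) (by linarith) fun y hy hlt => ?_
    obtain ⟨z, hz, rfl⟩ := mem_image.1 hy
    have := h3 z hz (by linarith)
    linarith
  · refine nxt_eq_of_max (key _ ha) (key _ h1) (fun y hy => ?_) fun y hy => ?_
    · obtain ⟨z, hz, rfl⟩ := mem_image.1 hy
      have := h3 z hz; linarith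
    · obtain ⟨z, hz, rfl⟩ := mem_image.1 hy
      have := h4 z hz; linarith

lemma prv_neg {s : Fr} {a : ℝ} (ha : a ∈ s) :
    prv (s.image (fun y => -y)) (-a) = - nxt s a := by
  have h := nxt_neg (s := s) (nxt_mem ha)
  rw [prv_nxt ha] at h
  rw [← h, prv_nxt (mem_image_of_mem _ (nxt_mem ha))]

/-- points of `X` on the line of slope `t` through `(x, f x)` -/
def Ln (X : Fr) (f : Fn) (x t : ℝ) : Fr :=
  X.filter (fun y => f y - f x = t * (y - x))

/-- slopes of the lines joining `x` to the other points of `X` -/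
def Sl (X : Fr) (f : Fn) (x : ℝ) : Fr :=
  (X.erase x).image (fun y => (f y - f x) / (y - x))

abbrev Dart := ℝ × ℝ × Bool

/-- rotation about the vertex -/
def rho (X : Fr) (f : Fn) (d : Dart) : Dart :=
  (nxt (Ln X f d.1 d.2.1) d.1, d.2.1,
    if nxt (Ln X f d.1 d.2.1) d.1 ≤ d.1 then !d.2.2 else d.2.2)

/-- inverse rotation about the vertex -/
def rhoi (X : Fr) (f : Fn) (d : Dart) : Dart :=
  (prv (Ln X f d.1 d.2.1) d.1, d.2.1,
    if d.1 ≤ prv (Ln X f d.1 d.2.1) d.1 then !d.2.2 else d.2.2)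

/-- other end of the edge -/
def rev (X : Fr) (f : Fn) (d : Dart) : Dart :=
  if d.2.2 then (d.1, nxt (Sl X f d.1) d.2.1, false) else (d.1, prv (Sl X f d.1) d.2.1, true)

/-- the set of darts -/
def darts (X : Fr) (f : Fn) : Finset Dart :=
  (X.biUnion (fun x => (Sl X f x).image (fun t => (x, t, true)))) ∪
  (X.biUnion (fun x => (Sl X f x).image (fun t => (x, t, false))))

section
variable {X : Fr} {f : Fn}

lemma mem_darts {d : Dart} : d ∈ darts X f ↔ d.1 ∈ X ∧ d.2.1 ∈ Sl X f d.1 := by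
  obtain ⟨x, t, e⟩ := d
  unfold darts
  simp only [mem_union, mem_biUnion, mem_image, Prod.mk.injEq]
  constructor
  · rintro (⟨a, ha, b, hb, rfl, rfl, h⟩ | ⟨a, ha, b, hb, rfl, rfl, h⟩) <;> exact ⟨ha, hb⟩
  · rintro ⟨h1, h2⟩
    cases e
    · exact Or.inr ⟨x, h1, t, h2, rfl, rfl, rfl⟩
    · exact Or.inl ⟨x, h1, t, h2, rfl, rfl, rfl⟩

lemma mem_Ln {x t y : ℝ} : y ∈ Ln X f x t ↔ y ∈ X ∧ f y - f x = t * (y - x) := by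
  simp [Ln]

lemma mem_Sl {x t : ℝ} : t ∈ Sl X f x ↔ ∃ y ∈ Ln X f x t, y ≠ x := by
  simp only [Sl, mem_image, mem_erase, mem_Ln]
  constructor
  · rintro ⟨y, ⟨h1, h2⟩, rfl⟩
    refine ⟨y, ⟨h2, ?_⟩, h1⟩
    have : y - x ≠ 0 := sub_ne_zero.2 h1
    field_simp
  · rintro ⟨y, ⟨h1, h2⟩, h3⟩
    refine ⟨y, ⟨h3, h1⟩, ?_⟩
    have : y - x ≠ 0 := sub_ne_zero.2 h3
    rw [h2]; field_simp

lemma self_mem_Ln {x t : ℝ} (hx : x ∈ X) : x ∈ Ln X f x t := by simp [mem_Ln, hx]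

lemma Ln_eq {x y t : ℝ} (hy : y ∈ Ln X f x t) : Ln X f y t = Ln X f x t := by
  ext z
  rw [mem_Ln] at hy
  simp only [mem_Ln]
  refine and_congr_right fun _ => ⟨fun h => by linarith, fun h => by linarith⟩

lemma Sl_of_mem {x y t : ℝ} (hx : x ∈ X) (hy : y ∈ Ln X f x t) (ht : t ∈ Sl X f x) :
    t ∈ Sl X f y := by
  rw [mem_Sl, Ln_eq hy]
  by_cases h : x = y
  · subst h; exact mem_Sl.1 ht
  · exact ⟨x, self_mem_Ln hx, h⟩

lemma mem_X_of_Ln {x y t : ℝ} (hy : y ∈ Ln X f x t) : y ∈ X := (mem_Ln.1 hy).1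

lemma rho_mem {d : Dart} (hd : d ∈ darts X f) : rho X f d ∈ darts X f := by
  rw [mem_darts] at *
  have := nxt_mem (self_mem_Ln (f := f) (t := d.2.1) hd.1)
  exact ⟨mem_X_of_Ln this, Sl_of_mem hd.1 this hd.2⟩

lemma rhoi_mem {d : Dart} (hd : d ∈ darts X f) : rhoi X f d ∈ darts X f := by
  rw [mem_darts] at *
  have := prv_mem (self_mem_Ln (f := f) (t := d.2.1) hd.1)
  exact ⟨mem_X_of_Ln this, Sl_of_mem hd.1 this hd.2⟩

lemma rev_mem {d : Dart} (hd : d ∈ darts X f) : rev X f d ∈ darts X f := by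
  rw [mem_darts] at *
  unfold rev
  split_ifs
  · exact ⟨hd.1, nxt_mem hd.2⟩
  · exact ⟨hd.1, prv_mem hd.2⟩

lemma rev_rev {d : Dart} (hd : d ∈ darts X f) : rev X f (rev X f d) = d := by
  rw [mem_darts] at hd
  obtain ⟨x, t, e⟩ := d
  cases e
  · simp [rev, nxt_prv hd.2]
  · simp [rev, prv_nxt hd.2]

lemma nxt_ne {s : Fr} {a y : ℝ} (ha : a ∈ s) (hy : y ∈ s) (h : y ≠ a) : nxt s a ≠ a := by
  intro h0
  obtain ⟨h1, ⟨h2, h3⟩ | ⟨h2, h3, h4⟩⟩ := nxt_cases s a ha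
  · linarith
  · exact h (le_antisymm (h3 y hy) (h0 ▸ h4 y hy))

lemma prv_ne {s : Fr} {a y : ℝ} (ha : a ∈ s) (hy : y ∈ s) (h : y ≠ a) : prv s a ≠ a := by
  intro h0
  obtain ⟨h1, ⟨h2, h3⟩ | ⟨h2, h3, h4⟩⟩ := prv_cases s a ha
  · linarith
  · exact h (le_antisymm (h0 ▸ h4 y hy) (h3 y hy))

lemma rhoi_rho {d : Dart} (hd : d ∈ darts X f) : rhoi X f (rho X f d) = d := by
  rw [mem_darts] at hd
  obtain ⟨x, t, e⟩ := d
  have hs := self_mem_Ln (f := f) (t := t) hd.1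
  have h1 := nxt_mem hs
  obtain ⟨y, hy, hyx⟩ := mem_Sl.1 hd.2
  have hne := nxt_ne hs hy hyx
  simp only [rho, rhoi, Ln_eq h1, prv_nxt hs]
  by_cases h : nxt (Ln X f x t) x ≤ x
  · simp [h]
  · simp [h]

lemma rho_rhoi {d : Dart} (hd : d ∈ darts X f) : rho X f (rhoi X f d) = d := by
  rw [mem_darts] at hd
  obtain ⟨x, t, e⟩ := d
  have hs := self_mem_Ln (f := f) (t := t) hd.1
  have h1 := prv_mem hs
  obtain ⟨y, hy, hyx⟩ := mem_Sl.1 hd.2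
  have hne := prv_ne hs hy hyx
  simp only [rho, rhoi, Ln_eq h1, nxt_prv hs]
  by_cases h : x ≤ prv (Ln X f x t) x
  · simp [h]
  · simp [h]

end

def phi (X : Fr) (f : Fn) (d : Dart) : Dart := rhoi X f (rev X f d)
def phii (X : Fr) (f : Fn) (d : Dart) : Dart := rev X f (rho X f d)

/-- reflection of a dart -/
def JJ (d : Dart) : Dart := (d.1, -d.2.1, !d.2.2)

def Side (X : Fr) (f : Fn) : Finset Dart :=
  (darts X f).filter (fun d => nxt (Ln X f d.1 d.2.1) d.1 ≤ d.1)

def RO (X : Fr) (f : Fn) : Finset Dart :=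
  (darts X f).filter (fun d => d.2.2 = true ∧ d.1 < nxt (Ln X f d.1 d.2.1) d.1 ∧
    d.2.1 < nxt (Sl X f d.1) d.2.1 ∧
    d.2.1 < nxt (Sl X f (nxt (Ln X f d.1 d.2.1) d.1)) d.2.1)

open Classical in
def Ph (X : Fr) (f : Fn) (d : Dart) : Dart :=
  if nxt (Sl X f d.1) d.2.1 ≤ nxt (Sl X f (nxt (Ln X f d.1 d.2.1) d.1)) d.2.1 then
    phi X f d else phii X f d

section
variable {X : Fr} {f : Fn}

lemma phi_mem {d : Dart} (hd : d ∈ darts X f) : phi X f d ∈ darts X f := rhoi_mem (rev_mem hd)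
lemma phii_mem {d : Dart} (hd : d ∈ darts X f) : phii X f d ∈ darts X f := rev_mem (rho_mem hd)
lemma phi_phii {d : Dart} (hd : d ∈ darts X f) : phi X f (phii X f d) = d := by
  rw [phi, phii, rev_rev (rho_mem hd), rhoi_rho hd]
lemma phii_phi {d : Dart} (hd : d ∈ darts X f) : phii X f (phi X f d) = d := by
  rw [phi, phii, rho_rhoi (rev_mem hd), rev_rev hd]

lemma JJ_JJ (d : Dart) : JJ (JJ d) = d := by simp [JJ]
lemma JJ_inj : Function.Injective JJ := fun a b h => by rw [← JJ_JJ a, h, JJ_JJ]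

lemma Ln_neg (x t : ℝ) : Ln X (fun x => - f x) x (-t) = Ln X f x t := by
  ext y
  simp only [mem_Ln]
  refine and_congr_right fun _ => ⟨fun h => by linarith, fun h => by linarith⟩

lemma Sl_neg (x : ℝ) : Sl X (fun x => - f x) x = (Sl X f x).image (fun y => -y) := by
  rw [Sl, Sl, image_image]
  congr 1
  ext y
  simp only [Function.comp]
  rw [← neg_div]; congr 1; ring

lemma JJ_mem {d : Dart} : JJ d ∈ darts X (fun x => - f x) ↔ d ∈ darts X f := by
  simp [mem_darts, JJ, Sl_neg]

lemma rho_JJ (d : Dart) : rho X (fun x => - f x) (JJ d) = JJ (rho X f d) := by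
  simp only [rho, JJ, Ln_neg]
  split_ifs <;> simp

lemma rhoi_JJ (d : Dart) : rhoi X (fun x => - f x) (JJ d) = JJ (rhoi X f d) := by
  simp only [rhoi, JJ, Ln_neg]
  split_ifs <;> simp

lemma rev_JJ {d : Dart} (hd : d ∈ darts X f) :
    rev X (fun x => - f x) (JJ d) = JJ (rev X f d) := by
  obtain ⟨x, t, e⟩ := d
  rw [mem_darts] at hd
  cases e
  · simp [rev, JJ, Sl_neg, nxt_neg hd.2]
  · simp [rev, JJ, Sl_neg, prv_neg hd.2]

lemma phi_JJ {d : Dart} (hd : d ∈ darts X f) :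
    phi X (fun x => - f x) (JJ d) = JJ (phi X f d) := by
  rw [phi, phi, rev_JJ hd, rhoi_JJ]

lemma phii_JJ {d : Dart} (hd : d ∈ darts X f) :
    phii X (fun x => - f x) (JJ d) = JJ (phii X f d) := by
  rw [phii, phii, rho_JJ, rev_JJ (rho_mem hd)]

lemma Side_JJ {d : Dart} : JJ d ∈ Side X (fun x => - f x) ↔ d ∈ Side X f := by
  simp only [Side, mem_filter, JJ_mem]
  simp only [JJ, Ln_neg]

/-- two dual lines which change order cross in between -/
lemma cross {x y r s : ℝ} (_hx : x ∈ X) (hy : y ∈ X) (hrs : r < s)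
    (h : (r * x - f x < r * y - f y ∧ s * y - f y < s * x - f x) ∨
      (r * y - f y < r * x - f x ∧ s * x - f x < s * y - f y)) :
    ∃ t, r < t ∧ t < s ∧ t ∈ Sl X f x := by
  have hne : x ≠ y := by
    rintro rfl
    rcases h with h | h <;> linarith [h.1, h.2]
  refine ⟨(f y - f x) / (y - x), ?_, ?_, ?_⟩
  · rcases h with ⟨h1, h2⟩ | ⟨h1, h2⟩
    · have : y - x < 0 := by nlinarith
      rw [lt_div_iff_of_neg this]; linarith
    · have : 0 < y - x := by nlinarith
      rw [lt_div_iff₀ this]; linarith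
  · rcases h with ⟨h1, h2⟩ | ⟨h1, h2⟩
    · have : y - x < 0 := by nlinarith
      rw [div_lt_iff_of_neg this]; linarith
    · have : 0 < y - x := by nlinarith
      rw [div_lt_iff₀ this]; linarith
  · exact mem_image_of_mem _ (mem_erase.2 ⟨hne.symm, hy⟩)

lemma meet {x y t : ℝ} (hy : y ∈ X) (h : t * x - f x = t * y - f y) : y ∈ Ln X f x t :=
  mem_Ln.2 ⟨hy, by linarith⟩

lemma nxt_gap {s : Fr} {a y : ℝ} (ha : a ∈ s) (hy : y ∈ s) (h1 : a < y)
    (h2 : y < nxt s a) : False := by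
  obtain ⟨-, ⟨h4, h3⟩ | ⟨h4, h3, -⟩⟩ := nxt_cases s a ha
  · linarith [h3 y hy h1]
  · linarith [h3 y hy]

lemma prv_gap {s : Fr} {a y : ℝ} (ha : a ∈ s) (hy : y ∈ s) (h1 : y < a)
    (h2 : prv s a < y) : False := by
  obtain ⟨-, ⟨h4, h3⟩ | ⟨h4, h3, -⟩⟩ := prv_cases s a ha
  · linarith [h3 y hy h1]
  · linarith [h3 y hy]

lemma RO_data {d : Dart} (hd : d ∈ RO X f) : ∃ l t u, d = (l, t, true) ∧ l ∈ X ∧ t ∈ Sl X f l ∧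
    u = nxt (Ln X f l t) l ∧ l < u ∧ u ∈ X ∧ u ∈ Ln X f l t ∧ t ∈ Sl X f u ∧
    t < nxt (Sl X f l) t ∧ t < nxt (Sl X f u) t ∧ rho X f d = (u, t, true) := by
  obtain ⟨l, t, e⟩ := d
  simp only [RO, mem_filter, mem_darts] at hd
  obtain ⟨⟨h1, h2⟩, h3, h4, h5, h6⟩ := hd
  subst h3
  have hu := nxt_mem (self_mem_Ln (f := f) (t := t) h1)
  refine ⟨l, t, _, rfl, h1, h2, rfl, h4, mem_X_of_Ln hu, hu, Sl_of_mem h1 hu h2, h5, h6, ?_⟩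
  simp [rho, not_le.2 h4]

lemma top_min {l t u : ℝ} (hl : l ∈ X) (ht : t ∈ Sl X f l) (hu : u ∈ Ln X f l t) (hlu : l < u)
    (h1 : t < nxt (Sl X f l) t) (h2 : nxt (Sl X f l) t ≤ nxt (Sl X f u) t) :
    ∀ y ∈ Ln X f l (nxt (Sl X f l) t), l ≤ y := by
  intro h hh
  by_contra hc
  push Not at hc
  set s := nxt (Sl X f l) t
  rw [mem_Ln] at hh
  have huX := mem_X_of_Ln hu
  have htu := Sl_of_mem hl hu ht
  rw [mem_Ln] at hu
  obtain ⟨r, hr1, hr2, hr3⟩ := cross (f := f) (r := t) (s := s) huX hh.1 h1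
    (Or.inl ⟨by nlinarith [hh.2, hu.2], by nlinarith [hh.2, hu.2]⟩)
  exact nxt_gap htu hr3 hr1 (lt_of_lt_of_le hr2 h2)

lemma bot_max {l t u : ℝ} (hl : l ∈ X) (ht : t ∈ Sl X f l) (hu : u ∈ Ln X f l t) (hlu : l < u)
    (h1 : t < nxt (Sl X f u) t) (h2 : nxt (Sl X f u) t ≤ nxt (Sl X f l) t) :
    ∀ y ∈ Ln X f u (nxt (Sl X f u) t), y ≤ u := by
  intro h hh
  by_contra hc
  push Not at hc
  set s := nxt (Sl X f u) t
  rw [mem_Ln] at hh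
  rw [mem_Ln] at hu
  obtain ⟨r, hr1, hr2, hr3⟩ := cross (f := f) (r := t) (s := s) hl hh.1 h1
    (Or.inr ⟨by nlinarith [hh.2, hu.2], by nlinarith [hh.2, hu.2]⟩)
  exact nxt_gap ht hr3 hr1 (lt_of_lt_of_le hr2 h2)

lemma le_nxt_iff {x t : ℝ} (hx : x ∈ X) :
    nxt (Ln X f x t) x ≤ x ↔ ∀ y ∈ Ln X f x t, y ≤ x := by
  have hs := self_mem_Ln (f := f) (t := t) hx
  obtain ⟨h1, ⟨h2, h3⟩ | ⟨h2, h3, h4⟩⟩ := nxt_cases _ x hs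
  · exact ⟨fun h => by linarith, fun h => h _ h1⟩
  · exact ⟨fun _ => h3, fun _ => h2⟩

lemma Ph_spec {d : Dart} (hd : d ∈ RO X f) : Ph X f d ∈ Side X f ∧
    (((Ph X f d).2.2 = true ∧ Ph X f d = phi X f d ∧
      nxt (Sl X f d.1) d.2.1 ≤ nxt (Sl X f (nxt (Ln X f d.1 d.2.1) d.1)) d.2.1) ∨
     ((Ph X f d).2.2 = false ∧ Ph X f d = phii X f d ∧
      nxt (Sl X f (nxt (Ln X f d.1 d.2.1) d.1)) d.2.1 < nxt (Sl X f d.1) d.2.1)) := by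
  have hd0 : d ∈ darts X f := (mem_filter.1 hd).1
  obtain ⟨l, t, u, rfl, hl, ht, hu, hlu, huX, huL, htu, h1, h2, h3⟩ := RO_data hd
  unfold Ph
  rw [Side]
  simp only [← hu, mem_filter]
  split_ifs with h
  · have hmin := top_min hl ht huL hlu h1 h
    have e : (phi X f (l, t, true)) =
      (prv (Ln X f l (nxt (Sl X f l) t)) l, nxt (Sl X f l) t, true) := by
      have hs := self_mem_Ln (f := f) (t := (nxt (Sl X f l) t)) hl
      have := hmin _ (prv_mem hs)
      simp [phi, rev, rhoi, this]
    refine ⟨⟨phi_mem hd0, ?_⟩, Or.inl ⟨?_, rfl, h⟩⟩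
    · rw [e]
      have hs := self_mem_Ln (f := f) (t := (nxt (Sl X f l) t)) hl
      simp only
      rw [Ln_eq (prv_mem hs), nxt_prv hs]
      exact hmin _ (prv_mem hs)
    · rw [e]
  · push Not at h
    have hmax := bot_max hl ht huL hlu h2 h.le
    have e : (phii X f (l, t, true)) = (u, nxt (Sl X f u) t, false) := by
      simp [phii, h3, rev]
    refine ⟨⟨phii_mem hd0, ?_⟩, Or.inr ⟨?_, rfl, h⟩⟩
    · rw [e]
      exact (le_nxt_iff huX).2 hmax
    · rw [e]

lemma Ph_inj : Set.InjOn (Ph X f) (RO X f : Set Dart) := by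
  intro a ha b hb hab
  have ha0 : a ∈ darts X f := (mem_filter.1 ha).1
  have hb0 : b ∈ darts X f := (mem_filter.1 hb).1
  obtain ⟨-, ⟨h1, h2, -⟩ | ⟨h1, h2, -⟩⟩ := Ph_spec ha <;>
  obtain ⟨-, ⟨h3, h4, -⟩ | ⟨h3, h4, -⟩⟩ := Ph_spec hb
  · rw [← phii_phi ha0, ← phii_phi hb0, ← h2, ← h4, hab]
  · rw [hab, h3] at h1; cases h1
  · rw [hab, h3] at h1; cases h1
  · rw [← phi_phii ha0, ← phi_phii hb0, ← h2, ← h4, hab]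

/-- the triangle lemma -/
lemma tri_top {d c c' : Dart} (hc : c ∈ RO X f) (hc' : c' ∈ RO X (fun x => - f x))
    (h1 : Ph X f c = d) (h2 : JJ (Ph X (fun x => - f x) c') = d) (hd : d.2.2 = true) :
    phi X f (phi X f (phi X f d)) = d := by
  have hc0 : c ∈ darts X f := (mem_filter.1 hc).1
  have hc0' : c' ∈ darts X (fun x => - f x) := (mem_filter.1 hc').1
  obtain ⟨hs, ⟨-, hp, hle⟩ | ⟨hf, -⟩⟩ := Ph_spec hc
  swap
  · rw [h1, hd] at hf; cases hf
  obtain ⟨hs', ⟨hf', -⟩ | ⟨-, hp', hlt⟩⟩ := Ph_spec hc'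
  · rw [← h2] at hd
    simp [JJ, hf'] at hd
  obtain ⟨l, t0, u, rfl, hl, ht, hu, hlu, huX, huL, htu, h5, h6, h7⟩ := RO_data hc
  obtain ⟨v, t1, w, rfl, hv, ht', hw, hvw, hwX, hwL, htw, h5', h6', h7'⟩ := RO_data hc'
  simp only [← hu] at hle
  simp only [← hw] at hlt
  have hmin := top_min hl ht huL hlu h5 hle
  have hmax' := bot_max hv ht' hwL hvw h6' hlt.le
  obtain ⟨t1', rfl⟩ : ∃ r, t1 = -r := ⟨-t1, by ring⟩
  rw [Ln_neg] at hw hwL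
  have mS : ∀ {x : ℝ} {r : ℝ}, -r ∈ Sl X (fun x => - f x) x ↔ r ∈ Sl X f x := by
    intro x r; rw [Sl_neg]; simp
  rw [mS] at ht' htw
  rw [Sl_neg, nxt_neg ht'] at h5'
  rw [Sl_neg, nxt_neg htw] at h6' hmax'
  rw [Sl_neg, Sl_neg, nxt_neg ht', nxt_neg htw] at hlt
  rw [Ln_neg] at hmax'
  have hd1 : d = JJ (w, - prv (Sl X f w) t1', false) := by
    rw [← h2, hp', phii, h7']
    simp [rev, Sl_neg, nxt_neg htw]
  have hd2 : d = (prv (Ln X f l (nxt (Sl X f l) t0)) l, nxt (Sl X f l) t0, true) := by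
    rw [← h1, hp]
    have hs := self_mem_Ln (f := f) (t := (nxt (Sl X f l) t0)) hl
    have := hmin _ (prv_mem hs)
    simp [phi, rev, rhoi, this]
  rw [hd1] at hd2
  simp only [JJ, Prod.mk.injEq, neg_neg] at hd2
  obtain ⟨hw2, ht2, -⟩ := hd2
  set tw := nxt (Sl X f l) t0 with htw_def
  have hwl : w ∈ Ln X f l tw := by
    rw [hw2]; exact prv_mem (self_mem_Ln hl)
  have hlw : l ≤ w := hmin _ hwl
  have h51 : prv (Sl X f v) t1' < tw := by linarith
  have h61 : tw < t1' := by linarith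
  have Hl := (mem_Ln.1 hwl).2
  have Hu := (mem_Ln.1 huL).2
  have Hw := (mem_Ln.1 hwL).2
  have htwl : tw ∈ Sl X f l := nxt_mem ht
  have P1 := mul_pos (sub_pos.2 h61) (sub_pos.2 hvw)
  have P2 := mul_pos (sub_pos.2 h5) (sub_pos.2 hlu)
  -- key: u = v
  have huv : u = v := by
    rcases lt_trichotomy (tw * v - f v) (tw * u - f u) with hlt1 | heq | hlt1
    · exfalso
      -- v above l at tw so v ≥ l at t0
      have g1 : ¬ (t0 * v - f v < t0 * l - f l) := by
        intro hh
        obtain ⟨r, hr1, hr2, hr3⟩ := cross (f := f) (r := t0) (s := tw) hl hv h5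
          (Or.inr ⟨hh, by linarith⟩)
        exact nxt_gap ht hr3 hr1 hr2
      have g2 : ¬ (t0 * l - f l < t0 * v - f v) := by
        intro hh
        obtain ⟨r, hr1, hr2, hr3⟩ := cross (f := f) (r := t0) (s := tw) huX hv h5
          (Or.inl ⟨by linarith, hlt1⟩)
        exact nxt_gap htu hr3 hr1 (lt_of_lt_of_le hr2 hle)
      have g3 : t0 * l - f l = t0 * v - f v := le_antisymm (not_lt.1 g1) (not_lt.1 g2)
      have g4 := meet (f := f) hv g3
      have g5 : l < v := by
        have : 0 < (tw - t0) * (v - l) := by linarith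
        linarith [pos_of_mul_pos_right this (by linarith)]
      have g6 : v < u := by
        have : 0 < (tw - t0) * (u - v) := by linarith
        linarith [pos_of_mul_pos_right this (by linarith)]
      rw [hu] at g6
      exact nxt_gap (self_mem_Ln hl) g4 g5 g6
    · by_contra hne
      have := meet (f := f) huX heq
      have hsl : tw ∈ Sl X f v := mem_Sl.2 ⟨u, this, hne⟩
      exact prv_gap ht' hsl h61 h51
    · exfalso
      have g1 : ¬ (t1' * u - f u < t1' * w - f w) := by
        intro hh
        obtain ⟨r, hr1, hr2, hr3⟩ := cross (f := f) (r := tw) (s := t1') hwX huX h61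
          (Or.inl ⟨by linarith, hh⟩)
        exact prv_gap htw hr3 hr2 (by linarith)
      have g2 : ¬ (t1' * w - f w < t1' * u - f u) := by
        intro hh
        obtain ⟨r, hr1, hr2, hr3⟩ := cross (f := f) (r := tw) (s := t1') hv huX h61
          (Or.inr ⟨hlt1, by linarith⟩)
        exact prv_gap ht' hr3 hr2 (by linarith)
      have g3 : t1' * v - f v = t1' * u - f u := by
        have := le_antisymm (not_lt.1 g1) (not_lt.1 g2); linarith
      have g4 := meet (f := f) huX g3
      have g5 : v < u := by
        have : 0 < (t1' - tw) * (u - v) := by linarith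
        linarith [pos_of_mul_pos_right this (by linarith)]
      have g6 : u < w := by
        have : 0 < (t1' - tw) * (w - u) := by linarith
        linarith [pos_of_mul_pos_right this (by linarith)]
      rw [hw] at g6
      exact nxt_gap (self_mem_Ln hv) g4 g5 g6
  have hprv : prv (Sl X f v) t1' = t0 := by
    subst huv
    refine prv_eq_of_lt ht' htu (by linarith) fun y hy hyt => ?_
    by_contra hc2
    push Not at hc2
    rcases lt_or_ge y tw with h | h
    · exact nxt_gap htu hy hc2 (lt_of_lt_of_le h hle)
    · exact prv_gap ht' hy hyt (by linarith)
  -- conclude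
  have hcd : phi X f d = (v, t1', false) := by
    have hm : (v, t1', false) ∈ darts X f := mem_darts.2 ⟨hv, ht'⟩
    have e2 : phii X f (v, t1', false) = d := by
      have := phii_JJ hm
      rw [← h2, hp']
      apply JJ_inj
      rw [JJ_JJ, ← this]
      simp [JJ]
    exact (congrArg (phi X f) e2.symm).trans (phi_phii hm)
  have hcc : phi X f (v, t1', false) = (l, t0, true) := by
    rw [phi]
    have : rev X f (v, t1', false) = rho X f (l, t0, true) := by
      rw [h7]; simp [rev, hprv, huv]
    rw [this, rhoi_rho hc0]
  have e3 : phi X f (phi X f (phi X f d)) = phi X f (phi X f (v, t1', false)) :=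
    congrArg (fun z => phi X f (phi X f z)) hcd
  have e4 : phi X f (phi X f (v, t1', false)) = phi X f (l, t0, true) :=
    congrArg (fun z => phi X f z) hcc
  exact e3.trans (e4.trans (hp.symm.trans h1))

end

open Classical in
/-- pairs of points of the configuration spanning an ordinary line -/
def ordPairs (X : Fr) (f : Fn) : Finset (Fr) :=
  (X.powersetCard 2).filter (fun s => ∃ t c : ℝ, ∀ x ∈ X, f x = t * x + c ↔ x ∈ s)

def N2 (X : Fr) (f : Fn) : ℕ := (ordPairs X f).card

section
variable {X : Fr} {f : Fn}

lemma two_card_filter (S : Finset Dart) (hS : ∀ d ∈ S, ((d.1, d.2.1, !d.2.2) : Dart) ∈ S) (b : Bool) :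
    2 * (S.filter (fun d => d.2.2 = b)).card = S.card := by
  have h1 := card_filter_add_card_filter_not (s := S) (fun d => d.2.2 = b)
  have h2 : (S.filter (fun d => d.2.2 = b)).card = (S.filter (fun d => ¬ d.2.2 = b)).card := by
    apply card_bij (fun d _ => ((d.1, d.2.1, !d.2.2) : Dart))
    · intro a ha
      rw [mem_filter] at ha ⊢
      refine ⟨hS _ ha.1, ?_⟩
      simp [ha.2]
    · rintro ⟨a, b, c⟩ _ ⟨a', b', c'⟩ _ h
      simpa using h
    · intro a ha
      rw [mem_filter] at ha
      refine ⟨(a.1, a.2.1, !a.2.2), ?_, by simp⟩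
      rw [mem_filter]
      refine ⟨hS _ ha.1, ?_⟩
      have := ha.2
      revert this
      cases a.2.2 <;> cases b <;> simp
  omega

/-- the side dart at the same vertex -/
def sid (X : Fr) (f : Fn) (d : Dart) : Dart :=
  if h : (Ln X f d.1 d.2.1).Nonempty then ((Ln X f d.1 d.2.1).max' h, d.2.1, d.2.2) else d

lemma sid_spec {d : Dart} (hd : d ∈ darts X f) : sid X f d ∈ Side X f ∧
    (sid X f d).1 ∈ Ln X f d.1 d.2.1 ∧ (sid X f d).2 = d.2 := by
  rw [mem_darts] at hd
  have hs := self_mem_Ln (f := f) (t := d.2.1) hd.1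
  have hne : (Ln X f d.1 d.2.1).Nonempty := ⟨_, hs⟩
  have hm := max'_mem _ hne
  simp only [sid, hne, dite_true, Side, mem_filter, mem_darts]
  refine ⟨⟨⟨mem_X_of_Ln hm, Sl_of_mem hd.1 hm hd.2⟩, ?_⟩, hm, trivial⟩
  rw [le_nxt_iff (mem_X_of_Ln hm), Ln_eq hm]
  exact fun y hy => le_max' _ _ hy

lemma sum_Side (g : Dart → ℤ) (hg : ∀ x y t e, y ∈ Ln X f x t → g (y, t, e) = g (x, t, e)) :
    ∑ d ∈ darts X f, g d = ∑ d ∈ Side X f, ((Ln X f d.1 d.2.1).card : ℤ) * g d := by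
  rw [← sum_fiberwise_of_maps_to (fun d hd => (sid_spec hd).1)]
  refine sum_congr rfl fun s hs => ?_
  obtain ⟨w, t, e⟩ := s
  have hs0 := hs
  rw [Side, mem_filter, mem_darts] at hs0
  obtain ⟨⟨hw, ht⟩, hmx⟩ := hs0
  have : (darts X f).filter (fun d => sid X f d = (w, t, e)) =
      (Ln X f w t).image (fun y => (y, t, e)) := by
    ext d
    obtain ⟨y, t', e'⟩ := d
    simp only [mem_filter, mem_image, Prod.mk.injEq]
    constructor
    · rintro ⟨hd, hsd⟩
      have := sid_spec hd
      rw [hsd] at this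
      obtain ⟨-, h1, h2⟩ := this
      simp only [Prod.mk.injEq] at h1 h2
      obtain ⟨rfl, rfl⟩ := h2
      refine ⟨y, ?_, rfl, rfl, rfl⟩
      rw [Ln_eq h1]
      exact self_mem_Ln (mem_darts.1 hd).1
    · rintro ⟨y', hy', rfl, rfl, rfl⟩
      have hd : (y', t, e) ∈ darts X f := mem_darts.2 ⟨mem_X_of_Ln hy', Sl_of_mem hw hy' ht⟩
      refine ⟨hd, ?_⟩
      obtain ⟨h1, h2, h3⟩ := sid_spec hd
      simp only [Ln_eq hy'] at h2
      refine Prod.ext ?_ h3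
      rw [Side, mem_filter, mem_darts] at h1
      have a1 := (le_nxt_iff h1.1.1).1 h1.2
      have a2 := (le_nxt_iff hw).1 hmx
      apply le_antisymm (a2 _ h2)
      rw [h3, Ln_eq h2] at a1
      exact a1 w (self_mem_Ln hw)
  rw [this, sum_image (by rintro a _ b _ h; simpa using h)]
  rw [sum_congr rfl (fun y hy => hg w y t e hy)]
  simp

lemma two_le_card {d : Dart} (hd : d ∈ darts X f) : 2 ≤ (Ln X f d.1 d.2.1).card := by
  rw [mem_darts] at hd
  obtain ⟨y, hy, hyx⟩ := mem_Sl.1 hd.2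
  exact one_lt_card.2 ⟨y, hy, _, self_mem_Ln hd.1, hyx⟩

def nonRO (X : Fr) (f : Fn) : Finset Dart :=
  (darts X f).filter (fun d => d.2.2 = true ∧ d.1 < nxt (Ln X f d.1 d.2.1) d.1 ∧ d ∉ RO X f)

lemma nxt_le_iff {s : Fr} {a : ℝ} (ha : a ∈ s) : nxt s a ≤ a ↔ ∀ y ∈ s, y ≤ a := by
  obtain ⟨h1, ⟨h2, h3⟩ | ⟨h2, h3, h4⟩⟩ := nxt_cases s a ha
  · exact ⟨fun h => by linarith, fun h => h _ h1⟩
  · exact ⟨fun _ => h3, fun _ => h2⟩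

lemma nonRO_card : (nonRO X f).card ≤ 2 * X.card := by
  classical
  have hsub : nonRO X f ⊆
      (nonRO X f).filter (fun d => nxt (Sl X f d.1) d.2.1 ≤ d.2.1) ∪
      (nonRO X f).filter (fun d => nxt (Sl X f (nxt (Ln X f d.1 d.2.1) d.1)) d.2.1 ≤ d.2.1) := by
    intro d hd
    have h0 := hd
    simp only [nonRO, RO, mem_filter, mem_union, not_and, not_lt] at h0 ⊢
    by_cases h : nxt (Sl X f d.1) d.2.1 ≤ d.2.1
    · exact Or.inl ⟨h0, h⟩
    · exact Or.inr ⟨h0, h0.2.2.2 h0.1 h0.2.1 h0.2.2.1 (not_le.1 h)⟩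
  have h1 : ((nonRO X f).filter (fun d => nxt (Sl X f d.1) d.2.1 ≤ d.2.1)).card ≤ X.card := by
    apply card_le_card_of_injOn (fun d => d.1)
    · intro d hd
      have hd := mem_coe.1 hd
      simp only [nonRO, mem_filter, mem_darts] at hd
      exact hd.1.1.1
    · rintro ⟨a, t, e⟩ ha ⟨b, t', e'⟩ hb hab
      have ha := mem_coe.1 ha
      have hb := mem_coe.1 hb
      simp only [nonRO, mem_filter, mem_darts] at ha hb hab
      subst hab
      obtain ⟨⟨⟨a1, a2⟩, rfl, -⟩, a5⟩ := ha
      obtain ⟨⟨⟨b1, b2⟩, rfl, -⟩, b5⟩ := hb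
      rw [nxt_le_iff a2] at a5
      rw [nxt_le_iff b2] at b5
      rw [le_antisymm (a5 _ b2) (b5 _ a2)]
  have h2 : ((nonRO X f).filter
      (fun d => nxt (Sl X f (nxt (Ln X f d.1 d.2.1) d.1)) d.2.1 ≤ d.2.1)).card ≤ X.card := by
    apply card_le_card_of_injOn (fun d => nxt (Ln X f d.1 d.2.1) d.1)
    · intro d hd
      have hd := mem_coe.1 hd
      simp only [nonRO, mem_filter, mem_darts] at hd
      exact mem_X_of_Ln (nxt_mem (self_mem_Ln hd.1.1.1))
    · rintro ⟨a, t, e⟩ ha ⟨b, t', e'⟩ hb hab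
      have ha := mem_coe.1 ha
      have hb := mem_coe.1 hb
      simp only [nonRO, mem_filter, mem_darts] at ha hb hab
      obtain ⟨⟨⟨a1, a2⟩, rfl, -⟩, a5⟩ := ha
      obtain ⟨⟨⟨b1, b2⟩, rfl, -⟩, b5⟩ := hb
      have ma := nxt_mem (self_mem_Ln (f := f) (t := t) a1)
      have mb := nxt_mem (self_mem_Ln (f := f) (t := t') b1)
      have sa := Sl_of_mem a1 ma a2
      have sb := Sl_of_mem b1 mb b2
      rw [nxt_le_iff sa] at a5
      rw [nxt_le_iff sb] at b5
      rw [← hab] at b5 sb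
      have htt : t = t' := le_antisymm (b5 _ sa) (a5 _ sb)
      subst htt
      have hL : Ln X f a t = Ln X f b t := by
        rw [← Ln_eq ma, ← Ln_eq mb, hab]
      have : a = b := by
        rw [← prv_nxt (self_mem_Ln (f := f) (t := t) a1), ← prv_nxt (self_mem_Ln (f := f) (t := t) b1),
          hab, hL]
      rw [this]
  calc _ ≤ _ := card_le_card hsub
    _ ≤ _ := card_union_le _ _
    _ ≤ _ := by omega

lemma RO_card : (darts X f).card ≤ 2 * (RO X f).card + 4 * X.card + (Side X f).card := by
  classical
  have h1 : (darts X f).filter (fun d => d.2.2 = true) ⊆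
      RO X f ∪ nonRO X f ∪ (Side X f).filter (fun d => d.2.2 = true) := by
    intro d hd
    rw [mem_filter] at hd
    by_cases h : nxt (Ln X f d.1 d.2.1) d.1 ≤ d.1
    · exact mem_union_right _ (mem_filter.2 ⟨mem_filter.2 ⟨hd.1, h⟩, hd.2⟩)
    · apply mem_union_left
      by_cases h' : d ∈ RO X f
      · exact mem_union_left _ h'
      · exact mem_union_right _ (mem_filter.2 ⟨hd.1, hd.2, not_le.1 h, h'⟩)
  have h2 := card_le_card h1
  have h3 := card_union_le (RO X f ∪ nonRO X f) ((Side X f).filter (fun d => d.2.2 = true))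
  have h4 := card_union_le (RO X f) (nonRO X f)
  have h5 := two_card_filter (darts X f)
    (fun d hd => by simp only [mem_darts] at hd ⊢; exact hd) true
  have h6 := two_card_filter (Side X f) (fun d hd => by
    simp only [Side, mem_filter, mem_darts] at hd ⊢; exact hd) true
  have h7 := nonRO_card (X := X) (f := f)
  omega

lemma RO_card_le : (RO X f).card ≤ (Side X f).card :=
  card_le_card_of_injOn (Ph X f) (fun _ hd => (Ph_spec hd).1) Ph_inj

def M2 (X : Fr) (f : Fn) : ℕ :=
  ((Side X f).filter (fun d => (Ln X f d.1 d.2.1).card = 2)).card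

lemma M2_le : M2 X f ≤ 2 * N2 X f := by
  classical
  have h6 := two_card_filter ((Side X f).filter (fun d => (Ln X f d.1 d.2.1).card = 2))
    (fun d hd => by
    simp only [Side, mem_filter, mem_darts] at hd ⊢; exact hd) true
  rw [← M2] at h6
  rw [← h6]
  apply Nat.mul_le_mul_left
  apply card_le_card_of_injOn (fun d => Ln X f d.1 d.2.1)
  · intro d hd
    have hd := mem_coe.1 hd
    simp only [Side, mem_filter, mem_darts] at hd
    rw [mem_coe, ordPairs, mem_filter, mem_powersetCard]
    refine ⟨⟨filter_subset _ _, hd.1.2⟩, d.2.1, f d.1 - d.2.1 * d.1, fun x hx => ?_⟩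
    rw [mem_Ln]
    exact ⟨fun h => ⟨hx, by linarith⟩, fun h => by linarith [h.2]⟩
  · rintro ⟨a, t, e⟩ ha ⟨b, t', e'⟩ hb hab
    have ha := mem_coe.1 ha
    have hb := mem_coe.1 hb
    simp only [Side, mem_filter, mem_darts] at ha hb hab
    obtain ⟨⟨⟨⟨a1, a2⟩, a3⟩, a4⟩, rfl⟩ := ha
    obtain ⟨⟨⟨⟨b1, b2⟩, b3⟩, b4⟩, rfl⟩ := hb
    rw [le_nxt_iff a1] at a3
    rw [le_nxt_iff b1] at b3
    have : a = b := le_antisymm (b3 a (hab ▸ self_mem_Ln a1)) (a3 b (hab ▸ self_mem_Ln b1))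
    subst this
    obtain ⟨y, hy, hya⟩ := mem_Sl.1 a2
    have hy' := hy
    rw [hab] at hy'
    rw [mem_Ln] at hy hy'
    have h1 : t * (y - a) = t' * (y - a) := by rw [← hy.2, ← hy'.2]
    rw [mul_right_cancel₀ (sub_ne_zero.2 hya) h1]

lemma count3 : ((darts X f).card : ℤ) - 3 * (Side X f).card ≤ 4 * X.card := by
  have h1 := RO_card (X := X) (f := f)
  have h2 := RO_card_le (X := X) (f := f)
  omega

lemma sum_card : ((darts X f).card : ℤ) = ∑ d ∈ Side X f, ((Ln X f d.1 d.2.1).card : ℤ) := by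
  have := sum_Side (X := X) (f := f) (fun _ => 1) (fun _ _ _ _ _ => rfl)
  simpa using this

lemma M2_ge : (3 * (Side X f).card : ℤ) - (darts X f).card ≤ M2 X f := by
  rw [sum_card, M2, card_filter]
  have : (3 * (Side X f).card : ℤ) = ∑ d ∈ Side X f, (3 : ℤ) := by simp [mul_comm]
  rw [this, ← sum_sub_distrib]
  push_cast
  refine sum_le_sum fun d hd => ?_
  have := two_le_card (mem_filter.1 hd).1
  split_ifs with h <;> omega

lemma ne3_card : (((darts X f).filter (fun d => (Ln X f d.1 d.2.1).card ≠ 3)).card : ℤ)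
    ≤ 16 * X.card + 6 * M2 X f := by
  have h1 := sum_Side (X := X) (f := f)
    (fun d => if (Ln X f d.1 d.2.1).card ≠ 3 then 1 else 0) (fun x y t e h => by
      simp only [Ln_eq h])
  rw [card_filter]
  push_cast
  rw [h1]
  have h2 : ∑ d ∈ Side X f, ((Ln X f d.1 d.2.1).card : ℤ) *
      (if (Ln X f d.1 d.2.1).card ≠ 3 then 1 else 0) ≤
      ∑ d ∈ Side X f, (4 * ((Ln X f d.1 d.2.1).card : ℤ) - 12 +
        6 * (if (Ln X f d.1 d.2.1).card = 2 then 1 else 0)) := by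
    refine sum_le_sum fun d hd => ?_
    have := two_le_card (mem_filter.1 hd).1
    split_ifs with h1 h2 <;> omega
  refine h2.trans ?_
  rw [sum_add_distrib, sum_sub_distrib, ← mul_sum, ← mul_sum, ← sum_card, M2, card_filter]
  have := count3 (X := X) (f := f)
  push_cast
  simp only [sum_const, nsmul_eq_mul]
  linarith

def Im1 (X : Fr) (f : Fn) : Finset Dart := (RO X f).image (Ph X f)

lemma Im1_sub : Im1 X f ⊆ Side X f := by
  intro d hd
  obtain ⟨c, hc, rfl⟩ := mem_image.1 hd
  exact (Ph_spec hc).1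

lemma Im1_card : 2 * (((Side X f) \ Im1 X f).card : ℤ) ≤ M2 X f + 4 * X.card := by
  have h1 := card_sdiff_add_card_eq_card (Im1_sub (X := X) (f := f))
  have h2 : (Im1 X f).card = (RO X f).card := card_image_of_injOn Ph_inj
  have h3 := RO_card (X := X) (f := f)
  have h4 := M2_ge (X := X) (f := f)
  omega

lemma M2_neg : M2 X (fun x => - f x) = M2 X f := by
  symm
  unfold M2
  apply card_bij (fun d _ => JJ d)
  · intro a ha
    rw [mem_filter] at ha ⊢
    exact ⟨Side_JJ.2 ha.1, by simpa [JJ, Ln_neg] using ha.2⟩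
  · intro a _ b _ h; exact JJ_inj h
  · intro b hb
    refine ⟨JJ b, ?_, JJ_JJ b⟩
    rw [mem_filter] at hb ⊢
    constructor
    · rw [← Side_JJ, JJ_JJ]; exact hb.1
    · have := hb.2
      rw [← Ln_neg]; simpa [JJ] using this

def Tri (X : Fr) (f : Fn) (d : Dart) : Prop := phi X f (phi X f (phi X f d)) = d

lemma Tri_of_phi {d : Dart} (hd : d ∈ darts X f) (h : Tri X f (phi X f d)) : Tri X f d := by
  have h' := congrArg (phii X f) h
  rw [phii_phi hd, phii_phi (phi_mem (phi_mem (phi_mem hd)))] at h'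
  exact h'

lemma Tri_of_phii {d : Dart} (hd : d ∈ darts X f) (h : Tri X f (phii X f d)) : Tri X f d := by
  have h' := congrArg (phi X f) h
  unfold Tri at *
  rwa [phi_phii hd] at h'

lemma Tri_JJ {d : Dart} (hd : d ∈ darts X f) (h : Tri X (fun x => - f x) (JJ d)) : Tri X f d := by
  unfold Tri at h
  rw [phi_JJ hd, phi_JJ (phi_mem hd), phi_JJ (phi_mem (phi_mem hd))] at h
  exact JJ_inj h

/-- bad side darts -/
def BS (X : Fr) (f : Fn) : Finset Dart :=
  (Side X f \ Im1 X f) ∪ (Side X (fun x => - f x) \ Im1 X (fun x => - f x)).image JJ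

lemma BS_card : ((BS X f).card : ℤ) ≤ M2 X f + 4 * X.card := by
  have h1 := Im1_card (X := X) (f := f)
  have h2 := Im1_card (X := X) (f := fun x => - f x)
  have h3 := card_union_le (Side X f \ Im1 X f)
    ((Side X (fun x => - f x) \ Im1 X (fun x => - f x)).image JJ)
  rw [← BS] at h3
  have h4 := card_image_le (s := Side X (fun x => - f x) \ Im1 X (fun x => - f x)) (f := JJ)
  rw [M2_neg] at h2
  omega

lemma Tri_of_Side {d : Dart} (hd : d ∈ Side X f) (h : d ∉ BS X f) : Tri X f d := by
  have hd0 := (mem_filter.1 hd).1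
  simp only [BS, mem_union, mem_sdiff, mem_image, not_or, not_and, not_not, not_exists] at h
  obtain ⟨h1, h2⟩ := h
  have h3 := h1 hd
  have h4 : JJ d ∈ Im1 X (fun x => - f x) := by
    by_contra hc
    exact h2 (JJ d) ⟨Side_JJ.2 hd, hc⟩ (JJ_JJ d)
  obtain ⟨c, hc, hcd⟩ := mem_image.1 h3
  obtain ⟨c', hc', hcd'⟩ := mem_image.1 h4
  cases he : d.2.2
  · have : Tri X (fun x => - f x) (JJ d) := by
      refine tri_top (c := c') (c' := c) hc' (by simpa using hc) hcd' ?_ ?_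
      · simp only [neg_neg]; rw [hcd]
      · simp [JJ, he]
    exact Tri_JJ hd0 this
  · exact tri_top hc hc' hcd (by rw [hcd', JJ_JJ]) he

lemma Tri_of_RO {d : Dart} (hd : d ∈ RO X f) (h : Tri X f (Ph X f d)) : Tri X f d := by
  have hd0 := (mem_filter.1 hd).1
  obtain ⟨-, ⟨-, h2, -⟩ | ⟨-, h2, -⟩⟩ := Ph_spec hd
  · rw [h2] at h; exact Tri_of_phi hd0 h
  · rw [h2] at h; exact Tri_of_phii hd0 h

open Classical in
def bad0 (X : Fr) (f : Fn) : Finset Dart :=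
  (darts X f).filter (fun d => ¬ (Tri X f d ∧ (Ln X f d.1 d.2.1).card = 3))

lemma bad0_card : (bad0 X f).card ≤ 32 * X.card + 18 * N2 X f := by
  classical
  set g : ℝ → ℝ := fun x => - f x with hg
  set R := (RO X f).filter (fun d => Ph X f d ∈ BS X f) with hR
  set R' := (RO X g).filter (fun d => Ph X g d ∈ BS X g) with hR'
  have hsub : bad0 X f ⊆ (BS X f ∪ R ∪ nonRO X f ∪ R'.image JJ ∪ (nonRO X g).image JJ) ∪
      ((darts X f).filter (fun d => (Ln X f d.1 d.2.1).card ≠ 3)) := by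
    intro d hd
    rw [bad0, mem_filter] at hd
    obtain ⟨hd, hbad⟩ := hd
    by_cases h3 : (Ln X f d.1 d.2.1).card = 3
    swap
    · exact mem_union_right _ (mem_filter.2 ⟨hd, h3⟩)
    have hT : ¬ Tri X f d := fun h => hbad ⟨h, h3⟩
    apply mem_union_left
    simp only [mem_union]
    by_cases hs : nxt (Ln X f d.1 d.2.1) d.1 ≤ d.1
    · left; left; left; left
      by_contra hc
      exact hT (Tri_of_Side (mem_filter.2 ⟨hd, hs⟩) hc)
    push Not at hs
    cases he : d.2.2
    · have hJ : JJ d ∈ darts X g := JJ_mem.2 hd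
      by_cases hro : JJ d ∈ RO X g
      · left; right
        refine mem_image.2 ⟨JJ d, mem_filter.2 ⟨hro, ?_⟩, JJ_JJ d⟩
        by_contra hc
        exact hT (Tri_JJ hd (Tri_of_RO hro (Tri_of_Side (Ph_spec hro).1 hc)))
      · right
        refine mem_image.2 ⟨JJ d, mem_filter.2 ⟨hJ, ?_, ?_, hro⟩, JJ_JJ d⟩
        · simp [JJ, he]
        · simp only [JJ, hg, Ln_neg]; exact hs
    · by_cases hro : d ∈ RO X f
      · left; left; left; right
        refine mem_filter.2 ⟨hro, ?_⟩
        by_contra hc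
        exact hT (Tri_of_RO hro (Tri_of_Side (Ph_spec hro).1 hc))
      · left; left; right
        exact mem_filter.2 ⟨hd, he, hs, hro⟩
  have c1 := card_le_card hsub
  have c2 := card_union_le (BS X f ∪ R ∪ nonRO X f ∪ R'.image JJ ∪ (nonRO X g).image JJ)
      ((darts X f).filter (fun d => (Ln X f d.1 d.2.1).card ≠ 3))
  have c3 := card_union_le (BS X f ∪ R ∪ nonRO X f ∪ R'.image JJ) ((nonRO X g).image JJ)
  have c4 := card_union_le (BS X f ∪ R ∪ nonRO X f) (R'.image JJ)
  have c5 := card_union_le (BS X f ∪ R) (nonRO X f)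
  have c6 := card_union_le (BS X f) R
  have d1 := BS_card (X := X) (f := f)
  have d1' := BS_card (X := X) (f := g)
  rw [M2_neg] at d1'
  have d2 := ne3_card (X := X) (f := f)
  have d3 := nonRO_card (X := X) (f := f)
  have d4 := nonRO_card (X := X) (f := g)
  have d5 := card_image_le (s := nonRO X g) (f := JJ)
  have d6 := card_image_le (s := R') (f := JJ)
  have d7 : R.card ≤ (BS X f).card := card_le_card_of_injOn (Ph X f)
    (fun d hd => (mem_filter.1 (mem_coe.1 hd)).2)
    (Ph_inj.mono fun d hd => (mem_filter.1 (mem_coe.1 hd)).1)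
  have d8 : R'.card ≤ (BS X g).card := card_le_card_of_injOn (Ph X g)
    (fun d hd => (mem_filter.1 (mem_coe.1 hd)).2)
    (Ph_inj.mono fun d hd => (mem_filter.1 (mem_coe.1 hd)).1)
  have d9 := M2_le (X := X) (f := f)
  omega

end

section abstract_words
variable {D : Type*} (R Ri V : D → D) (M : D → Prop) (G : ℕ → D → Prop)

structure Words : Prop where
  ri_r : ∀ x, M x → Ri (R x) = x
  r_ri : ∀ x, M x → R (Ri x) = x
  v_v : ∀ x, M x → V (V x) = x
  mR : ∀ x, M x → M (R x)
  mRi : ∀ x, M x → M (Ri x)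
  mV : ∀ x, M x → M (V x)
  gM : ∀ k x, G k x → M x
  gs : ∀ k x, G (k + 1) x → G k x
  gR : ∀ k x, G (k + 1) x → G k (R x)
  gRi : ∀ k x, G (k + 1) x → G k (Ri x)
  gV : ∀ k x, G (k + 1) x → G k (V x)
  r6 : ∀ x, G 0 x → R (R (R (R (R (R x))))) = x
  tri : ∀ x, G 0 x → Ri (V (Ri (V (Ri (V x))))) = x

variable {R Ri V M G}

namespace Words

lemma g0 (h : Words R Ri V M G) {k : ℕ} {x : D} (hx : G k x) : G 0 x := by
  induction k with
  | zero => exact hx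
  | succ k ih => exact ih (h.gs _ _ hx)

lemma le (h : Words R Ri V M G) {k l : ℕ} (hkl : l ≤ k) {x : D} (hx : G k x) : G l x := by
  induction k with
  | zero => obtain rfl : l = 0 := by omega
            exact hx
  | succ k ih =>
    rcases Nat.lt_or_ge l (k + 1) with h1 | h1
    · exact ih (by omega) (h.gs _ _ hx)
    · obtain rfl : l = k + 1 := by omega
      exact hx

lemma rel (h : Words R Ri V M G) {x : D} (hx : G 0 x) : V (Ri (V x)) = R (V (R x)) := by
  have m := h.gM _ _ hx
  have m1 := h.mV _ (h.mRi _ (h.mV _ m))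
  have e := h.tri x hx
  have e1 : V (Ri (V (Ri (V x)))) = R x := by
    rw [← h.r_ri _ (h.mV _ (h.mRi _ m1)), e]
  have e2 : Ri (V (Ri (V x))) = V (R x) := by
    rw [← h.v_v _ (h.mRi _ m1), e1]
  rw [← h.r_ri _ m1, e2]

lemma r5 (h : Words R Ri V M G) {x : D} (hx : G 0 x) : R (R (R (R (R x)))) = Ri x := by
  have m := h.gM _ _ hx
  have m1 := h.mR _ (h.mR _ (h.mR _ (h.mR _ (h.mR _ m))))
  rw [← h.ri_r _ m1, h.r6 x hx]

lemma r4 (h : Words R Ri V M G) {x : D} (hx : G 0 x) : R (R (R (R x))) = Ri (Ri x) := by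
  have m := h.gM _ _ hx
  have m1 := (h.mR _ (h.mR _ (h.mR _ (h.mR _ m))))
  rw [← h.ri_r _ m1, h.r5 hx]

lemma L2 (h : Words R Ri V M G) {x : D} (hx : G 1 x) :
    R (R (R (R (V (R x))))) = R (R (R (V (R (R (R (R (R (V x))))))))) := by
  rw [h.r5 (h.gV _ _ hx), h.rel (h.g0 hx)]

lemma L3 (h : Words R Ri V M G) {x : D} (hx : G 3 x) :
    R (R (R (V (R (R (V (R x))))))) = R (R (V (R (R (R (R (V x))))))) := by
  have m := h.gM _ _ hx
  have e0 : G 0 (V (Ri (V x))) := h.gV _ _ (h.gRi _ _ (h.gV _ _ hx))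
  rw [h.r4 (h.g0 (h.gV _ _ hx))]
  have e1 := h.rel (h.g0 hx)
  have e2 := h.rel e0
  rw [h.v_v _ (h.mRi _ (h.mV _ m)), e1] at e2
  rw [e2]

lemma UiU (h : Words R Ri V M G) {x : D} (m : M x) : Ri (V (Ri (Ri (R (R (V (R x))))))) = x := by
  have m1 := h.mV _ (h.mR _ m)
  rw [h.ri_r _ (h.mR _ m1), h.ri_r _ m1, h.v_v _ (h.mR _ m), h.ri_r _ m]

lemma UUi (h : Words R Ri V M G) {x : D} (m : M x) : R (R (V (R (Ri (V (Ri (Ri x))))))) = x := by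
  have m1 := h.mRi _ m
  have m2 := h.mRi _ m1
  rw [h.r_ri _ (h.mV _ m2), h.v_v _ m2, h.r_ri _ m1, h.r_ri _ m]

lemma gU (h : Words R Ri V M G) {k : ℕ} {x : D} (hx : G (k + 4) x) : G k (R (R (V (R x)))) :=
  h.gR _ _ (h.gR _ _ (h.gV _ _ (h.gR _ _ hx)))
lemma gUi (h : Words R Ri V M G) {k : ℕ} {x : D} (hx : G (k + 4) x) : G k (Ri (V (Ri (Ri x)))) :=
  h.gRi _ _ (h.gV _ _ (h.gRi _ _ (h.gRi _ _ hx)))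
lemma gS (h : Words R Ri V M G) {k : ℕ} {x : D} (hx : G (k + 4) x) : G k (R (R (R (V x)))) :=
  h.gR _ _ (h.gR _ _ (h.gR _ _ (h.gV _ _ hx)))

lemma SUi (h : Words R Ri V M G) {x : D} (hx : G 12 x) :
    R (R (R (V (Ri (V (Ri (Ri x))))))) = Ri (V (Ri (Ri (R (R (R (V x))))))) := by
  have e := h.L3 (x := Ri (V (Ri (Ri x)))) (h.le (by norm_num) (h.gUi (k := 8) hx))
  rw [h.UUi (h.gM _ _ hx)] at e
  have m : M (R (R (R (V (Ri (V (Ri (Ri x)))))))) :=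
    h.gM _ _ (h.gS (k := 0) (h.gUi (k := 4) (h.le (by norm_num) hx)))
  rw [e, h.UiU m]

/-- `R² U⁻¹ S x = S⁻¹ R² x` in the form `S R² U⁻¹ S x = R² x`. -/
lemma L2i (h : Words R Ri V M G) {x : D} (hx : G 12 x) :
    R (R (R (V (R (R (Ri (V (Ri (Ri (R (R (R (V x))))))))))))) = R (R x) := by
  rw [← h.SUi hx]
  have e := h.L2 (x := Ri (V (Ri (Ri x)))) (h.le (by norm_num) (h.gUi (k := 8) hx))
  rw [h.UUi (h.gM _ _ hx)] at e
  rw [e]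

/-- `S R U⁻¹ x = R x` -/
lemma L1i (h : Words R Ri V M G) {x : D} (m : M x) : R (R (R (V (R (Ri (V (Ri (Ri x)))))))) = R x := by
  rw [h.UUi m]

end Words
end abstract_words

section
variable {X : Fr} {f : Fn}

lemma nxt_card3 {s : Fr} {a : ℝ} (ha : a ∈ s) (h3 : s.card = 3) :
    s = {a, nxt s a, nxt s (nxt s a)} ∧ nxt s (nxt s (nxt s a)) = a ∧
    ((a < nxt s a ∧ nxt s a < nxt s (nxt s a)) ∨
     (nxt s a < nxt s (nxt s a) ∧ nxt s (nxt s a) < a) ∨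
     (nxt s (nxt s a) < a ∧ a < nxt s a)) := by
  have ord : ∃ x y z, x < y ∧ y < z ∧ s = {x, y, z} := by
    have e : ∀ i, s.orderEmbOfFin h3 i ∈ s := fun i => orderEmbOfFin_mem s h3 i
    have l1 : s.orderEmbOfFin h3 0 < s.orderEmbOfFin h3 1 :=
      (s.orderEmbOfFin h3).lt_iff_lt.2 (by decide)
    have l2 : s.orderEmbOfFin h3 1 < s.orderEmbOfFin h3 2 :=
      (s.orderEmbOfFin h3).lt_iff_lt.2 (by decide)
    refine ⟨_, _, _, l1, l2, ?_⟩
    symm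
    apply eq_of_subset_of_card_le
    · intro w hw
      simp only [mem_insert, mem_singleton] at hw
      rcases hw with rfl | rfl | rfl <;> exact e _
    · rw [h3, card_eq_three.2 ⟨_, _, _, l1.ne, (l1.trans l2).ne, l2.ne, rfl⟩]
  obtain ⟨x, y, z, hxy, hyz, rfl⟩ := ord
  have n1 : nxt {x, y, z} x = y := nxt_eq_of_lt (by simp) (by simp) hxy (by
    intro w hw hlt
    simp only [mem_insert, mem_singleton] at hw
    rcases hw with rfl | rfl | rfl <;> linarith)
  have n2 : nxt {x, y, z} y = z := nxt_eq_of_lt (by simp) (by simp) hyz (by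
    intro w hw hlt
    simp only [mem_insert, mem_singleton] at hw
    rcases hw with rfl | rfl | rfl <;> linarith)
  have n3 : nxt {x, y, z} z = x := nxt_eq_of_max (by simp) (by simp) (by
    intro w hw
    simp only [mem_insert, mem_singleton] at hw
    rcases hw with rfl | rfl | rfl <;> linarith) (by
    intro w hw
    simp only [mem_insert, mem_singleton] at hw
    rcases hw with rfl | rfl | rfl <;> linarith)
  simp only [mem_insert, mem_singleton] at ha
  rcases ha with rfl | rfl | rfl
  · rw [n1, n2, n3]; exact ⟨rfl, rfl, Or.inl ⟨hxy, hyz⟩⟩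
  · rw [n2, n3, n1]
    refine ⟨by ext w; simp only [mem_insert, mem_singleton]; tauto, rfl, Or.inr (Or.inr ⟨hxy, hyz⟩)⟩
  · rw [n3, n1, n2]
    refine ⟨by ext w; simp only [mem_insert, mem_singleton]; tauto, rfl, Or.inr (Or.inl ⟨hxy, hyz⟩)⟩

/-- cyclically increasing triples -/
def Cyc (x y z : ℝ) : Prop := (x < y ∧ y < z) ∨ (y < z ∧ z < x) ∨ (z < x ∧ x < y)

lemma rho3_data {x t : ℝ} {e : Bool} (hd : (x, t, e) ∈ darts X f) (h3 : (Ln X f x t).card = 3) :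
    rho X f (rho X f (rho X f (x, t, e))) = (x, t, !e) ∧
    (rho X f (x, t, e)).2.1 = t ∧ (rho X f (rho X f (x, t, e))).2.1 = t ∧
    Ln X f x t = {x, (rho X f (x, t, e)).1, (rho X f (rho X f (x, t, e))).1} ∧
    Cyc x (rho X f (x, t, e)).1 (rho X f (rho X f (x, t, e))).1 := by
  have hx := (mem_darts.1 hd).1
  have hs := self_mem_Ln (f := f) (t := t) hx
  obtain ⟨h1, h2, h4⟩ := nxt_card3 hs h3
  have m1 := nxt_mem hs
  have m2 := nxt_mem m1
  refine ⟨?_, rfl, rfl, ?_, ?_⟩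
  · simp only [rho, Ln_eq m1, Ln_eq m2, h2]
    refine Prod.ext rfl (Prod.ext rfl ?_)
    simp only
    rcases h4 with ⟨a, b⟩ | ⟨a, b⟩ | ⟨a, b⟩
    · rw [if_pos (a.trans b).le, if_neg (not_le.2 b), if_neg (not_le.2 a)]
    · rw [if_neg (not_le.2 b), if_neg (not_le.2 a), if_pos (a.trans b).le]
    · rw [if_neg (not_le.2 a), if_pos (a.trans b).le, if_neg (not_le.2 b)]
  · simp only [rho, Ln_eq m1]; exact h1
  · simp only [rho, Ln_eq m1]; exact h4

def bads (X : Fr) (f : Fn) : ℕ → Finset Dart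
  | 0 => bad0 X f
  | k + 1 => (darts X f).filter (fun d => d ∈ bads X f k ∨ rho X f d ∈ bads X f k ∨
      rhoi X f d ∈ bads X f k ∨ rev X f d ∈ bads X f k)

lemma bads_card (k : ℕ) : (bads X f k).card ≤ 4 ^ k * (32 * X.card + 18 * N2 X f) := by
  classical
  induction k with
  | zero => simpa [bads] using bad0_card (X := X) (f := f)
  | succ k ih =>
    have hsub : bads X f (k + 1) ⊆ ((bads X f k) ∪ ((bads X f k).image (rhoi X f))) ∪
      ((bads X f k).image (rho X f) ∪ (bads X f k).image (rev X f)) := by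
      intro d hd
      rw [bads, mem_filter] at hd
      obtain ⟨hd, h | h | h | h⟩ := hd
      · exact mem_union_left _ (mem_union_left _ h)
      · exact mem_union_left _ (mem_union_right _ (mem_image.2 ⟨_, h, rhoi_rho hd⟩))
      · exact mem_union_right _ (mem_union_left _ (mem_image.2 ⟨_, h, rho_rhoi hd⟩))
      · exact mem_union_right _ (mem_union_right _ (mem_image.2 ⟨_, h, rev_rev hd⟩))
    have h0 := card_le_card hsub
    have h1 := card_union_le ((bads X f k) ∪ ((bads X f k).image (rhoi X f)))
      ((bads X f k).image (rho X f) ∪ (bads X f k).image (rev X f))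
    have h2 := card_union_le (bads X f k) ((bads X f k).image (rhoi X f))
    have h3 := card_union_le ((bads X f k).image (rho X f)) ((bads X f k).image (rev X f))
    have h4 := card_image_le (s := bads X f k) (f := rhoi X f)
    have h5 := card_image_le (s := bads X f k) (f := rho X f)
    have h6 := card_image_le (s := bads X f k) (f := rev X f)
    rw [pow_succ]
    calc _ ≤ 4 * (bads X f k).card := by omega
      _ ≤ 4 * (4 ^ k * (32 * X.card + 18 * N2 X f)) := Nat.mul_le_mul_left _ ih
      _ = _ := by ring

def Gd (X : Fr) (f : Fn) (k : ℕ) (d : Dart) : Prop := d ∈ darts X f ∧ d ∉ bads X f k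

lemma Gd0 {d : Dart} (h : Gd X f 0 d) : Tri X f d ∧ (Ln X f d.1 d.2.1).card = 3 := by
  classical
  obtain ⟨h1, h2⟩ := h
  rw [bads, bad0, mem_filter] at h2
  by_contra hc
  exact h2 ⟨h1, hc⟩

lemma Gd_words : Words (rho X f) (rhoi X f) (rev X f) (fun d => d ∈ darts X f) (Gd X f) := by
  have key : ∀ k d, Gd X f (k + 1) d → d ∈ darts X f ∧ d ∉ bads X f k ∧ rho X f d ∉ bads X f k ∧
      rhoi X f d ∉ bads X f k ∧ rev X f d ∉ bads X f k := by
    rintro k d ⟨h1, h2⟩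
    rw [bads, mem_filter] at h2
    tauto
  refine ⟨fun x => rhoi_rho, fun x => rho_rhoi, fun x => rev_rev, fun x => rho_mem,
    fun x => rhoi_mem, fun x => rev_mem, fun k x h => h.1, fun k x h => ?_, fun k x h => ?_,
    fun k x h => ?_, fun k x h => ?_, fun x h => ?_, fun x h => ?_⟩
  · have := key k x h; exact ⟨this.1, this.2.1⟩
  · have := key k x h; exact ⟨rho_mem this.1, this.2.2.1⟩
  · have := key k x h; exact ⟨rhoi_mem this.1, this.2.2.2.1⟩
  · have := key k x h; exact ⟨rev_mem this.1, this.2.2.2.2⟩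
  · obtain ⟨a, t, e⟩ := x
    have h3 := (Gd0 h).2
    have hm : (a, t, !e) ∈ darts X f := by
      have := h.1
      rw [mem_darts] at this ⊢
      exact this
    rw [(rho3_data h.1 h3).1, (rho3_data hm h3).1, Bool.not_not]
  · exact (Gd0 h).1

/-- a vertex line with exactly the three given points -/
def Col3 (X : Fr) (f : Fn) (u v w : ℝ) : Prop :=
  u ≠ v ∧ u ≠ w ∧ v ≠ w ∧ ∃ t c : ℝ, ∀ x, (x ∈ X ∧ f x = t * x + c) ↔ (x = u ∨ x = v ∨ x = w)

lemma Cyc.ne {x y z : ℝ} (h : Cyc x y z) : x ≠ y ∧ x ≠ z ∧ y ≠ z := by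
  rcases h with ⟨a, b⟩ | ⟨a, b⟩ | ⟨a, b⟩
  · exact ⟨a.ne, (a.trans b).ne, b.ne⟩
  · exact ⟨(a.trans b).ne', b.ne', a.ne⟩
  · exact ⟨b.ne, a.ne', (a.trans b).ne'⟩

lemma Col3_of_good {d : Dart} (h : Gd X f 0 d) :
    Col3 X f d.1 (rho X f d).1 (rho X f (rho X f d)).1 ∧
    Cyc d.1 (rho X f d).1 (rho X f (rho X f d)).1 := by
  obtain ⟨a, t, e⟩ := d
  have h3 := (Gd0 h).2
  obtain ⟨-, -, -, h4, h5⟩ := rho3_data h.1 h3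
  refine ⟨⟨h5.ne.1, h5.ne.2.1, h5.ne.2.2, t, f a - t * a, fun x => ?_⟩, h5⟩
  have : x ∈ Ln X f a t ↔ x = a ∨ x = (rho X f (a, t, e)).1 ∨ x = (rho X f (rho X f (a, t, e))).1 := by
    rw [h4]; simp
  rw [← this, mem_Ln]
  exact and_congr_right fun _ => ⟨fun h => by linarith, fun h => by linarith⟩

lemma rho3_fst {d : Dart} (h : Gd X f 0 d) : (rho X f (rho X f (rho X f d))).1 = d.1 := by
  obtain ⟨a, t, e⟩ := d
  rw [(rho3_data h.1 (Gd0 h).2).1]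

lemma rev_fst (d : Dart) : (rev X f d).1 = d.1 := by unfold rev; split_ifs <;> rfl

lemma S_fst {d : Dart} (h : Gd X f 1 d) :
    (rho X f (rho X f (rho X f (rev X f d)))).1 = d.1 := by
  rw [rho3_fst (Gd_words.gV _ _ h), rev_fst]

lemma S_eq {q t : ℝ} (h : Gd X f 1 (q, t, true)) :
    rho X f (rho X f (rho X f (rev X f (q, t, true)))) = (q, nxt (Sl X f q) t, true) := by
  have := Gd_words.gV _ _ h
  have e : rev X f (q, t, true) = (q, nxt (Sl X f q) t, false) := by simp [rev]
  rw [e] at this ⊢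
  rw [(rho3_data this.1 (Gd0 this).2).1]; rfl

/-- a run of good consecutive slopes at `q` with its lattice of triple points -/
structure IsRun (X : Fr) (f : Fn) (q : ℝ) (L : ℕ) (t a b : ℕ → ℝ) (p1 pm pn : ℝ) : Prop where
  slope : ∀ i < L, t i ∈ Sl X f q
  next : ∀ i, i + 1 < L → t i < t (i + 1) ∧ t (i + 1) = nxt (Sl X f q) (t i)
  line : ∀ i < L, Ln X f q (t i) = {q, a i, b i}
  cyc : ∀ i < L, Cyc q (a i) (b i)
  c0 : ∀ i < L, Col3 X f q (a i) (b i)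
  c1 : ∀ i, i + 1 < L → Col3 X f p1 (a i) (b (i + 1))
  c2 : ∀ i, i + 1 < L → Col3 X f pm (a (i + 1)) (b i)
  c3 : ∀ i, i + 2 < L → Col3 X f pn (a (i + 2)) (b i)

/-- goodness depth used for runs -/
def KK : ℕ := 40

theorem run_of_good {q : ℝ} {L : ℕ} {t : ℕ → ℝ}
    (hg : ∀ i < L, Gd X f KK (q, t i, true))
    (hn : ∀ i, i + 1 < L → t i < t (i + 1) ∧ t (i + 1) = nxt (Sl X f q) (t i)) :
    ∃ a b : ℕ → ℝ, ∃ p1 pm pn : ℝ, IsRun X f q L t a b p1 pm pn := by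
  have W := Gd_words (X := X) (f := f)
  set R := rho X f
  set Ri := rhoi X f
  set V := rev X f
  set e : ℕ → Dart := fun i => (q, t i, true) with he
  have hS : ∀ i, i + 1 < L → R (R (R (V (e i)))) = e (i + 1) := by
    intro i hi
    rw [he]
    simp only
    rw [(hn i hi).2]
    exact S_eq (W.le (by norm_num [KK]) (hg i (by omega)))
  have hG : ∀ i < L, Gd X f 40 (e i) := hg
  have hM : ∀ i < L, e i ∈ darts X f := fun i hi => (hg i hi).1
  refine ⟨fun i => (R (e i)).1, fun i => (R (R (e i))).1, (R (R (V (R (e 0))))).1,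
    (Ri (V (Ri (Ri (e 0))))).1, (Ri (V (Ri (Ri (Ri (V (Ri (Ri (e 0))))))))).1, ?_⟩
  have P1 : ∀ i < L, (R (R (V (R (e i))))).1 = (R (R (V (R (e 0))))).1 := by
    intro i
    induction i with
    | zero => intro _; rfl
    | succ i ih =>
      intro hi
      rw [← ih (by omega), ← hS i hi, ← W.L3 (W.le (by norm_num) (hG i (by omega)))]
      exact S_fst (W.gU (k := 1) (W.le (by norm_num) (hG i (by omega))))
  have Pm : ∀ i < L, (Ri (V (Ri (Ri (e i))))).1 = (Ri (V (Ri (Ri (e 0))))).1 := by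
    intro i
    induction i with
    | zero => intro _; rfl
    | succ i ih =>
      intro hi
      rw [← ih (by omega), ← hS i hi, ← W.SUi (W.le (by norm_num) (hG i (by omega)))]
      exact S_fst (W.gUi (k := 1) (W.le (by norm_num) (hG i (by omega))))
  have Pn : ∀ i < L, (Ri (V (Ri (Ri (Ri (V (Ri (Ri (e i))))))))).1 =
      (Ri (V (Ri (Ri (Ri (V (Ri (Ri (e 0))))))))).1 := by
    intro i
    induction i with
    | zero => intro _; rfl
    | succ i ih =>
      intro hi
      rw [← ih (by omega), ← hS i hi, ← W.SUi (W.le (by norm_num) (hG i (by omega))),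
        ← W.SUi (W.gUi (k := 12) (W.le (by norm_num) (hG i (by omega))))]
      exact S_fst (W.gUi (k := 1) (W.gUi (k := 5) (W.le (by norm_num) (hG i (by omega)))))
  have A1 : ∀ i < L, (R (R (R (V (R (e i)))))).1 = (R (e i)).1 := fun i hi =>
    S_fst (W.gR _ _ (W.le (by norm_num) (hG i (by omega))))
  have B1 : ∀ i, i + 1 < L → (R (R (R (R (V (R (e i))))))).1 = (R (R (e (i + 1)))).1 := by
    intro i hi
    rw [W.L2 (W.le (by norm_num) (hG i (by omega))), hS i hi]
    exact S_fst (W.gR _ _ (W.gR _ _ (W.le (by norm_num) (hG (i + 1) (by omega)))))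
  have Am : ∀ y, Gd X f 6 y → (R (Ri (V (Ri (Ri y))))).1 = (R y).1 := by
    intro y hy
    rw [← W.L1i hy.1]
    exact (S_fst (W.gR _ _ (W.gUi (k := 2) hy))).symm
  have Bm : ∀ y, Gd X f 16 y → (R (R (Ri (V (Ri (Ri (R (R (R (V y)))))))))).1 = (R (R y)).1 := by
    intro y hy
    rw [← W.L2i (W.le (by norm_num) hy)]
    exact (S_fst (W.gR _ _ (W.gR _ _ (W.gUi (k := 3) (W.gS (k := 7)
      (W.le (by norm_num) hy)))))).symm
  refine ⟨fun i hi => (mem_darts.1 (hM i hi)).2, hn, fun i hi => ?_, fun i hi => ?_, fun i hi => ?_,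
    fun i hi => ?_, fun i hi => ?_, fun i hi => ?_⟩
  · exact (rho3_data (hM i hi) (Gd0 (W.g0 (hG i hi))).2).2.2.2.1
  · exact (Col3_of_good (W.g0 (hG i hi))).2
  · exact (Col3_of_good (W.g0 (hG i hi))).1
  · have := (Col3_of_good (W.gU (k := 0) (W.le (by norm_num) (hG i (by omega))))).1
    rw [← P1 i (by omega), ← A1 i (by omega), ← B1 i hi]
    exact this
  · have h1 := hG (i + 1) hi
    have := (Col3_of_good (W.gUi (k := 0) (W.le (by norm_num) h1))).1
    have a2 := Am _ (W.le (by norm_num) h1)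
    have b2 := Bm _ (W.le (by norm_num) (hG i (by omega)))
    rw [hS i hi] at b2
    rw [← Pm (i + 1) hi, ← a2, ← b2]
    exact this
  · have h1 := hG (i + 2) hi
    have := (Col3_of_good (W.gUi (k := 0) (W.gUi (k := 4) (W.le (by norm_num) h1)))).1
    have a2 := Am _ (W.le (by norm_num) h1)
    have a3 := Am _ (W.gUi (k := 6) (W.le (by norm_num) h1))
    have b2 := Bm _ (W.le (by norm_num) (hG i (by omega)))
    have b3 := Bm _ (W.gUi (k := 16) (W.le (by norm_num) (hG (i + 1) (by omega))))
    rw [W.SUi (W.le (by norm_num) (hG (i + 1) (by omega))), hS (i + 1) hi] at b3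
    rw [hS i (by omega)] at b2
    rw [← Pn (i + 2) hi, ← a2, ← a3, ← b2, ← b3]
    exact this

end

lemma enum_convex {T R : Fr} (hRT : R ⊆ T)
    (hc : ∀ x ∈ R, ∀ y ∈ R, ∀ r ∈ T, x ≤ r → r ≤ y → r ∈ R) :
    ∃ t : ℕ → ℝ, (∀ i < R.card, t i ∈ R) ∧ (∀ r ∈ R, ∃ i < R.card, t i = r) ∧
      (∀ i < R.card, ∀ j < R.card, t i = t j → i = j) ∧
      ∀ i, i + 1 < R.card → t i < t (i + 1) ∧ t (i + 1) = nxt T (t i) := by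
  set F := R.orderEmbOfFin rfl with hF
  refine ⟨fun i => if h : i < R.card then F ⟨i, h⟩ else 0, ?_, ?_, ?_, ?_⟩
  · intro i hi
    simp only [hi, dite_true]
    exact orderEmbOfFin_mem R rfl _
  · intro r hr
    have : r ∈ Set.range F := by rw [hF, range_orderEmbOfFin]; exact hr
    obtain ⟨i, hi⟩ := this
    exact ⟨i, i.2, by simp [hi]⟩
  · intro i hi j hj h
    simp only [hi, hj, dite_true] at h
    simpa using F.injective h
  · intro i hi
    have hi' : i < R.card := by omega
    simp only [hi, hi', dite_true]
    have hlt : F ⟨i, hi'⟩ < F ⟨i + 1, hi⟩ := F.lt_iff_lt.2 (by simp)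
    refine ⟨hlt, ?_⟩
    have m1 : F ⟨i, hi'⟩ ∈ R := orderEmbOfFin_mem R rfl _
    have m2 : F ⟨i + 1, hi⟩ ∈ R := orderEmbOfFin_mem R rfl _
    symm
    refine nxt_eq_of_lt (hRT m1) (hRT m2) hlt fun y hy hly => ?_
    by_contra hcc
    push Not at hcc
    have hyR := hc _ m1 _ m2 y hy hly.le hcc.le
    have : y ∈ Set.range F := by rw [hF, range_orderEmbOfFin]; exact hyR
    obtain ⟨j, rfl⟩ := this
    rw [F.lt_iff_lt] at hly hcc
    have h1 := Fin.lt_def.1 hly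
    have h2 := Fin.lt_def.1 hcc
    simp only at h1 h2
    omega

/-- all runs at a point `q` -/
structure Runs (X : Fr) (f : Fn) (q : ℝ) (m : ℕ) where
  B : Fr
  L : ℕ → ℕ
  t : ℕ → ℕ → ℝ
  a : ℕ → ℕ → ℝ
  b : ℕ → ℕ → ℝ
  p1 : ℕ → ℝ
  pm : ℕ → ℝ
  pn : ℕ → ℝ
  Bsub : B ⊆ Sl X f q
  Bcard : B.card ≤ m
  run : ∀ k, IsRun X f q (L k) (t k) (a k) (b k) (p1 k) (pm k) (pn k)
  cover : ∀ s ∈ Sl X f q, s ∉ B → ∃ k ≤ m, ∃ i < L k, t k i = s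
  inj : ∀ k k' i i', i < L k → i' < L k' → t k i = t k' i' → k = k' ∧ i = i'

theorem runs_exist : ∃ C0 : ℕ, ∀ (X : Fr) (f : Fn), ∃ bd : ℝ → ℕ,
    ∑ q ∈ X, bd q ≤ C0 * (X.card + N2 X f) ∧ ∀ q ∈ X, Nonempty (Runs X f q (bd q)) := by
  classical
  refine ⟨4 ^ KK * 32, fun X f => ?_⟩
  set B : ℝ → Fr := fun q => (Sl X f q).filter (fun t => (q, t, true) ∈ bads X f KK) with hB
  refine ⟨fun q => (B q).card, ?_, fun q hq => ?_⟩
  · have h1 : ∑ q ∈ X, (B q).card = (X.sigma B).card := (card_sigma X B).symm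
    have h2 : (X.sigma B).card ≤ (bads X f KK).card := by
      apply card_le_card_of_injOn (fun s => ((s.1, s.2, true) : Dart))
      · intro s hs
        have := mem_sigma.1 (mem_coe.1 hs)
        exact (mem_filter.1 this.2).2
      · rintro ⟨a, b⟩ _ ⟨a', b'⟩ _ h
        simp only [Prod.mk.injEq, and_true] at h
        obtain ⟨rfl, rfl⟩ := h
        rfl
    rw [h1]
    refine h2.trans ((bads_card KK).trans ?_)
    rw [mul_assoc]
    exact Nat.mul_le_mul_left _ (by omega)
  · set idn : ℝ → ℕ := fun s => ((B q).filter (fun b => b < s)).card with hid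
    set Rk : ℕ → Fr := fun k => (Sl X f q \ B q).filter (fun s => idn s = k) with hRk
    have mono : ∀ x y, x ≤ y → idn x ≤ idn y := fun x y hxy =>
      card_le_card (fun z hz => by
        rw [mem_filter] at hz ⊢; exact ⟨hz.1, hz.2.trans_le hxy⟩)
    have hsub : ∀ k, Rk k ⊆ Sl X f q := fun k s hs =>
      (mem_sdiff.1 (mem_filter.1 hs).1).1
    have hconv : ∀ k, ∀ x ∈ Rk k, ∀ y ∈ Rk k, ∀ r ∈ Sl X f q, x ≤ r → r ≤ y → r ∈ Rk k := by
      intro k x hx y hy r hr hxr hry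
      simp only [hRk, mem_filter, mem_sdiff] at hx hy ⊢
      have h1 := mono _ _ hxr
      have h2 := mono _ _ hry
      refine ⟨⟨hr, fun hrB => ?_⟩, by omega⟩
      have hlt : r < y := lt_of_le_of_ne hry (fun h => hy.1.2 (h ▸ hrB))
      have : idn x < idn y := by
        apply card_lt_card
        rw [ssubset_iff_of_subset]
        · exact ⟨r, mem_filter.2 ⟨hrB, hlt⟩, fun h => by
            have := (mem_filter.1 h).2; linarith⟩
        · intro z hz
          rw [mem_filter] at hz ⊢; exact ⟨hz.1, hz.2.trans_le (hxr.trans hry)⟩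
      omega
    choose t ht1 ht2 ht3 ht4 using fun k => enum_convex (hsub k) (hconv k)
    have hrun : ∀ k, ∃ a b : ℕ → ℝ, ∃ p1 pm pn : ℝ, IsRun X f q (Rk k).card (t k) a b p1 pm pn := by
      intro k
      refine run_of_good (fun i hi => ?_) (ht4 k)
      have := ht1 k i hi
      simp only [hRk, mem_filter, mem_sdiff] at this
      refine ⟨mem_darts.2 ⟨hq, this.1.1⟩, fun h => this.1.2 (mem_filter.2 ⟨this.1.1, h⟩)⟩
    choose a b p1 pm pn hr using hrun
    refine ⟨⟨B q, fun k => (Rk k).card, t, a, b, p1, pm, pn, filter_subset _ _, le_rfl, hr, ?_, ?_⟩⟩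
    · intro s hs hsB
      have : s ∈ Rk (idn s) := mem_filter.2 ⟨mem_sdiff.2 ⟨hs, hsB⟩, rfl⟩
      obtain ⟨i, hi, his⟩ := ht2 _ s this
      exact ⟨idn s, card_le_card (filter_subset _ _), i, hi, his⟩
    · intro k k' i i' hi hi' h
      have h1 := (mem_filter.1 (ht1 k i hi)).2
      have h2 := (mem_filter.1 (ht1 k' i' hi')).2
      have hk : k = k' := by rw [← h1, ← h2, h]
      subst hk
      exact ⟨rfl, ht3 k i hi i' hi' h⟩

end GT

namespace GT
open Polynomial

/-- bivariate polynomials -/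
abbrev PY := Polynomial (Polynomial ℝ)

/-- grading homomorphism `X ↦ T`, `Y ↦ X T` -/
def psi : PY →+* PY :=
  eval₂RingHom (eval₂RingHom ((C : ℝ[X] →+* PY).comp (C : ℝ →+* ℝ[X])) (X : PY)) (C X * X)

/-- total degree -/
def td (F : PY) : ℕ := (psi F).natDegree

lemma psi_mono (i j : ℕ) (r : ℝ) : psi (monomial i (monomial j r)) = monomial (i + j) (monomial i r) := by
  simp only [psi, coe_eval₂RingHom, eval₂_monomial, RingHom.comp_apply]
  rw [mul_pow, ← C_mul_X_pow_eq_monomial (n := i + j), ← C_mul_X_pow_eq_monomial (n := i), C_mul, C_pow, pow_add]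
  ring

lemma psi_coeff (F : PY) (d i : ℕ) :
    ((psi F).coeff d).coeff i = if i ≤ d then (F.coeff i).coeff (d - i) else 0 := by
  induction F using Polynomial.induction_on' with
  | add p q hp hq => simp only [map_add, coeff_add, hp, hq]; split_ifs <;> simp
  | monomial n a =>
    induction a using Polynomial.induction_on' with
    | add p q hp hq =>
      simp only [map_add, coeff_add, hp, hq]; split_ifs <;> simp
    | monomial m r =>
      rw [psi_mono]
      simp only [coeff_monomial]
      split_ifs with h1 h2 h3 h4 h5 <;> simp only [coeff_monomial, coeff_zero]
      all_goals (try split_ifs)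
      all_goals (first | rfl | omega)

lemma psi_inj : Function.Injective psi := by
  rw [injective_iff_map_eq_zero]
  intro F hF
  ext i j
  have := psi_coeff F (i + j) i
  rw [hF] at this
  simpa using this.symm

lemma td_mul {F G : PY} (hF : F ≠ 0) (hG : G ≠ 0) : td (F * G) = td F + td G := by
  rw [td, map_mul, natDegree_mul]
  · rfl
  · exact fun h => hF (psi_inj (by simpa using h))
  · exact fun h => hG (psi_inj (by simpa using h))

lemma td_mul_le (F G : PY) : td (F * G) ≤ td F + td G := by
  rw [td, map_mul]; exact natDegree_mul_le

lemma td_le_iff {F : PY} {d : ℕ} : td F ≤ d ↔ ∀ i j, d < i + j → (F.coeff i).coeff j = 0 := by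
  constructor
  · intro h i j hij
    have h1 : (psi F).coeff (i + j) = 0 := coeff_eq_zero_of_natDegree_lt (h.trans_lt hij)
    have := psi_coeff F (i + j) i
    rw [h1] at this
    simpa using this.symm
  · intro h
    rw [td, natDegree_le_iff_coeff_eq_zero]
    intro N hN
    ext i
    rw [psi_coeff]
    split_ifs with h1
    · rw [h _ _ (by omega)]; simp
    · simp

lemma td_add_le {F G : PY} {d : ℕ} (hF : td F ≤ d) (hG : td G ≤ d) : td (F + G) ≤ d := by
  rw [td_le_iff] at *
  intro i j h
  simp [hF i j h, hG i j h]

lemma td_sub_le {F G : PY} {d : ℕ} (hF : td F ≤ d) (hG : td G ≤ d) : td (F - G) ≤ d := by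
  rw [td_le_iff] at *
  intro i j h
  simp [hF i j h, hG i j h]

/-- scalars -/
abbrev sc (r : ℝ) : PY := C (C r)

lemma td_sc (r : ℝ) : td (sc r) = 0 := by
  simp [td, psi]

lemma eq_sc_of_td {F : PY} (h : td F = 0) : ∃ r, F = sc r := by
  have := td_le_iff.1 h.le
  refine ⟨(F.coeff 0).coeff 0, ?_⟩
  ext i j
  rcases i with _ | i
  · rcases j with _ | j
    · simp
    · rw [this 0 (j+1) (by omega)]; simp
  · rw [this (i+1) j (by omega)]; simp

lemma td_sc_mul_le (r : ℝ) (F : PY) : td (sc r * F) ≤ td F := by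
  have := td_mul_le (sc r) F
  rw [td_sc] at this; omega

/-- line polynomial -/
def lin (t c : ℝ) : PY := X - C (C t * X + C c)

lemma lin_ne (t c : ℝ) : lin t c ≠ 0 := X_sub_C_ne_zero _

lemma td_lin (t c : ℝ) : td (lin t c) = 1 := by
  apply le_antisymm
  · rw [td_le_iff]
    intro i j h
    rcases i with _ | _ | i
    · have h1 : j ≠ 0 := by omega
      have h2 : 1 ≠ j := by omega
      simp [lin, coeff_X, coeff_C, h1, h2]
    · have h1 : j ≠ 0 := by omega
      simp [lin, coeff_X, coeff_C, coeff_one, h1]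
    · simp [lin, coeff_X, coeff_C]
  · by_contra h
    have := (td_le_iff (F := lin t c) (d := 0)).1 (by omega) 1 0 (by omega)
    simp [lin, coeff_X, coeff_C] at this

lemma ev_lin (t c x y : ℝ) : (lin t c).evalEval x y = y - (t * x + c) := by
  simp [lin, evalEval]

lemma evalEval_line (F : PY) (t c x : ℝ) :
    (F.eval (C t * X + C c)).eval x = F.evalEval x (t * x + c) := by
  induction F using Polynomial.induction_on' with
  | add p q hp hq => simp [hp, hq]
  | monomial n a => simp [evalEval]

lemma natDegree_eval_line (F : PY) (t c : ℝ) : (F.eval (C t * X + C c)).natDegree ≤ td F := by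
  rw [eval_eq_sum]
  refine natDegree_sum_le_of_forall_le _ _ (fun i hi => ?_)
  have h1 : (F.coeff i).natDegree + i ≤ td F := by
    by_contra h
    push Not at h
    have := td_le_iff.1 (le_refl (td F)) i (F.coeff i).natDegree (by omega)
    rw [coeff_natDegree, leadingCoeff_eq_zero] at this
    exact (mem_support_iff.1 hi) this
  have h2 : ((C t * X + C c) ^ i : ℝ[X]).natDegree ≤ i := by
    refine natDegree_pow_le.trans ?_
    have : (C t * X + C c : ℝ[X]).natDegree ≤ 1 := natDegree_linear_le
    nlinarith
  exact natDegree_mul_le.trans (by omega)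

lemma lin_dvd_iff {F : PY} {t c : ℝ} : lin t c ∣ F ↔ F.eval (C t * X + C c) = 0 := dvd_iff_isRoot

/-- line lemma -/
lemma line_dvd {F : PY} {t c : ℝ} (s : Fr) (hs : td F < s.card)
    (h : ∀ x ∈ s, F.evalEval x (t * x + c) = 0) : lin t c ∣ F := by
  rw [lin_dvd_iff]
  refine eq_zero_of_natDegree_lt_card_of_eval_eq_zero' _ s (fun x hx => ?_)
    ((natDegree_eval_line F t c).trans_lt hs)
  rw [evalEval_line]; exact h x hx

lemma ev_sc (r x y : ℝ) : (sc r).evalEval x y = r := by simp [evalEval]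

lemma td_quot {F G : PY} {t c : ℝ} {d : ℕ} (hF : F = lin t c * G) (h : td F ≤ d + 1) : td G ≤ d := by
  by_cases hG : G = 0
  · rw [hG]; simp [td]
  · rw [hF, td_mul (lin_ne t c) hG, td_lin] at h; omega

lemma ev_quot {F G : PY} {t c x y : ℝ} (hF : F = lin t c * G) (h : F.evalEval x y = 0)
    (hx : y ≠ t * x + c) : G.evalEval x y = 0 := by
  rw [hF, evalEval_mul, ev_lin] at h
  exact (mul_eq_zero.1 h).resolve_left (sub_ne_zero.2 hx)

/-- Cayley–Bacharach -/
lemma CB {F M : PY} (hF : td F ≤ 3) (hM : td M ≤ 3) {f : Fn}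
    {t1 c1 t2 c2 t3 c3 : ℝ} {x1 x2 x3 y1 y2 y3 z1 z2 : ℝ}
    (hx : x1 ≠ x2 ∧ x1 ≠ x3 ∧ x2 ≠ x3) (hy : y1 ≠ y2 ∧ y1 ≠ y3 ∧ y2 ≠ y3) (hz : z1 ≠ z2)
    (hF1 : ∀ x, (x = x1 ∨ x = x2 ∨ x = x3) → f x = t1 * x + c1 ∧ F.evalEval x (f x) = 0 ∧ M.evalEval x (f x) = 0)
    (hF2 : ∀ x, (x = y1 ∨ x = y2 ∨ x = y3) → f x = t2 * x + c2 ∧ f x ≠ t1 * x + c1 ∧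
      F.evalEval x (f x) = 0 ∧ M.evalEval x (f x) = 0)
    (hF3 : ∀ x, (x = z1 ∨ x = z2) → f x = t3 * x + c3 ∧ f x ≠ t1 * x + c1 ∧ f x ≠ t2 * x + c2 ∧
      F.evalEval x (f x) = 0 ∧ M.evalEval x (f x) = 0)
    (hML : ¬ lin t1 c1 ∣ M) :
    ∃ α β : ℝ, F = sc α * M + sc β * (lin t1 c1 * lin t2 c2 * lin t3 c3) := by
  classical
  obtain ⟨x0, hx0⟩ := Infinite.exists_notMem_finset ({x1, x2, x3} : Fr)
  have hcard : ({x0, x1, x2, x3} : Fr).card = 4 := by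
    rw [card_insert_of_notMem hx0, card_insert_of_notMem (by simp [hx.1, hx.2.1]),
      card_insert_of_notMem (by simp [hx.2.2]), card_singleton]
  have hm0 : M.evalEval x0 (t1 * x0 + c1) ≠ 0 := by
    intro h
    apply hML
    refine line_dvd {x0, x1, x2, x3} (by omega) (fun x hx => ?_)
    simp only [mem_insert, mem_singleton] at hx
    rcases hx with rfl | hx
    · exact h
    · rw [← (hF1 x hx).1]; exact (hF1 x hx).2.2
  set α := F.evalEval x0 (t1 * x0 + c1) / M.evalEval x0 (t1 * x0 + c1) with hα
  set G := F - sc α * M with hG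
  have hGt : td G ≤ 3 := td_sub_le hF ((td_sc_mul_le _ _).trans hM)
  have hGe : ∀ x, F.evalEval x (f x) = 0 → M.evalEval x (f x) = 0 → G.evalEval x (f x) = 0 := by
    intro x h1 h2
    rw [hG, evalEval_sub, evalEval_mul, h1, h2]; simp
  obtain ⟨G1, h1⟩ : lin t1 c1 ∣ G := by
    refine line_dvd {x0, x1, x2, x3} (by omega) (fun x hx => ?_)
    simp only [mem_insert, mem_singleton] at hx
    rcases hx with rfl | hx
    · rw [hG, evalEval_sub, evalEval_mul, ev_sc, hα, div_mul_cancel₀ _ hm0, sub_self]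
    · rw [← (hF1 x hx).1]; exact hGe x (hF1 x hx).2.1 (hF1 x hx).2.2
  have hG1 := td_quot h1 hGt
  obtain ⟨G2, h2⟩ : lin t2 c2 ∣ G1 := by
    refine line_dvd {y1, y2, y3} ?_ (fun x hx => ?_)
    · rw [card_insert_of_notMem (by simp [hy.1, hy.2.1]),
        card_insert_of_notMem (by simp [hy.2.2]), card_singleton]
      omega
    · simp only [mem_insert, mem_singleton] at hx
      have := hF2 x hx
      rw [← this.1]
      exact ev_quot h1 (hGe x this.2.2.1 this.2.2.2) this.2.1
  have hG2 := td_quot h2 hG1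
  obtain ⟨G3, h3⟩ : lin t3 c3 ∣ G2 := by
    refine line_dvd {z1, z2} ?_ (fun x hx => ?_)
    · rw [card_insert_of_notMem (by simp [hz]), card_singleton]
      omega
    · simp only [mem_insert, mem_singleton] at hx
      have := hF3 x hx
      rw [← this.1]
      exact ev_quot h2 (ev_quot h1 (hGe x this.2.2.2.1 this.2.2.2.2) this.2.1) this.2.2.1
  have hG3 := td_quot h3 hG2
  obtain ⟨β, hβ⟩ := eq_sc_of_td (Nat.le_zero.1 hG3)
  refine ⟨α, β, ?_⟩
  have : F = sc α * M + G := by rw [hG]; ring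
  rw [this, h1, h2, h3, hβ]; ring

lemma natDegree_det_le {ι : Type*} [Fintype ι] [DecidableEq ι] (A : Matrix ι ι ℝ[X]) (k : ℕ)
    (h : ∀ i j, (A i j).natDegree ≤ k) : A.det.natDegree ≤ Fintype.card ι * k := by
  rw [Matrix.det_apply]
  refine natDegree_sum_le_of_forall_le _ _ (fun σ _ => ?_)
  have : (∏ i, A (σ i) i).natDegree ≤ Fintype.card ι * k := by
    refine (natDegree_prod_le _ _).trans ?_
    refine (sum_le_card_nsmul _ _ k (fun i _ => h _ _)).trans ?_
    simp
  exact (natDegree_smul_le _ _).trans this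

lemma coeff_natDegree_le {F : PY} {d : ℕ} (hF : td F ≤ d) (i : ℕ) : (F.coeff i).natDegree ≤ d := by
  rw [natDegree_le_iff_coeff_eq_zero]
  intro j hj
  exact td_le_iff.1 hF i j (by omega)

lemma natDegreeY_le {F : PY} {d : ℕ} (hF : td F ≤ d) : F.natDegree ≤ d := by
  rw [natDegree_le_iff_coeff_eq_zero]
  intro i hi
  ext j
  rw [td_le_iff.1 hF i j (by omega)]; simp

lemma bezout {F G : PY} (hF : Irreducible F) (dF : td F ≤ 3) (dG : td G ≤ 3) (hFG : ¬ F ∣ G)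
    (s : Fr) (f : Fn) (h : ∀ x ∈ s, F.evalEval x (f x) = 0 ∧ G.evalEval x (f x) = 0) :
    s.card ≤ 18 := by
  by_cases h0 : F.natDegree = 0
  · obtain ⟨p, hp⟩ := natDegree_eq_zero.1 h0
    have hp0 : p ≠ 0 := by rintro rfl; exact hF.ne_zero (by simp [← hp])
    have h1 : s.card ≤ p.natDegree := by
      refine card_le_degree_of_subset_roots (p := p) (Z := s) ?_
      intro x hx
      have := (h x (by simpa using hx)).1
      rw [← hp, evalEval_C] at this
      exact (mem_roots hp0).2 this
    have h2 : p.natDegree ≤ 3 := by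
      have := coeff_natDegree_le dF 0
      rwa [← hp, coeff_C_zero] at this
    omega
  · set r := F.resultant G with hr
    have hr0 : r ≠ 0 := by
      let K := FractionRing ℝ[X]
      have hinj : Function.Injective (algebraMap ℝ[X] K) := IsFractionRing.injective _ _
      have hmap : (F.map (algebraMap ℝ[X] K)).resultant (G.map (algebraMap ℝ[X] K)) = algebraMap _ _ r := by
        have := resultant_map_map F G F.natDegree G.natDegree (algebraMap ℝ[X] K)
        rw [← hr] at this
        rw [← this, natDegree_map_eq_of_injective hinj, natDegree_map_eq_of_injective hinj]
      have hprim : F.IsPrimitive := hF.isPrimitive h0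
      have hirr : Irreducible (F.map (algebraMap ℝ[X] K)) :=
        (IsPrimitive.irreducible_iff_irreducible_map_fraction_map hprim).1 hF
      intro h0'
      rw [h0', map_zero, resultant_eq_zero_iff] at hmap
      rcases EuclideanDomain.dvd_or_coprime _ (G.map (algebraMap ℝ[X] K)) hirr with hd | hc
      · obtain ⟨H, hH⟩ := hd
        obtain ⟨b, hbm, hb⟩ := IsLocalization.integerNormalization_spec (nonZeroDivisors ℝ[X]) H
        apply hFG
        have hb' : C b * G = F * IsLocalization.integerNormalization (nonZeroDivisors ℝ[X]) H := by
          apply map_injective _ hinj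
          rw [Polynomial.map_mul, Polynomial.map_mul, hb, map_C, hH,
            ← algebraMap_smul K, smul_eq_C_mul]
          ring
        have hpr : Prime F := hF.prime
        rcases hpr.dvd_or_dvd (Dvd.intro _ hb'.symm) with h1 | h1
        · exfalso
          have hb0 : (b : ℝ[X]) ≠ 0 := nonZeroDivisors.ne_zero hbm
          have := natDegree_le_of_dvd h1 (by simpa using hb0)
          simp at this
          omega
        · exact h1
      · exact hmap.2 hc
    have hdeg : r.natDegree ≤ 18 := by
      have h1 := natDegree_det_le (sylvester F G F.natDegree G.natDegree) 3 (by
        intro i j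
        refine Fin.addCases (fun j => ?_) (fun j => ?_) j
        · simp only [sylvester, Matrix.of_apply, Fin.addCases_left]
          split_ifs
          · exact coeff_natDegree_le ‹_› _
          · simp
        · simp only [sylvester, Matrix.of_apply, Fin.addCases_right]
          split_ifs
          · exact coeff_natDegree_le ‹_› _
          · simp)
      have h2 := natDegreeY_le dF
      have h3 := natDegreeY_le dG
      rw [Fintype.card_fin] at h1
      change r.natDegree ≤ _ at h1
      omega
    have : s.card ≤ r.natDegree := by
      refine card_le_degree_of_subset_roots (p := r) (Z := s) ?_
      intro x hx
      have := h x (by simpa using hx)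
      refine (mem_roots hr0).2 ?_
      obtain ⟨p, q, -, -, e⟩ := exists_mul_add_mul_eq_C_resultant F G le_rfl le_rfl (Or.inl h0)
      have e' := congrArg (fun P => P.evalEval x (f x)) e
      simp only [evalEval_add, evalEval_mul, this.1, this.2, evalEval_C] at e'
      rw [IsRoot, hr, ← e']; simp
    omega

lemma bezout3 {F G : PY} (hF : Irreducible F) (dF : td F = 3) (dG : td G ≤ 3)
    (s : Fr) (f : Fn) (h : ∀ x ∈ s, F.evalEval x (f x) = 0 ∧ G.evalEval x (f x) = 0)
    (hs : 18 < s.card) : ∃ r, G = sc r * F := by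
  by_contra hc
  have hFG : ¬ F ∣ G := by
    rintro ⟨H, rfl⟩
    by_cases hH : H = 0
    · exact hc ⟨0, by simp [hH]⟩
    · rw [td_mul hF.ne_zero hH] at dG
      obtain ⟨r, rfl⟩ := eq_sc_of_td (F := H) (by omega)
      exact hc ⟨r, mul_comm _ _⟩
  have := bezout hF dF.le dG hFG s f h
  omega

/-- the general cubic -/
def cub (c : Fin 10 → ℝ) : PY :=
  sc (c 0) + sc (c 1) * C X + sc (c 2) * X + sc (c 3) * C X * C X + sc (c 4) * C X * X
    + sc (c 5) * X * X + sc (c 6) * C X * C X * C X + sc (c 7) * C X * C X * X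
    + sc (c 8) * C X * X * X + sc (c 9) * X * X * X

lemma ev_cub (c : Fin 10 → ℝ) (x y : ℝ) : (cub c).evalEval x y =
    c 0 + c 1 * x + c 2 * y + c 3 * x * x + c 4 * x * y + c 5 * y * y + c 6 * x * x * x
    + c 7 * x * x * y + c 8 * x * y * y + c 9 * y * y * y := by
  simp [cub, evalEval]

lemma td_CX : td (C X : PY) ≤ 1 := by
  rw [td_le_iff]
  intro i j h
  rcases i with _ | i
  · have : 1 ≠ j := by omega
    simp [coeff_X, this]
  · simp

lemma td_X : td (X : PY) ≤ 1 := by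
  rw [td_le_iff]
  intro i j h
  rcases i with _ | _ | i
  · simp
  · have : j ≠ 0 := by omega
    simp [coeff_one, this]
  · simp [coeff_X]

lemma td_cub (c : Fin 10 → ℝ) : td (cub c) ≤ 3 := by
  have hs : ∀ (r : ℝ) (G : PY), td G ≤ 3 → td (sc r * G) ≤ 3 := fun r G h => (td_sc_mul_le r G).trans h
  have m1 := td_CX
  have m2 := td_X
  have mm : ∀ (A B : PY) (a b : ℕ), td A ≤ a → td B ≤ b → td (A * B) ≤ a + b :=
    fun A B a b h1 h2 => (td_mul_le A B).trans (by omega)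
  have m0 : ∀ r, td (sc r) ≤ 0 := fun r => (td_sc r).le
  unfold cub
  refine td_add_le (td_add_le (td_add_le (td_add_le (td_add_le (td_add_le (td_add_le (td_add_le (td_add_le ?_ ?_) ?_) ?_) ?_) ?_) ?_) ?_) ?_) ?_
  · exact (m0 _).trans (by omega)
  · exact (mm _ _ _ _ (m0 _) m1).trans (by omega)
  · exact (mm _ _ _ _ (m0 _) m2).trans (by omega)
  · exact (mm _ _ _ _ (mm _ _ _ _ (m0 _) m1) m1).trans (by omega)
  · exact (mm _ _ _ _ (mm _ _ _ _ (m0 _) m1) m2).trans (by omega)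
  · exact (mm _ _ _ _ (mm _ _ _ _ (m0 _) m2) m2).trans (by omega)
  · exact (mm _ _ _ _ (mm _ _ _ _ (mm _ _ _ _ (m0 _) m1) m1) m1).trans (by omega)
  · exact (mm _ _ _ _ (mm _ _ _ _ (mm _ _ _ _ (m0 _) m1) m1) m2).trans (by omega)
  · exact (mm _ _ _ _ (mm _ _ _ _ (mm _ _ _ _ (m0 _) m1) m2) m2).trans (by omega)
  · exact (mm _ _ _ _ (mm _ _ _ _ (mm _ _ _ _ (m0 _) m2) m2) m2).trans (by omega)

/-- index of coefficient -/
lemma eq_cub {F : PY} (h : td F ≤ 3) : ∃ c, F = cub c := by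
  refine ⟨![(F.coeff 0).coeff 0, (F.coeff 0).coeff 1, (F.coeff 1).coeff 0, (F.coeff 0).coeff 2,
    (F.coeff 1).coeff 1, (F.coeff 2).coeff 0, (F.coeff 0).coeff 3, (F.coeff 1).coeff 2,
    (F.coeff 2).coeff 1, (F.coeff 3).coeff 0], ?_⟩
  have hz := td_le_iff.1 h
  have h1 : F.natDegree < 4 := by have := natDegreeY_le h; omega
  have h2 : ∀ i, F.coeff i = ∑ j ∈ range 4, C ((F.coeff i).coeff j) * X ^ j := fun i =>
    (F.coeff i).as_sum_range_C_mul_X_pow' (by have := coeff_natDegree_le h i; omega)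
  have e := F.as_sum_range_C_mul_X_pow' h1
  rw [sum_range_succ, sum_range_succ, sum_range_succ, Finset.sum_range_one,
    h2 0, h2 1, h2 2, h2 3] at e
  simp only [sum_range_succ, sum_range_zero, hz 1 3 (by norm_num), hz 2 2 (by norm_num),
    hz 2 3 (by norm_num), hz 3 1 (by norm_num), hz 3 2 (by norm_num), hz 3 3 (by norm_num)] at e
  refine e.trans ?_
  simp only [cub, sc]
  simp only [C_add, C_mul, C_pow, C_0, Matrix.cons_val]
  ring

lemma cub_ne {c : Fin 10 → ℝ} (hc : c ≠ 0) : cub c ≠ 0 := by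
  intro h
  have key : ∀ x y : ℝ, c 0 + c 1 * x + c 2 * y + c 3 * x * x + c 4 * x * y + c 5 * y * y
    + c 6 * x * x * x + c 7 * x * x * y + c 8 * x * y * y + c 9 * y * y * y = 0 := by
    intro x y
    rw [← ev_cub, h]; simp [evalEval]
  apply hc
  have := key 0 0; have := key 1 0; have := key (-1) 0; have := key 2 0
  have := key 0 1; have := key 0 (-1); have := key 0 2; have := key 1 1
  have := key 1 (-1); have := key (-1) 1
  ext i
  fin_cases i <;> simp <;> linarith

lemma exists_cubic (x : Fin 9 → ℝ) (f : Fn) : ∃ F : PY, F ≠ 0 ∧ td F ≤ 3 ∧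
    ∀ i, F.evalEval (x i) (f (x i)) = 0 := by
  let T : (Fin 10 → ℝ) →ₗ[ℝ] (Fin 9 → ℝ) :=
    { toFun := fun c i => (cub c).evalEval (x i) (f (x i))
      map_add' := by intro a b; ext i; simp only [ev_cub, Pi.add_apply]; ring
      map_smul' := by intro a b; ext i; simp only [ev_cub, Pi.smul_apply, smul_eq_mul, RingHom.id_apply]; ring }
  have : LinearMap.ker T ≠ ⊥ := by
    intro h
    have := LinearMap.finrank_le_finrank_of_injective (LinearMap.ker_eq_bot.1 h)
    simp at this
  obtain ⟨c, hc, hc0⟩ := Submodule.exists_mem_ne_zero_of_ne_bot this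
  exact ⟨cub c, cub_ne hc0, td_cub c, fun i => congrFun (LinearMap.mem_ker.1 hc) i⟩

lemma cls (d : ℕ) : ∀ F : PY, F ≠ 0 → td F ≤ d → ∃ s : Finset PY, s.card ≤ d ∧
    (∀ G ∈ s, Irreducible G ∧ td G ≤ d) ∧ ∀ x y, F.evalEval x y = 0 → ∃ G ∈ s, G.evalEval x y = 0 := by
  classical
  induction d using Nat.strong_induction_on with
  | _ d ih =>
  intro F hF hd
  have hpos : ∀ G : PY, G ≠ 0 → ¬ IsUnit G → 1 ≤ td G := by
    intro G hG hu
    by_contra h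
    obtain ⟨r, rfl⟩ := eq_sc_of_td (F := G) (by omega)
    have hr : r ≠ 0 := by rintro rfl; simp at hG
    exact hu (isUnit_C.2 (isUnit_C.2 hr.isUnit))
  by_cases hu : IsUnit F
  · refine ⟨∅, by simp, by simp, fun x y h => ?_⟩
    have := hu.map (evalEvalRingHom x y)
    rw [coe_evalEvalRingHom, h] at this
    simp at this
  by_cases hi : Irreducible F
  · exact ⟨{F}, by simpa using (hpos F hF hu).trans hd, by simpa using ⟨hi, hd⟩, fun x y h => ⟨F, by simp, h⟩⟩
  · rw [irreducible_iff] at hi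
    push Not at hi
    obtain ⟨G, H, hGH, hG, hH⟩ := hi hu
    have hG0 : G ≠ 0 := by rintro rfl; simp at hGH; exact hF hGH
    have hH0 : H ≠ 0 := by rintro rfl; simp at hGH; exact hF hGH
    have e := td_mul hG0 hH0
    rw [← hGH] at e
    have g1 := hpos G hG0 hG
    have h1 := hpos H hH0 hH
    obtain ⟨s, hs1, hs2, hs3⟩ := ih (td G) (by omega) G hG0 le_rfl
    obtain ⟨s', hs1', hs2', hs3'⟩ := ih (td H) (by omega) H hH0 le_rfl
    refine ⟨s ∪ s', (card_union_le _ _).trans (by omega), ?_, ?_⟩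
    · intro K hK
      rcases mem_union.1 hK with h | h
      · exact ⟨(hs2 K h).1, (hs2 K h).2.trans (by omega)⟩
      · exact ⟨(hs2' K h).1, (hs2' K h).2.trans (by omega)⟩
    · intro x y h
      rw [hGH, evalEval_mul] at h
      rcases mul_eq_zero.1 h with h | h
      · obtain ⟨K, hK, h⟩ := hs3 x y h
        exact ⟨K, mem_union_left _ hK, h⟩
      · obtain ⟨K, hK, h⟩ := hs3' x y h
        exact ⟨K, mem_union_right _ hK, h⟩

lemma lin_prime (t c : ℝ) : Prime (lin t c) := prime_X_sub_C _

lemma td_lin3 (t4 s4 t5 s5 t6 s6 : ℝ) : td (lin t4 s4 * lin t5 s5 * lin t6 s6) ≤ 3 := by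
  have := td_mul_le (lin t4 s4 * lin t5 s5) (lin t6 s6)
  have := td_mul_le (lin t4 s4) (lin t5 s5)
  have := td_lin t4 s4; have := td_lin t5 s5; have := td_lin t6 s6
  omega

lemma lin_dvd_lin {t c t' c' : ℝ} (h : lin t c ∣ lin t' c') : t = t' ∧ c = c' := by
  rw [lin_dvd_iff] at h
  have h0 := congrArg (eval 0) h
  have h1 := congrArg (eval 1) h
  rw [evalEval_line, ev_lin] at h0 h1
  simp at h0 h1
  constructor <;> linarith

variable {X : Fr} {f : Fn}

lemma Col3.perm1 {u v w : ℝ} (h : Col3 X f u v w) : Col3 X f v w u := by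
  obtain ⟨h1, h2, h3, t, c, h⟩ := h
  exact ⟨h3, h1.symm, h2.symm, t, c, fun x => by rw [h]; tauto⟩
lemma Col3.perm2 {u v w : ℝ} (h : Col3 X f u v w) : Col3 X f u w v := by
  obtain ⟨h1, h2, h3, t, c, h⟩ := h
  exact ⟨h2, h1, h3.symm, t, c, fun x => by rw [h]; tauto⟩

lemma Col3.uniq {u v w w' : ℝ} (h : Col3 X f u v w) (h' : Col3 X f u v w') : w = w' := by
  obtain ⟨h1, h2, h3, t, c, h⟩ := h
  obtain ⟨h1', h2', h3', t', c', h'⟩ := h'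
  have a1 := ((h u).2 (by simp)).2
  have a2 := ((h v).2 (by simp)).2
  have b1 := ((h' u).2 (by simp)).2
  have b2 := ((h' v).2 (by simp)).2
  have e : (t - t') * (u - v) = 0 := by linarith
  have e1 : t = t' := by
    rcases mul_eq_zero.1 e with e | e
    · linarith
    · exact absurd (by linarith) h1
  subst e1
  have e2 : c = c' := by linarith
  subst e2
  rcases (h' w).1 ((h w).2 (by simp)) with rfl | rfl | rfl
  · exact absurd rfl h2
  · exact absurd rfl h3
  · rfl

/-- 3 by 3 grid -/
lemma grid {F : PY} (hF : td F ≤ 3) {a1 a2 a3 b1 b2 b3 c1 c2 c3 : ℝ}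
    (hd : [a1, a2, a3, b1, b2, b3, c1, c2, c3].Nodup)
    (r1 : Col3 X f a1 a2 a3) (r2 : Col3 X f b1 b2 b3) (r3 : Col3 X f c1 c2 c3)
    (k1 : Col3 X f a1 b1 c1) (k2 : Col3 X f a2 b2 c2) (k3 : Col3 X f a3 b3 c3)
    (hv : ∀ x ∈ [a1, a2, a3, b1, b2, b3, c1, c2], F.evalEval x (f x) = 0) : F.evalEval c3 (f c3) = 0 := by
  obtain ⟨_, _, _, t1, s1, h1⟩ := r1
  obtain ⟨_, _, _, t2, s2, h2⟩ := r2
  obtain ⟨_, _, _, t3, s3, h3⟩ := r3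
  obtain ⟨_, _, _, t4, s4, h4⟩ := k1
  obtain ⟨_, _, _, t5, s5, h5⟩ := k2
  obtain ⟨_, _, _, t6, s6, h6⟩ := k3
  simp only [nodup_cons, List.mem_cons, not_or, not_mem_nil, not_false_eq_true, and_true] at hd
  simp only [List.mem_cons, not_mem_nil, or_false, forall_eq_or_imp, forall_eq] at hv
  have e : ∀ t s x, (lin t s).evalEval x (f x) = 0 ↔ f x = t * x + s := by
    intro t s x; rw [ev_lin, sub_eq_zero]
  have n1 : ∀ x ∈ X, ¬ (x = a1 ∨ x = a2 ∨ x = a3) → f x ≠ t1 * x + s1 := fun x hx hn h => hn ((h1 x).1 ⟨hx, h⟩)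
  have n2 : ∀ x ∈ X, ¬ (x = b1 ∨ x = b2 ∨ x = b3) → f x ≠ t2 * x + s2 := fun x hx hn h => hn ((h2 x).1 ⟨hx, h⟩)
  have v1 : ∀ x, x = a1 ∨ x = b1 ∨ x = c1 → x ∈ X ∧ f x = t4 * x + s4 := fun x h => (h4 x).2 h
  have v2 : ∀ x, x = a2 ∨ x = b2 ∨ x = c2 → x ∈ X ∧ f x = t5 * x + s5 := fun x h => (h5 x).2 h
  have v3 : ∀ x, x = a3 ∨ x = b3 ∨ x = c3 → x ∈ X ∧ f x = t6 * x + s6 := fun x h => (h6 x).2 h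
  set M := lin t4 s4 * lin t5 s5 * lin t6 s6 with hM
  have hMt : td M ≤ 3 := td_lin3 _ _ _ _ _ _
  have hMv : ∀ x, (f x = t4 * x + s4 ∨ f x = t5 * x + s5 ∨ f x = t6 * x + s6) → M.evalEval x (f x) = 0 := by
    intro x h
    rw [hM, evalEval_mul, evalEval_mul]
    rcases h with h | h | h
    · rw [(e _ _ x).2 h]; ring
    · rw [(e _ _ x).2 h]; ring
    · rw [(e _ _ x).2 h]; ring
  have w1 := fun x h => hMv x (Or.inl (v1 x h).2)
  have w2 := fun x h => hMv x (Or.inr (Or.inl (v2 x h).2))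
  have w3 := fun x h => hMv x (Or.inr (Or.inr (v3 x h).2))
  obtain ⟨α, β, hab⟩ := CB (F := F) (M := M) hF hMt (f := f) (t1 := t1) (c1 := s1) (t2 := t2) (c2 := s2)
    (t3 := t3) (c3 := s3) (x1 := a1) (x2 := a2) (x3 := a3) (y1 := b1) (y2 := b2) (y3 := b3)
    (z1 := c1) (z2 := c2) ⟨by tauto, by tauto, by tauto⟩ ⟨by tauto, by tauto, by tauto⟩ (by tauto)
    (by
      intro x hx
      refine ⟨((h1 x).2 hx).2, ?_, ?_⟩
      · rcases hx with rfl | rfl | rfl <;> tauto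
      · rcases hx with rfl | rfl | rfl
        · exact w1 _ (by simp)
        · exact w2 _ (by simp)
        · exact w3 _ (by simp))
    (by
      intro x hx
      refine ⟨((h2 x).2 hx).2, n1 x ((h2 x).2 hx).1 ?_, ?_, ?_⟩
      · rcases hx with rfl | rfl | rfl <;> grind
      · rcases hx with rfl | rfl | rfl <;> tauto
      · rcases hx with rfl | rfl | rfl
        · exact w1 _ (by simp)
        · exact w2 _ (by simp)
        · exact w3 _ (by simp))
    (by
      intro x hx
      have hx' : x = c1 ∨ x = c2 ∨ x = c3 := by tauto
      refine ⟨((h3 x).2 hx').2, n1 x ((h3 x).2 hx').1 ?_, n2 x ((h3 x).2 hx').1 ?_, ?_, ?_⟩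
      · rcases hx with rfl | rfl <;> grind
      · rcases hx with rfl | rfl <;> grind
      · rcases hx with rfl | rfl <;> tauto
      · rcases hx with rfl | rfl
        · exact w1 _ (by simp)
        · exact w2 _ (by simp))
    (by
      intro h
      rcases (lin_prime t1 s1).dvd_or_dvd h with h | h
      · rcases (lin_prime t1 s1).dvd_or_dvd h with h | h
        · obtain ⟨rfl, rfl⟩ := lin_dvd_lin h
          have := (h1 b1).1 ((h4 b1).2 (by simp))
          grind
        · obtain ⟨rfl, rfl⟩ := lin_dvd_lin h
          have := (h1 b2).1 ((h5 b2).2 (by simp))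
          grind
      · obtain ⟨rfl, rfl⟩ := lin_dvd_lin h
        have := (h1 b3).1 ((h6 b3).2 (by simp))
        grind)
  rw [hab, evalEval_add, evalEval_mul _ _ (sc α) M, w3 _ (by simp), evalEval_mul, evalEval_mul,
    (e t3 s3 c3).2 ((h3 c3).2 (by simp)).2]
  ring

end GT

namespace GT
open Polynomial
variable {X : Fr} {f : Fn}

/-- distinctness facts for a run -/
structure RunNe (q : ℝ) (L : ℕ) (a b : ℕ → ℝ) (p1 pm pn : ℝ) : Prop where
  aa : ∀ i j, i < L → j < L → i ≠ j → a i ≠ a j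
  bb : ∀ i j, i < L → j < L → i ≠ j → b i ≠ b j
  ab : ∀ i j, i < L → j < L → a i ≠ b j
  qa : ∀ i, i < L → q ≠ a i
  qb : ∀ i, i < L → q ≠ b i
  p1a : ∀ i, i + 1 < L → p1 ≠ a i
  p1b : ∀ i, i + 1 < L → 0 < i → p1 ≠ b i
  pma : ∀ i, i + 1 < L → 0 < i → pm ≠ a i
  pmb : ∀ i, i + 1 < L → pm ≠ b i
  pna : ∀ i, i + 1 < L → 1 < i → pn ≠ a i
  pnb : ∀ i, i + 2 < L → pn ≠ b i
  p1q : 3 < L → p1 ≠ q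
  pmq : 3 < L → pm ≠ q
  pnq : 3 < L → pn ≠ q
  p1m : 3 < L → p1 ≠ pm
  pmn : 3 < L → pm ≠ pn

lemma IsRun.ne {q : ℝ} {L : ℕ} {t a b : ℕ → ℝ} {p1 pm pn : ℝ} (h : IsRun X f q L t a b p1 pm pn) :
    RunNe q L a b p1 pm pn := by
  have tm : ∀ i j, i < L → j < L → i < j → t i < t j := by
    intro i j hi hj hij
    induction j with
    | zero => omega
    | succ j ih =>
      have h1 := (h.next j hj).1
      rcases Nat.lt_succ_iff_lt_or_eq.1 hij with h2 | h2
      · exact (ih (by omega) h2).trans h1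
      · exact h2 ▸ h1
  have tne : ∀ i j, i < L → j < L → i ≠ j → t i ≠ t j := by
    intro i j hi hj hij
    rcases lt_or_gt_of_ne hij with h2 | h2
    · exact (tm i j hi hj h2).ne
    · exact (tm j i hj hi h2).ne'
  have key : ∀ i j, i < L → j < L → i ≠ j → ∀ x, (x = a i ∨ x = b i) → (x = a j ∨ x = b j) → False := by
    intro i j hi hj hij x h1 h2
    have m1 : x ∈ Ln X f q (t i) := by rw [h.line i hi]; rcases h1 with rfl | rfl <;> simp
    have m2 : x ∈ Ln X f q (t j) := by rw [h.line j hj]; rcases h2 with rfl | rfl <;> simp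
    have e1 := (mem_Ln.1 m1).2
    have e2 := (mem_Ln.1 m2).2
    have hxq : x ≠ q := by
      rcases h1 with rfl | rfl
      · exact (h.c0 i hi).1.symm
      · exact (h.c0 i hi).2.1.symm
    have : (t i - t j) * (x - q) = 0 := by linarith
    rcases mul_eq_zero.1 this with h3 | h3
    · exact tne i j hi hj hij (by linarith)
    · exact hxq (by linarith)
  have aa : ∀ i j, i < L → j < L → i ≠ j → a i ≠ a j := fun i j hi hj hij e =>
    key i j hi hj hij (a i) (by simp) (Or.inl e)
  have bb : ∀ i j, i < L → j < L → i ≠ j → b i ≠ b j := fun i j hi hj hij e =>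
    key i j hi hj hij (b i) (by simp) (Or.inr e)
  refine ⟨aa, bb, ?_, fun i hi => (h.c0 i hi).1, fun i hi => (h.c0 i hi).2.1, fun i hi => (h.c1 i hi).1,
    ?_, ?_, fun i hi => (h.c2 i hi).2.1, ?_, fun i hi => (h.c3 i hi).2.1, ?_, ?_, ?_, ?_, ?_⟩
  · intro i j hi hj e
    by_cases hij : i = j
    · subst hij
      exact (h.c0 i hi).2.2.1 e
    · exact key i j hi hj hij (a i) (by simp) (Or.inr e)
  · intro i hi h0
    obtain ⟨j, rfl⟩ : ∃ j, i = j + 1 := ⟨i - 1, by omega⟩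
    exact (h.c1 j (by omega)).2.1
  · intro i hi h0
    obtain ⟨j, rfl⟩ : ∃ j, i = j + 1 := ⟨i - 1, by omega⟩
    exact (h.c2 j (by omega)).1
  · intro i hi h0
    obtain ⟨j, rfl⟩ : ∃ j, i = j + 2 := ⟨i - 2, by omega⟩
    exact (h.c3 j (by omega)).1
  · intro hL e
    subst e
    exact bb 0 1 (by omega) (by omega) (by omega) ((h.c0 0 (by omega)).uniq (h.c1 0 (by omega)))
  · intro hL e
    subst e
    exact bb 1 0 (by omega) (by omega) (by omega) ((h.c0 1 (by omega)).uniq (h.c2 0 (by omega)))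
  · intro hL e
    subst e
    exact bb 2 0 (by omega) (by omega) (by omega) ((h.c0 2 (by omega)).uniq (h.c3 0 (by omega)))
  · intro hL e
    subst e
    exact bb 2 0 (by omega) (by omega) (by omega) ((h.c1 1 (by omega)).uniq (h.c2 0 (by omega)))
  · intro hL e
    subst e
    exact bb 1 0 (by omega) (by omega) (by omega) ((h.c2 1 (by omega)).uniq (h.c3 0 (by omega)))

/-- the cubic of a run -/
lemma run_cubic {q : ℝ} {L : ℕ} {t a b : ℕ → ℝ} {p1 pm pn : ℝ} (h : IsRun X f q L t a b p1 pm pn)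
    (hL : 10 ≤ L) : ∃ F : PY, F ≠ 0 ∧ td F ≤ 3 ∧ F.evalEval q (f q) = 0 ∧ F.evalEval p1 (f p1) = 0 ∧
      F.evalEval pm (f pm) = 0 ∧ F.evalEval pn (f pn) = 0 ∧
      ∀ i, 3 ≤ i → i + 3 < L → F.evalEval (a i) (f (a i)) = 0 ∧ F.evalEval (b i) (f (b i)) = 0 := by
  have N := h.ne
  obtain ⟨F, hF0, hF, hv⟩ := exists_cubic ![pm, q, p1, a 3, a 4, a 5, b 3, b 4, a 6] f
  have v0 := hv 0; have v1 := hv 1; have v2 := hv 2; have v3 := hv 3; have v4 := hv 4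
  have v5 := hv 5; have v6 := hv 6; have v7 := hv 7; have v8 := hv 8
  simp only [Matrix.cons_val] at v0 v1 v2 v3 v4 v5 v6 v7 v8
  clear hv
  have p1q := N.p1q (by omega)
  have pmq := N.pmq (by omega)
  have pnq := N.pnq (by omega)
  have p1m := N.p1m (by omega)
  have pmn := N.pmn (by omega)
  have gg : ∀ i, 3 ≤ i → i + 5 < L → [a i, b i, q, b (i+1), pm, a (i+2), p1, a (i+1), b (i+2)].Nodup ∧
      [a (i+1), b i, pm, q, a (i+2), b (i+2), b (i+1), pn, a (i+3)].Nodup ∧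
      [pm, a (i+1), b i, b (i+2), q, a (i+2), a (i+3), b (i+1), pn].Nodup := by
    intro i h3 hi
    simp only [nodup_cons, List.mem_cons, not_or, not_mem_nil, not_false_eq_true, and_true,
      nodup_nil]
    and_intros
    all_goals first
      | assumption | (apply Ne.symm; assumption) | (apply N.aa <;> omega) | (apply N.bb <;> omega)
      | (apply N.ab <;> omega) | (apply N.qa <;> omega) | (apply N.qb <;> omega) | (apply N.p1a <;> omega)
      | (apply N.p1b <;> omega) | (apply N.pma <;> omega) | (apply N.pmb <;> omega) | (apply N.pna <;> omega)
      | (apply N.pnb <;> omega)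
      | (apply Ne.symm; apply N.ab <;> omega) | (apply Ne.symm; apply N.qa <;> omega)
      | (apply Ne.symm; apply N.qb <;> omega) | (apply Ne.symm; apply N.p1a <;> omega)
      | (apply Ne.symm; apply N.p1b <;> omega) | (apply Ne.symm; apply N.pma <;> omega)
      | (apply Ne.symm; apply N.pmb <;> omega) | (apply Ne.symm; apply N.pna <;> omega)
      | (apply Ne.symm; apply N.pnb <;> omega)
  have G1 : ∀ i, 3 ≤ i → i + 5 < L → F.evalEval (a i) (f (a i)) = 0 → F.evalEval (a (i+1)) (f (a (i+1))) = 0 →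
      F.evalEval (a (i+2)) (f (a (i+2))) = 0 → F.evalEval (b i) (f (b i)) = 0 →
      F.evalEval (b (i+1)) (f (b (i+1))) = 0 → F.evalEval (b (i+2)) (f (b (i+2))) = 0 := by
    intro i h3 hi e1 e2 e3 e4 e5
    refine grid hF (gg i h3 hi).1 (h.c0 i (by omega)).perm1 (h.c2 (i+1) (by omega)).perm1.perm1
      (h.c1 (i+1) (by omega)) (h.c1 i (by omega)).perm1 (h.c2 i (by omega)).perm1.perm1
      (h.c0 (i+2) (by omega)) ?_
    simp [*]
  have G3 : ∀ i, 3 ≤ i → i + 5 < L → F.evalEval (a (i+1)) (f (a (i+1))) = 0 →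
      F.evalEval (a (i+2)) (f (a (i+2))) = 0 → F.evalEval (a (i+3)) (f (a (i+3))) = 0 →
      F.evalEval (b i) (f (b i)) = 0 → F.evalEval (b (i+1)) (f (b (i+1))) = 0 →
      F.evalEval (b (i+2)) (f (b (i+2))) = 0 → F.evalEval pn (f pn) = 0 := by
    intro i h3 hi e1 e2 e3 e4 e5 e6
    refine grid hF (gg i h3 hi).2.2 (h.c2 i (by omega)) (h.c0 (i+2) (by omega)).perm1.perm1
      (h.c3 (i+1) (by omega)).perm1 (h.c2 (i+2) (by omega)).perm2 (h.c0 (i+1) (by omega)).perm1.perm2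
      (h.c3 i (by omega)).perm1.perm1.perm2 ?_
    simp [*]
  have v9 := G1 3 (by omega) (by omega) v3 v4 v5 v6 v7
  have v10 := G3 3 (by omega) (by omega) v4 v5 v8 v6 v7 v9
  have G2 : ∀ i, 3 ≤ i → i + 5 < L → F.evalEval (a (i+1)) (f (a (i+1))) = 0 →
      F.evalEval (a (i+2)) (f (a (i+2))) = 0 →
      F.evalEval (b i) (f (b i)) = 0 → F.evalEval (b (i+1)) (f (b (i+1))) = 0 →
      F.evalEval (b (i+2)) (f (b (i+2))) = 0 → F.evalEval (a (i+3)) (f (a (i+3))) = 0 := by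
    intro i h3 hi e1 e2 e4 e5 e6
    refine grid hF (gg i h3 hi).2.1 (h.c2 i (by omega)).perm1 (h.c0 (i+2) (by omega))
      (h.c3 (i+1) (by omega)).perm1.perm1 (h.c0 (i+1) (by omega)).perm1.perm2
      (h.c3 i (by omega)).perm1.perm1.perm2 (h.c2 (i+2) (by omega)).perm2 ?_
    simp [*]
  refine ⟨F, hF0, hF, v1, v2, v0, v10, ?_⟩
  have key : ∀ j, j + 8 < L → (F.evalEval (a (j+3)) (f (a (j+3))) = 0 ∧ F.evalEval (b (j+3)) (f (b (j+3))) = 0) ∧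
      (F.evalEval (a (j+4)) (f (a (j+4))) = 0 ∧ F.evalEval (b (j+4)) (f (b (j+4))) = 0) ∧
      (F.evalEval (a (j+5)) (f (a (j+5))) = 0 ∧ F.evalEval (b (j+5)) (f (b (j+5))) = 0) := by
    intro j
    induction j with
    | zero => intro _; exact ⟨⟨v3, v6⟩, ⟨v4, v7⟩, ⟨v5, v9⟩⟩
    | succ j ih =>
      intro hj
      obtain ⟨⟨e1, e2⟩, ⟨e3, e4⟩, ⟨e5, e6⟩⟩ := ih (by omega)
      have e7 := G2 (j+3) (by omega) (by omega) e3 e5 e2 e4 e6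
      have e8 := G1 (j+4) (by omega) (by omega) e3 e5 e7 e4 e6
      refine ⟨?_, ?_, ?_⟩
      · rw [show j + 1 + 3 = j + 4 by omega]; exact ⟨e3, e4⟩
      · rw [show j + 1 + 4 = j + 5 by omega]; exact ⟨e5, e6⟩
      · rw [show j + 1 + 5 = j + 6 by omega]; exact ⟨e7, e8⟩
  intro i h3 hi
  by_cases h5 : i ≤ 5
  · have := key 0 (by omega)
    interval_cases i
    · exact this.1
    · exact this.2.1
    · exact this.2.2
  · have := (key (i - 5) (by omega)).2.2
    rwa [show i - 5 + 5 = i by omega] at this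

lemma lin_irr (t c : ℝ) : Irreducible (lin t c) := (lin_prime t c).irreducible

lemma cover_q' {q : ℝ} {m : ℕ} (R : Runs X f q m) : ∃ s : Finset PY, s.card ≤ 17 * (m + 1) ∧
    (∀ G ∈ s, G ≠ 0 ∧ td G ≤ 3 ∧ G.evalEval q (f q) = 0) ∧ ∀ x ∈ X, ∃ G ∈ s, G.evalEval x (f x) = 0 := by
  classical
  set l : ℝ → PY := fun s => lin s (f q - s * q) with hl
  have hlx : ∀ s x, f x - f q = s * (x - q) → (l s).evalEval x (f x) = 0 := by
    intro s x h
    rw [hl, ev_lin]; linarith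
  have hS : ∀ k, ∃ S : Finset PY, S.card ≤ 3 ∧ (∀ G ∈ S, G ≠ 0 ∧ td G ≤ 3 ∧ G.evalEval q (f q) = 0) ∧
      (10 ≤ R.L k → ∀ i, 3 ≤ i → i + 3 < R.L k → (∃ G ∈ S, G.evalEval (R.a k i) (f (R.a k i)) = 0) ∧
        ∃ G ∈ S, G.evalEval (R.b k i) (f (R.b k i)) = 0) := by
    intro k
    by_cases hL : 10 ≤ R.L k
    · obtain ⟨F, h0, h1, h2⟩ := run_cubic (R.run k) hL
      exact ⟨{F}, by simp, by simpa using ⟨h0, h1, h2.1⟩, fun _ i hi hi' => ⟨⟨F, by simp, (h2.2.2.2.2 i hi hi').1⟩,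
        ⟨F, by simp, (h2.2.2.2.2 i hi hi').2⟩⟩⟩
    · exact ⟨∅, by simp, by simp, fun h => absurd h hL⟩
  choose S s1 s2 s3 using hS
  set E : ℕ → Finset PY := fun k => ((range 10 ∪ Ico (R.L k - 3) (R.L k)).image
    (fun i => l (R.t k i))) with hE
  refine ⟨{l 0} ∪ R.B.image l ∪ (range (m+1)).biUnion (fun k => S k ∪ E k), ?_, ?_, ?_⟩
  · have e1 : (R.B.image l).card ≤ m := card_image_le.trans R.Bcard
    have e2 : ((range (m+1)).biUnion (fun k => S k ∪ E k)).card ≤ (m+1) * 16 := by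
      refine (card_biUnion_le_card_mul _ _ 16 (fun k _ => ?_)).trans (by simp)
      refine (card_union_le _ _).trans ?_
      have : (E k).card ≤ 13 := by
        refine card_image_le.trans ((card_union_le _ _).trans ?_)
        simp; omega
      have := s1 k
      omega
    have e3 := card_union_le ({l 0} ∪ R.B.image l) ((range (m+1)).biUnion (fun k => S k ∪ E k))
    have e4 := card_union_le ({l 0}) (R.B.image l)
    rw [card_singleton] at e4
    omega
  · have hlin : ∀ s, l s ≠ 0 ∧ td (l s) ≤ 3 ∧ (l s).evalEval q (f q) = 0 := fun s => ⟨lin_ne _ _, by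
      rw [hl, td_lin]; omega, hlx _ _ (by ring)⟩
    intro G hG
    simp only [mem_union, mem_singleton, mem_image, mem_biUnion, hE] at hG
    rcases hG with (rfl | ⟨s, _, rfl⟩) | ⟨k, _, h | ⟨i, _, rfl⟩⟩
    · exact hlin _
    · exact hlin _
    · exact s2 k G h
    · exact hlin _
  · intro x hx
    by_cases hxq : x = q
    · subst hxq
      exact ⟨l 0, by simp, hlx _ _ (by simp)⟩
    set s := (f x - f q) / (x - q) with hs
    have hsx : f x - f q = s * (x - q) := by
      rw [hs, div_mul_cancel₀ _ (sub_ne_zero.2 hxq)]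
    have hmem : x ∈ Ln X f q s := mem_Ln.2 ⟨hx, hsx⟩
    have hsl : s ∈ Sl X f q := mem_Sl.2 ⟨x, hmem, hxq⟩
    by_cases hB : s ∈ R.B
    · exact ⟨l s, by simp only [mem_union]; left; right; exact mem_image_of_mem _ hB, hlx _ _ hsx⟩
    obtain ⟨k, hk, i, hi, his⟩ := R.cover s hsl hB
    have hin : ∀ G ∈ S k ∪ E k, G ∈ {l 0} ∪ R.B.image l ∪ (range (m+1)).biUnion (fun k => S k ∪ E k) := by
      intro G hG
      apply mem_union_right
      exact mem_biUnion.2 ⟨k, mem_range.2 (by omega), hG⟩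
    by_cases hgood : 10 ≤ R.L k ∧ 3 ≤ i ∧ i + 3 < R.L k
    · have hh := s3 k hgood.1 i hgood.2.1 hgood.2.2
      rw [← his, (R.run k).line i hi] at hmem
      simp only [mem_insert, mem_singleton] at hmem
      rcases hmem with h | rfl | rfl
      · exact absurd h hxq
      · obtain ⟨G, hG, h⟩ := hh.1
        exact ⟨G, hin G (mem_union_left _ hG), h⟩
      · obtain ⟨G, hG, h⟩ := hh.2
        exact ⟨G, hin G (mem_union_left _ hG), h⟩
    · refine ⟨l s, hin _ (mem_union_right _ ?_), hlx _ _ hsx⟩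
      rw [hE, ← his]
      refine mem_image.2 ⟨i, ?_, rfl⟩
      simp only [mem_union, mem_range, mem_Ico]
      omega

lemma cover_q {q : ℝ} {m : ℕ} (R : Runs X f q m) : ∃ s : Finset PY, s.card ≤ 51 * (m + 1) ∧
    (∀ G ∈ s, Irreducible G ∧ td G ≤ 3) ∧ ∀ x ∈ X, ∃ G ∈ s, G.evalEval x (f x) = 0 := by
  classical
  obtain ⟨s, h1, h2, h3⟩ := cover_q' R
  have : ∀ G : PY, ∃ S : Finset PY, G ∈ s → S.card ≤ 3 ∧ (∀ H ∈ S, Irreducible H ∧ td H ≤ 3) ∧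
      ∀ x y, G.evalEval x y = 0 → ∃ H ∈ S, H.evalEval x y = 0 := by
    intro G
    by_cases hG : G ∈ s
    · obtain ⟨S, a, b, c⟩ := cls 3 G (h2 G hG).1 (h2 G hG).2.1
      exact ⟨S, fun _ => ⟨a, b, fun x y => c x y⟩⟩
    · exact ⟨∅, fun h => absurd h hG⟩
  choose S hS using this
  refine ⟨s.biUnion S, ?_, ?_, ?_⟩
  · refine (card_biUnion_le_card_mul _ _ 3 fun G hG => (hS G hG).1).trans ?_
    omega
  · intro H hH
    obtain ⟨G, hG, h⟩ := mem_biUnion.1 hH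
    exact (hS G hG).2.1 H h
  · intro x hx
    obtain ⟨G, hG, h⟩ := h3 x hx
    obtain ⟨H, hH, h'⟩ := (hS G hG).2.2 x _ h
    exact ⟨H, mem_biUnion.2 ⟨G, hG, hH⟩, h'⟩

theorem cover_exist : ∃ C1 : ℕ, ∀ X : Fr, ∀ f : Fn, X.Nonempty → N2 X f ≤ X.card →
    ∃ s : Finset PY, s.card ≤ C1 ∧
    (∀ G ∈ s, Irreducible G ∧ td G ≤ 3) ∧ ∀ x ∈ X, ∃ G ∈ s, G.evalEval x (f x) = 0 := by
  obtain ⟨C0, h⟩ := runs_exist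
  refine ⟨51 * (2 * C0 + 1), fun X f hX hN => ?_⟩
  obtain ⟨bd, h1, h2⟩ := h X f
  obtain ⟨q, hq, hb⟩ : ∃ q ∈ X, bd q ≤ 2 * C0 := by
    by_contra hc
    push Not at hc
    have := Finset.sum_lt_sum_of_nonempty hX hc
    rw [sum_const, smul_eq_mul] at this
    have h3 : C0 * (X.card + N2 X f) ≤ C0 * (X.card + X.card) := Nat.mul_le_mul_left _ (by omega)
    have h4 : C0 * (X.card + X.card) = X.card * (2 * C0) := by ring
    omega
  obtain ⟨R⟩ := h2 q hq
  obtain ⟨s, a, b⟩ := cover_q R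
  exact ⟨s, a.trans (by omega), b⟩

end GT

namespace GT
open Finset

/-- the points of `R` with fewer than `C` points above them -/
def Tops (R : Fr) (g : Fn) (C : ℕ) : Fr :=
  R.filter (fun r => (R.filter (fun r' => g r < g r')).card < C)

lemma mem_Tops {R : Fr} {g : Fn} {C : ℕ} {r : ℝ} :
    r ∈ Tops R g C ↔ r ∈ R ∧ (R.filter (fun r' => g r < g r')).card < C := mem_filter

lemma Tops_card_le {R : Fr} {g : Fn} {C : ℕ} (hg : ∀ x ∈ R, ∀ y ∈ R, g x = g y → x = y) :
    (Tops R g C).card ≤ C := by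
  by_cases h : (Tops R g C).Nonempty
  · obtain ⟨r, hr, hm⟩ := exists_min_image _ g h
    have h1 : (Tops R g C).erase r ⊆ R.filter (fun r' => g r < g r') := by
      intro x hx
      rw [mem_erase] at hx
      refine mem_filter.2 ⟨(mem_Tops.1 hx.2).1, lt_of_le_of_ne (hm x hx.2) fun he => ?_⟩
      exact hx.1 (hg _ (mem_Tops.1 hr).1 _ (mem_Tops.1 hx.2).1 he).symm
    have h2 := card_le_card h1
    have h3 := (mem_Tops.1 hr).2
    have h4 := card_erase_add_one hr
    omega
  · rw [not_nonempty_iff_eq_empty.1 h]; simp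

lemma Tops_card_ge (R : Fr) (g : Fn) (C : ℕ) : min C R.card ≤ (Tops R g C).card := by
  by_cases h : (R \ Tops R g C).Nonempty
  · obtain ⟨r, hr, hm⟩ := exists_max_image _ g h
    rw [mem_sdiff, mem_Tops] at hr
    have h1 : R.filter (fun r' => g r < g r') ⊆ Tops R g C := by
      intro x hx
      rw [mem_filter] at hx
      by_contra hc
      exact absurd (hm x (mem_sdiff.2 ⟨hx.1, hc⟩)) (not_le.2 hx.2)
    have h2 := card_le_card h1
    have h3 : C ≤ (R.filter (fun r' => g r < g r')).card := by
      by_contra hc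
      exact hr.2 ⟨hr.1, not_le.1 hc⟩
    exact (min_le_left _ _).trans (h3.trans h2)
  · rw [not_nonempty_iff_eq_empty, sdiff_eq_empty_iff_subset] at h
    exact (min_le_right _ _).trans (card_le_card h)

lemma Tops_sub {R S : Fr} {g : Fn} {C : ℕ} {r : ℝ} (hS : S ⊆ R) (hr : r ∈ Tops R g C) (h : r ∈ S) :
    r ∈ Tops S g C :=
  mem_Tops.2 ⟨h, lt_of_le_of_lt (card_le_card (filter_subset_filter _ hS)) (mem_Tops.1 hr).2⟩

lemma Tops_aff {R : Fr} {g p : Fn} {C : ℕ} {r u v : ℝ} (hv : v ≠ 0)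
    (hg : ∀ x ∈ R, g x = u + v * p x) (hr : r ∈ Tops R g C) :
    r ∈ Tops R p C ∨ r ∈ Tops R (fun x => - p x) C := by
  rw [mem_Tops] at hr
  rcases lt_or_gt_of_ne hv with h | h
  · right
    refine mem_Tops.2 ⟨hr.1, ?_⟩
    refine lt_of_eq_of_lt (congrArg card (filter_congr fun x hx => ?_)) hr.2
    rw [hg x hx, hg r hr.1]
    constructor
    · intro h'; nlinarith
    · intro h'; by_contra hc; nlinarith
  · left
    refine mem_Tops.2 ⟨hr.1, ?_⟩
    refine lt_of_eq_of_lt (congrArg card (filter_congr fun x hx => ?_)) hr.2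
    rw [hg x hx, hg r hr.1]
    constructor
    · intro h'; nlinarith
    · intro h'; by_contra hc; nlinarith

lemma mem_ordPairs {X : Fr} {f : Fn} {u v t c : ℝ} (hu : u ∈ X) (hv : v ∈ X) (huv : u ≠ v)
    (h1 : f u = t * u + c) (h2 : f v = t * v + c) (h : ∀ x ∈ X, f x = t * x + c → x = u ∨ x = v) :
    ({u, v} : Fr) ∈ ordPairs X f := by
  classical
  unfold ordPairs
  rw [mem_filter, mem_powersetCard]
  refine ⟨⟨?_, card_pair huv⟩, t, c, fun x hx => ?_⟩
  · intro x hx; simp only [mem_insert, mem_singleton] at hx; rcases hx with rfl | rfl <;> assumption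
  · simp only [mem_insert, mem_singleton]
    exact ⟨h x hx, by rintro (rfl | rfl) <;> assumption⟩

lemma caseC_core {X : Fr} {f : Fn} {Λ : Finset (ℝ × ℝ)} {E : Fr} {K C : ℕ}
    (hΛ : Λ.card ≤ K) (hE : E.card ≤ K)
    (hcov : ∀ x ∈ X, x ∈ E ∨ ∃ l ∈ Λ, f x = l.1 * x + l.2) {α β : ℝ} {A R : Fr}
    (hA : A = X.filter (fun x => f x = α * x + β)) (hR : R = X.filter (fun x => ¬ f x = α * x + β)) :
    (A.card - (K + (K + K * (2 * C)) ^ 2)) * min C R.card ≤ N2 X f := by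
  classical
  set D : ℝ → ℝ := fun x => f x - (α * x + β) with hD
  have hDR : ∀ x ∈ R, D x ≠ 0 := fun x hx h => by
    rw [hR, mem_filter] at hx
    exact hx.2 (by simp only [hD] at h; linarith)
  set κ : ℝ → ℝ → ℝ := fun a x => x / D x - a * (1 / D x) with hκ
  set Rj : ℝ × ℝ → Fr := fun l => R.filter (fun x => f x = l.1 * x + l.2) with hRj
  set p : ℝ × ℝ → ℝ → ℝ := fun l x => if l.1 = α then x / D x else 1 / D x with hp
  have hDl : ∀ l x, x ∈ Rj l → D x = (l.1 - α) * x + (l.2 - β) := by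
    intro l x hx
    rw [hRj, mem_filter] at hx
    simp only [hD]; rw [hx.2]; ring
  have hRjR : ∀ l, Rj l ⊆ R := fun l => filter_subset _ _
  have pinj : ∀ l, ∀ x ∈ Rj l, ∀ y ∈ Rj l, p l x = p l y → x = y := by
    intro l x hx y hy h
    have dx := hDR x (hRjR l hx); have dy := hDR y (hRjR l hy)
    have ex := hDl l x hx; have ey := hDl l y hy
    simp only [hp] at h
    split_ifs at h with h0
    · have : D x = D y := by rw [ex, ey, h0]; ring
      rw [this] at h
      field_simp at h; exact h
    · have : D x = D y := by field_simp at h; exact h.symm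
      rw [ex, ey] at this
      have h1 : (l.1 - α) * (x - y) = 0 := by linarith
      rcases mul_eq_zero.1 h1 with h2 | h2
      · exact absurd (sub_eq_zero.1 h2) h0
      · linarith
  set LL : Fr := E ∪ Λ.biUnion (fun l => Tops (Rj l) (p l) C ∪ Tops (Rj l) (fun x => - p l x) C) with hLL
  have LLcard : LL.card ≤ K + K * (2 * C) := by
    refine (card_union_le _ _).trans (add_le_add hE ((card_biUnion_le_card_mul _ _ (2 * C) fun l _ => ?_).trans
      (Nat.mul_le_mul_right _ hΛ)))
    refine (card_union_le _ _).trans ?_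
    have h1 := Tops_card_le (C := C) (pinj l)
    have h2 := Tops_card_le (C := C) (R := Rj l) (g := fun x => - p l x)
      (fun x hx y hy h => pinj l x hx y hy (neg_injective h))
    omega
  set B1 : Fr := Λ.image (fun l => - (l.2 - β) / (l.1 - α)) with hB1
  set B2 : Fr := (LL ×ˢ LL).image
    (fun r => (r.1 / D r.1 - r.2 / D r.2) / (1 / D r.1 - 1 / D r.2)) with hB2
  set A' := A \ (B1 ∪ B2) with hA'
  have A'card : A.card - (K + (K + K * (2 * C)) ^ 2) ≤ A'.card := by
    have h1 : A.card - (B1 ∪ B2).card ≤ A'.card := le_card_sdiff (B1 ∪ B2) A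
    have h2 := card_union_le B1 B2
    have h3 : B1.card ≤ K := card_image_le.trans hΛ
    have h4 : B2.card ≤ (K + K * (2 * C)) ^ 2 := by
      refine card_image_le.trans ?_
      rw [card_product, sq]
      exact Nat.mul_le_mul LLcard LLcard
    omega
  have top_sub : ∀ q ∈ A', ∀ r ∈ Tops R (κ q) C, r ∈ LL := by
    intro q hq r hr
    have hrR := (mem_Tops.1 hr).1
    have hrX : r ∈ X := by rw [hR] at hrR; exact (mem_filter.1 hrR).1
    rcases hcov r hrX with h | ⟨l, hl, h⟩
    · exact mem_union_left _ h
    refine mem_union_right _ (mem_biUnion.2 ⟨l, hl, mem_union.2 ?_⟩)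
    have hrj : r ∈ Rj l := mem_filter.2 ⟨hrR, h⟩
    have hr' := Tops_sub (hRjR l) hr hrj
    by_cases h0 : l.1 = α
    · refine Tops_aff (u := - q * (1 / (l.2 - β))) (v := 1) one_ne_zero (fun x hx => ?_) hr'
      have ex := hDl l x hx
      have dx := hDR x (hRjR l hx)
      simp only [hκ, hp, if_pos h0]
      have : D x = l.2 - β := by rw [ex, h0]; ring
      rw [this]; ring
    · have h1 : l.1 - α ≠ 0 := sub_ne_zero.2 h0
      refine Tops_aff (u := 1 / (l.1 - α)) (v := - ((l.2 - β) / (l.1 - α) + q)) ?_ (fun x hx => ?_) hr'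
      · intro hv
        rw [hA', mem_sdiff, mem_union, not_or] at hq
        refine hq.2.1 (mem_image.2 ⟨l, hl, ?_⟩)
        rw [neg_div]; linarith
      have ex := hDl l x hx
      have dx := hDR x (hRjR l hx)
      simp only [hκ, hp, if_neg h0]
      have : x = (D x - (l.2 - β)) / (l.1 - α) := by rw [ex]; field_simp; ring
      rw [show x / D x = ((D x - (l.2 - β)) / (l.1 - α)) / D x by rw [← this]]
      field_simp; ring
  have inj : ∀ q ∈ A', ∀ r ∈ LL, ∀ r' ∈ LL, D r ≠ 0 → D r' ≠ 0 → κ q r = κ q r' → r = r' := by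
    intro q hq r hr r' hr' hd hd' h
    simp only [hκ] at h
    by_cases h0 : 1 / D r - 1 / D r' = 0
    · have h1 : 1 / D r = 1 / D r' := sub_eq_zero.1 h0
      rw [h1] at h
      have h2 : D r = D r' := by field_simp at h1; exact h1.symm
      rw [h2] at h
      have : r / D r' = r' / D r' := by linarith
      field_simp at this; exact this
    · exfalso
      rw [hA', mem_sdiff, mem_union, not_or] at hq
      refine hq.2.2 (mem_image.2 ⟨(r, r'), mem_product.2 ⟨hr, hr'⟩, ?_⟩)
      simp only
      rw [div_eq_iff h0]; linarith
  have key : ∀ q ∈ A', ∀ r ∈ Tops R (κ q) C, ({q, r} : Fr) ∈ ordPairs X f := by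
    intro q hq r hr
    have hrR := (mem_Tops.1 hr).1
    have hqA : q ∈ A := (mem_sdiff.1 hq).1
    have hqA' := hqA
    have hrR' := hrR
    rw [hA, mem_filter] at hqA'
    rw [hR, mem_filter] at hrR'
    have hqr : q ≠ r := fun h => hrR'.2 (h ▸ hqA'.2)
    have hsub : r - q ≠ 0 := sub_ne_zero.2 hqr.symm
    set t := (f r - f q) / (r - q) with ht
    have htt : t * (r - q) = f r - f q := by rw [ht]; field_simp
    refine mem_ordPairs (t := t) (c := f q - t * q) hqA'.1 hrR'.1 hqr (by ring) (by linarith) fun x hx hxl => ?_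
    by_contra hc
    push Not at hc
    have hDx : ∀ x, f x = t * x + (f q - t * q) → D x = (t - α) * (x - q) := by
      intro x hxl
      simp only [hD]; rw [hxl, hqA'.2]; ring
    have e1 := hDx r (by linarith)
    have d1 := hDR r hrR
    have hta : t - α ≠ 0 := by intro h; rw [h, zero_mul] at e1; exact d1 e1
    have hκx : ∀ x, x ≠ q → D x = (t - α) * (x - q) → κ q x = 1 / (t - α) := by
      intro x hxq hx
      have : x - q ≠ 0 := sub_ne_zero.2 hxq
      simp only [hκ, hx]
      field_simp
    have e2 := hDx x hxl
    have d2 : D x ≠ 0 := by rw [e2]; exact mul_ne_zero hta (sub_ne_zero.2 hc.1)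
    have hxR : x ∈ R := by
      rw [hR, mem_filter]; exact ⟨hx, fun h => d2 (by simp only [hD]; rw [h]; ring)⟩
    have hk : κ q x = κ q r := by rw [hκx x hc.1 e2, hκx r hqr.symm e1]
    have hxT : x ∈ Tops R (κ q) C := by
      rw [mem_Tops] at hr ⊢
      rw [hk]; exact ⟨hxR, hr.2⟩
    exact hc.2 (inj q hq x (top_sub q hq x hxT) r (top_sub q hq r hr) d2 d1 hk)
  calc (A.card - (K + (K + K * (2 * C)) ^ 2)) * min C R.card ≤ A'.card * min C R.card :=
        Nat.mul_le_mul_right _ A'card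
    _ ≤ ∑ q ∈ A', (Tops R (κ q) C).card := by
        rw [← smul_eq_mul]
        exact card_nsmul_le_sum _ _ _ fun q _ => Tops_card_ge _ _ _
    _ = (A'.sigma (fun q => Tops R (κ q) C)).card := (card_sigma _ _).symm
    _ ≤ N2 X f := by
        refine card_le_card_of_injOn (fun s => ({s.1, s.2} : Fr)) ?_ ?_
        · intro s hs
          rw [mem_coe, mem_sigma] at hs
          exact key _ hs.1 _ hs.2
        · rintro ⟨q, r⟩ hs ⟨q', r'⟩ hs' h
          rw [mem_coe, mem_sigma] at hs hs'
          simp only at hs hs' h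
          have a1 := (mem_sdiff.1 hs.1).1; have a2 := (mem_sdiff.1 hs'.1).1
          have b1 := (mem_Tops.1 hs.2).1; have b2 := (mem_Tops.1 hs'.2).1
          rw [hA, mem_filter] at a1 a2
          rw [hR, mem_filter] at b1 b2
          have h1 : q ∈ ({q', r'} : Fr) := h ▸ (by simp)
          have h2 : r ∈ ({q', r'} : Fr) := h ▸ (by simp)
          simp only [mem_insert, mem_singleton] at h1 h2
          have h3 : q = q' := by
            rcases h1 with h1 | h1
            · exact h1
            · subst h1; exact absurd a1.2 b2.2
          have h4 : r = r' := by
            rcases h2 with h1 | h1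
            · subst h1; exact absurd a2.2 b1.2
            · exact h1
          subst h3; subst h4; rfl

theorem caseC (K : ℕ) : ∃ n0 : ℕ, ∀ X : Fr, ∀ f : Fn, n0 ≤ X.card →
    (¬ ∃ t c, ∀ x ∈ X, f x = t * x + c) →
    (∃ Λ : Finset (ℝ × ℝ), ∃ E : Fr, Λ.card ≤ K ∧ E.card ≤ K ∧
      ∀ x ∈ X, x ∈ E ∨ ∃ l ∈ Λ, f x = l.1 * x + l.2) → 3 * X.card ≤ 4 * N2 X f := by
  set C := 2 * (K + 1) with hC
  set W := K + (K + K * (2 * C)) ^ 2 with hW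
  refine ⟨8 * (K + C + W + 1) * (K + 1), fun X f hn hcol ⟨Λ, E, hΛ, hE, hcov⟩ => ?_⟩
  classical
  have hsum : X.card ≤ K + ∑ l ∈ Λ, (X.filter (fun x => f x = l.1 * x + l.2)).card := by
    have : X ⊆ E ∪ Λ.biUnion (fun l => X.filter (fun x => f x = l.1 * x + l.2)) := by
      intro x hx
      rcases hcov x hx with h | ⟨l, hl, h⟩
      · exact mem_union_left _ h
      · exact mem_union_right _ (mem_biUnion.2 ⟨l, hl, mem_filter.2 ⟨hx, h⟩⟩)
    refine (card_le_card this).trans ((card_union_le _ _).trans (add_le_add hE card_biUnion_le))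
  obtain ⟨l, hl, hbig⟩ : ∃ l ∈ Λ, X.card ≤ K + K * (X.filter (fun x => f x = l.1 * x + l.2)).card := by
    by_cases hne : Λ.Nonempty
    · obtain ⟨l, hl, hm⟩ := exists_max_image Λ (fun l => (X.filter (fun x => f x = l.1 * x + l.2)).card) hne
      refine ⟨l, hl, hsum.trans (Nat.add_le_add_left ?_ _)⟩
      have := sum_le_card_nsmul _ _ _ hm
      rw [smul_eq_mul] at this
      exact this.trans (Nat.mul_le_mul_right _ hΛ)
    · exfalso
      rw [not_nonempty_iff_eq_empty.1 hne, sum_empty] at hsum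
      have : 8 * (K + C + W + 1) * (K + 1) ≥ 8 * (K + C + W + 1) * 1 := Nat.mul_le_mul_left _ (by omega)
      omega
  have hcore := caseC_core (C := C) hΛ hE hcov (α := l.1) (β := l.2) rfl rfl
  set A := X.filter (fun x => f x = l.1 * x + l.2) with hA
  set R := X.filter (fun x => ¬ f x = l.1 * x + l.2) with hR
  have hAR : A.card + R.card = X.card := card_filter_add_card_filter_not _
  have hR1 : 1 ≤ R.card := by
    rw [Nat.one_le_iff_ne_zero, Ne, card_eq_zero]
    intro h
    refine hcol ⟨l.1, l.2, fun x hx => ?_⟩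
    by_contra hc
    have : x ∈ R := mem_filter.2 ⟨hx, hc⟩
    rw [h] at this; simp at this
  rw [← hW] at hcore
  have hn2 : 8 * (K + C + W + 1) ≤ X.card := by
    refine le_trans ?_ hn
    nlinarith
  by_cases hk : C ≤ R.card
  · rw [min_eq_left hk] at hcore
    have h1 : X.card ≤ K + (K + 1) * A.card := hbig.trans (by nlinarith)
    zify at *
    have h2 : ((A.card : ℤ) - W) * C ≤ N2 X f := by
      refine le_trans ?_ hcore
      have : (A.card : ℤ) - W ≤ ((A.card - W : ℕ) : ℤ) := by omega
      nlinarith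
    have hC' : (C : ℤ) = 2 * (K + 1) := by rw [hC]
    have h3 : (A.card : ℤ) * C ≥ 2 * (X.card - K) := by rw [hC']; nlinarith
    have h4 : (W : ℤ) * C * 8 ≤ 2 * X.card := by
      rw [hC']; nlinarith
    nlinarith
  · have h1 : A.card - W ≤ (A.card - W) * min C R.card := Nat.le_mul_of_pos_right _ (by
      rw [lt_min_iff]; omega)
    omega

end GT

namespace GT

set_option linter.unusedSimpArgs false
open Polynomial
variable {X : Fr} {f : Fn}

/-- the line `y = t x + s` meets the cubic `F` exactly in `u, v, w` with multiplicity -/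
def TriC (F : PY) (t s u v w : ℝ) : Prop :=
  ∃ l : ℝ, l ≠ 0 ∧ ∀ x, F.evalEval x (t * x + s) = l * ((x - u) * (x - v) * (x - w))

lemma TriC.root {F : PY} {t s u v w x : ℝ} (h : TriC F t s u v w) (hx : F.evalEval x (t * x + s) = 0) :
    x = u ∨ x = v ∨ x = w := by
  obtain ⟨l, h0, h⟩ := h
  rw [h] at hx
  simp only [mul_eq_zero, h0, false_or, sub_eq_zero] at hx
  tauto

lemma lin_fac {l l' u v w w' : ℝ} (h : ∀ x : ℝ, l * ((x - u) * (x - v) * (x - w)) = l' * ((x - u) * (x - v) * (x - w')))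
    (h0 : l ≠ 0) : w = w' := by
  have key : ∀ x, x ≠ u → x ≠ v → l * (x - w) = l' * (x - w') := by
    intro x h1 h2
    have := h x
    have h3 : (x - u) * (x - v) ≠ 0 := mul_ne_zero (sub_ne_zero.2 h1) (sub_ne_zero.2 h2)
    apply mul_left_cancel₀ h3
    linarith
  set m := |u| + |v| + 1
  have a1 := le_abs_self u; have a2 := le_abs_self v; have a3 := abs_nonneg u; have a4 := abs_nonneg v
  have k1 := key m (by simp only [m]; intro; linarith) (by simp only [m]; intro; linarith)
  have k2 := key (m + 1) (by simp only [m]; intro; linarith) (by simp only [m]; intro; linarith)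
  have : l = l' := by linarith
  subst this
  have := mul_left_cancel₀ h0 k1
  linarith

lemma TriC.uniq {F : PY} {t s u v w w' : ℝ} (h : TriC F t s u v w) (h' : TriC F t s u v w') : w = w' := by
  obtain ⟨l, h0, h⟩ := h
  obtain ⟨l', h0', h'⟩ := h'
  exact lin_fac (fun x => (h x).symm.trans (h' x)) h0

lemma TriC.dbl {F : PY} {t s u v u' v' : ℝ} (h : TriC F t s u u v) (h' : TriC F t s u' u' v') (huv : u ≠ v) : u = u' := by
  have r1 : u = u' ∨ u = u' ∨ u = v' := h'.root (by obtain ⟨l, _, h⟩ := h; rw [h]; ring)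
  have r2 : v = u' ∨ v = u' ∨ v = v' := h'.root (by obtain ⟨l, _, h⟩ := h; rw [h]; ring)
  rcases r1 with r1 | r1 | r1
  · exact r1
  · exact r1
  have r3 : v = u' := by
    rcases r2 with r2 | r2 | r2
    · exact r2
    · exact r2
    · exact absurd (r1.trans r2.symm) huv
  subst r1; subst r3
  obtain ⟨l, h0, h⟩ := h
  obtain ⟨l', h0', h'⟩ := h'
  refine absurd (lin_fac (l := l) (l' := l') (u := u) (v := v) (w := u) (w' := v) (fun x => ?_) h0) huv
  have := (h x).symm.trans (h' x)
  linarith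

lemma tri_mk {F : PY} {t s t1 s1 t2 s2 t3 s3 u1 u2 u3 g : ℝ} (hg : g ≠ 0)
    (h : ∀ x, F.evalEval x (t * x + s) =
      g * ((t * x + s - (t1 * x + s1)) * (t * x + s - (t2 * x + s2)) * (t * x + s - (t3 * x + s3))))
    (n1 : t ≠ t1) (n2 : t ≠ t2) (n3 : t ≠ t3) (e1 : t * u1 + s = t1 * u1 + s1) (e2 : t * u2 + s = t2 * u2 + s2)
    (e3 : t * u3 + s = t3 * u3 + s3) : TriC F t s u1 u2 u3 := by
  refine ⟨g * ((t - t1) * (t - t2) * (t - t3)), mul_ne_zero hg (mul_ne_zero (mul_ne_zero (sub_ne_zero.2 n1)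
    (sub_ne_zero.2 n2)) (sub_ne_zero.2 n3)), fun x => ?_⟩
  rw [h]
  have f1 : t * x + s - (t1 * x + s1) = (t - t1) * (x - u1) := by linarith
  have f2 : t * x + s - (t2 * x + s2) = (t - t2) * (x - u2) := by linarith
  have f3 : t * x + s - (t3 * x + s3) = (t - t3) * (x - u3) := by linarith
  rw [f1, f2, f3]; ring

lemma irr_not_lin {F : PY} (hF : Irreducible F) (dF : td F = 3) (t s : ℝ) : ¬ lin t s ∣ F := by
  rintro ⟨G, rfl⟩
  have hG : G ≠ 0 := by rintro rfl; exact hF.ne_zero (by simp)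
  rw [td_mul (lin_ne _ _) hG, td_lin] at dF
  rcases hF.isUnit_or_isUnit rfl with h | h
  · exact (lin_irr t s).not_isUnit h
  · obtain ⟨H, hH⟩ := h.exists_right_inv
    have hH0 : H ≠ 0 := by rintro rfl; simp at hH
    have := td_mul hG hH0
    rw [hH] at this
    have h1 : td (1 : PY) = 0 := by have := td_sc 1; rwa [sc, C_1, C_1] at this
    omega

lemma no4 {F : PY} (hF : Irreducible F) (dF : td F = 3) {t s x1 x2 x3 x4 : ℝ}
    (hd : [x1, x2, x3, x4].Nodup) (h : ∀ x ∈ [x1, x2, x3, x4], F.evalEval x (t * x + s) = 0) : False := by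
  refine irr_not_lin hF dF t s (line_dvd ([x1, x2, x3, x4].toFinset) ?_ (fun x hx => h x (by simpa using hx)))
  rw [List.toFinset_card_of_nodup hd, dF]; simp

lemma comb_ne {F : PY} (hF : Irreducible F) (dF : td F = 3) {t1 s1 t2 s2 t3 s3 t4 s4 t5 s5 t6 s6 α β : ℝ}
    (h : F = sc α * (lin t1 s1 * lin t2 s2 * lin t3 s3) + sc β * (lin t4 s4 * lin t5 s5 * lin t6 s6)) :
    α ≠ 0 ∧ β ≠ 0 := by
  constructor
  · rintro rfl
    exact irr_not_lin hF dF t4 s4 ⟨sc β * (lin t5 s5 * lin t6 s6), by rw [h, sc, C_0, C_0]; ring⟩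
  · rintro rfl
    exact irr_not_lin hF dF t1 s1 ⟨sc α * (lin t2 s2 * lin t3 s3), by rw [h, show sc 0 = 0 by rw [sc, C_0, C_0]]; ring⟩

/-- a connecting line -/
def Con (X : Fr) (f : Fn) (t s : ℝ) : Prop :=
  ∃ u ∈ X, ∃ v ∈ X, u ≠ v ∧ f u = t * u + s ∧ f v = t * v + s

/-- distinct connecting lines are not parallel -/
def NoPar (X : Fr) (f : Fn) : Prop := ∀ t s s', Con X f t s → Con X f t s' → s = s'

lemma grid_tri {F : PY} (hF : Irreducible F) (dF : td F = 3) (np : NoPar X f)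
    {u1 u2 v1 v2 p p' b' b'' t s t' s' : ℝ}
    (hd : [u1, u2, v1, v2, p, p', b', b''].Nodup)
    (r2 : Col3 X f p b' v2) (r3 : Col3 X f b'' p' v1) (k1 : Col3 X f u1 p b'') (k2 : Col3 X f u2 b' p')
    (hu1 : f u1 = t * u1 + s) (hu2 : f u2 = t * u2 + s) (hv1 : f v1 = t' * v1 + s') (hv2 : f v2 = t' * v2 + s')
    (hv : ∀ x ∈ [u1, u2, v1, v2, p, p', b', b''], F.evalEval x (f x) = 0) :
    t ≠ t' ∧ ∃ c, TriC F t s u1 u2 c ∧ TriC F t' s' v1 v2 c ∧ t * c + s = t' * c + s' := by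
  obtain ⟨_, _, _, t2, s2, h2⟩ := r2
  obtain ⟨_, _, _, t3, s3, h3⟩ := r3
  obtain ⟨_, _, _, t4, s4, h4⟩ := k1
  obtain ⟨_, _, _, t5, s5, h5⟩ := k2
  have hd2 := List.nodup_reverse.2 hd
  simp only [List.reverse_cons, List.reverse_nil, List.nil_append, List.cons_append, nodup_cons,
    List.mem_cons, not_or, not_mem_nil, not_false_eq_true, and_true, nodup_nil] at hd hd2
  simp only [List.mem_cons, not_mem_nil, or_false, forall_eq_or_imp, forall_eq] at hv
  have e : ∀ t s x, (lin t s).evalEval x (f x) = 0 ↔ f x = t * x + s := by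
    intro t s x; rw [ev_lin, sub_eq_zero]
  have w2 : ∀ x, x = p ∨ x = b' ∨ x = v2 → x ∈ X ∧ f x = t2 * x + s2 := fun x h => (h2 x).2 h
  have w3 : ∀ x, x = b'' ∨ x = p' ∨ x = v1 → x ∈ X ∧ f x = t3 * x + s3 := fun x h => (h3 x).2 h
  have w4 : ∀ x, x = u1 ∨ x = p ∨ x = b'' → x ∈ X ∧ f x = t4 * x + s4 := fun x h => (h4 x).2 h
  have w5 : ∀ x, x = u2 ∨ x = b' ∨ x = p' → x ∈ X ∧ f x = t5 * x + s5 := fun x h => (h5 x).2 h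
  have mu1 := (w4 u1 (by simp)).1; have mu2 := (w5 u2 (by simp)).1
  have mv1 := (w3 v1 (by simp)).1; have mv2 := (w2 v2 (by simp)).1
  have mp := (w2 p (by simp)).1; have mp' := (w3 p' (by simp)).1
  have mb' := (w2 b' (by simp)).1; have mb'' := (w3 b'' (by simp)).1
  have n2 : ∀ x ∈ X, ¬ (x = p ∨ x = b' ∨ x = v2) → f x ≠ t2 * x + s2 := fun x hx hn h => hn ((h2 x).1 ⟨hx, h⟩)
  have n3 : ∀ x ∈ X, ¬ (x = b'' ∨ x = p' ∨ x = v1) → f x ≠ t3 * x + s3 := fun x hx hn h => hn ((h3 x).1 ⟨hx, h⟩)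
  have n4 : ∀ x ∈ X, ¬ (x = u1 ∨ x = p ∨ x = b'') → f x ≠ t4 * x + s4 := fun x hx hn h => hn ((h4 x).1 ⟨hx, h⟩)
  have n5 : ∀ x ∈ X, ¬ (x = u2 ∨ x = b' ∨ x = p') → f x ≠ t5 * x + s5 := fun x hx hn h => hn ((h5 x).1 ⟨hx, h⟩)
  have C1 : Con X f t s := ⟨u1, mu1, u2, mu2, by simp [hd, hd2], hu1, hu2⟩
  have C6 : Con X f t' s' := ⟨v1, mv1, v2, mv2, by simp [hd, hd2], hv1, hv2⟩
  have C2 : Con X f t2 s2 := ⟨p, mp, b', mb', by simp [hd, hd2], (w2 _ (by simp)).2, (w2 _ (by simp)).2⟩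
  have C3 : Con X f t3 s3 := ⟨p', mp', b'', mb'', by simp [hd, hd2], (w3 _ (by simp)).2, (w3 _ (by simp)).2⟩
  have C4 : Con X f t4 s4 := ⟨p, mp, b'', mb'', by simp [hd, hd2], (w4 _ (by simp)).2, (w4 _ (by simp)).2⟩
  have C5 : Con X f t5 s5 := ⟨p', mp', b', mb', by simp [hd, hd2], (w5 _ (by simp)).2, (w5 _ (by simp)).2⟩
  -- slopes differ
  have htt : t ≠ t' := by
    rintro rfl
    have := np _ _ _ C1 C6
    subst this
    refine no4 hF dF (t := t) (s := s) (x1 := u1) (x2 := u2) (x3 := v1) (x4 := v2) ?_ ?_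
    · simp only [nodup_cons, List.mem_cons, not_or, not_mem_nil, not_false_eq_true, and_true,
        nodup_nil]; simp [hd, hd2]
    · simp only [List.mem_cons, not_mem_nil, or_false, forall_eq_or_imp, forall_eq]
      rw [← hu1, ← hu2, ← hv1, ← hv2]; simp only [hv, and_self]
  have t14 : t ≠ t4 := by
    rintro rfl
    have := np _ _ _ C1 C4; subst this
    exact n4 u2 mu2 (by simp [hd, hd2]) hu2
  have t15 : t ≠ t5 := by
    rintro rfl
    have := np _ _ _ C1 C5; subst this
    exact n5 u1 mu1 (by simp [hd, hd2]) hu1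
  have t62 : t' ≠ t2 := by
    rintro rfl
    have := np _ _ _ C6 C2; subst this
    exact n2 v1 mv1 (by simp [hd, hd2]) hv1
  have t63 : t' ≠ t3 := by
    rintro rfl
    have := np _ _ _ C6 C3; subst this
    exact n3 v2 mv2 (by simp [hd, hd2]) hv2
  obtain ⟨α, β, hab⟩ := CB (F := F) (M := lin t4 s4 * lin t5 s5 * lin t' s') dF.le (td_lin3 _ _ _ _ _ _) (f := f)
    (t1 := t2) (c1 := s2) (t2 := t3) (c2 := s3) (t3 := t) (c3 := s) (x1 := p) (x2 := b') (x3 := v2)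
    (y1 := b'') (y2 := p') (y3 := v1) (z1 := u1) (z2 := u2) ⟨by simp [hd, hd2], by simp [hd, hd2], by simp [hd, hd2]⟩
    ⟨by simp [hd, hd2], by simp [hd, hd2], by simp [hd, hd2]⟩ (by simp [hd, hd2]) (by
      rintro x hx
      refine ⟨(w2 x hx).2, by rcases hx with rfl | rfl | rfl <;> simp only [hv], ?_⟩
      rw [evalEval_mul, evalEval_mul, mul_eq_zero, mul_eq_zero, e, e, e]
      rcases hx with rfl | rfl | rfl
      · exact Or.inl (Or.inl (w4 _ (by simp)).2)
      · exact Or.inl (Or.inr (w5 _ (by simp)).2)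
      · exact Or.inr hv2) (by
      rintro x hx
      refine ⟨(w3 x hx).2, n2 x (w3 x hx).1 (by rcases hx with rfl | rfl | rfl <;> simp [hd, hd2]),
        by rcases hx with rfl | rfl | rfl <;> simp only [hv], ?_⟩
      rw [evalEval_mul, evalEval_mul, mul_eq_zero, mul_eq_zero, e, e, e]
      rcases hx with rfl | rfl | rfl
      · exact Or.inl (Or.inl (w4 _ (by simp)).2)
      · exact Or.inl (Or.inr (w5 _ (by simp)).2)
      · exact Or.inr hv1) (by
      rintro x (rfl | rfl)
      · refine ⟨hu1, n2 _ mu1 (by simp [hd, hd2]), n3 _ mu1 (by simp [hd, hd2]), by simp only [hv], ?_⟩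
        rw [evalEval_mul, evalEval_mul, mul_eq_zero, mul_eq_zero, e, e, e]
        exact Or.inl (Or.inl (w4 _ (by simp)).2)
      · refine ⟨hu2, n2 _ mu2 (by simp [hd, hd2]), n3 _ mu2 (by simp [hd, hd2]), by simp only [hv], ?_⟩
        rw [evalEval_mul, evalEval_mul, mul_eq_zero, mul_eq_zero, e, e, e]
        exact Or.inl (Or.inr (w5 _ (by simp)).2)) (by
      intro hdv
      rcases (lin_prime _ _).dvd_or_dvd hdv with hdv | hdv
      · rcases (lin_prime _ _).dvd_or_dvd hdv with hdv | hdv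
        · obtain ⟨rfl, rfl⟩ := lin_dvd_lin hdv
          exact n4 b' mb' (by simp [hd, hd2]) (w2 _ (by simp)).2
        · obtain ⟨rfl, rfl⟩ := lin_dvd_lin hdv
          exact n5 p mp (by simp [hd, hd2]) (w2 _ (by simp)).2
      · obtain ⟨rfl, rfl⟩ := lin_dvd_lin hdv
        exact n2 v1 mv1 (by simp [hd, hd2]) hv1)
  obtain ⟨ha, hb⟩ := comb_ne hF dF hab
  have hs : t - t' ≠ 0 := sub_ne_zero.2 htt
  have hc : t * ((s' - s) / (t - t')) + s = t' * ((s' - s) / (t - t')) + s' := by field_simp; ring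
  refine ⟨htt, (s' - s) / (t - t'), ?_, ?_, hc⟩
  · refine tri_mk ha (t1 := t4) (s1 := s4) (t2 := t5) (s2 := s5) (t3 := t') (s3 := s') (fun x => ?_) t14 t15 htt
      (by rw [← hu1]; exact (w4 _ (by simp)).2) (by rw [← hu2]; exact (w5 _ (by simp)).2) hc
    rw [hab]
    simp only [evalEval_add, evalEval_mul, ev_lin, ev_sc]
    ring
  · refine tri_mk hb (t1 := t3) (s1 := s3) (t2 := t2) (s2 := s2) (t3 := t) (s3 := s) (fun x => ?_) t63 t62 htt.symm
      (by rw [← hv1]; exact (w3 _ (by simp)).2) (by rw [← hv2]; exact (w2 _ (by simp)).2) hc.symm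
    rw [hab]
    simp only [evalEval_add, evalEval_mul, ev_lin, ev_sc]
    ring

lemma grid_tan {F : PY} (hF : Irreducible F) (dF : td F = 3) (np : NoPar X f)
    {u1 u2 w c p p' b' b'' t s t' s' : ℝ}
    (hd : [u1, u2, w, c, p, p', b', b''].Nodup)
    (r2 : Col3 X f p b' w) (r3 : Col3 X f b'' p' w) (k1 : Col3 X f u1 p b'') (k2 : Col3 X f u2 b' p')
    (hT : TriC F t s u1 u2 c) (hcX : c ∈ X)
    (hu1 : f u1 = t * u1 + s) (hu2 : f u2 = t * u2 + s) (hc : f c = t * c + s)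
    (hw' : f w = t' * w + s') (hc' : f c = t' * c + s')
    (hv : ∀ x ∈ [u1, u2, w, c, p, p', b', b''], F.evalEval x (f x) = 0) :
    TriC F t' s' w w c := by
  obtain ⟨_, _, _, t2, s2, h2⟩ := r2
  obtain ⟨_, _, _, t3, s3, h3⟩ := r3
  obtain ⟨_, _, _, t4, s4, h4⟩ := k1
  obtain ⟨_, _, _, t5, s5, h5⟩ := k2
  have hd2 := List.nodup_reverse.2 hd
  simp only [List.reverse_cons, List.reverse_nil, List.nil_append, List.cons_append, nodup_cons,
    List.mem_cons, not_or, not_mem_nil, not_false_eq_true, and_true, nodup_nil] at hd hd2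
  simp only [List.mem_cons, not_mem_nil, or_false, forall_eq_or_imp, forall_eq] at hv
  have e : ∀ t s x, (lin t s).evalEval x (f x) = 0 ↔ f x = t * x + s := by
    intro t s x; rw [ev_lin, sub_eq_zero]
  have w2 : ∀ x, x = p ∨ x = b' ∨ x = w → x ∈ X ∧ f x = t2 * x + s2 := fun x h => (h2 x).2 h
  have w3 : ∀ x, x = b'' ∨ x = p' ∨ x = w → x ∈ X ∧ f x = t3 * x + s3 := fun x h => (h3 x).2 h
  have w4 : ∀ x, x = u1 ∨ x = p ∨ x = b'' → x ∈ X ∧ f x = t4 * x + s4 := fun x h => (h4 x).2 h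
  have w5 : ∀ x, x = u2 ∨ x = b' ∨ x = p' → x ∈ X ∧ f x = t5 * x + s5 := fun x h => (h5 x).2 h
  have mu1 := (w4 u1 (by simp)).1; have mu2 := (w5 u2 (by simp)).1
  have mw := (w3 w (by simp)).1
  have mp := (w2 p (by simp)).1; have mp' := (w3 p' (by simp)).1
  have mb' := (w2 b' (by simp)).1; have mb'' := (w3 b'' (by simp)).1
  have n2 : ∀ x ∈ X, ¬ (x = p ∨ x = b' ∨ x = w) → f x ≠ t2 * x + s2 := fun x hx hn h => hn ((h2 x).1 ⟨hx, h⟩)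
  have n3 : ∀ x ∈ X, ¬ (x = b'' ∨ x = p' ∨ x = w) → f x ≠ t3 * x + s3 := fun x hx hn h => hn ((h3 x).1 ⟨hx, h⟩)
  have n4 : ∀ x ∈ X, ¬ (x = u1 ∨ x = p ∨ x = b'') → f x ≠ t4 * x + s4 := fun x hx hn h => hn ((h4 x).1 ⟨hx, h⟩)
  have n5 : ∀ x ∈ X, ¬ (x = u2 ∨ x = b' ∨ x = p') → f x ≠ t5 * x + s5 := fun x hx hn h => hn ((h5 x).1 ⟨hx, h⟩)
  have n1 : ∀ x, F.evalEval x (f x) = 0 → ¬ (x = u1 ∨ x = u2 ∨ x = c) → f x ≠ t * x + s := by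
    intro x hx hn h
    rw [h] at hx
    exact hn (hT.root hx)
  have C1 : Con X f t s := ⟨u1, mu1, u2, mu2, by simp [hd, hd2], hu1, hu2⟩
  have C6 : Con X f t' s' := ⟨w, mw, c, hcX, by simp [hd, hd2], hw', hc'⟩
  have C2 : Con X f t2 s2 := ⟨p, mp, b', mb', by simp [hd, hd2], (w2 _ (by simp)).2, (w2 _ (by simp)).2⟩
  have C3 : Con X f t3 s3 := ⟨p', mp', b'', mb'', by simp [hd, hd2], (w3 _ (by simp)).2, (w3 _ (by simp)).2⟩
  have t61 : t' ≠ t := by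
    rintro rfl
    have := np _ _ _ C1 C6; subst this
    exact n1 w (by simp only [hv]) (by simp [hd, hd2]) hw'
  have t62 : t' ≠ t2 := by
    rintro rfl
    have := np _ _ _ C6 C2; subst this
    exact n2 c hcX (by simp [hd, hd2]) hc'
  have t63 : t' ≠ t3 := by
    rintro rfl
    have := np _ _ _ C6 C3; subst this
    exact n3 c hcX (by simp [hd, hd2]) hc'
  obtain ⟨α, β, hab⟩ := CB (F := F) (M := lin t4 s4 * lin t5 s5 * lin t' s') dF.le (td_lin3 _ _ _ _ _ _) (f := f)
    (t1 := t) (c1 := s) (t2 := t2) (c2 := s2) (t3 := t3) (c3 := s3) (x1 := u1) (x2 := u2) (x3 := c)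
    (y1 := p) (y2 := b') (y3 := w) (z1 := b'') (z2 := p') ⟨by simp [hd, hd2], by simp [hd, hd2], by simp [hd, hd2]⟩
    ⟨by simp [hd, hd2], by simp [hd, hd2], by simp [hd, hd2]⟩ (by simp [hd, hd2]) (by
      rintro x hx
      refine ⟨by rcases hx with rfl | rfl | rfl <;> assumption, by rcases hx with rfl | rfl | rfl <;> simp only [hv], ?_⟩
      rw [evalEval_mul, evalEval_mul, mul_eq_zero, mul_eq_zero, e, e, e]
      rcases hx with rfl | rfl | rfl
      · exact Or.inl (Or.inl (w4 _ (by simp)).2)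
      · exact Or.inl (Or.inr (w5 _ (by simp)).2)
      · exact Or.inr hc') (by
      rintro x hx
      have hFx : F.evalEval x (f x) = 0 := by rcases hx with rfl | rfl | rfl <;> simp only [hv]
      refine ⟨(w2 x hx).2, n1 x hFx (by rcases hx with rfl | rfl | rfl <;> simp [hd, hd2]), hFx, ?_⟩
      rw [evalEval_mul, evalEval_mul, mul_eq_zero, mul_eq_zero, e, e, e]
      rcases hx with rfl | rfl | rfl
      · exact Or.inl (Or.inl (w4 _ (by simp)).2)
      · exact Or.inl (Or.inr (w5 _ (by simp)).2)
      · exact Or.inr hw') (by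
      rintro x (rfl | rfl)
      · refine ⟨(w3 _ (by simp)).2, n1 _ (by simp only [hv]) (by simp [hd, hd2]), n2 _ mb'' (by simp [hd, hd2]), by simp only [hv], ?_⟩
        rw [evalEval_mul, evalEval_mul, mul_eq_zero, mul_eq_zero, e, e, e]
        exact Or.inl (Or.inl (w4 _ (by simp)).2)
      · refine ⟨(w3 _ (by simp)).2, n1 _ (by simp only [hv]) (by simp [hd, hd2]), n2 _ mp' (by simp [hd, hd2]), by simp only [hv], ?_⟩
        rw [evalEval_mul, evalEval_mul, mul_eq_zero, mul_eq_zero, e, e, e]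
        exact Or.inl (Or.inr (w5 _ (by simp)).2)) (by
      intro hdv
      rcases (lin_prime _ _).dvd_or_dvd hdv with hdv | hdv
      · rcases (lin_prime _ _).dvd_or_dvd hdv with hdv | hdv
        · obtain ⟨rfl, rfl⟩ := lin_dvd_lin hdv
          exact n4 u2 mu2 (by simp [hd, hd2]) hu2
        · obtain ⟨rfl, rfl⟩ := lin_dvd_lin hdv
          exact n5 u1 mu1 (by simp [hd, hd2]) hu1
      · obtain ⟨rfl, rfl⟩ := lin_dvd_lin hdv
        exact t61 rfl)
  obtain ⟨ha, hb⟩ := comb_ne hF dF hab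
  refine tri_mk hb (t1 := t2) (s1 := s2) (t2 := t3) (s2 := s3) (t3 := t) (s3 := s) (fun x => ?_) t62 t63 t61
      (by rw [← hw']; exact (w2 _ (by simp)).2) (by rw [← hw']; exact (w3 _ (by simp)).2)
      (by rw [← hc', ← hc])
  rw [hab]
  simp only [evalEval_add, evalEval_mul, ev_lin, ev_sc]
  ring

end GT

namespace GT
open Polynomial
variable {X : Fr} {f : Fn}

lemma Col3.mem {u v w : ℝ} (h : Col3 X f u v w) : u ∈ X ∧ v ∈ X ∧ w ∈ X := by
  obtain ⟨_, _, _, t, c, h⟩ := h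
  exact ⟨((h u).2 (by simp)).1, ((h v).2 (by simp)).1, ((h w).2 (by simp)).1⟩

/-- slope of the line through two points of the graph -/
def slo (f : Fn) (x y : ℝ) : ℝ := (f y - f x) / (y - x)
/-- intercept of the line through two points of the graph -/
def icp (f : Fn) (x y : ℝ) : ℝ := f x - slo f x y * x

lemma slo_left (x y : ℝ) : f x = slo f x y * x + icp f x y := by unfold icp; ring
lemma slo_right {x y : ℝ} (h : x ≠ y) : f y = slo f x y * y + icp f x y := by
  have : y - x ≠ 0 := sub_ne_zero.2 h.symm
  unfold icp slo; field_simp; ring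

lemma slo_uniq {x y t s : ℝ} (h : x ≠ y) (h1 : f x = t * x + s) (h2 : f y = t * y + s) :
    slo f x y = t ∧ icp f x y = s := by
  have : y - x ≠ 0 := sub_ne_zero.2 h.symm
  have e : slo f x y = t := by unfold slo; rw [h1, h2]; field_simp; ring
  exact ⟨e, by unfold icp; rw [e, h1]; ring⟩

/-- a window of a run on a cubic -/
structure Win (X : Fr) (f : Fn) (F : PY) (q p : ℝ) (L : ℕ) (a b : ℕ → ℝ) : Prop where
  c0 : ∀ i, i < L → Col3 X f q (a i) (b i)
  c1 : ∀ i, i + 1 < L → Col3 X f p (a i) (b (i + 1))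
  aa : ∀ i j, i < L → j < L → i ≠ j → a i ≠ a j
  bb : ∀ i j, i < L → j < L → i ≠ j → b i ≠ b j
  ab : ∀ i j, i < L → j < L → a i ≠ b j
  pa : ∀ i, i < L → p ≠ a i
  pb : ∀ i, i < L → p ≠ b i
  pq : p ≠ q
  Fq : F.evalEval q (f q) = 0
  Fp : F.evalEval p (f p) = 0
  Fa : ∀ i, i < L → F.evalEval (a i) (f (a i)) = 0
  Fb : ∀ i, i < L → F.evalEval (b i) (f (b i)) = 0

/-- centre of symmetry -/
structure Cen (X : Fr) (f : Fn) (F : PY) (a : ℕ → ℝ) (k r : ℕ) (c y : ℝ) : Prop where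
  tri : ∀ i, 1 ≤ i → i ≤ r → TriC F (slo f (a (k+i)) (a (k-i))) (icp f (a (k+i)) (a (k-i))) (a (k+i)) (a (k-i)) c
  thru : ∀ i, 1 ≤ i → i ≤ r → slo f (a (k+i)) (a (k-i)) * c + icp f (a (k+i)) (a (k-i)) = y
  dist : ∀ i j, 1 ≤ i → i ≤ r → 1 ≤ j → j ≤ r → i ≠ j → slo f (a (k+i)) (a (k-i)) ≠ slo f (a (k+j)) (a (k-j))

variable {F : PY} {q p : ℝ} {L : ℕ} {a b : ℕ → ℝ}

lemma Win.mem (W : Win X f F q p L a b) {i : ℕ} (hi : i < L) : a i ∈ X ∧ b i ∈ X :=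
  ⟨(W.c0 i hi).mem.2.1, (W.c0 i hi).mem.2.2⟩

lemma Win.step (W : Win X f F q p L a b) (hF : Irreducible F) (dF : td F = 3) (np : NoPar X f) {k i : ℕ}
    (h2 : 2 ≤ i) (hik : i ≤ k) (hL : k + i + 1 < L) :
    ∃ c, TriC F (slo f (a (k+i)) (a (k-i))) (icp f (a (k+i)) (a (k-i))) (a (k+i)) (a (k-i)) c ∧
      TriC F (slo f (a (k+(i-1))) (a (k-(i-1)))) (icp f (a (k+(i-1))) (a (k-(i-1)))) (a (k+(i-1))) (a (k-(i-1))) c ∧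
      slo f (a (k+i)) (a (k-i)) * c + icp f (a (k+i)) (a (k-i)) =
      slo f (a (k+(i-1))) (a (k-(i-1))) * c + icp f (a (k+(i-1))) (a (k-(i-1))) := by
  have r2 : Col3 X f q (b (k-(i-1))) (a (k-(i-1))) := (W.c0 _ (by omega)).perm2
  have r3 : Col3 X f (b (k+i)) p (a (k+(i-1))) := by
    have := (W.c1 (k+(i-1)) (by omega)).perm1.perm1
    rwa [show k + (i-1) + 1 = k + i by omega] at this
  have k1 : Col3 X f (a (k+i)) q (b (k+i)) := (W.c0 (k+i) (by omega)).perm1.perm2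
  have k2 : Col3 X f (a (k-i)) (b (k-(i-1))) p := by
    have := (W.c1 (k-i) (by omega)).perm1
    rwa [show k - i + 1 = k - (i-1) by omega] at this
  have q1 := fun i hi => (W.c0 i hi).1
  have q2 := fun i hi => (W.c0 i hi).2.1
  have d1 : a (k+i) ≠ a (k-i) := W.aa _ _ (by omega) (by omega) (by omega)
  have d2 : a (k+(i-1)) ≠ a (k-(i-1)) := W.aa _ _ (by omega) (by omega) (by omega)
  refine (grid_tri hF dF np (u1 := a (k+i)) (u2 := a (k-i)) (v1 := a (k+(i-1))) (v2 := a (k-(i-1)))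
    (p := q) (p' := p) (b' := b (k-(i-1))) (b'' := b (k+i)) ?_ r2 r3 k1 k2 (slo_left _ _) (slo_right d1)
    (slo_left _ _) (slo_right d2) ?_).2
  · simp only [nodup_cons, List.mem_cons, not_or, not_mem_nil, not_false_eq_true, and_true,
      nodup_nil]
    refine ⟨⟨d1, W.aa _ _ ?_ ?_ ?_, W.aa _ _ ?_ ?_ ?_, (q1 _ ?_).symm, (W.pa _ ?_).symm, W.ab _ _ ?_ ?_, W.ab _ _ ?_ ?_⟩,
      ⟨W.aa _ _ ?_ ?_ ?_, W.aa _ _ ?_ ?_ ?_, (q1 _ ?_).symm, (W.pa _ ?_).symm, W.ab _ _ ?_ ?_, W.ab _ _ ?_ ?_⟩,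
      ⟨d2, (q1 _ ?_).symm, (W.pa _ ?_).symm, W.ab _ _ ?_ ?_, W.ab _ _ ?_ ?_⟩,
      ⟨(q1 _ ?_).symm, (W.pa _ ?_).symm, W.ab _ _ ?_ ?_, W.ab _ _ ?_ ?_⟩,
      ⟨W.pq.symm, q2 _ ?_, q2 _ ?_⟩, ⟨W.pb _ ?_, W.pb _ ?_⟩, W.bb _ _ ?_ ?_ ?_⟩ <;> omega
  · simp only [List.mem_cons, not_mem_nil, or_false, forall_eq_or_imp, forall_eq]
    refine ⟨W.Fa _ ?_, W.Fa _ ?_, W.Fa _ ?_, W.Fa _ ?_, W.Fq, W.Fp, W.Fb _ ?_, W.Fb _ ?_⟩ <;> omega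

lemma Win.cen (W : Win X f F q p L a b) (hF : Irreducible F) (dF : td F = 3) (np : NoPar X f) {k r : ℕ}
    (h2 : 2 ≤ r) (hrk : r ≤ k) (hL : k + r + 1 < L) : ∃ c y, Cen X f F a k r c y := by
  obtain ⟨c, c2, c1, cy⟩ := W.step hF dF np (k := k) (i := 2) le_rfl (by omega) (by omega)
  have key : ∀ i, 1 ≤ i → i ≤ r → TriC F (slo f (a (k+i)) (a (k-i))) (icp f (a (k+i)) (a (k-i))) (a (k+i)) (a (k-i)) c ∧
      slo f (a (k+i)) (a (k-i)) * c + icp f (a (k+i)) (a (k-i)) =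
        slo f (a (k+1)) (a (k-1)) * c + icp f (a (k+1)) (a (k-1)) := by
    intro i hi
    induction i, hi using Nat.le_induction with
    | base => exact fun _ => ⟨c1, rfl⟩
    | succ i hi ih =>
      intro hr
      obtain ⟨i1, i2⟩ := ih (by omega)
      obtain ⟨c', d2, d1, dy⟩ := W.step hF dF np (k := k) (i := i + 1) (by omega) (by omega) (by omega)
      rw [Nat.add_sub_cancel] at d1 dy
      have := d1.uniq i1
      subst this
      exact ⟨d2, dy.trans i2⟩
  refine ⟨c, _, fun i hi hr => (key i hi hr).1, fun i hi hr => (key i hi hr).2, fun i j hi hr hj hjr hij he => ?_⟩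
  have m : ∀ i, i ≤ r → a (k+i) ∈ X ∧ a (k-i) ∈ X := fun i hi => ⟨(W.mem (by omega)).1, (W.mem (by omega)).1⟩
  have di : a (k+i) ≠ a (k-i) := W.aa _ _ (by omega) (by omega) (by omega)
  have dj : a (k+j) ≠ a (k-j) := W.aa _ _ (by omega) (by omega) (by omega)
  have hcj : Con X f (slo f (a (k+j)) (a (k-j))) (icp f (a (k+j)) (a (k-j))) :=
    ⟨_, (m j hjr).1, _, (m j hjr).2, dj, slo_left _ _, slo_right dj⟩
  have hci : Con X f (slo f (a (k+i)) (a (k-i))) (icp f (a (k+i)) (a (k-i))) :=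
    ⟨_, (m i hr).1, _, (m i hr).2, di, slo_left _ _, slo_right di⟩
  have hic := np _ _ _ hcj (he ▸ hci)
  have e1 : f (a (k+i)) = _ := slo_left _ (a (k-i))
  have e2 := slo_right (f := f) di
  rw [he, ← hic] at e1 e2
  refine no4 hF dF (t := slo f (a (k+j)) (a (k-j))) (s := icp f (a (k+j)) (a (k-j)))
    (x1 := a (k+i)) (x2 := a (k-i)) (x3 := a (k+j)) (x4 := a (k-j)) ?_ ?_
  · simp only [nodup_cons, List.mem_cons, not_or, not_mem_nil, not_false_eq_true, and_true,
      nodup_nil]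
    refine ⟨⟨di, W.aa _ _ ?_ ?_ ?_, W.aa _ _ ?_ ?_ ?_⟩, ⟨W.aa _ _ ?_ ?_ ?_, W.aa _ _ ?_ ?_ ?_⟩, dj⟩ <;> omega
  · simp only [List.mem_cons, not_mem_nil, or_false, forall_eq_or_imp, forall_eq]
    rw [← e1, ← e2, ← slo_left, ← slo_right dj]
    refine ⟨W.Fa _ ?_, W.Fa _ ?_, W.Fa _ ?_, W.Fa _ ?_⟩ <;> omega

/-- type 1: centre not in the set -/
lemma Win.type1 (W : Win X f F q p L a b) {k r : ℕ} {c y : ℝ}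
    (hrk : r ≤ k) (hL : k + r + 1 < L) (hC : Cen X f F a k r c y) (hn : ¬ (c ∈ X ∧ f c = y)) (e : ℕ)
    (hE : (X.filter (fun x => F.evalEval x (f x) ≠ 0)).card ≤ e) (h1 : 1 ≤ r) :
    r - e ≤ ((Icc 1 r).filter (fun i => ({a (k+i), a (k-i)} : Fr) ∈ ordPairs X f)).card := by
  classical
  set I := (Icc 1 r).filter (fun i => ({a (k+i), a (k-i)} : Fr) ∈ ordPairs X f)
  have hFc : F.evalEval c y = 0 := by
    obtain ⟨l, _, h⟩ := hC.tri 1 le_rfl h1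
    rw [← hC.thru 1 le_rfl h1, h]; ring
  have key : ∀ i ∈ Icc 1 r \ I, ∃ x ∈ X.filter (fun x => F.evalEval x (f x) ≠ 0),
      f x = slo f (a (k+i)) (a (k-i)) * x + icp f (a (k+i)) (a (k-i)) := by
    intro i hi
    by_contra hc
    push Not at hc
    rw [mem_sdiff, mem_Icc] at hi
    refine hi.2 (mem_filter.2 ⟨mem_Icc.2 hi.1, ?_⟩)
    have di : a (k+i) ≠ a (k-i) := W.aa _ _ (by omega) (by omega) (by omega)
    refine mem_ordPairs (W.mem (by omega)).1 (W.mem (by omega)).1 di (slo_left _ _) (slo_right di) fun x hx hxl => ?_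
    have hF0 : F.evalEval x (f x) = 0 := by
      by_contra h
      exact hc x (mem_filter.2 ⟨hx, h⟩) hxl
    rw [hxl] at hF0
    rcases (hC.tri i hi.1.1 hi.1.2).root hF0 with h | h | h
    · exact Or.inl h
    · exact Or.inr h
    · subst h
      exact absurd ⟨hx, hxl.trans (hC.thru i hi.1.1 hi.1.2)⟩ hn
  choose! g hg1 hg2 using key
  have hcard : (Icc 1 r \ I).card ≤ e := by
    refine le_trans ?_ hE
    refine card_le_card_of_injOn g (fun i hi => hg1 i hi) ?_
    intro i hi j hj hij
    by_contra hne
    have hi' := hi; have hj' := hj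
    rw [mem_coe] at hi hj
    rw [mem_coe, mem_sdiff, mem_Icc] at hi' hj'
    have hs := hC.dist i j hi'.1.1 hi'.1.2 hj'.1.1 hj'.1.2 hne
    have e1 := hg2 i hi; have e2 := hg2 j hj
    rw [← hij] at e2
    have t1 := hC.thru i hi'.1.1 hi'.1.2; have t2 := hC.thru j hj'.1.1 hj'.1.2
    have : (slo f (a (k+i)) (a (k-i)) - slo f (a (k+j)) (a (k-j))) * (g i - c) = 0 := by linarith
    rcases mul_eq_zero.1 this with h | h
    · exact hs (sub_eq_zero.1 h)
    · have h' : g i = c := sub_eq_zero.1 h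
      rw [h'] at e1
      have hgm := (mem_filter.1 (hg1 i hi)).2
      rw [h', e1, t1] at hgm
      exact hgm hFc
  have h3 : (Icc 1 r \ I).card = (Icc 1 r).card - I.card :=
    card_sdiff_of_subset (filter_subset _ _)
  rw [Nat.card_Icc] at h3
  omega

/-- type 2 centres are far apart -/
lemma Win.type2 (W : Win X f F q p L a b) (hF : Irreducible F) (dF : td F = 3) {k j r d : ℕ} {c y c' y' : ℝ}
    (hrk : r ≤ k) (hL : k + j + r + 1 < L) (hj : 3 ≤ j) (hjr : j + 1 ≤ r)
    (hC : Cen X f F a k r c y) (hC' : Cen X f F a (k + j) r c' y') (hd : d ≤ 2) (hc : c = a (k + d - 1)) (hy : f c = y)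
    (hc' : c' = a (k + j + d - 1)) (hy' : f c' = y') : False := by
  -- the line through a (k+d-1) and a (k+j+d-1)
  have l1 := hC.thru (j + d - 1) (by omega) (by omega)
  have l2 := hC'.thru (j + 1 - d) (by omega) (by omega)
  have di : a (k+(j+d-1)) ≠ a (k-(j+d-1)) := W.aa _ _ (by omega) (by omega) (by omega)
  have dj : a (k+j+(j+1-d)) ≠ a (k+j-(j+1-d)) := W.aa _ _ (by omega) (by omega) (by omega)
  set t := slo f (a (k+(j+d-1))) (a (k-(j+d-1)))
  set s := icp f (a (k+(j+d-1))) (a (k-(j+d-1)))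
  set t' := slo f (a (k+j+(j+1-d))) (a (k+j-(j+1-d)))
  set s' := icp f (a (k+j+(j+1-d))) (a (k+j-(j+1-d)))
  have e1 : f (a (k+(j+d-1))) = t * a (k+(j+d-1)) + s := slo_left _ _
  have e2 : f (a (k-(j+d-1))) = t * a (k-(j+d-1)) + s := slo_right di
  have e3 : f (a (k+j+(j+1-d))) = t' * a (k+j+(j+1-d)) + s' := slo_left _ _
  have e4 : f (a (k+j-(j+1-d))) = t' * a (k+j-(j+1-d)) + s' := slo_right dj
  rw [← hy, hc] at l1
  rw [← hy', hc'] at l2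
  rw [show k + j - (j+1-d) = k + d - 1 by omega] at e4
  rw [show k + (j+d-1) = k + j + d - 1 by omega] at e1
  have hne : a (k + d - 1) ≠ a (k + j + d - 1) := W.aa _ _ (by omega) (by omega) (by omega)
  obtain ⟨u1, u2⟩ := slo_uniq hne l1.symm e1
  obtain ⟨v1, v2⟩ := slo_uniq hne e4 l2.symm
  have ht : t' = t := v1.symm.trans u1
  have hs : s' = s := v2.symm.trans u2
  rw [ht, hs] at e3
  refine no4 hF dF (t := t) (s := s)
    (x1 := a (k+d-1)) (x2 := a (k+j+d-1)) (x3 := a (k-(j+d-1))) (x4 := a (k+j+(j+1-d))) ?_ ?_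
  · simp only [nodup_cons, List.mem_cons, not_or, not_mem_nil, not_false_eq_true, and_true,
      nodup_nil]
    refine ⟨⟨hne, W.aa _ _ ?_ ?_ ?_, W.aa _ _ ?_ ?_ ?_⟩, ⟨W.aa _ _ ?_ ?_ ?_, W.aa _ _ ?_ ?_ ?_⟩,
      W.aa _ _ ?_ ?_ ?_⟩ <;> omega
  · simp only [List.mem_cons, not_mem_nil, or_false, forall_eq_or_imp, forall_eq]
    rw [l1, ← e1, ← e2, ← e3]
    refine ⟨W.Fa _ ?_, W.Fa _ ?_, W.Fa _ ?_, W.Fa _ ?_⟩ <;> omega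

/-- the tangent at `u` meets the cubic in another point of the set -/
def Tang (X : Fr) (f : Fn) (F : PY) (u : ℝ) : Prop :=
  ∃ v ∈ X, u ≠ v ∧ ∃ t s, f u = t * u + s ∧ f v = t * v + s ∧ TriC F t s u u v

lemma Win.type3 (W : Win X f F q p L a b) (hF : Irreducible F) (dF : td F = 3) (np : NoPar X f) {k r : ℕ} {c y : ℝ}
    (h1 : 1 ≤ r) (hrk : r ≤ k) (hL : k + r + 1 < L) (hC : Cen X f F a k r c y) (hcX : c ∈ X) (hy : f c = y)
    (n0 : c ≠ a (k-1)) (n1 : c ≠ a k) (n2 : c ≠ a (k+1)) : Tang X f F (a k) := by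
  have hT := hC.tri 1 le_rfl h1
  have hth := hC.thru 1 le_rfl h1
  rw [← hy] at hth
  have d1 : a (k+1) ≠ a (k-1) := W.aa _ _ (by omega) (by omega) (by omega)
  set t := slo f (a (k+1)) (a (k-1)) with ht
  set s := icp f (a (k+1)) (a (k-1)) with hs
  have e1 : f (a (k+1)) = t * a (k+1) + s := slo_left _ _
  have e2 : f (a (k-1)) = t * a (k-1) + s := slo_right d1
  have q1 := fun i hi => (W.c0 i hi).1
  have q2 := fun i hi => (W.c0 i hi).2.1
  -- exclusion
  have excl : ∀ {u v w x : ℝ} {t s : ℝ}, Col3 X f u v w → u ≠ v → f u = t * u + s → f v = t * v + s → x ∈ X → f x = t * x + s →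
      x ≠ u → x ≠ v → x ≠ w → False := by
    intro u v w x t s h huv h1 h2 hx h3 x1 x2 x3
    obtain ⟨_, _, _, t', s', h⟩ := h
    have g1 := ((h u).2 (by simp)).2
    have g2 := ((h v).2 (by simp)).2
    obtain ⟨a1, a2⟩ := slo_uniq huv h1 h2
    obtain ⟨b1, b2⟩ := slo_uniq huv g1 g2
    have := (h x).1 ⟨hx, by rw [h3, ← a1, ← a2, b1, b2]⟩
    tauto
  have ma : ∀ i, i < L → a i ∈ X := fun i hi => (W.mem hi).1
  have x1 : c ≠ q := by
    intro h
    rw [h] at hth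
    exact excl (W.c0 (k+1) (by omega)) (q1 _ (by omega)) hth.symm e1 (ma (k-1) (by omega)) e2 (q1 _ (by omega)).symm
      d1.symm (W.ab _ _ (by omega) (by omega))
  have x2 : c ≠ p := by
    intro h
    rw [h] at hth
    exact excl (W.c1 (k+1) (by omega)) (W.pa _ (by omega)) hth.symm e1 (ma (k-1) (by omega)) e2 (W.pa _ (by omega)).symm
      d1.symm (W.ab _ _ (by omega) (by omega))
  have x3 : c ≠ b (k+1) := by
    intro h
    rw [h] at hth
    exact excl (W.c0 (k+1) (by omega)).perm1 (W.ab _ _ (by omega) (by omega)) e1 hth.symm (ma (k-1) (by omega)) e2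
      d1.symm (W.ab _ _ (by omega) (by omega)) (q1 _ (by omega)).symm
  have x4 : c ≠ b k := by
    intro h
    rw [h] at hth
    have := (W.c1 (k-1) (by omega)).perm1
    rw [show k - 1 + 1 = k by omega] at this
    exact excl this (W.ab _ _ (by omega) (by omega)) e2 hth.symm (ma (k+1) (by omega)) e1
      d1 (W.ab _ _ (by omega) (by omega)) (W.pa _ (by omega)).symm
  refine ⟨c, hcX, n1.symm, slo f (a k) c, icp f (a k) c, slo_left _ _, slo_right n1.symm, ?_⟩
  have k2 := (W.c1 (k-1) (by omega)).perm1
  rw [show k - 1 + 1 = k by omega] at k2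
  refine grid_tan hF dF np (u1 := a (k+1)) (u2 := a (k-1)) (w := a k) (c := c) (p := q) (p' := p) (b' := b k)
    (b'' := b (k+1)) (t := t) (s := s) ?_ (W.c0 k (by omega)).perm2 (W.c1 k (by omega)).perm1.perm1
    (W.c0 (k+1) (by omega)).perm1.perm2 k2 hT hcX e1 e2 hth.symm
    (slo_left _ _) (slo_right n1.symm) ?_
  · simp only [nodup_cons, List.mem_cons, not_or, not_mem_nil, not_false_eq_true, and_true,
      nodup_nil]
    refine ⟨⟨d1, W.aa _ _ ?_ ?_ ?_, n2.symm, (q1 _ ?_).symm, (W.pa _ ?_).symm, W.ab _ _ ?_ ?_, W.ab _ _ ?_ ?_⟩,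
      ⟨W.aa _ _ ?_ ?_ ?_, n0.symm, (q1 _ ?_).symm, (W.pa _ ?_).symm, W.ab _ _ ?_ ?_, W.ab _ _ ?_ ?_⟩,
      ⟨n1.symm, (q1 _ ?_).symm, (W.pa _ ?_).symm, W.ab _ _ ?_ ?_, W.ab _ _ ?_ ?_⟩,
      ⟨x1, x2, x4, x3⟩,
      ⟨W.pq.symm, q2 _ ?_, q2 _ ?_⟩, ⟨W.pb _ ?_, W.pb _ ?_⟩, W.bb _ _ ?_ ?_ ?_⟩ <;> omega
  · simp only [List.mem_cons, not_mem_nil, or_false, forall_eq_or_imp, forall_eq]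
    refine ⟨W.Fa _ ?_, W.Fa _ ?_, W.Fa _ ?_, ?_, W.Fq, W.Fp, W.Fb _ ?_, W.Fb _ ?_⟩ <;> try omega
    rw [← hth]
    obtain ⟨l, _, h⟩ := hT
    rw [h]; ring

end GT

namespace GT
open Polynomial
variable {X : Fr} {f : Fn}
variable {F : PY} {q p : ℝ} {L : ℕ} {a b : ℕ → ℝ}

lemma Win.L_le (W : Win X f F q p L a b) : L ≤ X.card := by
  rw [← card_range L]
  refine card_le_card_of_injOn a (fun i hi => (W.mem (mem_range.1 hi)).1) ?_
  intro i hi j hj hij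
  by_contra h
  exact W.aa i j (mem_range.1 hi) (mem_range.1 hj) h hij

lemma Win.pair_inj (W : Win X f F q p L a b) {i j i' j' : ℕ} (h1 : j < i) (h2 : i < L) (h1' : j' < i') (h2' : i' < L)
    (h : ({a i, a j} : Fr) = {a i', a j'}) : i = i' ∧ j = j' := by
  have inj : ∀ u v, u < L → v < L → a u = a v → u = v := fun u v hu hv e => by
    by_contra hh; exact W.aa u v hu hv hh e
  have m1 : a i ∈ ({a i', a j'} : Fr) := h ▸ by simp
  have m2 : a j ∈ ({a i', a j'} : Fr) := h ▸ by simp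
  have m3 : a i' ∈ ({a i, a j} : Fr) := h ▸ by simp
  simp only [mem_insert, mem_singleton] at m1 m2 m3
  have c1 : i = i' ∨ i = j' := m1.imp (inj _ _ h2 h2') (inj _ _ h2 (by omega))
  have c2 : j = i' ∨ j = j' := m2.imp (inj _ _ (by omega) h2') (inj _ _ (by omega) (by omega))
  have c3 : i' = i ∨ i' = j := m3.imp (inj _ _ h2' h2) (inj _ _ h2' (by omega))
  omega

open Classical in
/-- indices in the bulk of a window without tangency -/
def badk (X : Fr) (f : Fn) (F : PY) (a : ℕ → ℝ) (L r : ℕ) : Finset ℕ :=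
  (range L).filter (fun k => 3 * r ≤ k ∧ k + 3 * r + 1 < L ∧ ¬ Tang X f F (a k))

lemma Win.count (W : Win X f F q p L a b) (hF : Irreducible F) (dF : td F = 3) (np : NoPar X f) {r : ℕ}
    (hE : (X.filter (fun x => F.evalEval x (f x) ≠ 0)).card ≤ r) (hr : 1 ≤ r) :
    (badk X f F a L r).card * r ≤ N2 X f + 3 * X.card := by
  classical
  set Bd := badk X f F a L r with hBd
  have hb : ∀ k ∈ Bd, 3 * r ≤ k ∧ k + 3 * r + 1 < L ∧ ¬ Tang X f F (a k) := fun k hk => by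
    rw [hBd, badk, mem_filter] at hk; exact hk.2
  have hc : ∀ k ∈ Bd, ∃ c y, Cen X f F a k (3*r) c y := fun k hk =>
    W.cen hF dF np (by omega) (hb k hk).1 (hb k hk).2.1
  choose! c y hcy using hc
  set B1 := Bd.filter (fun k => ¬ (c k ∈ X ∧ f (c k) = y k)) with hB1
  let B2 : ℕ → Finset ℕ := fun d => Bd.filter (fun k => f (c k) = y k ∧ c k = a (k + d - 1))
  have hsub : Bd ⊆ B1 ∪ B2 0 ∪ B2 1 ∪ B2 2 := by
    intro k hk
    by_contra hn
    simp only [B2, hB1, mem_union, mem_filter, hk, true_and, not_or, not_not] at hn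
    obtain ⟨⟨⟨h1, h2⟩, h3⟩, h4⟩ := hn
    obtain ⟨b1, b2, b3⟩ := hb k hk
    refine b3 (W.type3 hF dF np (by omega) b1 b2 (hcy k hk) h1.1 h1.2 ?_ ?_ ?_)
    · exact fun h => h2 ⟨h1.2, h⟩
    · exact fun h => h3 ⟨h1.2, h⟩
    · exact fun h => h4 ⟨h1.2, h⟩
  have n1 : B1.card * r ≤ N2 X f := by
    have : (B1.sigma fun k => (Icc 1 (3*r)).filter (fun i => ({a (k+i), a (k-i)} : Fr) ∈ ordPairs X f)).card
        ≤ N2 X f := by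
      refine card_le_card_of_injOn (fun z => ({a (z.1+z.2), a (z.1-z.2)} : Fr)) ?_ ?_
      · intro z hz
        simp only [mem_coe, mem_sigma, mem_filter] at hz
        exact hz.2.2
      · rintro ⟨k, i⟩ hz ⟨k', i'⟩ hz' he
        simp only [mem_coe, mem_sigma, mem_filter, mem_Icc, hB1] at hz hz'
        have b1 := hb k hz.1.1
        have b1' := hb k' hz'.1.1
        dsimp only at he
        have := W.pair_inj (by omega) (by omega) (by omega) (by omega) he
        have e1 : k = k' := by omega
        have e2 : i = i' := by omega
        subst e1; subst e2; rfl
    refine le_trans ?_ this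
    rw [card_sigma, ← smul_eq_mul]
    refine card_nsmul_le_sum _ _ _ fun k hk => ?_
    rw [hB1, mem_filter] at hk
    have b1 := hb k hk.1
    have := W.type1 b1.1 b1.2.1 (hcy k hk.1) hk.2 r hE (by omega)
    omega
  have n2 : ∀ d, d ≤ 2 → (B2 d).card * r ≤ X.card := by
    intro d hd
    refine le_trans ?_ W.L_le
    rw [← card_range r, ← card_range L, ← card_product]
    have no : ∀ k k' i i', k ∈ B2 d → k' ∈ B2 d → i < r → k + 3 * i = k' + 3 * i' → k < k' → False := by
      intro k k' i i' hk hk' hi he hlt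
      simp only [B2, mem_filter] at hk hk'
      obtain ⟨j, rfl⟩ := Nat.exists_eq_add_of_lt hlt
      rw [show k + j + 1 = k + (j + 1) by ring] at *
      have b1 := hb _ hk.1
      have b2 := hb _ hk'.1
      exact W.type2 hF dF b1.1 (by omega) (by omega) (by omega) (hcy _ hk.1) (hcy _ hk'.1) hd hk.2.2 hk.2.1 hk'.2.2 hk'.2.1
    refine card_le_card_of_injOn (fun z => z.1 + 3 * z.2) ?_ ?_
    · rintro ⟨k, i⟩ hz
      simp only [mem_coe, mem_product, mem_range] at hz
      have := hb k (mem_filter.1 hz.1).1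
      simp only [mem_coe, mem_range]; omega
    · rintro ⟨k, i⟩ hz ⟨k', i'⟩ hz' he
      simp only [mem_coe, mem_product, mem_range] at hz hz' he
      rcases lt_trichotomy k k' with h | h | h
      · exact (no k k' i i' hz.1 hz'.1 hz.2 he h).elim
      · subst h
        have : i = i' := by omega
        subst this; rfl
      · exact (no k' k i' i hz'.1 hz.1 hz'.2 he.symm h).elim
  have hle : Bd.card ≤ B1.card + (B2 0).card + (B2 1).card + (B2 2).card := by
    refine (card_le_card hsub).trans ?_
    have u1 := card_union_le (B1 ∪ B2 0 ∪ B2 1) (B2 2)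
    have u2 := card_union_le (B1 ∪ B2 0) (B2 1)
    have u3 := card_union_le (B1) (B2 0)
    omega
  have := n2 0 (by omega); have := n2 1 (by omega); have := n2 2 (by omega)
  nlinarith [Nat.mul_le_mul_right r hle]

/-- few tangents through a point off the cubic -/
lemma polar (hF : Irreducible F) (dF : td F = 3) {e e' : ℝ} (he : F.evalEval e e' ≠ 0) (U : Fr)
    (hU : ∀ u ∈ U, ∃ t s v, f u = t * u + s ∧ e' = t * e + s ∧ TriC F t s u u v) : U.card ≤ 18 := by
  by_contra hc
  push Not at hc
  obtain ⟨c, rfl⟩ := eq_cub dF.le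
  set d : Fin 10 → ℝ := ![e * c 1 + e' * c 2, 2 * c 3 * e + c 4 * e' - c 1, c 4 * e + 2 * c 5 * e' - c 2,
    3 * c 6 * e + c 7 * e' - 2 * c 3, 2 * c 7 * e + 2 * c 8 * e' - 2 * c 4, c 8 * e + 3 * c 9 * e' - 2 * c 5,
    -3 * c 6, -3 * c 7, -3 * c 8, -3 * c 9] with hd
  have hG : ∀ x y, (cub d).evalEval x y = (c 1 + 2 * c 3 * x + c 4 * y + 3 * c 6 * x * x + 2 * c 7 * x * y + c 8 * y * y) * (e - x)
      + (c 2 + c 4 * x + 2 * c 5 * y + c 7 * x * x + 2 * c 8 * x * y + 3 * c 9 * y * y) * (e' - y) := by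
    intro x y
    rw [ev_cub]
    simp only [hd, Matrix.cons_val]
    ring
  obtain ⟨r, hr⟩ := bezout3 hF dF (td_cub d) U f (fun u hu => by
    obtain ⟨t, s, v, h1, h2, l, _, h⟩ := hU u hu
    have r0 := h u
    have r1 := h (u + 1)
    have r2 := h (u - 1)
    have r3 := h (u + 2)
    refine ⟨by rw [h1, r0]; ring, ?_⟩
    rw [hG, h1, h2]
    simp only [ev_cub] at r0 r1 r2 r3
    linear_combination (e - u) * (r1 - r2 / 3 - r3 / 6 - r0 / 2)) hc
  have h0 : (cub d).evalEval e e' = 0 := by rw [hG]; ring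
  rw [hr, evalEval_mul, ev_sc] at h0
  have hr0 : r = 0 := by
    rcases mul_eq_zero.1 h0 with h | h
    · exact h
    · exact absurd h he
  have hd0 : d = 0 := by
    by_contra h
    exact cub_ne h (by rw [hr, hr0]; simp [sc])
  have g := fun i => congrFun hd0 i
  have g1 := g 1; have g2 := g 2; have g3 := g 3; have g4 := g 4; have g5 := g 5
  have g6 := g 6; have g7 := g 7; have g8 := g 8; have g9 := g 9
  simp only [hd, Matrix.cons_val, Pi.zero_apply] at g1 g2 g3 g4 g5 g6 g7 g8 g9
  have k6 : c 6 = 0 := by linarith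
  have k7 : c 7 = 0 := by linarith
  have k8 : c 8 = 0 := by linarith
  have k9 : c 9 = 0 := by linarith
  have k3 : c 3 = 0 := by rw [k6, k7] at g3; linarith
  have k4 : c 4 = 0 := by rw [k8, k7] at g4; linarith
  have k5 : c 5 = 0 := by rw [k8, k9] at g5; linarith
  have k1 : c 1 = 0 := by rw [k3, k4] at g1; linarith
  have k2 : c 2 = 0 := by rw [k4, k5] at g2; linarith
  have : cub c = sc (c 0) := by
    simp only [cub, k1, k2, k3, k4, k5, k6, k7, k8, k9, sc]
    simp
  rw [this, td_sc] at dF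
  omega

open Classical in
/-- lower bound for `N2` from tangents -/
lemma tang_count (hF : Irreducible F) (dF : td F = 3) :
    (X.filter (fun u => Tang X f F u)).card ≤ N2 X f +
      18 * (X.filter (fun x => F.evalEval x (f x) ≠ 0)).card := by
  set T := X.filter (fun u => Tang X f F u) with hT
  set E := X.filter (fun x => F.evalEval x (f x) ≠ 0) with hE
  have hch : ∀ u ∈ T, ∃ v t s, v ∈ X ∧ u ≠ v ∧ f u = t * u + s ∧ f v = t * v + s ∧ TriC F t s u u v := by
    intro u hu
    obtain ⟨v, h1, h2, t, s, h3, h4, h5⟩ := (mem_filter.1 hu).2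
    exact ⟨v, t, s, h1, h2, h3, h4, h5⟩
  choose! v t s hv huv h1 h2 h3 using hch
  have hTX : ∀ u ∈ T, u ∈ X := fun u hu => (mem_filter.1 hu).1
  set T1 := T.filter (fun u => ∃ e ∈ E, f e = t u * e + s u) with hT1
  set T2 := T.filter (fun u => ¬ ∃ e ∈ E, f e = t u * e + s u) with hT2
  have hsum : T1.card + T2.card = T.card := card_filter_add_card_filter_not _
  have hc1 : T1.card ≤ 18 * E.card := by
    have : T1 ⊆ E.biUnion (fun e => T.filter (fun u => f e = t u * e + s u)) := by
      intro u hu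
      obtain ⟨hu, e, he, h⟩ := mem_filter.1 hu
      exact mem_biUnion.2 ⟨e, he, mem_filter.2 ⟨hu, h⟩⟩
    refine (card_le_card this).trans ?_
    rw [mul_comm]
    refine card_biUnion_le_card_mul _ _ _ fun e he => ?_
    refine polar (f := f) hF dF (mem_filter.1 he).2 _ fun u hu => ?_
    obtain ⟨hu, h⟩ := mem_filter.1 hu
    exact ⟨t u, s u, v u, h1 u hu, h, h3 u hu⟩
  have hc2 : T2.card ≤ N2 X f := by
    refine card_le_card_of_injOn (fun u => ({u, v u} : Fr)) ?_ ?_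
    · intro u hu
      obtain ⟨hu, hn⟩ := mem_filter.1 (mem_coe.1 hu)
      refine mem_ordPairs (hTX u hu) (hv u hu) (huv u hu) (h1 u hu) (h2 u hu) fun x hx hxl => ?_
      have hx0 : F.evalEval x (f x) = 0 := by
        by_contra h
        exact hn ⟨x, mem_filter.2 ⟨hx, h⟩, hxl⟩
      rw [hxl] at hx0
      rcases (h3 u hu).root hx0 with h | h | h
      · exact Or.inl h
      · exact Or.inl h
      · exact Or.inr h
    · intro u hu u' hu' he
      have hu := (mem_filter.1 (mem_coe.1 hu)).1
      have hu' := (mem_filter.1 (mem_coe.1 hu')).1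
      by_contra hne
      dsimp only at he
      have m1 : u ∈ ({u', v u'} : Fr) := he ▸ by simp
      have m2 : u' ∈ ({u, v u} : Fr) := he ▸ by simp
      simp only [mem_insert, mem_singleton, hne, Ne.symm hne, false_or] at m1 m2
      have a1 := h1 u hu
      have a2 := h2 u hu
      have a3 := h1 u' hu'
      have a4 := h2 u' hu'
      rw [← m2] at a2
      rw [← m1] at a4
      obtain ⟨x1, x2⟩ := slo_uniq hne a1 a2
      obtain ⟨y1, y2⟩ := slo_uniq hne a4 a3
      have g1 := h3 u hu
      have g2 := h3 u' hu'
      rw [← x1, ← x2] at g1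
      rw [← y1, ← y2] at g2
      exact hne (g1.dbl g2 (huv u hu))
  omega

open Classical in
/-- few non-tangent points on one run -/
lemma run_bad {t : ℕ → ℝ} {p1 pm pn : ℝ} (h : IsRun X f q L t a b p1 pm pn)
    (hF : Irreducible F) (dF : td F = 3) (np : NoPar X f) {r : ℕ}
    (hE : (X.filter (fun x => F.evalEval x (f x) ≠ 0)).card ≤ r) (hr : 1 ≤ r) :
    ((((range L).image a) ∪ ((range L).image b)).filter (fun u => ¬ Tang X f F u)).card * r
      ≤ (12 * r + 80) * r + 2 * (N2 X f + 3 * X.card) := by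
  have N := h.ne
  by_cases hL : L < r + 30
  · have : ((((range L).image a) ∪ ((range L).image b)).filter (fun u => ¬ Tang X f F u)).card ≤ 2 * L := by
      refine (card_filter_le _ _).trans ((card_union_le _ _).trans ?_)
      have c1 := card_image_le (s := range L) (f := a)
      have c2 := card_image_le (s := range L) (f := b)
      rw [card_range] at c1 c2
      omega
    nlinarith
  push Not at hL
  obtain ⟨G, hG0, hG3, gq, gp1, gpm, gpn, gab⟩ := run_cubic h (by omega)
  have mab : ∀ i, i < L → a i ∈ X ∧ b i ∈ X := fun i hi => ⟨(h.c0 i hi).mem.2.1, (h.c0 i hi).mem.2.2⟩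
  obtain ⟨c, hc⟩ : ∃ c, G = sc c * F := by
    set U := (Ico 3 (L-3)).image a ∪ (Ico 3 (L-3)).image b with hU
    have hUc : U.card = 2 * (L - 6) := by
      rw [hU, card_union_of_disjoint, card_image_of_injOn, card_image_of_injOn, Nat.card_Ico]
      · omega
      · intro i hi j hj hij
        simp only [coe_Ico, Set.mem_Ico] at hi hj
        by_contra hh
        exact N.bb i j (by omega) (by omega) hh hij
      · intro i hi j hj hij
        simp only [coe_Ico, Set.mem_Ico] at hi hj
        by_contra hh
        exact N.aa i j (by omega) (by omega) hh hij
      · rw [disjoint_left]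
        intro x hx hx'
        obtain ⟨i, hi, rfl⟩ := mem_image.1 hx
        obtain ⟨j, hj, hij⟩ := mem_image.1 hx'
        rw [mem_Ico] at hi hj
        exact N.ab i j (by omega) (by omega) hij.symm
    have hUX : U ⊆ X := by
      intro x hx
      rcases mem_union.1 hx with hx | hx <;> obtain ⟨i, hi, rfl⟩ := mem_image.1 hx <;> rw [mem_Ico] at hi
      · exact (mab i (by omega)).1
      · exact (mab i (by omega)).2
    have hUG : ∀ x ∈ U, G.evalEval x (f x) = 0 := by
      intro x hx
      rcases mem_union.1 hx with hx | hx <;> obtain ⟨i, hi, rfl⟩ := mem_image.1 hx <;> rw [mem_Ico] at hi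
      · exact (gab i hi.1 (by omega)).1
      · exact (gab i hi.1 (by omega)).2
    refine bezout3 hF dF hG3 (U.filter (fun x => F.evalEval x (f x) = 0)) f (fun x hx => ?_) ?_
    · exact ⟨(mem_filter.1 hx).2, hUG x (mem_filter.1 hx).1⟩
    · have e1 := card_filter_add_card_filter_not (s := U) (fun x => F.evalEval x (f x) = 0)
      have e2 : (U.filter (fun x => ¬ F.evalEval x (f x) = 0)).card ≤ r :=
        (card_le_card (Finset.filter_subset_filter _ hUX)).trans hE
      omega
  have hc0 : c ≠ 0 := by rintro rfl; exact hG0 (by rw [hc]; simp [sc])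
  have hGF : ∀ {x y}, G.evalEval x y = 0 → F.evalEval x y = 0 := by
    intro x y hh
    rw [hc, evalEval_mul, ev_sc] at hh
    exact (mul_eq_zero.1 hh).resolve_left hc0
  have W1 : Win X f F q p1 (L - 6) (fun i => a (i + 3)) (fun i => b (i + 3)) :=
    { c0 := fun i hi => h.c0 _ (by omega)
      c1 := fun i hi => by
        have := h.c1 (i + 3) (by omega)
        rwa [show i + 3 + 1 = i + 1 + 3 by ring] at this
      aa := fun i j hi hj hij => N.aa _ _ (by omega) (by omega) (by omega)
      bb := fun i j hi hj hij => N.bb _ _ (by omega) (by omega) (by omega)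
      ab := fun i j hi hj => N.ab _ _ (by omega) (by omega)
      pa := fun i hi => N.p1a _ (by omega)
      pb := fun i hi => N.p1b _ (by omega) (by omega)
      pq := N.p1q (by omega)
      Fq := hGF gq
      Fp := hGF gp1
      Fa := fun i hi => hGF (gab _ (by omega) (by omega)).1
      Fb := fun i hi => hGF (gab _ (by omega) (by omega)).2 }
  have W2 : Win X f F q pm (L - 6) (fun i => b (i + 3)) (fun i => a (i + 3)) :=
    { c0 := fun i hi => (h.c0 _ (by omega)).perm2
      c1 := fun i hi => by
        have := (h.c2 (i + 3) (by omega)).perm2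
        rwa [show i + 3 + 1 = i + 1 + 3 by ring] at this
      bb := fun i j hi hj hij => N.aa _ _ (by omega) (by omega) (by omega)
      aa := fun i j hi hj hij => N.bb _ _ (by omega) (by omega) (by omega)
      ab := fun i j hi hj => (N.ab _ _ (by omega) (by omega)).symm
      pb := fun i hi => N.pma _ (by omega) (by omega)
      pa := fun i hi => N.pmb _ (by omega)
      pq := N.pmq (by omega)
      Fq := hGF gq
      Fp := hGF gpm
      Fb := fun i hi => hGF (gab _ (by omega) (by omega)).1
      Fa := fun i hi => hGF (gab _ (by omega) (by omega)).2 }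
  have n1 := W1.count hF dF np hE hr
  have n2 := W2.count hF dF np hE hr
  have key : ∀ g : ℕ → ℝ, (((range L).image g).filter (fun u => ¬ Tang X f F u)).card ≤
      6 * r + 8 + (badk X f F (fun i => g (i + 3)) (L - 6) r).card := by
    intro g
    have : ((range L).image g).filter (fun u => ¬ Tang X f F u) ⊆
        (range (3 * r + 3) ∪ Ico (L - 3 * r - 5) L).image g ∪
        (badk X f F (fun i => g (i + 3)) (L - 6) r).image (fun i => g (i + 3)) := by
      intro x hx
      obtain ⟨hx, hn⟩ := mem_filter.1 hx
      obtain ⟨i, hi, rfl⟩ := mem_image.1 hx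
      rw [mem_range] at hi
      by_cases hh : i < 3 * r + 3 ∨ L - 3 * r - 5 ≤ i
      · refine mem_union_left _ (mem_image_of_mem _ ?_)
        rw [mem_union, mem_range, mem_Ico]
        omega
      · push Not at hh
        refine mem_union_right _ (mem_image.2 ⟨i - 3, ?_, by rw [show i - 3 + 3 = i by omega]⟩)
        rw [badk, mem_filter, mem_range, show i - 3 + 3 = i by omega]
        exact ⟨by omega, by omega, by omega, hn⟩
    refine (card_le_card this).trans ((card_union_le _ _).trans ?_)
    refine add_le_add (card_image_le.trans ((card_union_le _ _).trans ?_)) card_image_le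
    rw [card_range, Nat.card_Ico]; omega
  rw [Finset.filter_union]
  have k1 := key a
  have k2 := key b
  have k3 := card_union_le (((range L).image a).filter (fun u => ¬ Tang X f F u))
    (((range L).image b).filter (fun u => ¬ Tang X f F u))
  have k4 := Nat.mul_le_mul_right r (k3.trans (add_le_add k1 k2))
  nlinarith

end GT

namespace GT
open Polynomial
variable {X : Fr} {f : Fn}
variable {F : PY} {q : ℝ}

lemma not_dvd_of_td {F G : PY} (hG : G ≠ 0) (h : td G < td F) : ¬ F ∣ G := by
  rintro ⟨H, rfl⟩
  have hF : F ≠ 0 := by rintro rfl; simp at hG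
  have hH : H ≠ 0 := by rintro rfl; simp at hG
  rw [td_mul hF hH] at h
  omega

lemma A_le {m : ℕ} (R : Runs X f q m) (hF : Irreducible F) (dF : td F = 3) (hq : F.evalEval q (f q) ≠ 0) :
    (X.filter (fun x => F.evalEval x (f x) = 0)).card ≤ 306 * (m + 1) := by
  classical
  obtain ⟨s, h1, h2, h3⟩ := cover_q' R
  have : X.filter (fun x => F.evalEval x (f x) = 0) ⊆ s.biUnion (fun G => X.filter (fun x => F.evalEval x (f x) = 0 ∧
      G.evalEval x (f x) = 0)) := by
    intro x hx
    obtain ⟨hx, h⟩ := mem_filter.1 hx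
    obtain ⟨G, hG, hGx⟩ := h3 x hx
    exact mem_biUnion.2 ⟨G, hG, mem_filter.2 ⟨hx, h, hGx⟩⟩
  refine (card_le_card this).trans ((card_biUnion_le_card_mul _ _ 18 fun G hG => ?_).trans (by omega))
  obtain ⟨g1, g2, g3⟩ := h2 G hG
  by_contra hc
  push Not at hc
  obtain ⟨r, hr⟩ := bezout3 hF dF g2 _ f (fun x hx => (mem_filter.1 hx).2) hc
  rw [hr, evalEval_mul, ev_sc] at g3
  rcases mul_eq_zero.1 g3 with h | h
  · rw [hr, h] at g1; exact g1 (by simp [sc])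
  · exact hq h

open Classical in
lemma nontang {m : ℕ} (R : Runs X f q m) (hF : Irreducible F) (dF : td F = 3) (np : NoPar X f) {r : ℕ}
    (hE : (X.filter (fun x => F.evalEval x (f x) ≠ 0)).card ≤ r) (hr : 1 ≤ r) :
    (X.filter (fun u => ¬ Tang X f F u)).card * r ≤
      (1 + r + 18 * m) * r + (m + 1) * ((12 * r + 80) * r + 2 * (N2 X f + 3 * X.card)) := by
  set V : ℕ → Fr := fun k => (((range (R.L k)).image (R.a k)) ∪
    ((range (R.L k)).image (R.b k))).filter (fun u => ¬ Tang X f F u) with hV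
  have hsub : X.filter (fun u => ¬ Tang X f F u) ⊆ ({q} ∪ X.filter (fun x => F.evalEval x (f x) ≠ 0)
      ∪ R.B.biUnion (fun s => (Ln X f q s).filter (fun x => F.evalEval x (f x) = 0))) ∪
      (range (m+1)).biUnion V := by
    intro x hx
    obtain ⟨hx, hn⟩ := mem_filter.1 hx
    by_cases h1 : x = q
    · simp [h1]
    by_cases h2 : F.evalEval x (f x) = 0
    swap
    · simp [hx, h2]
    set s := (f x - f q) / (x - q) with hs
    have hsx : f x - f q = s * (x - q) := by
      rw [hs, div_mul_cancel₀]; exact sub_ne_zero.2 h1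
    have hxl : x ∈ Ln X f q s := mem_Ln.2 ⟨hx, hsx⟩
    have hsl : s ∈ Sl X f q := mem_Sl.2 ⟨x, hxl, h1⟩
    by_cases hB : s ∈ R.B
    · refine mem_union_left _ (mem_union_right _ ?_)
      exact mem_biUnion.2 ⟨s, hB, mem_filter.2 ⟨hxl, h2⟩⟩
    · obtain ⟨k, hk, i, hi, hts⟩ := R.cover s hsl hB
      refine mem_union_right _ (mem_biUnion.2 ⟨k, by simp; omega, ?_⟩)
      have := (R.run k).line i hi
      rw [hts] at this
      rw [this] at hxl
      simp only [mem_insert, mem_singleton, h1, false_or] at hxl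
      refine mem_filter.2 ⟨?_, hn⟩
      rcases hxl with h | h
      · exact mem_union_left _ (mem_image.2 ⟨i, by simpa using hi, h.symm⟩)
      · exact mem_union_right _ (mem_image.2 ⟨i, by simpa using hi, h.symm⟩)
  have h1 : ({q} ∪ X.filter (fun x => F.evalEval x (f x) ≠ 0)
      ∪ R.B.biUnion (fun s => (Ln X f q s).filter (fun x => F.evalEval x (f x) = 0))).card ≤ 1 + r + 18 * m := by
    refine (card_union_le _ _).trans (add_le_add ((card_union_le _ _).trans (add_le_add (by simp) hE)) ?_)
    refine (card_biUnion_le_card_mul _ _ 18 fun s hs => ?_).trans ?_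
    · refine bezout hF dF.le (G := lin s (f q - s * q)) (by rw [td_lin]; omega) (not_dvd_of_td (lin_ne _ _) (by rw [td_lin]; omega))
        _ f fun x hx => ?_
      obtain ⟨hx, hx0⟩ := mem_filter.1 hx
      refine ⟨hx0, ?_⟩
      have := (mem_Ln.1 hx).2
      rw [ev_lin]; linarith
    · have := R.Bcard; omega
  have h2 : ((range (m+1)).biUnion V).card * r ≤ (m + 1) * ((12 * r + 80) * r + 2 * (N2 X f + 3 * X.card)) := by
    refine (Nat.mul_le_mul_right r Finset.card_biUnion_le).trans ?_
    rw [Finset.sum_mul]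
    refine (sum_le_card_nsmul _ _ ((12 * r + 80) * r + 2 * (N2 X f + 3 * X.card)) fun k _ => ?_).trans ?_
    · exact run_bad (R.run k) hF dF np hE hr
    · rw [card_range, smul_eq_mul]
  have h3 := (card_le_card hsub).trans (card_union_le _ _)
  have h4 := Nat.mul_le_mul_right r h3
  have h5 := Nat.mul_le_mul_right r h1
  rw [add_mul] at h4
  omega

/-- Case A: many points on an irreducible cubic -/
theorem caseA : ∃ M n0 : ℕ, ∀ X : Fr, ∀ f : Fn, n0 ≤ X.card → NoPar X f → N2 X f ≤ X.card →
    ∀ F : PY, Irreducible F → td F = 3 → M < (X.filter (fun x => F.evalEval x (f x) = 0)).card →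
    3 * X.card ≤ 4 * N2 X f := by
  classical
  obtain ⟨C0, hruns⟩ := runs_exist
  obtain ⟨C, hC⟩ : ∃ C, C = 306 * (2 * C0 + 1) := ⟨_, rfl⟩
  obtain ⟨K, hK⟩ : ∃ K, K = 4 * C0 := ⟨_, rfl⟩
  obtain ⟨r, hr⟩ : ∃ r, r = 2 * C + 64 * (K + 1) + 1 := ⟨_, rfl⟩
  obtain ⟨D, hD⟩ : ∃ D, D = 1 + r + 18 * K + (K + 1) * (12 * r + 80) := ⟨_, rfl⟩
  refine ⟨2 * C, 8 * D + 288 * C, fun X f hn np hN F hF dF hM => ?_⟩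
  obtain ⟨bd, hs, hR⟩ := hruns X f
  set n := X.card with hndef
  set A := X.filter (fun x => F.evalEval x (f x) = 0) with hA
  set E := X.filter (fun x => F.evalEval x (f x) ≠ 0) with hE
  have hAE : A.card + E.card = n := card_filter_add_card_filter_not _
  have hs' : ∑ q ∈ X, bd q ≤ 2 * C0 * n := by nlinarith
  have e1 : E.card * A.card ≤ C * n := by
    have : ∑ q ∈ E, A.card ≤ ∑ q ∈ E, 306 * (bd q + 1) := by
      refine sum_le_sum fun q hq => ?_
      obtain ⟨hqX, hq⟩ := mem_filter.1 hq
      obtain ⟨R⟩ := hR q hqX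
      exact A_le R hF dF hq
    rw [sum_const, smul_eq_mul, ← mul_sum, sum_add_distrib, sum_const, smul_eq_mul] at this
    have h2 : ∑ q ∈ E, bd q ≤ ∑ q ∈ X, bd q := sum_le_sum_of_subset (filter_subset _ _)
    have h3 : E.card ≤ n := by omega
    nlinarith
  have e2 : 2 * E.card ≤ n := by
    by_contra hc
    push Not at hc
    nlinarith
  have e3 : E.card ≤ 2 * C := by
    by_contra hc
    push Not at hc
    nlinarith
  obtain ⟨q, hq, hbq⟩ : ∃ q ∈ A, bd q ≤ K := by
    by_contra hc
    push Not at hc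
    have h1 : A.card * (K + 1) ≤ ∑ q ∈ A, bd q := by
      rw [← smul_eq_mul]
      exact card_nsmul_le_sum _ _ _ fun q hq => hc q hq
    have h2 : ∑ q ∈ A, bd q ≤ ∑ q ∈ X, bd q := sum_le_sum_of_subset (filter_subset _ _)
    nlinarith
  obtain ⟨R⟩ := hR q (mem_filter.1 hq).1
  have h1 := nontang R hF dF np (r := r) (le_trans (le_of_eq (by rw [hE])) (show E.card ≤ r by omega)) (by omega)
  have h2 := tang_count (X := X) (f := f) hF dF
  have h3 : (X.filter (fun u => Tang X f F u)).card + (X.filter (fun u => ¬ Tang X f F u)).card = n :=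
    card_filter_add_card_filter_not _
  set Z := (X.filter (fun u => ¬ Tang X f F u)).card with hZ
  have h4 : Z * r ≤ D * r + (K + 1) * (8 * n) := by
    refine h1.trans ?_
    have : (bd q + 1) * ((12 * r + 80) * r + 2 * (N2 X f + 3 * X.card)) ≤ (K + 1) * ((12 * r + 80) * r + 8 * n) :=
      Nat.mul_le_mul (by omega) (by omega)
    have h6 : (1 + r + 18 * bd q) * r ≤ (1 + r + 18 * K) * r := Nat.mul_le_mul_right _ (by omega)
    refine (add_le_add h6 this).trans (le_of_eq ?_)
    rw [hD]; ring
  have h5 : 8 * Z ≤ 8 * D + n := by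
    have h64 : 64 * (K + 1) * n ≤ r * n := Nat.mul_le_mul_right _ (by omega)
    have : 8 * Z * r ≤ (8 * D + n) * r := by linarith
    exact Nat.le_of_mul_le_mul_right this (by omega)
  change (X.filter (fun u => Tang X f F u)).card ≤ N2 X f + 18 * E.card at h2
  clear h4 h1 hD hr hs hs' e1
  omega

end GT

namespace GT
open Polynomial

lemma td1 {F : PY} (h : td F ≤ 1) : ∃ c0 c1 c2 : ℝ, F = sc c0 + sc c1 * C X + sc c2 * X := by
  refine ⟨(F.coeff 0).coeff 0, (F.coeff 0).coeff 1, (F.coeff 1).coeff 0, ?_⟩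
  have hz := td_le_iff.1 h
  ext i j
  rcases i with _ | _ | i
  · rcases j with _ | _ | j
    · simp
    · simp
    · rw [hz _ _ (by omega)]; simp [coeff_X, coeff_C]
  · rcases j with _ | j
    · simp [mul_assoc]
    · rw [hz _ _ (by omega)]; simp [coeff_C]
  · rw [hz _ _ (by omega)]; simp [coeff_X, coeff_C]

variable {X : Fr} {f : Fn}

/-- the three cases -/
theorem trich (M2 : ℕ) : ∃ n0 : ℕ, ∀ X : Fr, ∀ f : Fn, n0 ≤ X.card → NoPar X f →
    (¬ ∃ t c, ∀ x ∈ X, f x = t * x + c) → N2 X f ≤ X.card →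
    3 * X.card ≤ 4 * N2 X f ∨ ∃ Q : PY, Irreducible Q ∧ td Q = 2 ∧
      M2 < (X.filter (fun x => Q.evalEval x (f x) = 0)).card := by
  classical
  obtain ⟨MA, nA, hA⟩ := caseA
  obtain ⟨C1, hC1⟩ := cover_exist
  obtain ⟨nC, hC⟩ := caseC (C1 + C1 * (MA + M2 + 1))
  refine ⟨nA + nC + 1, fun X f hn np hcol hN => ?_⟩
  by_cases hQ : ∃ Q : PY, Irreducible Q ∧ td Q = 2 ∧
      M2 < (X.filter (fun x => Q.evalEval x (f x) = 0)).card
  · exact Or.inr hQ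
  left
  by_cases h3 : ∃ F : PY, Irreducible F ∧ td F = 3 ∧ MA < (X.filter (fun x => F.evalEval x (f x) = 0)).card
  · obtain ⟨F, h1, h2, h3⟩ := h3
    exact hA X f (by omega) np hN F h1 h2 h3
  push Not at hQ h3
  obtain ⟨s, s1, s2, s3⟩ := hC1 X f (card_pos.1 (by omega)) hN
  have key : ∀ G ∈ s, (∃ l : ℝ × ℝ, ∀ x, G.evalEval x (f x) = 0 → f x = l.1 * x + l.2) ∨
      (X.filter (fun x => G.evalEval x (f x) = 0)).card ≤ MA + M2 + 1 := by
    intro G hG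
    obtain ⟨g1, g2⟩ := s2 G hG
    by_cases e3 : td G = 3
    · right; have := h3 G g1 e3; omega
    by_cases e2 : td G = 2
    · right; have := hQ G g1 e2; omega
    obtain ⟨c0, c1, c2, rfl⟩ := td1 (F := G) (by omega)
    have hev : ∀ x y, (sc c0 + sc c1 * C Polynomial.X + sc c2 * Polynomial.X).evalEval x y = c0 + c1 * x + c2 * y := by
      intro x y
      simp [evalEval]
    by_cases h : c2 = 0
    · right
      refine le_trans (card_le_one.2 ?_) (by omega)
      intro x hx y hy
      have a1 := (mem_filter.1 hx).2
      have a2 := (mem_filter.1 hy).2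
      rw [hev, h] at a1 a2
      have hc1 : c1 ≠ 0 := by
        rintro rfl
        have : c0 = 0 := by linarith
        rw [this, h] at g1
        exact g1.ne_zero (by simp [sc])
      have : c1 * (x - y) = 0 := by linarith
      rcases mul_eq_zero.1 this with h | h
      · exact absurd h hc1
      · linarith
    · left
      refine ⟨(-c1 / c2, -c0 / c2), fun x hx => ?_⟩
      rw [hev] at hx
      field_simp
      linarith
  refine hC X f (by omega) hcol ?_
  set s' := s.filter (fun G => ∃ l : ℝ × ℝ, ∀ x, G.evalEval x (f x) = 0 → f x = l.1 * x + l.2) with hs'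
  have hl : ∀ G ∈ s', ∃ l : ℝ × ℝ, ∀ x, G.evalEval x (f x) = 0 → f x = l.1 * x + l.2 := fun G hG => (mem_filter.1 hG).2
  choose! l hl using hl
  refine ⟨s'.image l, (s \ s').biUnion (fun G => X.filter (fun x => G.evalEval x (f x) = 0)), ?_, ?_, ?_⟩
  · have := card_image_le (s := s') (f := l)
    have : s'.card ≤ s.card := card_filter_le _ _
    exact (by omega : (s'.image l).card ≤ C1).trans (Nat.le_add_right _ _)
  · refine (card_biUnion_le_card_mul _ _ (MA + M2 + 1) fun G hG => ?_).trans ?_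
    · obtain ⟨a1, a2⟩ := mem_sdiff.1 hG
      refine (key G a1).resolve_left fun h => a2 (mem_filter.2 ⟨a1, h⟩)
    · have : (s \ s').card ≤ C1 := (card_le_card Finset.sdiff_subset).trans s1
      exact (Nat.mul_le_mul_right _ this).trans (Nat.le_add_left _ _)
  · intro x hx
    obtain ⟨G, hG, hGx⟩ := s3 x hx
    by_cases h : G ∈ s'
    · exact Or.inr ⟨l G, mem_image_of_mem _ h, hl G h x hGx⟩
    · exact Or.inl (mem_biUnion.2 ⟨G, mem_sdiff.2 ⟨hG, h⟩, mem_filter.2 ⟨hx, hGx⟩⟩)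

end GT

namespace GT
open Polynomial
variable {X : Fr} {f : Fn}

/-- points on the parabola -/
def Par (X : Fr) (f : Fn) : Fr := X.filter (fun x => f x = x * x)

lemma mem_Par {x : ℝ} : x ∈ Par X f ↔ x ∈ X ∧ f x = x * x := by simp [Par]

lemma parab {G : PY} (hG : G ≠ 0) (dG : td G ≤ 3) (U : Fr) (hU : 6 < U.card)
    (h : ∀ x ∈ U, G.evalEval x (x * x) = 0) : ∃ l0 l1 l2 : ℝ, (l0 ≠ 0 ∨ l1 ≠ 0 ∨ l2 ≠ 0) ∧
      ∀ x y, G.evalEval x y = (y - x * x) * (l0 + l1 * x + l2 * y) := by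
  obtain ⟨c, rfl⟩ := eq_cub dG
  set p : ℝ[X] := C (c 0) + C (c 1) * X + C (c 2 + c 3) * X ^ 2 + C (c 4 + c 6) * X ^ 3 + C (c 5 + c 7) * X ^ 4
    + C (c 8) * X ^ 5 + C (c 9) * X ^ 6 with hp
  have hdeg : p.natDegree ≤ 6 := by rw [hp]; compute_degree
  have hp0 : p = 0 := by
    refine eq_zero_of_natDegree_lt_card_of_eval_eq_zero' p U (fun x hx => ?_) (by omega)
    have := h x hx
    rw [ev_cub] at this
    simp only [hp, eval_add, eval_mul, eval_C, eval_X, eval_pow]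
    linarith
  have k : ∀ i, p.coeff i = 0 := fun i => by rw [hp0]; simp
  have k0 := k 0; have k1 := k 1; have k2 := k 2; have k3 := k 3; have k4 := k 4; have k5 := k 5; have k6 := k 6
  simp only [hp, coeff_add, coeff_C_mul, coeff_X_pow, coeff_C, coeff_X] at k0 k1 k2 k3 k4 k5 k6
  norm_num at k0 k1 k2 k3 k4 k5 k6
  have z3 : c 3 = - c 2 := by linarith
  have z6 : c 6 = - c 4 := by linarith
  have z7 : c 7 = - c 5 := by linarith
  refine ⟨c 2, c 4, c 5, ?_, fun x y => ?_⟩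
  · by_contra hc
    push Not at hc
    obtain ⟨x1, x2, x3⟩ := hc
    apply hG
    simp only [cub, k0, k1, x1, x2, x3, z3, z6, z7, k5, k6, sc]
    simp
  · rw [ev_cub, k0, k1, z3, z6, z7, k5, k6]; ring

/-- same branch as seen from `(a, a^2 - k)` -/
def Br (a k x y : ℝ) : Prop := 0 < (x - a) * (y - a) ∧ 0 < ((x - a) ^ 2 - k) * ((y - a) ^ 2 - k)

lemma Br.symm {a k x y : ℝ} (h : Br a k x y) : Br a k y x :=
  ⟨by rw [mul_comm]; exact h.1, by rw [mul_comm]; exact h.2⟩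

lemma Br.pos {a k x y : ℝ} (h : Br a k x y) (hx : 0 < (x - a) ^ 2 - k) : 0 < (y - a) ^ 2 - k :=
  (mul_pos_iff_of_pos_left hx).1 h.2

lemma Br.neg {a k x y : ℝ} (h : Br a k x y) (hx : (x - a) ^ 2 - k < 0) : (y - a) ^ 2 - k < 0 := by
  by_contra hc
  push Not at hc
  nlinarith [h.2]

/-- slopes increase on plus branches, decrease on minus branches -/
lemma br_slope {a b x y s s' : ℝ} (hB : Br a (a ^ 2 - b) x y) (hx : x * x - b = s * (x - a)) (hy : y * y - b = s' * (y - a))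
    (hxy : x < y) : (0 < (x - a) ^ 2 - (a ^ 2 - b) → s < s') ∧ ((x - a) ^ 2 - (a ^ 2 - b) < 0 → s' < s) := by
  obtain ⟨k, hk⟩ : ∃ k, k = a ^ 2 - b := ⟨_, rfl⟩
  rw [← hk] at hB ⊢
  obtain ⟨U, hU⟩ : ∃ U, U = x - a := ⟨_, rfl⟩
  obtain ⟨V, hV⟩ : ∃ V, V = y - a := ⟨_, rfl⟩
  have hUV : U < V := by rw [hU, hV]; linarith
  have e : (s' - s) * (U * V) = (V - U) * (U * V - k) := by
    have h1 : s * U = U ^ 2 + 2 * a * U + k := by rw [hU, hk]; linarith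
    have h2 : s' * V = V ^ 2 + 2 * a * V + k := by rw [hV, hk]; linarith
    linear_combination U * h2 - V * h1
  have hp : 0 < U * V := by rw [hU, hV]; exact hB.1
  rw [← hU]
  constructor
  · intro h
    have h' := hB.pos (by rw [← hU]; exact h)
    rw [← hV] at h'
    have : k < U * V := by
      rcases lt_or_ge 0 U with h0 | h0 <;> nlinarith
    by_contra hc
    push Not at hc
    nlinarith [mul_pos (sub_pos.2 hUV) (sub_pos.2 this)]
  · intro h
    have h' := hB.neg (by rw [← hU]; exact h)
    rw [← hV] at h'
    have : U * V < k := by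
      rcases lt_or_ge 0 U with h0 | h0 <;> nlinarith
    by_contra hc
    push Not at hc
    nlinarith [mul_pos (sub_pos.2 hUV) (sub_pos.2 this)]

lemma br_mid {a k x y z : ℝ} (h : Br a k x y) (h1 : x < z) (h2 : z < y) : Br a k x z ∧ Br a k z y := by
  obtain ⟨hp, hq⟩ := h
  have key : 0 < (x - a) * (z - a) ∧ 0 < (z - a) * (y - a) ∧
    (0 < (x - a) ^ 2 - k ∧ 0 < (y - a) ^ 2 - k ∧ 0 < (z - a) ^ 2 - k ∨ (x - a) ^ 2 - k < 0 ∧ (y - a) ^ 2 - k < 0 ∧ (z - a) ^ 2 - k < 0) := by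
    rcases pos_and_pos_or_neg_and_neg_of_mul_pos hp with ⟨u, v⟩ | ⟨u, v⟩
    · have w : 0 < z - a := by linarith
      refine ⟨mul_pos u w, mul_pos w v, ?_⟩
      rcases pos_and_pos_or_neg_and_neg_of_mul_pos hq with ⟨p, q⟩ | ⟨p, q⟩
      · left; exact ⟨p, q, by nlinarith⟩
      · right; exact ⟨p, q, by nlinarith⟩
    · have w : z - a < 0 := by linarith
      refine ⟨mul_pos_of_neg_of_neg u w, mul_pos_of_neg_of_neg w v, ?_⟩
      rcases pos_and_pos_or_neg_and_neg_of_mul_pos hq with ⟨p, q⟩ | ⟨p, q⟩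
      · left; exact ⟨p, q, by nlinarith⟩
      · right; exact ⟨p, q, by nlinarith⟩
  obtain ⟨k1, k2, ⟨c1, c2, c3⟩ | ⟨c1, c2, c3⟩⟩ := key
  · exact ⟨⟨k1, mul_pos c1 c3⟩, ⟨k2, mul_pos c3 c2⟩⟩
  · exact ⟨⟨k1, mul_pos_of_neg_of_neg c1 c3⟩, ⟨k2, mul_pos_of_neg_of_neg c3 c2⟩⟩

/-- adjacent elements -/
def Adj (S : Fr) (x y : ℝ) : Prop := x ∈ S ∧ y ∈ S ∧ x < y ∧ ∀ z ∈ S, ¬ (x < z ∧ z < y)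

lemma Adj.uniq {S : Fr} {x y y' : ℝ} (h : Adj S x y) (h' : Adj S x y') : y = y' := by
  rcases lt_trichotomy y y' with h1 | h1 | h1
  · exact absurd ⟨h.2.2.1, h1⟩ (h'.2.2.2 y h.2.1)
  · exact h1
  · exact absurd ⟨h'.2.2.1, h1⟩ (h.2.2.2 y' h'.2.1)

def MR (A D β x y : ℝ) : Prop := x * y + D * y - A * x - β = 0

/-- the window starting at `u` is good for `q` -/
def GoodW (S : Fr) (f : Fn) (q u : ℝ) : Prop :=
  ∃ w1 w2 w3 A D β, Adj S u w1 ∧ Adj S w1 w2 ∧ Adj S w2 w3 ∧ MR A D β u w1 ∧ MR A D β w1 w2 ∧ MR A D β w2 w3 ∧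
    f q = (A - D) * q + β

lemma MR.uniq {A D β A' D' β' u0 u1 u2 u3 : ℝ} (h01 : u0 < u1) (h12 : u1 < u2) (_h23 : u2 < u3)
    (a1 : MR A D β u0 u1) (a2 : MR A D β u1 u2) (a3 : MR A D β u2 u3)
    (b1 : MR A' D' β' u0 u1) (b2 : MR A' D' β' u1 u2) (b3 : MR A' D' β' u2 u3) : A = A' ∧ D = D' ∧ β = β' := by
  unfold MR at *
  have hD : D = D' := by
    by_contra hne
    have hd : D - D' ≠ 0 := sub_ne_zero.2 hne
    -- u_{i+1} = m u_i + k
    obtain ⟨m, hm⟩ : ∃ m, m = (A - A') / (D - D') := ⟨_, rfl⟩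
    obtain ⟨k, hk⟩ : ∃ k, k = (β - β') / (D - D') := ⟨_, rfl⟩
    have e : ∀ x y, x * y + D * y - A * x - β = 0 → x * y + D' * y - A' * x - β' = 0 → y = m * x + k := by
      intro x y p1 p2
      rw [hm, hk]; field_simp; linarith
    have r1 := e _ _ a1 b1
    have r2 := e _ _ a2 b2
    have r3 := e _ _ a3 b3
    have q1 : (u1 - u0) * (m * (u0 + u1) + k + m * D - A) = 0 := by
      rw [r1] at a1; rw [r2] at a2; linear_combination a2 - a1
    have q2 : (u2 - u1) * (m * (u1 + u2) + k + m * D - A) = 0 := by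
      rw [r2] at a2; rw [r3] at a3; linear_combination a3 - a2
    have q1' := (mul_eq_zero.1 q1).resolve_left (by linarith [h01] : u1 - u0 ≠ 0)
    have q2' := (mul_eq_zero.1 q2).resolve_left (by linarith [h12] : u2 - u1 ≠ 0)
    have : m * (u2 - u0) = 0 := by linarith
    have hm0 : m = 0 := (mul_eq_zero.1 this).resolve_right (by linarith : u2 - u0 ≠ 0)
    rw [hm0] at r1 r2
    linarith
  subst hD
  have : (A - A') * (u1 - u0) = 0 := by linarith
  have hA : A = A' := by
    rcases mul_eq_zero.1 this with h | h <;> linarith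
  subst hA
  exact ⟨rfl, rfl, by linarith⟩

lemma chain_good {q : ℝ} {g t : ℕ → ℝ} {i : ℕ} {A D β : ℝ} (hi : 3 ≤ i)
    (hS : ∀ j, i ≤ j + 3 → j ≤ i + 3 → g j ∈ Par X f ∧ f (g j) - f q = t j * (g j - q))
    (hT : ∀ j, i ≤ j + 3 → j + 1 ≤ i + 3 → t j ∈ Sl X f q ∧ t j < t (j+1) ∧ t (j+1) = nxt (Sl X f q) (t j))
    (hB : ∀ j, i ≤ j + 3 → j + 1 ≤ i + 3 → Br q (q ^ 2 - f q) (g j) (g (j+1)))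
    (hM : ∀ j, i ≤ j + 3 → j + 1 ≤ i + 3 → MR A D β (g j) (g (j+1))) (hl : f q = (A - D) * q + β) :
    GoodW (Par X f) f q (g i) := by
  have gap : ∀ j, i ≤ j + 3 → j + 1 ≤ i + 3 → ∀ z ∈ Par X f, z ≠ q → ∀ s, f z - f q = s * (z - q) → t j < s → s < t (j+1) → False := by
    intro j h1 h2 z hz hzq s hs h3 h4
    rw [(hT j h1 h2).2.2] at h4
    exact nxt_gap (hT j h1 h2).1 (mem_Sl.2 ⟨z, mem_Ln.2 ⟨(mem_Par.1 hz).1, hs⟩, hzq⟩) h3 h4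
  have sl : ∀ z ∈ Par X f, ∀ s, f z - f q = s * (z - q) → z * z - f q = s * (z - q) := by
    intro z hz s h
    rw [← (mem_Par.1 hz).2]; exact h
  have adjp : ∀ j, i ≤ j + 3 → j + 1 ≤ i + 3 → 0 < (g j - q) ^ 2 - (q ^ 2 - f q) → Adj (Par X f) (g j) (g (j+1)) := by
    intro j h1 h2 hp
    have s1 := hS j h1 (by omega)
    have s2 := hS (j+1) (by omega) h2
    have e1 := sl _ s1.1 _ s1.2
    have e2 := sl _ s2.1 _ s2.2
    have lt : g j < g (j+1) := by
      rcases lt_trichotomy (g j) (g (j+1)) with h | h | h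
      · exact h
      · have := (hT j h1 h2).2.1
        rw [← h] at e2
        have h0 : (t (j+1) - t j) * (g j - q) = 0 := by linarith
        have hq := (mul_eq_zero.1 h0).resolve_left (by linarith : t (j+1) - t j ≠ 0)
        have := (hB j h1 h2).1
        rw [hq] at this; simp at this
      · have := (br_slope (hB j h1 h2).symm e2 e1 h).1 ((hB j h1 h2).pos hp)
        linarith [(hT j h1 h2).2.1]
    refine ⟨s1.1, s2.1, lt, fun z hz ⟨z1, z2⟩ => ?_⟩
    obtain ⟨m1, m2⟩ := br_mid (hB j h1 h2) z1 z2
    have hzq : z ≠ q := by rintro rfl; have := m1.1; simp at this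
    have hsz : f z - f q = ((f z - f q) / (z - q)) * (z - q) := by
      rw [div_mul_cancel₀]; exact sub_ne_zero.2 hzq
    have e3 := sl _ hz _ hsz
    exact gap j h1 h2 z hz hzq _ hsz ((br_slope m1 e1 e3 z1).1 hp) ((br_slope m2 e3 e2 z2).1 (m1.pos hp))
  have adjn : ∀ j, i ≤ j + 3 → j + 1 ≤ i + 3 → (g (j+1) - q) ^ 2 - (q ^ 2 - f q) < 0 → Adj (Par X f) (g (j+1)) (g j) := by
    intro j h1 h2 hp
    have s1 := hS j h1 (by omega)
    have s2 := hS (j+1) (by omega) h2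
    have e1 := sl _ s1.1 _ s1.2
    have e2 := sl _ s2.1 _ s2.2
    have lt : g (j+1) < g j := by
      rcases lt_trichotomy (g (j+1)) (g j) with h | h | h
      · exact h
      · have := (hT j h1 h2).2.1
        rw [h] at e2
        have h0 : (t (j+1) - t j) * (g j - q) = 0 := by linarith
        have hq := (mul_eq_zero.1 h0).resolve_left (by linarith : t (j+1) - t j ≠ 0)
        have := (hB j h1 h2).1
        rw [hq] at this; simp at this
      · have := (br_slope (hB j h1 h2) e1 e2 h).2 ((hB j h1 h2).symm.neg hp)
        linarith [(hT j h1 h2).2.1]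
    refine ⟨s2.1, s1.1, lt, fun z hz ⟨z1, z2⟩ => ?_⟩
    obtain ⟨m1, m2⟩ := br_mid (hB j h1 h2).symm z1 z2
    have hzq : z ≠ q := by rintro rfl; have := m1.1; simp at this
    have hsz : f z - f q = ((f z - f q) / (z - q)) * (z - q) := by
      rw [div_mul_cancel₀]; exact sub_ne_zero.2 hzq
    have e3 := sl _ hz _ hsz
    exact gap j h1 h2 z hz hzq _ hsz ((br_slope m2 e3 e1 z2).2 (m1.neg hp)) ((br_slope m1 e2 e3 z1).2 hp)
  have hne : (g i - q) ^ 2 - (q ^ 2 - f q) ≠ 0 := by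
    intro h
    have := (hB i (by omega) (by omega)).2
    rw [h] at this; simp at this
  rcases lt_or_gt_of_ne hne with h0 | h0
  · obtain ⟨j, rfl⟩ : ∃ j, i = j + 3 := ⟨i - 3, by omega⟩
    have n1 := (hB (j+2) (by omega) (by omega)).symm.neg h0
    have n2 := (hB (j+1) (by omega) (by omega)).symm.neg n1
    have m : ∀ j', j + 3 ≤ j' + 3 → j' + 1 ≤ j + 3 + 3 → MR (-D) (-A) β (g (j'+1)) (g j') := by
      intro j' h1 h2
      have := hM j' h1 h2
      unfold MR at *; linarith
    exact ⟨g (j+2), g (j+1), g j, -D, -A, β, adjn (j+2) (by omega) (by omega) h0, adjn (j+1) (by omega) (by omega) n1,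
      adjn j (by omega) (by omega) n2, m (j+2) (by omega) (by omega), m (j+1) (by omega) (by omega), m j (by omega) (by omega),
      by rw [hl]; ring⟩
  · have n1 := (hB i (by omega) (by omega)).pos h0
    have n2 := (hB (i+1) (by omega) (by omega)).pos n1
    exact ⟨g (i+1), g (i+2), g (i+3), A, D, β, adjp i (by omega) (by omega) h0, adjp (i+1) (by omega) (by omega) n1,
      adjp (i+2) (by omega) (by omega) n2, hM i (by omega) (by omega), hM (i+1) (by omega) (by omega), hM (i+2) (by omega) (by omega), hl⟩

lemma col3_par {p a b : ℝ} (h : Col3 X f p a b) (ha : a ∈ Par X f) (hb : b ∈ Par X f) :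
    f p = (a + b) * p - a * b := by
  obtain ⟨_, _, hab, t, c, h⟩ := h
  have h1 := ((h p).2 (by simp)).2
  have h2 := ((h a).2 (by simp)).2
  have h3 := ((h b).2 (by simp)).2
  rw [(mem_Par.1 ha).2] at h2
  rw [(mem_Par.1 hb).2] at h3
  have : (a - b) * (a + b - t) = 0 := by linarith
  have ht := (mul_eq_zero.1 this).resolve_left (sub_ne_zero.2 hab)
  have e : t = a + b := by linarith
  subst e
  rw [h1]; linarith

lemma br_cyc {q k a b : ℝ} (hc : Cyc q a b) (h : (a - q) * (b - q) = k) :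
    (k < 0 ∧ 0 < a - q ∧ b - q < 0) ∨
    (0 < k ∧ 0 < a - q + (b - q) ∧ 0 < a - q ∧ 0 < b - q ∧ (a - q) ^ 2 < k ∧ k < (b - q) ^ 2) ∨
    (0 < k ∧ a - q + (b - q) < 0 ∧ a - q < 0 ∧ b - q < 0 ∧ k < (a - q) ^ 2 ∧ (b - q) ^ 2 < k) := by
  obtain ⟨U, hU⟩ : ∃ U, U = a - q := ⟨_, rfl⟩
  obtain ⟨V, hV⟩ : ∃ V, V = b - q := ⟨_, rfl⟩
  rw [← hU, ← hV] at h ⊢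
  rcases hc with ⟨h1, h2⟩ | ⟨h1, h2⟩ | ⟨h1, h2⟩
  · have u : 0 < U := by linarith
    have v : U < V := by linarith
    right; left
    refine ⟨by nlinarith, by linarith, u, by linarith, by nlinarith, by nlinarith⟩
  · have u : V < 0 := by linarith
    have v : U < V := by linarith
    right; right
    refine ⟨by nlinarith, by linarith, by linarith, u, by nlinarith, by nlinarith⟩
  · left
    have u : V < 0 := by linarith
    have v : 0 < U := by linarith
    exact ⟨by nlinarith, v, u⟩

lemma br_of {q k a b a' b' : ℝ} (hc : Cyc q a b) (h : (a - q) * (b - q) = k)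
    (hc' : Cyc q a' b') (h' : (a' - q) * (b' - q) = k)
    (hs : (0 < a - q + (b - q) ∧ 0 < a' - q + (b' - q)) ∨ (a - q + (b - q) ≤ 0 ∧ a' - q + (b' - q) ≤ 0)) :
    Br q k a a' ∧ Br q k b b' := by
  unfold Br
  rcases br_cyc hc h with ⟨c1, c2, c3⟩ | ⟨c1, c2, c3, c4, c5, c6⟩ | ⟨c1, c2, c3, c4, c5, c6⟩ <;>
  rcases br_cyc hc' h' with ⟨d1, d2, d3⟩ | ⟨d1, d2, d3, d4, d5, d6⟩ | ⟨d1, d2, d3, d4, d5, d6⟩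
  · refine ⟨⟨mul_pos c2 d2, mul_pos ?_ ?_⟩, ⟨mul_pos_of_neg_of_neg c3 d3, mul_pos ?_ ?_⟩⟩ <;> nlinarith [sq_nonneg (a - q), sq_nonneg (b - q), sq_nonneg (a' - q), sq_nonneg (b' - q)]
  · linarith
  · linarith
  · linarith
  · exact ⟨⟨mul_pos c3 d3, mul_pos_of_neg_of_neg (by linarith) (by linarith)⟩, ⟨mul_pos c4 d4, mul_pos (by linarith) (by linarith)⟩⟩
  · rcases hs with hs | hs <;> linarith [hs.1, hs.2]
  · linarith
  · rcases hs with hs | hs <;> linarith [hs.1, hs.2]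
  · exact ⟨⟨mul_pos_of_neg_of_neg c3 d3, mul_pos (by linarith) (by linarith)⟩, ⟨mul_pos_of_neg_of_neg c4 d4, mul_pos_of_neg_of_neg (by linarith) (by linarith)⟩⟩

lemma mr_of {q c y d a a' b' : ℝ} (hcq : c ≠ q) 
    (h1 : d = (a + b') * c - a * b') (h2 : y = (a' + b') * q - a' * b') :
    MR ((c * q - y) / (c - q)) ((q * c - d) / (c - q)) ((c * y - d * q) / (c - q)) a a' := by
  have h0 : c - q ≠ 0 := sub_ne_zero.2 hcq
  unfold MR
  field_simp
  subst h1 h2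
  ring

theorem run_good {q : ℝ} {L : ℕ} {t a b : ℕ → ℝ} {p1 pm pn : ℝ} (h : IsRun X f q L t a b p1 pm pn)
    (hq : f q ≠ q * q) : ∃ V : Fr, V.card ≤ 60 ∧ ∀ i < L, ∀ u, (u = a i ∨ u = b i) → u ∈ Par X f →
      u ∈ V ∨ GoodW (Par X f) f q u := by
  classical
  have N := h.ne
  have tm : ∀ i j, i < L → j < L → i < j → t i < t j := by
    intro i j hi hj hij
    induction j with
    | zero => omega
    | succ j ih =>
      have h1 := (h.next j hj).1
      rcases Nat.lt_or_ge i j with h2 | h2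
      · exact (ih (by omega) h2).trans h1
      · have : i = j := by omega
        rw [this]; exact h1
  by_cases hL : L < 20
  · refine ⟨(range L).image a ∪ (range L).image b, ?_, ?_⟩
    · have e1 := card_union_le ((range L).image a) ((range L).image b)
      have e2 := card_image_le (s := range L) (f := a)
      have e3 := card_image_le (s := range L) (f := b)
      rw [card_range] at e2 e3
      omega
    · intro i hi u hu _
      left
      rcases hu with rfl | rfl
      · exact mem_union_left _ (mem_image_of_mem _ (by simpa using hi))
      · exact mem_union_right _ (mem_image_of_mem _ (by simpa using hi))
  push Not at hL
  obtain ⟨E, hE⟩ : ∃ E : Finset ℕ, E = range 6 ∪ Ico (L-6) L := ⟨_, rfl⟩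
  have hEc : E.card ≤ 12 := by
    rw [hE]
    refine (card_union_le _ _).trans ?_
    rw [card_range, Nat.card_Ico]; omega
  set U := ((Ico 3 (L-3)).image a ∪ (Ico 3 (L-3)).image b).filter (fun u => u ∈ Par X f) with hU
  have cov : ∀ Z : Finset ℕ, Z.card ≤ 26 → (Z.image a ∪ Z.image b).card ≤ 52 := by
    intro Z hZ
    have e1 := card_union_le (Z.image a) (Z.image b)
    have e2 := card_image_le (s := Z) (f := a)
    have e3 := card_image_le (s := Z) (f := b)
    omega
  by_cases hUc : U.card ≤ 6
  · refine ⟨(E.image a ∪ E.image b) ∪ U, ?_, ?_⟩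
    · refine (card_union_le _ _).trans ?_
      have := cov E (by omega)
      omega
    · intro i hi u hu huP
      left
      by_cases hiE : i ∈ E
      · apply mem_union_left
        rcases hu with rfl | rfl
        · exact mem_union_left _ (mem_image_of_mem _ hiE)
        · exact mem_union_right _ (mem_image_of_mem _ hiE)
      · apply mem_union_right
        have hi' : i ∈ Ico 3 (L-3) := by
          rw [hE] at hiE
          simp only [mem_union, mem_range, mem_Ico] at hiE ⊢
          omega
        refine mem_filter.2 ⟨?_, huP⟩
        rcases hu with rfl | rfl
        · exact mem_union_left _ (mem_image_of_mem _ hi')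
        · exact mem_union_right _ (mem_image_of_mem _ hi')
  push Not at hUc
  obtain ⟨G, hG0, hG3, gq, -, -, -, gab⟩ := run_cubic h (by omega)
  have hmid : ∀ u ∈ U, G.evalEval u (u * u) = 0 := by
    intro u hu
    obtain ⟨h1, h2⟩ := mem_filter.1 hu
    rw [← (mem_Par.1 h2).2]
    rcases mem_union.1 h1 with h1 | h1
    · obtain ⟨i, hi, rfl⟩ := mem_image.1 h1
      rw [mem_Ico] at hi
      exact (gab i hi.1 (by omega)).1
    · obtain ⟨i, hi, rfl⟩ := mem_image.1 h1
      rw [mem_Ico] at hi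
      exact (gab i hi.1 (by omega)).2
  obtain ⟨l0, l1, l2, hl, hG⟩ := parab hG0 hG3 U hUc hmid
  have hlq : l0 + l1 * q + l2 * f q = 0 := by
    rw [hG] at gq
    exact (mul_eq_zero.1 gq).resolve_left (sub_ne_zero.2 hq)
  have lslope : ∀ i, i < L → ∀ u, (u = a i ∨ u = b i) → f u - f q = t i * (u - q) := by
    intro i hi u hu
    have : u ∈ Ln X f q (t i) := by rw [h.line i hi]; simp; tauto
    exact (mem_Ln.1 this).2
  have mX : ∀ i, i < L → a i ∈ X ∧ b i ∈ X := fun i hi => ⟨(h.c0 i hi).mem.2.1, (h.c0 i hi).mem.2.2⟩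
  -- a non-parabola point pins the slope
  have pin : ∀ i, 3 ≤ i → i + 3 < L → ¬ (a i ∈ Par X f ∧ b i ∈ Par X f) → l2 ≠ 0 ∧ l1 + l2 * t i = 0 := by
    intro i h3 h4 hn
    have : ∃ u, (u = a i ∨ u = b i) ∧ u ∉ Par X f := by
      by_contra hc
      push Not at hc
      exact hn ⟨hc _ (Or.inl rfl), hc _ (Or.inr rfl)⟩
    obtain ⟨u, hu, huP⟩ := this
    have huX : u ∈ X := by rcases hu with rfl | rfl; exacts [(mX i (by omega)).1, (mX i (by omega)).2]
    have hGu : G.evalEval u (f u) = 0 := by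
      rcases hu with rfl | rfl
      · exact (gab i h3 h4).1
      · exact (gab i h3 h4).2
    have huq : u ≠ q := by rcases hu with rfl | rfl; exacts [(N.qa i (by omega)).symm, (N.qb i (by omega)).symm]
    rw [hG] at hGu
    have h1 := (mul_eq_zero.1 hGu).resolve_left (sub_ne_zero.2 fun h => huP (mem_Par.2 ⟨huX, h⟩))
    have h2 := lslope i (by omega) u hu
    have h3 : (u - q) * (l1 + l2 * t i) = 0 := by linear_combination h1 - hlq - l2 * h2
    have h4 := (mul_eq_zero.1 h3).resolve_left (sub_ne_zero.2 huq)
    refine ⟨fun h0 => ?_, h4⟩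
    rw [h0] at h4 hlq
    have : l1 = 0 := by linarith
    rw [this] at hlq
    rcases hl with hl | hl | hl
    · apply hl; linarith
    · exact hl this
    · exact hl h0
  obtain ⟨J, hJ1, hJ⟩ : ∃ j0 : ℕ, True ∧ ∀ i, 3 ≤ i → i + 3 < L → i ≠ j0 → a i ∈ Par X f ∧ b i ∈ Par X f := by
    by_cases hex : ∃ j0, 3 ≤ j0 ∧ j0 + 3 < L ∧ ¬ (a j0 ∈ Par X f ∧ b j0 ∈ Par X f)
    · obtain ⟨j0, c1, c2, c3⟩ := hex
      refine ⟨j0, trivial, fun i h3 h4 hne => ?_⟩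
      by_contra hn
      obtain ⟨e1, e2⟩ := pin i h3 h4 hn
      obtain ⟨-, e3⟩ := pin j0 c1 c2 c3
      have : l2 * (t i - t j0) = 0 := by linarith
      have := (mul_eq_zero.1 this).resolve_left e1
      rcases lt_or_gt_of_ne hne with hh | hh
      · linarith [tm i j0 (by omega) (by omega) hh]
      · linarith [tm j0 i (by omega) (by omega) hh]
    · push Not at hex
      exact ⟨0, trivial, fun i h3 h4 _ => hex i h3 h4⟩
  obtain ⟨M, hM⟩ : ∃ M : ℕ, ∀ i < L, t i ≤ 2 * q ↔ i < M := by
    by_cases hex : ∃ i, i < L ∧ 2 * q < t i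
    · refine ⟨Nat.find hex, fun i hi => ⟨fun hti => ?_, fun hlt => ?_⟩⟩
      · by_contra hc
        push Not at hc
        obtain ⟨s1, s2⟩ := Nat.find_spec hex
        rcases Nat.lt_or_ge (Nat.find hex) i with h1 | h1
        · linarith [tm _ _ s1 hi h1]
        · have : Nat.find hex = i := le_antisymm hc h1
          rw [this] at s2; linarith
      · have := Nat.find_min hex hlt
        push Not at this
        exact this hi
    · push Not at hex
      exact ⟨L, fun i hi => ⟨fun _ => hi, fun _ => hex i hi⟩⟩
  obtain ⟨Z, hZ⟩ : ∃ Z : Finset ℕ, Z = E ∪ Icc (J-3) (J+3) ∪ Icc (M-3) (M+3) := ⟨_, rfl⟩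
  have hZc : Z.card ≤ 26 := by
    rw [hZ]
    have e1 := card_union_le (E ∪ Icc (J-3) (J+3)) (Icc (M-3) (M+3))
    have e2 := card_union_le E (Icc (J-3) (J+3))
    rw [Nat.card_Icc] at e1 e2
    omega
  refine ⟨Z.image a ∪ Z.image b, (cov Z hZc).trans (by norm_num), fun i hi u hu huP => ?_⟩
  by_cases hiZ : i ∈ Z
  · left
    rcases hu with rfl | rfl
    · exact mem_union_left _ (mem_image_of_mem _ hiZ)
    · exact mem_union_right _ (mem_image_of_mem _ hiZ)
  right
  have hi1 : 6 ≤ i ∧ i + 6 < L ∧ (i + 3 < J ∨ J + 3 < i) ∧ (i + 3 < M ∨ M + 3 < i) := by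
    rw [hZ, hE] at hiZ
    simp only [mem_union, mem_range, mem_Ico, mem_Icc] at hiZ
    omega
  obtain ⟨i1, i2, i3, i4⟩ := hi1
  have hk : q ^ 2 - f q ≠ 0 := fun h0 => hq (by linarith)
  have hP : ∀ j, i ≤ j + 3 → j ≤ i + 3 → a j ∈ Par X f ∧ b j ∈ Par X f := fun j h1 h2 =>
    hJ j (by omega) (by omega) (by omega)
  have hcol : ∀ j, i ≤ j + 3 → j ≤ i + 3 → f q = (a j + b j) * q - a j * b j := fun j h1 h2 =>
    col3_par (h.c0 j (by omega)) (hP j h1 h2).1 (hP j h1 h2).2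
  have hprod : ∀ j, i ≤ j + 3 → j ≤ i + 3 → (a j - q) * (b j - q) = q ^ 2 - f q := by
    intro j h1 h2
    rw [hcol j h1 h2]; ring
  have hsum : ∀ j, i ≤ j + 3 → j ≤ i + 3 → a j - q + (b j - q) = t j - 2 * q := by
    intro j h1 h2
    have e1 := lslope j (by omega) (a j) (Or.inl rfl)
    have hne : a j - q ≠ 0 := sub_ne_zero.2 (N.qa j (by omega)).symm
    rw [(mem_Par.1 (hP j h1 h2).1).2, hcol j h1 h2] at e1
    have : (a j - q) * (a j + b j - t j) = 0 := by linarith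
    have := (mul_eq_zero.1 this).resolve_left hne
    linarith
  have hBr : ∀ j, i ≤ j + 3 → j + 1 ≤ i + 3 → Br q (q ^ 2 - f q) (a j) (a (j+1)) ∧ Br q (q ^ 2 - f q) (b j) (b (j+1)) := by
    intro j h1 h2
    refine br_of (h.cyc j (by omega)) (hprod j h1 (by omega)) (h.cyc (j+1) (by omega)) (hprod (j+1) (by omega) h2) ?_
    rw [hsum j h1 (by omega), hsum (j+1) (by omega) h2]
    have m1 := hM j (by omega)
    have m2 := hM (j+1) (by omega)
    rcases i4 with i4 | i4
    · right
      have := m1.2 (by omega)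
      have := m2.2 (by omega)
      constructor <;> linarith
    · left
      have := mt m1.1 (by omega)
      have := mt m2.1 (by omega)
      constructor <;> linarith
  have p1q := N.p1q (by omega)
  have hl' : f q = ((p1 * q - f q) / (p1 - q) - (q * p1 - f p1) / (p1 - q)) * q + (p1 * f q - f p1 * q) / (p1 - q) := by
    have : p1 - q ≠ 0 := sub_ne_zero.2 p1q
    field_simp; ring
  have hcol1 : ∀ j, i ≤ j + 3 → j + 1 ≤ i + 3 → f p1 = (a j + b (j+1)) * p1 - a j * b (j+1) := fun j h1 h2 =>
    col3_par (h.c1 j (by omega)) (hP j h1 (by omega)).1 (hP (j+1) (by omega) h2).2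
  rcases hu with rfl | rfl
  · refine chain_good (t := t) (by omega) (fun j h1 h2 => ⟨(hP j h1 h2).1, lslope j (by omega) _ (Or.inl rfl)⟩)
      (fun j h1 h2 => ⟨h.slope j (by omega), h.next j (by omega)⟩) (fun j h1 h2 => (hBr j h1 h2).1)
      (fun j h1 h2 => mr_of p1q (hcol1 j h1 h2) (hcol (j+1) (by omega) h2)) hl'
  · refine chain_good (t := t) (A := -((q * p1 - f p1) / (p1 - q))) (D := -((p1 * q - f q) / (p1 - q)))
      (β := (p1 * f q - f p1 * q) / (p1 - q)) (by omega)
      (fun j h1 h2 => ⟨(hP j h1 h2).2, lslope j (by omega) _ (Or.inr rfl)⟩)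
      (fun j h1 h2 => ⟨h.slope j (by omega), h.next j (by omega)⟩) (fun j h1 h2 => (hBr j h1 h2).2)
      (fun j h1 h2 => ?_) (by linarith)
    have := mr_of (a := b (j+1)) (a' := b j) (b' := a j) (d := f p1) (y := f q) p1q (by linarith [hcol1 j h1 h2])
      (by linarith [hcol j h1 (by omega)])
    unfold MR at this ⊢
    linarith

lemma par_line_card {q s : ℝ} (V : Fr) (h : ∀ u ∈ V, u ∈ Par X f ∧ f u - f q = s * (u - q)) : V.card ≤ 2 := by
  by_contra hc
  push Not at hc
  obtain ⟨a, b, c, ha, hb, hc', hab, hac, hbc⟩ := two_lt_card_iff.1 hc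
  have e := fun u hu => (mem_Par.1 (h u hu).1).2
  have h1 := (h a ha).2
  have h2 := (h b hb).2
  have h3 := (h c hc').2
  rw [e a ha] at h1
  rw [e b hb] at h2
  rw [e c hc'] at h3
  have k1 : (a - b) * (a + b - s) = 0 := by linarith
  have k2 : (a - c) * (a + c - s) = 0 := by linarith
  have k1' := (mul_eq_zero.1 k1).resolve_left (sub_ne_zero.2 hab)
  have k2' := (mul_eq_zero.1 k2).resolve_left (sub_ne_zero.2 hac)
  exact hbc (by linarith)

open Classical in
theorem runs_good {q : ℝ} {m : ℕ} (R : Runs X f q m) (hq : f q ≠ q * q) :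
    ((Par X f).filter (fun u => ¬ GoodW (Par X f) f q u)).card ≤ 62 * (m + 1) := by
  choose V hVc hV using fun k => run_good (R.run k) hq
  have hsub : (Par X f).filter (fun u => ¬ GoodW (Par X f) f q u) ⊆
      (R.B.biUnion (fun s => (Par X f).filter (fun u => f u - f q = s * (u - q)))) ∪ (range (m+1)).biUnion V := by
    intro u hu0
    obtain ⟨hu, hn⟩ := mem_filter.1 hu0
    clear hu0
    have huq : u ≠ q := by rintro rfl; exact hq (mem_Par.1 hu).2
    have hsz : f u - f q = ((f u - f q) / (u - q)) * (u - q) := by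
      rw [div_mul_cancel₀]; exact sub_ne_zero.2 huq
    obtain ⟨s, hs⟩ : ∃ s, s = (f u - f q) / (u - q) := ⟨_, rfl⟩
    rw [← hs] at hsz
    by_cases hB : s ∈ R.B
    · exact mem_union_left _ (mem_biUnion.2 ⟨s, hB, mem_filter.2 ⟨hu, hsz⟩⟩)
    · have hL : u ∈ Ln X f q s := mem_Ln.2 ⟨(mem_Par.1 hu).1, hsz⟩
      obtain ⟨k, hk, i, hi, hki⟩ := R.cover s (mem_Sl.2 ⟨u, hL, huq⟩) hB
      rw [← hki, (R.run k).line i hi] at hL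
      simp only [mem_insert, mem_singleton] at hL
      have := (hV k i hi u (hL.resolve_left huq) hu).resolve_right hn
      exact mem_union_right _ (mem_biUnion.2 ⟨k, by simp; omega, this⟩)
  refine (card_le_card hsub).trans ((card_union_le _ _).trans ?_)
  have e1 := card_biUnion_le_card_mul R.B (fun s => (Par X f).filter (fun u => f u - f q = s * (u - q))) 2
    (fun s _ => par_line_card (X := X) (f := f) (q := q) (s := s) _ (fun u hu => mem_filter.1 hu))
  have e2 := card_biUnion_le_card_mul (range (m+1)) V 60 (fun k _ => hVc k)
  rw [card_range] at e2
  have := R.Bcard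
  omega

open Classical in
theorem line_exists (Q : Fr) (hQ : ∀ q ∈ Q, 3 * ((Par X f).filter (fun u => ¬ GoodW (Par X f) f q u)).card < (Par X f).card) :
    ∃ α β : ℝ, ∀ q ∈ Q, f q = α * q + β := by
  by_cases hc : Q.card ≤ 1
  · rw [Finset.card_le_one_iff_subset_singleton] at hc
    obtain ⟨q, hq⟩ := hc
    refine ⟨0, f q, fun x hx => ?_⟩
    have := mem_singleton.1 (hq hx)
    rw [this]; ring
  push Not at hc
  obtain ⟨q1, h1, q2, h2, h12⟩ := one_lt_card.1 hc
  refine ⟨(f q2 - f q1) / (q2 - q1), f q1 - (f q2 - f q1) / (q2 - q1) * q1, fun q hq => ?_⟩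
  have : ∃ u ∈ Par X f, GoodW (Par X f) f q1 u ∧ GoodW (Par X f) f q2 u ∧ GoodW (Par X f) f q u := by
    by_contra hn
    push Not at hn
    set B := fun q => (Par X f).filter (fun u => ¬ GoodW (Par X f) f q u)
    have hs : Par X f ⊆ B q1 ∪ B q2 ∪ B q := by
      intro u hu
      have := hn u hu
      simp only [B, mem_union, mem_filter]
      tauto
    have c1 := card_le_card hs
    have c2 := card_union_le (B q1 ∪ B q2) (B q)
    have c3 := card_union_le (B q1) (B q2)
    have d1 := hQ q1 h1
    have d2 := hQ q2 h2
    have d3 := hQ q hq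
    change 3 * (B q1).card < _ at d1
    change 3 * (B q2).card < _ at d2
    change 3 * (B q).card < _ at d3
    omega
  obtain ⟨u, -, g1, g2, g3⟩ := this
  obtain ⟨w1, w2, w3, A, D, β, a1, a2, a3, m1, m2, m3, hl⟩ := g1
  have key : ∀ q', GoodW (Par X f) f q' u → f q' = (A - D) * q' + β := by
    rintro q' ⟨v1, v2, v3, A', D', β', b1, b2, b3, n1, n2, n3, hl'⟩
    obtain rfl := a1.uniq b1
    obtain rfl := a2.uniq b2
    obtain rfl := a3.uniq b3
    obtain ⟨rfl, rfl, rfl⟩ := MR.uniq a1.2.2.1 a2.2.2.1 a3.2.2.1 m1 m2 m3 n1 n2 n3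
    exact hl'
  have k2 := key _ g2
  have k3 := key _ g3
  have : q2 - q1 ≠ 0 := sub_ne_zero.2 (Ne.symm h12)
  rw [k2, k3, hl]
  field_simp
  ring

end GT

namespace GT
variable {X : Fr} {f : Fn}

/-- collinearity of three points of the graph of `f` -/
def Co (f : Fn) (x y z : ℝ) : Prop := (f y - f x) * (z - x) = (f z - f x) * (y - x)

lemma Co.rot {x y z : ℝ} (h : Co f x y z) : Co f y z x := by unfold Co at *; linarith
lemma Co.swap {x y z : ℝ} (h : Co f x y z) : Co f x z y := by unfold Co at *; linarith

lemma Co.trans {e u v w : ℝ} (h1 : Co f e u v) (h2 : Co f e u w) (h : e ≠ u) : Co f u v w := by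
  unfold Co at *
  have h0 : u - e ≠ 0 := sub_ne_zero.2 (Ne.symm h)
  apply mul_left_cancel₀ h0
  linear_combination (u - w) * h1 + (v - u) * h2

lemma not_ord {u v : ℝ} (hu : u ∈ X) (hv : v ∈ X) (huv : u ≠ v) (h : ({u, v} : Fr) ∉ ordPairs X f) :
    ∃ x ∈ X, x ≠ u ∧ x ≠ v ∧ Co f x u v := by
  by_contra hc
  push Not at hc
  apply h
  have h0 : v - u ≠ 0 := sub_ne_zero.2 (Ne.symm huv)
  refine mem_ordPairs (t := (f v - f u) / (v - u)) (c := f u - (f v - f u) / (v - u) * u) hu hv huv (by ring)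
    (by field_simp; ring) (fun x hx hfx => ?_)
  by_contra hn
  push Not at hn
  refine hc x hx hn.1 hn.2 ?_
  unfold Co
  rw [hfx]
  field_simp
  ring

lemma cnt (F : Finset (ℝ × ℝ)) (h : ∀ p ∈ F, PR(p) ∈ ordPairs X f)
    (ha : ∀ p ∈ F, (p.2, p.1) ∉ F) : F.card ≤ N2 X f := by
  classical
  unfold N2
  refine card_le_card_of_injOn (fun p => {p.1, p.2}) h ?_
  intro p hp p' hp' hpp
  have hp := mem_coe.1 hp
  have hp' := mem_coe.1 hp'
  obtain ⟨a, b⟩ := p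
  obtain ⟨c, d⟩ := p'
  simp only at hpp
  have hcd : ({c, d} : Set ℝ) = {a, b} := by
    have := congrArg (fun s : Fr => (s : Set ℝ)) hpp
    simpa using this.symm
  rcases Set.pair_eq_pair_iff.1 hcd with ⟨rfl, rfl⟩ | ⟨rfl, rfl⟩
  · rfl
  · exact absurd hp' (ha _ hp)

lemma exc (R : ℝ → ℝ → ℝ → Prop) (A E : Fr) (F : Finset (ℝ × ℝ)) (h1 : ∀ p ∈ F, p.1 ∈ A) (h2 : ∀ p ∈ F, ∃ e ∈ E, R e p.1 p.2)
    (h3 : ∀ u v w e, (u, v) ∈ F → (u, w) ∈ F → e ∈ E → R e u v → R e u w → v = w) : F.card ≤ A.card * E.card := by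
  classical
  choose! g hg hc using h2
  rw [← card_product]
  refine card_le_card_of_injOn (fun p => (p.1, g p)) (fun p hp => ?_) ?_
  · exact mem_coe.2 (mem_product.2 ⟨h1 p hp, hg p hp⟩)
  · rintro ⟨a, b⟩ hp ⟨a', b'⟩ hp' h
    simp only [Prod.mk.injEq] at h
    obtain ⟨rfl, h⟩ := h
    have k1 := hc _ hp
    have k2 := hc _ hp'
    rw [← h] at k2
    rw [h3 _ _ _ _ hp hp' (hg _ hp) k1 k2]

structure Cfg (X : Fr) (f : Fn) (α β : ℝ) (S T E : Fr) : Prop where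
  mS : ∀ x, x ∈ S ↔ x ∈ X ∧ f x = x * x ∧ f x ≠ α * x + β
  mT : ∀ x, x ∈ T ↔ x ∈ X ∧ f x ≠ x * x ∧ f x = α * x + β
  mE : ∀ x, x ∈ E ↔ x ∈ X ∧ x ∉ S ∧ x ∉ T

namespace Cfg
variable {α β : ℝ} {S T E : Fr}

lemma card (h : Cfg X f α β S T E) : X.card = S.card + T.card + E.card := by
  classical
  have h1 : Disjoint S T := disjoint_left.2 fun x hx hx' => ((h.mT x).1 hx').2.1 ((h.mS x).1 hx).2.1
  have h2 : Disjoint (S ∪ T) E := by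
    rw [disjoint_left]
    intro x hx hx'
    have := (h.mE x).1 hx'
    rcases mem_union.1 hx with hx | hx
    · exact this.2.1 hx
    · exact this.2.2 hx
  rw [← card_union_of_disjoint h1, ← card_union_of_disjoint h2]
  congr 1
  ext x
  simp only [mem_union]
  have a := h.mS x; have b := h.mT x; have c := h.mE x
  constructor
  · intro hx
    by_cases h1 : x ∈ S
    · exact Or.inl (Or.inl h1)
    · by_cases h2 : x ∈ T
      · exact Or.inl (Or.inr h2)
      · exact Or.inr (c.2 ⟨hx, h1, h2⟩)
  · rintro ((hx | hx) | hx)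
    exacts [(a.1 hx).1, (b.1 hx).1, (c.1 hx).1]

lemma ne_ST (h : Cfg X f α β S T E) {u t : ℝ} (hu : u ∈ S) (ht : t ∈ T) : u ≠ t := by
  rintro rfl; exact ((h.mT u).1 ht).2.1 ((h.mS u).1 hu).2.1
lemma ne_SE (h : Cfg X f α β S T E) {u e : ℝ} (hu : u ∈ S) (he : e ∈ E) : u ≠ e := by
  rintro rfl; exact ((h.mE u).1 he).2.1 hu
lemma ne_TE (h : Cfg X f α β S T E) {t e : ℝ} (ht : t ∈ T) (he : e ∈ E) : t ≠ e := by
  rintro rfl; exact ((h.mE t).1 he).2.2 ht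

lemma co1 (h : Cfg X f α β S T E) {u v w : ℝ} (hu : u ∈ S) (hv : v ∈ S) (hw : w ∈ S) (hc : Co f u v w)
    (huv : u ≠ v) (huw : u ≠ w) : v = w := by
  unfold Co at hc
  rw [((h.mS u).1 hu).2.1, ((h.mS v).1 hv).2.1, ((h.mS w).1 hw).2.1] at hc
  have : (v - u) * ((w - u) * (v - w)) = 0 := by linarith
  rcases mul_eq_zero.1 this with h | h
  · exact absurd (by linarith) huv
  rcases mul_eq_zero.1 h with h | h
  · exact absurd (by linarith) huw
  · linarith

lemma co2 (h : Cfg X f α β S T E) {u t t' : ℝ} (hu : u ∈ S) (ht : t ∈ T) (ht' : t' ∈ T) (hc : Co f u t t') : t = t' := by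
  unfold Co at hc
  rw [((h.mT t).1 ht).2.2, ((h.mT t').1 ht').2.2] at hc
  have h1 := ((h.mS u).1 hu).2.2
  have : (t - t') * (f u - (α * u + β)) = 0 := by linarith
  have := (mul_eq_zero.1 this).resolve_right (sub_ne_zero.2 h1)
  linarith

lemma co3 (h : Cfg X f α β S T E) {u u' t : ℝ} (hu : u ∈ S) (hu' : u' ∈ S) (ht : t ∈ T) (huu : u ≠ u') :
    Co f t u u' ↔ u * u' + β = t * (u + u' - α) := by
  unfold Co
  rw [((h.mS u).1 hu).2.1, ((h.mS u').1 hu').2.1, ((h.mT t).1 ht).2.2]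
  constructor
  · intro hc
    have : (u - u') * (u * u' + β - t * (u + u' - α)) = 0 := by linarith
    have := (mul_eq_zero.1 this).resolve_left (sub_ne_zero.2 huu)
    linarith
  · intro hc
    linear_combination (u - u') * hc

lemma st (h : Cfg X f α β S T E) {u t : ℝ} (hu : u ∈ S) (ht : t ∈ T) (hn : ({u, t} : Fr) ∉ ordPairs X f) :
    (∃ e ∈ E, Co f e u t) ∨ ∃ v ∈ S, v ≠ u ∧ Co f t u v := by
  obtain ⟨x, hx, h1, h2, h3⟩ := not_ord ((h.mS u).1 hu).1 ((h.mT t).1 ht).1 (h.ne_ST hu ht) hn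
  by_cases hS : x ∈ S
  · exact Or.inr ⟨x, hS, h1, h3.rot.rot.swap⟩
  by_cases hT : x ∈ T
  · exact absurd (h.co2 hu ht hT h3.rot) (Ne.symm h2)
  · exact Or.inl ⟨x, (h.mE x).2 ⟨hx, hS, hT⟩, h3⟩

lemma ss (h : Cfg X f α β S T E) {u v : ℝ} (hu : u ∈ S) (hv : v ∈ S) (huv : u ≠ v) (hn : ({u, v} : Fr) ∉ ordPairs X f) :
    (∃ e ∈ E, Co f e u v) ∨ ∃ t ∈ T, Co f t u v := by
  obtain ⟨x, hx, h1, h2, h3⟩ := not_ord ((h.mS u).1 hu).1 ((h.mS v).1 hv).1 huv hn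
  by_cases hS : x ∈ S
  · exact absurd (h.co1 hS hu hv h3 h1 h2) huv
  by_cases hT : x ∈ T
  · exact Or.inr ⟨x, hT, h3⟩
  · exact Or.inl ⟨x, (h.mE x).2 ⟨hx, hS, hT⟩, h3⟩

/-- uniqueness: a point off `u` sees at most one other point of `S` on the line through `u` -/
lemma uniqS (h : Cfg X f α β S T E) {u v w e : ℝ} (hu : u ∈ S) (hv : v ∈ S) (hw : w ∈ S) (heu : e ≠ u) (huv : u ≠ v) (huw : u ≠ w)
    (h1 : Co f e u v) (h2 : Co f e u w) : v = w := h.co1 hu hv hw (h1.trans h2 heu) huv huw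

lemma uniqT (h : Cfg X f α β S T E) {u t t' e : ℝ} (hu : u ∈ S) (ht : t ∈ T) (ht' : t' ∈ T) (heu : e ≠ u)
    (h1 : Co f e u t) (h2 : Co f e u t') : t = t' := h.co2 hu ht ht' (h1.trans h2 heu)

end Cfg

end GT

namespace GT
variable {X : Fr} {f : Fn} {α β : ℝ} {S T E : Fr}

lemma Cfg.cntST (h : Cfg X f α β S T E) (F : Finset (ℝ × ℝ)) (hF : ∀ p ∈ F, p.1 ∈ S ∧ p.2 ∈ T)
    (ho : ∀ p ∈ F, PR(p) ∈ ordPairs X f) : F.card ≤ N2 X f :=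
  cnt F ho fun p hp hp' => h.ne_ST (hF p hp).1 (hF _ hp').2 rfl

lemma Cfg.excST (h : Cfg X f α β S T E) (F : Finset (ℝ × ℝ)) (hF : ∀ p ∈ F, p.1 ∈ S ∧ p.2 ∈ T)
    (ho : ∀ p ∈ F, ∃ e ∈ E, Co f e p.1 p.2) : F.card ≤ S.card * E.card :=
  exc (Co f) S E F (fun p hp => (hF p hp).1) ho fun _ _ _ _ h1 h2 h3 h4 h5 =>
    h.uniqT (hF _ h1).1 (hF _ h1).2 (hF _ h2).2 (h.ne_SE (hF _ h1).1 h3).symm h4 h5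

open Classical in
/-- the points `u ∈ S` with no partner with respect to `t` -/
def badU (S : Fr) (α β t : ℝ) : Fr :=
  S.filter (fun u => ∀ v ∈ S, u * v + β ≠ t * (u + v - α))

lemma Cfg.countC (h : Cfg X f α β S T E) : ∑ t ∈ T, (badU S α β t).card ≤ N2 X f + S.card * E.card := by
  classical
  set F := (S ×ˢ T).filter (fun p => p.1 ∈ badU S α β p.2) with hFd
  have hF : ∀ p ∈ F, p.1 ∈ S ∧ p.2 ∈ T := fun p hp => mem_product.1 (mem_filter.1 hp).1
  have e0 : ∑ t ∈ T, (badU S α β t).card = F.card := by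
    rw [hFd, card_filter, Finset.sum_product_right]
    refine sum_congr rfl fun t _ => ?_
    rw [← card_filter]
    congr 1
    ext u
    simp only [badU, mem_filter]
    tauto
  rw [e0, ← card_filter_add_card_filter_not (s := F) (fun p => PR(p) ∈ ordPairs X f)]
  refine Nat.add_le_add (h.cntST _ (fun p hp => hF p (mem_filter.1 hp).1) (fun p hp => (mem_filter.1 hp).2))
    (h.excST _ (fun p hp => hF p (mem_filter.1 hp).1) (fun p hp => ?_))
  obtain ⟨hp, hn⟩ := mem_filter.1 hp
  obtain ⟨hu, ht⟩ := hF p hp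
  refine (h.st hu ht hn).resolve_right ?_
  rintro ⟨v, hv, hvu, hco⟩
  have := (mem_filter.1 (mem_filter.1 hp).2).2 v hv
  exact this ((h.co3 hu hv ht hvu.symm).1 hco)

lemma Cfg.countA (h : Cfg X f α β S T E) : S.card * T.card ≤ N2 X f + S.card * E.card + S.card * S.card := by
  classical
  set F := S ×ˢ T with hFd
  have hF : ∀ p ∈ F, p.1 ∈ S ∧ p.2 ∈ T := fun p hp => mem_product.1 hp
  rw [← card_product, ← hFd,
    ← card_filter_add_card_filter_not (s := F) (fun p => PR(p) ∈ ordPairs X f),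
    ← card_filter_add_card_filter_not (s := F.filter (fun p => PR(p) ∉ ordPairs X f)) (fun p => ∃ e ∈ E, Co f e p.1 p.2), ← add_assoc]
  refine Nat.add_le_add (Nat.add_le_add (h.cntST _ (fun p hp => hF p (mem_filter.1 hp).1) (fun p hp => (mem_filter.1 hp).2))
    (h.excST _ (fun p hp => hF p (mem_filter.1 (mem_filter.1 hp).1).1) (fun p hp => (mem_filter.1 hp).2))) ?_
  have hF' : ∀ p ∈ ((F.filter fun p => PR(p) ∉ ordPairs X f).filter fun p => ¬ ∃ e ∈ E, Co f e p.1 p.2),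
    p.1 ∈ S ∧ p.2 ∈ T := fun p hp => hF p (mem_filter.1 (mem_filter.1 hp).1).1
  refine exc (fun e u v => e ≠ u ∧ Co f e u v) S S _ (fun p hp => (hF' p hp).1) ?_ ?_
  · intro p hp
    obtain ⟨h1, h2⟩ := mem_filter.1 hp
    obtain ⟨v, hv, hvu, hc⟩ := (h.st (hF' p hp).1 (hF' p hp).2 (mem_filter.1 h1).2).resolve_left h2
    exact ⟨v, hv, hvu, hc.rot.rot.swap⟩
  · intro u v w e h1 h2 he k1 k2
    exact h.uniqT (hF' _ h1).1 (hF' _ h1).2 (hF' _ h2).2 k1.1 k1.2 k2.2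

lemma Cfg.countB (h : Cfg X f α β S T E) : S.card * S.card ≤ S.card + 2 * N2 X f + S.card * E.card + S.card * T.card := by
  classical
  have hF : ∀ p ∈ S.offDiag, p.1 ∈ S ∧ p.2 ∈ S ∧ p.1 ≠ p.2 := fun p hp => Finset.mem_offDiag.1 hp
  have hc : S.card * S.card ≤ S.card + S.offDiag.card := by
    rw [Finset.offDiag_card]; omega
  refine hc.trans ?_
  have hsub : S.offDiag ⊆ (S.offDiag.filter (fun p => p.1 < p.2 ∧ PR(p) ∈ ordPairs X f)) ∪
    (S.offDiag.filter (fun p => p.2 < p.1 ∧ PR(p) ∈ ordPairs X f)) ∪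
    (S.offDiag.filter (fun p => ∃ e ∈ E, Co f e p.1 p.2)) ∪ (S.offDiag.filter (fun p => ∃ e ∈ T, Co f e p.1 p.2)) := by
    intro p hp
    simp only [mem_union, mem_filter]
    by_cases ho : PR(p) ∈ ordPairs X f
    · rcases lt_or_gt_of_ne (hF p hp).2.2 with h1 | h1
      · exact Or.inl (Or.inl (Or.inl ⟨hp, h1, ho⟩))
      · exact Or.inl (Or.inl (Or.inr ⟨hp, h1, ho⟩))
    · rcases h.ss (hF p hp).1 (hF p hp).2.1 (hF p hp).2.2 ho with h1 | h1
      · exact Or.inl (Or.inr ⟨hp, h1⟩)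
      · exact Or.inr ⟨hp, h1⟩
  have c0 := card_le_card hsub
  have c1 : (S.offDiag.filter (fun p => p.1 < p.2 ∧ PR(p) ∈ ordPairs X f)).card ≤ N2 X f :=
    cnt _ (fun p hp => (mem_filter.1 hp).2.2) (fun p hp hp' => by
      have := (mem_filter.1 hp).2.1
      have := (mem_filter.1 hp').2.1
      linarith)
  have c2 : (S.offDiag.filter (fun p => p.2 < p.1 ∧ PR(p) ∈ ordPairs X f)).card ≤ N2 X f :=
    cnt _ (fun p hp => (mem_filter.1 hp).2.2) (fun p hp hp' => by
      have := (mem_filter.1 hp).2.1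
      have := (mem_filter.1 hp').2.1
      linarith)
  have c3 : (S.offDiag.filter (fun p => ∃ e ∈ E, Co f e p.1 p.2)).card ≤ S.card * E.card :=
    exc (Co f) S E _ (fun p hp => (hF p (mem_filter.1 hp).1).1) (fun p hp => (mem_filter.1 hp).2)
      (fun u v w e h1 h2 he k1 k2 => by
        have a1 := hF _ (mem_filter.1 h1).1
        have a2 := hF _ (mem_filter.1 h2).1
        exact h.uniqS a1.1 a1.2.1 a2.2.1 (h.ne_SE a1.1 he).symm a1.2.2 a2.2.2 k1 k2)
  have c4 : (S.offDiag.filter (fun p => ∃ e ∈ T, Co f e p.1 p.2)).card ≤ S.card * T.card :=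
    exc (Co f) S T _ (fun p hp => (hF p (mem_filter.1 hp).1).1) (fun p hp => (mem_filter.1 hp).2)
      (fun u v w e h1 h2 he k1 k2 => by
        have a1 := hF _ (mem_filter.1 h1).1
        have a2 := hF _ (mem_filter.1 h2).1
        exact h.uniqS a1.1 a1.2.1 a2.2.1 (h.ne_ST a1.1 he).symm a1.2.2 a2.2.2 k1 k2)
  have d1 := card_union_le ((S.offDiag.filter (fun p => p.1 < p.2 ∧ PR(p) ∈ ordPairs X f)) ∪
    (S.offDiag.filter (fun p => p.2 < p.1 ∧ PR(p) ∈ ordPairs X f)) ∪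
    (S.offDiag.filter (fun p => ∃ e ∈ E, Co f e p.1 p.2))) (S.offDiag.filter (fun p => ∃ e ∈ T, Co f e p.1 p.2))
  have d2 := card_union_le ((S.offDiag.filter (fun p => p.1 < p.2 ∧ PR(p) ∈ ordPairs X f)) ∪
    (S.offDiag.filter (fun p => p.2 < p.1 ∧ PR(p) ∈ ordPairs X f)))
    (S.offDiag.filter (fun p => ∃ e ∈ E, Co f e p.1 p.2))
  have d3 := card_union_le (S.offDiag.filter (fun p => p.1 < p.2 ∧ PR(p) ∈ ordPairs X f))
    (S.offDiag.filter (fun p => p.2 < p.1 ∧ PR(p) ∈ ordPairs X f))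
  omega

lemma par_line2 (α β : ℝ) : ((Par X f).filter (fun x => f x = α * x + β)).card ≤ 2 := by
  by_contra hc
  push Not at hc
  obtain ⟨a, b, c, ha, hb, hc', hab, hac, hbc⟩ := two_lt_card_iff.1 hc
  obtain ⟨a1, a2⟩ := mem_filter.1 ha
  obtain ⟨b1, b2⟩ := mem_filter.1 hb
  obtain ⟨c1, c2⟩ := mem_filter.1 hc'
  rw [(mem_Par.1 a1).2] at a2
  rw [(mem_Par.1 b1).2] at b2
  rw [(mem_Par.1 c1).2] at c2
  have k1 : (a - b) * (a + b - α) = 0 := by linarith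
  have k2 : (a - c) * (a + c - α) = 0 := by linarith
  have k1' := (mul_eq_zero.1 k1).resolve_left (sub_ne_zero.2 hab)
  have k2' := (mul_eq_zero.1 k2).resolve_left (sub_ne_zero.2 hac)
  exact hbc (by linarith)

lemma size_arith {n S T E E' s N C : ℕ} (hn : n = S + T + E) (hN : N ≤ n)
    (a : S * T ≤ N + S * E + S * S) (b : S * S ≤ S + 2 * N + S * E + S * T) (hs : S ≤ s) (hs2 : s ≤ S + 2)
    (hE : E ≤ E' + 2) (hC : s * E' ≤ C * n) (hM : 200 * C + 400 < s) (hn0 : 1000 ≤ n) :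
    E ≤ 3 * C + 2 ∧ 9 * n ≤ 20 * S ∧ 9 * n ≤ 20 * T := by
  have e1 : 200 * E' ≤ n := by
    by_contra hc
    push Not at hc
    rcases Nat.eq_zero_or_pos C with h0 | h0
    · subst h0
      have : 400 * E' ≤ s * E' := Nat.mul_le_mul_right _ (by omega)
      omega
    have h1 : 200 * C * E' ≤ s * E' := Nat.mul_le_mul_right _ (by omega)
    have h2 : C * n < C * (200 * E') := Nat.mul_lt_mul_of_pos_left hc h0
    nlinarith
  have S0 : 200 ≤ S := by omega
  have e2 : 200 * T ≤ n + 200 * E + 200 * S := by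
    refine Nat.le_of_mul_le_mul_left (c := S) ?_ (by omega)
    have : 200 * n ≤ S * n := Nat.mul_le_mul_right _ S0
    nlinarith
  have e3 : 100 * S ≤ 100 + n + 100 * E + 100 * T := by
    refine Nat.le_of_mul_le_mul_left (c := S) ?_ (by omega)
    have : 200 * n ≤ S * n := Nat.mul_le_mul_right _ S0
    nlinarith
  have e4 : 9 * n ≤ 20 * S := by omega
  refine ⟨?_, e4, by omega⟩
  have : E' ≤ 3 * C := by
    by_contra hc
    push Not at hc
    have h1 : n * (9 * E') ≤ n * (20 * C) := by nlinarith
    have h2 := Nat.le_of_mul_le_mul_left h1 (by omega)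
    omega
  omega

theorem sizes : ∃ M2 n0 KE : ℕ, ∀ X f, n0 ≤ X.card → M2 < (Par X f).card → N2 X f ≤ X.card →
    ∃ α β S T E, Cfg X f α β S T E ∧ E.card ≤ KE ∧ 9 * X.card ≤ 20 * S.card ∧ 9 * X.card ≤ 20 * T.card := by
  classical
  obtain ⟨C0, hC0⟩ := runs_exist
  obtain ⟨C, hC⟩ : ∃ C, C = 186 * (2 * C0 + 1) := ⟨_, rfl⟩
  refine ⟨200 * C + 400, 1000, 3 * C + 2, fun X f hn hM hN => ?_⟩
  obtain ⟨bd, hbd, hR⟩ := hC0 X f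
  obtain ⟨α, β, hl⟩ := line_exists (X := X) (f := f) (X.filter (fun q => f q ≠ q * q ∧ 186 * (bd q + 1) < (Par X f).card)) (by
    intro q hq
    obtain ⟨h1, h2, h3⟩ := mem_filter.1 hq
    obtain ⟨R⟩ := hR q h1
    have := runs_good R h2
    omega)
  set E' := X.filter (fun q => f q ≠ q * q ∧ ¬ 186 * (bd q + 1) < (Par X f).card) with hE'
  have cfg : Cfg X f α β (X.filter (fun x => f x = x * x ∧ f x ≠ α * x + β)) (X.filter (fun x => f x ≠ x * x ∧ f x = α * x + β))
      ((X \ (X.filter (fun x => f x = x * x ∧ f x ≠ α * x + β))) \ (X.filter (fun x => f x ≠ x * x ∧ f x = α * x + β))) :=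
    ⟨fun x => by simp, fun x => by simp, fun x => by simp only [mem_sdiff]; tauto⟩
  obtain ⟨S, hS⟩ : ∃ S, S = X.filter (fun x => f x = x * x ∧ f x ≠ α * x + β) := ⟨_, rfl⟩
  obtain ⟨T, hT⟩ : ∃ T, T = X.filter (fun x => f x ≠ x * x ∧ f x = α * x + β) := ⟨_, rfl⟩
  rw [← hS, ← hT] at cfg
  obtain ⟨E, hE⟩ : ∃ E, E = (X \ S) \ T := ⟨_, rfl⟩
  rw [← hE] at cfg
  refine ⟨α, β, S, T, E, cfg, ?_⟩
  have hSP : S ⊆ Par X f := fun x hx => mem_Par.2 ⟨((cfg.mS x).1 hx).1, ((cfg.mS x).1 hx).2.1⟩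
  have hp2 := par_line2 (X := X) (f := f) α β
  have hEs : E ⊆ E' ∪ (Par X f).filter (fun x => f x = α * x + β) := by
    intro x hx
    obtain ⟨h1, h2, h3⟩ := (cfg.mE x).1 hx
    rw [cfg.mS] at h2
    rw [cfg.mT] at h3
    by_cases hp : f x = x * x
    · refine mem_union_right _ (mem_filter.2 ⟨mem_Par.2 ⟨h1, hp⟩, ?_⟩)
      by_contra hc
      exact h2 ⟨h1, hp, hc⟩
    · refine mem_union_left _ (mem_filter.2 ⟨h1, hp, fun hlt => ?_⟩)
      exact h3 ⟨h1, hp, hl x (mem_filter.2 ⟨h1, hp, hlt⟩)⟩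
  have hEc := (card_le_card hEs).trans (card_union_le _ _)
  have hPs : Par X f ⊆ S ∪ (Par X f).filter (fun x => f x = α * x + β) := by
    intro x hx
    by_cases hp : f x = α * x + β
    · exact mem_union_right _ (mem_filter.2 ⟨hx, hp⟩)
    · exact mem_union_left _ ((cfg.mS x).2 ⟨(mem_Par.1 hx).1, (mem_Par.1 hx).2, hp⟩)
  have hPc := (card_le_card hPs).trans (card_union_le _ _)
  have hmul : (Par X f).card * E'.card ≤ C * X.card := by
    have h1 : E'.card * (Par X f).card ≤ ∑ q ∈ E', 186 * (bd q + 1) := by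
      rw [← smul_eq_mul]
      refine card_nsmul_le_sum _ _ _ fun q hq => ?_
      have := (mem_filter.1 hq).2.2
      omega
    have h2 : ∑ q ∈ E', 186 * (bd q + 1) ≤ ∑ q ∈ X, 186 * (bd q + 1) :=
      sum_le_sum_of_subset (filter_subset _ _)
    have h4 : ∑ q ∈ X, 186 * (bd q + 1) = 186 * (∑ q ∈ X, bd q + X.card) := by
      rw [← mul_sum, sum_add_distrib]; simp
    have h3 : C0 * (X.card + N2 X f) ≤ C0 * (2 * X.card) := Nat.mul_le_mul_left _ (by omega)
    rw [hC]
    nlinarith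
  exact size_arith cfg.card hN cfg.countA cfg.countB (card_le_card hSP) (by omega) (by omega) hmul hM hn

end GT

namespace GT

open Classical in
/-- defect of translating `A` by `h` -/
def dft {G : Type*} [CommGroup G] (A : Finset G) (h : G) : ℕ := (A.filter (fun a => h * a ∉ A)).card

section
variable {G : Type*} [CommGroup G] {A : Finset G}

lemma dft_mul (g h : G) : dft A (g * h) ≤ dft A g + dft A h := by
  classical
  unfold dft
  have hs : A.filter (fun a => g * h * a ∉ A) ⊆ A.filter (fun a => h * a ∉ A) ∪
      (A.filter (fun a => g * h * a ∉ A ∧ h * a ∈ A)) := by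
    intro a ha
    obtain ⟨h1, h2⟩ := mem_filter.1 ha
    by_cases h3 : h * a ∈ A
    · exact mem_union_right _ (mem_filter.2 ⟨h1, h2, h3⟩)
    · exact mem_union_left _ (mem_filter.2 ⟨h1, h3⟩)
  have c := (card_le_card hs).trans (card_union_le _ _)
  have : (A.filter (fun a => g * h * a ∉ A ∧ h * a ∈ A)).card ≤ (A.filter (fun a => g * a ∉ A)).card := by
    refine card_le_card_of_injOn (fun a => h * a) (fun a ha => ?_) (fun a _ b _ hab => mul_left_cancel hab)
    obtain ⟨h1, h2, h3⟩ := mem_filter.1 ha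
    exact mem_coe.2 (mem_filter.2 ⟨h3, by rwa [← mul_assoc]⟩)
  omega

lemma dft_compl (h : G) [DecidablePred (fun a => h * a ∈ A)] : (A.filter (fun a => h * a ∈ A)).card + dft A h = A.card := by
  classical
  unfold dft
  have := card_filter_add_card_filter_not (s := A) (fun a => h * a ∈ A)
  convert this using 2
  congr!

lemma dft_inv (h : G) : dft A h⁻¹ = dft A h := by
  classical
  have h1 := dft_compl (A := A) h
  have h2 := dft_compl (A := A) h⁻¹
  have : (A.filter (fun a => h * a ∈ A)).card = (A.filter (fun a => h⁻¹ * a ∈ A)).card := by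
    refine Finset.card_bij (fun a _ => h * a) (fun a ha => ?_) (fun a _ b _ hab => mul_left_cancel hab) (fun b hb => ?_)
    · obtain ⟨a1, a2⟩ := mem_filter.1 ha
      exact mem_filter.2 ⟨a2, by simpa using a1⟩
    · obtain ⟨a1, a2⟩ := mem_filter.1 hb
      exact ⟨h⁻¹ * b, mem_filter.2 ⟨a2, by simpa using a1⟩, by simp⟩
  omega

lemma dft_one : dft A 1 = 0 := by
  classical
  unfold dft
  rw [Finset.card_eq_zero, Finset.filter_eq_empty_iff]
  intro x hx; simpa using hx

lemma dft_count (Y : Finset G) (k : ℕ) (hY : ∀ h ∈ Y, dft A h ≤ k) : Y.card * A.card ≤ A.card * A.card + Y.card * k := by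
  classical
  have h1 : ∑ h ∈ Y, (A.filter (fun a => h * a ∈ A)).card ≤ A.card * A.card := by
    rw [← card_sigma, ← card_product]
    refine card_le_card_of_injOn (fun p => (p.2, p.1 * p.2)) (fun p hp => ?_) ?_
    · obtain ⟨_, h2⟩ := mem_sigma.1 hp
      obtain ⟨h3, h4⟩ := mem_filter.1 h2
      exact mem_coe.2 (mem_product.2 ⟨h3, h4⟩)
    · rintro ⟨a, b⟩ _ ⟨c, d⟩ _ h
      simp only [Prod.mk.injEq] at h
      obtain ⟨rfl, h⟩ := h
      rw [mul_right_cancel h]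
  have h2 : ∑ h ∈ Y, A.card ≤ ∑ h ∈ Y, ((A.filter (fun a => h * a ∈ A)).card + k) := by
    refine sum_le_sum fun h hh => ?_
    have := dft_compl (A := A) h
    have := hY h hh
    omega
  rw [sum_add_distrib] at h2
  simp only [sum_const, smul_eq_mul] at h2
  omega

open Classical in
theorem approx_grp (D : Finset G) (K : ℕ) (hA : 100 * (K + 1) ≤ A.card) (hDA : 4 * A.card ≤ 5 * D.card)
    (hD : ∀ t ∈ D, (A.filter (fun a => t * a⁻¹ ∉ A)).card ≤ K) :
    ∃ H : Subgroup G, ∃ Hf : Finset G, (∀ h, h ∈ Hf ↔ h ∈ H) ∧ ∃ x : G,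
      (A.filter (fun a => a * x⁻¹ ∉ Hf)).card ≤ 4 * K ∧ (Hf.filter (fun h => h * x ∉ A)).card ≤ 4 * K := by
  have hDD : ∀ t ∈ D, ∀ t' ∈ D, dft A (t' * t⁻¹) ≤ 2 * K := by
    intro t ht t' ht'
    unfold dft
    have hs : A.filter (fun a => t' * t⁻¹ * a ∉ A) ⊆ A.filter (fun a => t * a⁻¹ ∉ A) ∪
        (A.filter (fun a => t' * t⁻¹ * a ∉ A ∧ t * a⁻¹ ∈ A)) := by
      intro a ha
      obtain ⟨h1, h2⟩ := mem_filter.1 ha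
      by_cases h3 : t * a⁻¹ ∈ A
      · exact mem_union_right _ (mem_filter.2 ⟨h1, h2, h3⟩)
      · exact mem_union_left _ (mem_filter.2 ⟨h1, h3⟩)
    have c := (card_le_card hs).trans (card_union_le _ _)
    have : (A.filter (fun a => t' * t⁻¹ * a ∉ A ∧ t * a⁻¹ ∈ A)).card ≤ (A.filter (fun a => t' * a⁻¹ ∉ A)).card := by
      refine card_le_card_of_injOn (fun a => t * a⁻¹) (fun a ha => ?_) (fun a _ b _ hab => inv_injective (mul_left_cancel hab))
      obtain ⟨h1, h2, h3⟩ := mem_filter.1 ha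
      refine mem_coe.2 (mem_filter.2 ⟨h3, ?_⟩)
      rwa [mul_inv_rev, inv_inv, ← mul_assoc, mul_right_comm]
    have := hD t ht
    have := hD t' ht'
    omega
  have hDpos : 0 < D.card := by omega
  obtain ⟨t0, ht0⟩ := card_pos.1 hDpos
  have key : ∀ g : G, dft A g ≤ 4 * K → dft A g ≤ 2 * K := by
    intro g hg
    obtain ⟨Y, hY⟩ : ∃ Y, Y = D.image (fun t => t * t0⁻¹) := ⟨_, rfl⟩
    have hYc : Y.card = D.card := by rw [hY]; exact card_image_of_injective _ (mul_left_injective _)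
    obtain ⟨Z, hZ⟩ : ∃ Z, Z = Y.image (fun y => g * y) := ⟨_, rfl⟩
    have hZc : Z.card = D.card := by rw [hZ, ← hYc]; exact card_image_of_injective _ (mul_right_injective _)
    have hYd : ∀ y ∈ Y, ∃ t ∈ D, t * t0⁻¹ = y := fun y hy => by rw [hY] at hy; exact mem_image.1 hy
    by_cases hdis : Disjoint Y Z
    · exfalso
      have hc := card_union_of_disjoint hdis
      have := dft_count (A := A) (Y ∪ Z) (6 * K) (by
        intro h hh
        rcases mem_union.1 hh with hh | hh
        · obtain ⟨t, ht, rfl⟩ := hYd h hh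
          have := hDD t0 ht0 t ht
          omega
        · rw [hZ] at hh
          obtain ⟨y, hy, rfl⟩ := mem_image.1 hh
          obtain ⟨t, ht, rfl⟩ := hYd y hy
          have := hDD t0 ht0 t ht
          have := dft_mul (A := A) g (t * t0⁻¹)
          omega)
      rw [hc, hYc, hZc] at this
      obtain ⟨a, ha⟩ : ∃ a, a = A.card := ⟨_, rfl⟩
      obtain ⟨d, hd⟩ : ∃ d, d = D.card := ⟨_, rfl⟩
      rw [← ha] at this hA hDA
      rw [← hd] at this hDA
      have h1 : 100 * K ≤ a := by omega
      have h2 : d * (100 * K) ≤ d * a := Nat.mul_le_mul_left _ h1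
      have h3 : a * (4 * a) ≤ a * (5 * d) := Nat.mul_le_mul_left _ hDA
      have h4 : 0 < a * a := Nat.mul_pos (by omega) (by omega)
      nlinarith
    · obtain ⟨y, hy, hy'⟩ := Finset.not_disjoint_iff.1 hdis
      obtain ⟨t, ht, h1⟩ := hYd y hy
      rw [hZ] at hy'
      obtain ⟨y', hy', h2⟩ := mem_image.1 hy'
      obtain ⟨t', ht', h3⟩ := hYd y' hy'
      have : g = t * t'⁻¹ := by
        rw [← h3, ← h1, ← mul_assoc] at h2
        have := mul_right_cancel h2
        rw [← this]; simp
      rw [this]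
      exact hDD _ ht' _ ht
  let H : Subgroup G :=
    { carrier := {g | dft A g ≤ 2 * K}
      mul_mem' := by
        intro a b ha hb
        have ha' : dft A a ≤ 2 * K := ha
        have hb' : dft A b ≤ 2 * K := hb
        exact key _ ((dft_mul a b).trans (by omega))
      one_mem' := by simp [dft_one]
      inv_mem' := by
        intro a ha
        have ha' : dft A a ≤ 2 * K := ha
        change dft A a⁻¹ ≤ 2 * K
        rw [dft_inv]; exact ha' }
  have memH : ∀ g, g ∈ H ↔ dft A g ≤ 2 * K := fun g => Iff.rfl
  obtain ⟨Hf, hHf⟩ : ∃ Hf, Hf = ((A ×ˢ A).image (fun p => p.1 * p.2⁻¹)).filter (fun g => dft A g ≤ 2 * K) := ⟨_, rfl⟩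
  have memHf : ∀ g, g ∈ Hf ↔ dft A g ≤ 2 * K := by
    intro g
    rw [hHf, mem_filter]
    refine ⟨fun h => h.2, fun h => ⟨?_, h⟩⟩
    have h1 := dft_compl (A := A) g
    obtain ⟨a, ha⟩ := card_pos.1 (by omega : 0 < (A.filter (fun a => g * a ∈ A)).card)
    obtain ⟨a1, a2⟩ := mem_filter.1 ha
    exact mem_image.2 ⟨(g * a, a), mem_product.2 ⟨a2, a1⟩, by simp⟩
  refine ⟨H, Hf, fun h => by rw [memHf, memH], ?_⟩
  have hHD : D.card ≤ Hf.card := by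
    refine card_le_card_of_injOn (fun t => t * t0⁻¹) (fun t ht => ?_) (fun a _ b _ hab => mul_right_cancel hab)
    exact mem_coe.2 ((memHf _).2 (hDD t0 ht0 t ht))
  have hHu := dft_count (A := A) Hf (2 * K) (fun h hh => (memHf h).1 hh)
  have hH2 : Hf.card ≤ 2 * A.card := by
    by_contra hc
    push Not at hc
    have h1 : Hf.card * (100 * K) ≤ Hf.card * A.card := Nat.mul_le_mul_left _ (by omega)
    have h2 : (2 * A.card) * A.card ≤ Hf.card * A.card := Nat.mul_le_mul_right _ hc.le
    have h4 : 0 < A.card * A.card := Nat.mul_pos (by omega) (by omega)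
    nlinarith
  -- double count of misses
  have hmiss : ∑ a ∈ A, (Hf.filter (fun h => h * a ∉ A)).card ≤ Hf.card * (2 * K) := by
    have e : ∑ a ∈ A, (Hf.filter (fun h => h * a ∉ A)).card = ∑ h ∈ Hf, dft A h := by
      unfold dft
      simp only [card_filter]
      exact Finset.sum_comm
    rw [e, ← smul_eq_mul]
    exact sum_le_card_nsmul _ _ _ fun h hh => (memHf h).1 hh
  have hex : ∃ x ∈ A, (Hf.filter (fun h => h * x ∉ A)).card ≤ 4 * K := by
    by_contra hc
    push Not at hc
    have h1 : A.card * (4 * K + 1) ≤ ∑ a ∈ A, (Hf.filter (fun h => h * a ∉ A)).card := by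
      rw [← smul_eq_mul]
      exact card_nsmul_le_sum _ _ _ fun a ha => hc a ha
    have h2 : Hf.card * (2 * K) ≤ 2 * A.card * (2 * K) := Nat.mul_le_mul_right _ hH2
    nlinarith
  obtain ⟨x, hx, hxK⟩ := hex
  refine ⟨x, ?_, hxK⟩
  obtain ⟨A2, hA2⟩ : ∃ A2, A2 = A.filter (fun a => a * x⁻¹ ∉ Hf) := ⟨_, rfl⟩
  rw [← hA2]
  have hA2c : A2.card + Hf.card ≤ A.card + 4 * K := by
    have h1 : (Hf.filter (fun h => h * x ∈ A)).card ≤ (A.filter (fun a => a * x⁻¹ ∈ Hf)).card := by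
      refine card_le_card_of_injOn (fun h => h * x) (fun h hh => ?_) (fun a _ b _ hab => mul_right_cancel hab)
      obtain ⟨a1, a2⟩ := mem_filter.1 hh
      exact mem_coe.2 (mem_filter.2 ⟨a2, by simpa using a1⟩)
    have h2 := card_filter_add_card_filter_not (s := Hf) (fun h => h * x ∈ A)
    have h3 := card_filter_add_card_filter_not (s := A) (fun a => a * x⁻¹ ∈ Hf)
    rw [← hA2] at h3
    omega
  have hpt : ∀ a ∈ A2, Hf.card ≤ 2 * (Hf.filter (fun h => h * a ∉ A)).card := by
    intro a ha
    rw [hA2] at ha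
    obtain ⟨ha1, ha2⟩ := mem_filter.1 ha
    have h1 : (Hf.filter (fun h => h * a ∈ A)).card ≤ A2.card := by
      refine card_le_card_of_injOn (fun h => h * a) (fun h hh => ?_) (fun a _ b _ hab => mul_right_cancel hab)
      obtain ⟨a1, a2⟩ := mem_filter.1 hh
      rw [hA2]
      refine mem_coe.2 (mem_filter.2 ⟨a2, fun hc => ha2 ?_⟩)
      have k1 : h ∈ H := (memH _).2 ((memHf _).1 a1)
      have k2 : h * a * x⁻¹ ∈ H := (memH _).2 ((memHf _).1 hc)
      have k3 := H.mul_mem (H.inv_mem k1) k2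
      rw [mul_assoc h, inv_mul_cancel_left] at k3
      exact (memHf _).2 ((memH _).1 k3)
    have h2 := card_filter_add_card_filter_not (s := Hf) (fun h => h * a ∈ A)
    omega
  by_contra hc
  push Not at hc
  have h1 : A2.card * Hf.card ≤ ∑ a ∈ A2, 2 * (Hf.filter (fun h => h * a ∉ A)).card := by
    rw [← smul_eq_mul]
    exact card_nsmul_le_sum _ _ _ hpt
  have h2 : ∑ a ∈ A2, (Hf.filter (fun h => h * a ∉ A)).card ≤ ∑ a ∈ A, (Hf.filter (fun h => h * a ∉ A)).card :=
    sum_le_sum_of_subset (by rw [hA2]; exact filter_subset _ _)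
  rw [← mul_sum] at h1
  have h3 : (4 * K + 1) * Hf.card ≤ A2.card * Hf.card := Nat.mul_le_mul_right _ hc
  have h4 : 0 < Hf.card := by omega
  nlinarith
end

end GT

namespace GT
variable {X : Fr} {f : Fn} {α β : ℝ} {S T E : Fr}

open Classical in
theorem grp_of {G : Type*} [CommGroup G] (h : Cfg X f α β S T E) (KE : ℕ) (hE : E.card ≤ KE) (hS : 9 * X.card ≤ 20 * S.card)
    (hT : 9 * X.card ≤ 20 * T.card) (hN : N2 X f ≤ X.card) (hn : 1000 * (100 * (3 + KE) + 1) ≤ X.card) (φ : ℝ → G)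
    (hφS : ∀ u ∈ S, ∀ v ∈ S, φ u = φ v → u = v) (hφT : ∀ u ∈ T, ∀ v ∈ T, φ u = φ v → u = v)
    (hrel : ∀ u ∈ S, ∀ v ∈ S, ∀ t ∈ T, u * v + β = t * (u + v - α) → φ u * φ v = φ t) :
    ∃ H : Subgroup G, ∃ Hf : Finset G, (∀ h, h ∈ Hf ↔ h ∈ H) ∧ ∃ x : G,
      (S.filter (fun u => φ u * x⁻¹ ∉ Hf)).card ≤ 400 * (3 + KE) ∧
      Hf.card ≤ (S.filter (fun u => φ u * x⁻¹ ∈ Hf)).card + 400 * (3 + KE) := by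
  obtain ⟨K, hK⟩ : ∃ K, K = 100 * (3 + KE) := ⟨_, rfl⟩
  have hc := h.card
  obtain ⟨D0, hD0⟩ : ∃ D0, D0 = T.filter (fun t => (badU S α β t).card ≤ K) := ⟨_, rfl⟩
  have hAc : (S.image φ).card = S.card := card_image_of_injOn (fun u hu v hv => hφS u hu v hv)
  have hDc : (D0.image φ).card = D0.card := card_image_of_injOn (fun u hu v hv => by
    rw [hD0] at hu hv
    exact hφT u (mem_filter.1 hu).1 v (mem_filter.1 hv).1)
  have hcount : (K + 1) * (T.card - D0.card) ≤ X.card + S.card * KE := by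
    have h1 := h.countC
    have h2 : (T.filter (fun t => ¬ (badU S α β t).card ≤ K)).card * (K + 1) ≤ ∑ t ∈ T, (badU S α β t).card := by
      refine le_trans ?_ (sum_le_sum_of_subset (filter_subset (fun t => ¬ (badU S α β t).card ≤ K) T))
      rw [← smul_eq_mul]
      refine card_nsmul_le_sum _ _ _ fun t ht => ?_
      have := (mem_filter.1 ht).2
      omega
    have h3 := card_filter_add_card_filter_not (s := T) (fun t => (badU S α β t).card ≤ K)
    rw [← hD0] at h3
    have h4 : T.card - D0.card = (T.filter (fun t => ¬ (badU S α β t).card ≤ K)).card := by omega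
    rw [h4, mul_comm]
    have : S.card * E.card ≤ S.card * KE := Nat.mul_le_mul_left _ hE
    omega
  have hdiff : 100 * (T.card - D0.card) ≤ S.card := by
    have h1 : X.card + S.card * KE ≤ (3 + KE) * S.card := by nlinarith
    have h2 : (3 + KE) * (100 * (T.card - D0.card)) ≤ (3 + KE) * S.card := by
      refine le_trans ?_ (hcount.trans h1)
      rw [hK]; nlinarith
    exact Nat.le_of_mul_le_mul_left h2 (by omega)
  obtain ⟨H, Hf, hH, x, h1, h2⟩ := approx_grp (A := S.image φ) (D0.image φ) K (by rw [hAc]; omega) (by rw [hAc, hDc]; omega) (by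
    intro t ht
    obtain ⟨t, ht2, rfl⟩ := mem_image.1 ht
    rw [hD0] at ht2
    obtain ⟨htT, htb⟩ := mem_filter.1 ht2
    refine le_trans (card_le_card ?_) ((card_image_le (s := badU S α β t) (f := φ)).trans htb)
    intro a ha
    obtain ⟨ha1, ha2⟩ := mem_filter.1 ha
    obtain ⟨u, hu, rfl⟩ := mem_image.1 ha1
    refine mem_image_of_mem _ ?_
    unfold badU
    refine mem_filter.2 ⟨hu, fun v hv hr => ha2 ?_⟩
    rw [← hrel u hu v hv t htT hr, mul_comm (φ u), mul_inv_cancel_right]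
    exact mem_image_of_mem _ hv)
  refine ⟨H, Hf, hH, x, ?_, ?_⟩
  · refine le_trans ?_ (h1.trans (by omega))
    refine card_le_card_of_injOn φ (fun u hu => ?_) (fun u hu v hv => ?_)
    · obtain ⟨hu1, hu2⟩ := mem_filter.1 hu
      exact mem_coe.2 (mem_filter.2 ⟨mem_image_of_mem _ hu1, hu2⟩)
    · exact hφS u (mem_filter.1 hu).1 v (mem_filter.1 hv).1
  · have h3 := card_filter_add_card_filter_not (s := Hf) (fun h => h * x ∉ S.image φ)
    have h4 : (Hf.filter (fun h => ¬ h * x ∉ S.image φ)).card ≤ (S.filter (fun u => φ u * x⁻¹ ∈ Hf)).card := by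
      refine le_trans (card_le_card (t := (S.filter (fun u => φ u * x⁻¹ ∈ Hf)).image (fun u => φ u * x⁻¹)) ?_) card_image_le
      intro g hg
      obtain ⟨hg1, hg2⟩ := mem_filter.1 hg
      rw [not_not] at hg2
      obtain ⟨u, hu, hug⟩ := mem_image.1 hg2
      have : φ u * x⁻¹ = g := by rw [hug, mul_inv_cancel_right]
      exact mem_image.2 ⟨u, mem_filter.2 ⟨hu, this ▸ hg1⟩, this⟩
    omega

/-- coordinate on conic/line -/
def cph (ω ω' : ℂ) (u : ℝ) : ℂ := (u - ω) / (u - ω')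

lemma Cfg.nr (h : Cfg X f α β S T E) {u : ℝ} (hu : u ∈ S ∨ u ∈ T) : u * u - α * u - β ≠ 0 := by
  rcases hu with hu | hu
  · have := (h.mS u).1 hu
    intro h0; apply this.2.2; rw [this.2.1]; linarith
  · have := (h.mT u).1 hu
    intro h0; apply this.2.1; rw [this.2.2]; linarith

lemma roots_ne {ω ω' : ℂ} (h1 : ω + ω' = α) (h2 : ω * ω' = -β) {u : ℝ} (hu : u * u - α * u - β ≠ 0) :
    (u : ℂ) - ω ≠ 0 ∧ (u : ℂ) - ω' ≠ 0 := by
  have : ((u : ℂ) - ω) * (u - ω') = ((u * u - α * u - β : ℝ) : ℂ) := by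
    push_cast; rw [← h1]; linear_combination h2
  have h3 : ((u : ℂ) - ω) * (u - ω') ≠ 0 := by rw [this]; exact_mod_cast hu
  exact mul_ne_zero_iff.1 h3

lemma cph_ne {ω ω' : ℂ} (h1 : ω + ω' = α) (h2 : ω * ω' = -β) {u : ℝ} (hu : u * u - α * u - β ≠ 0) : cph ω ω' u ≠ 0 :=
  div_ne_zero (roots_ne h1 h2 hu).1 (roots_ne h1 h2 hu).2

lemma cph_inj {ω ω' : ℂ} (hne : ω ≠ ω') (h1 : ω + ω' = α) (h2 : ω * ω' = -β) {u v : ℝ} (hu : u * u - α * u - β ≠ 0)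
    (hv : v * v - α * v - β ≠ 0) (h : cph ω ω' u = cph ω ω' v) : u = v := by
  unfold cph at h
  rw [div_eq_div_iff (roots_ne h1 h2 hu).2 (roots_ne h1 h2 hv).2] at h
  have : (ω - ω') * ((u : ℂ) - v) = 0 := by linear_combination h
  have := (mul_eq_zero.1 this).resolve_left (sub_ne_zero.2 hne)
  have := sub_eq_zero.1 this
  exact_mod_cast this

lemma cph_rel {ω ω' : ℂ} (hne : ω ≠ ω') (h1 : ω + ω' = α) (h2 : ω * ω' = -β) {u v t : ℝ} (hu : u * u - α * u - β ≠ 0)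
    (hv : v * v - α * v - β ≠ 0) (ht : t * t - α * t - β ≠ 0) :
    cph ω ω' u * cph ω ω' v = cph ω ω' t ↔ u * v + β = t * (u + v - α) := by
  have a := (roots_ne h1 h2 hu).2
  have b := (roots_ne h1 h2 hv).2
  have c := (roots_ne h1 h2 ht).2
  unfold cph
  rw [div_mul_div_comm, div_eq_div_iff (mul_ne_zero a b) c]
  have key : ((u : ℂ) - ω) * (v - ω) * (t - ω') - (t - ω) * ((u - ω') * (v - ω')) =
    (ω' - ω) * ((t * (u + v - α) - u * v - β : ℝ) : ℂ) := by
    push_cast; rw [← h1]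
    have : (β : ℂ) = - (ω * ω') := by rw [h2]; ring
    rw [this]; ring
  constructor
  · intro h
    rw [h, sub_self] at key
    have h3 : (ω' - ω) * ((t * (u + v - α) - u * v - β : ℝ) : ℂ) = 0 := by exact key.symm
    have := (mul_eq_zero.1 h3).resolve_left (sub_ne_zero.2 (Ne.symm hne))
    have : t * (u + v - α) - u * v - β = 0 := by exact_mod_cast this
    linarith
  · intro h
    have h0 : t * (u + v - α) - u * v - β = 0 := by linarith
    rw [h0] at key
    have : ((u : ℂ) - ω) * (v - ω) * (t - ω') - (t - ω) * ((u - ω') * (v - ω')) = 0 := by rw [key]; simp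
    linear_combination this

open Classical in
theorem cpx (h : Cfg X f α β S T E) (KE : ℕ) (hE : E.card ≤ KE) (hS : 9 * X.card ≤ 20 * S.card)
    (hT : 9 * X.card ≤ 20 * T.card) (hN : N2 X f ≤ X.card) (hn : 1000 * (100 * (3 + KE) + 1) ≤ X.card)
    {ω ω' : ℂ} (hne : ω ≠ ω') (h1 : ω + ω' = α) (h2 : ω * ω' = -β) :
    ∃ (m : ℕ) (c : ℂ), 0 < m ∧ c ≠ 0 ∧ (S.filter (fun u => cph ω ω' u ^ m ≠ c)).card ≤ 400 * (3 + KE) ∧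
      m ≤ (S.filter (fun u => cph ω ω' u ^ m = c)).card + 400 * (3 + KE) := by
  obtain ⟨φ, hφ⟩ : ∃ φ : ℝ → ℂˣ, ∀ u : ℝ, u * u - α * u - β ≠ 0 → (φ u : ℂ) = cph ω ω' u := by
    refine ⟨fun u => if hu : cph ω ω' u = 0 then 1 else Units.mk0 _ hu, fun u hu => ?_⟩
    beta_reduce
    rw [dif_neg (cph_ne h1 h2 hu)]
    rfl
  have inj : ∀ u v, (u ∈ S ∨ u ∈ T) → (v ∈ S ∨ v ∈ T) → φ u = φ v → u = v := by
    intro u v hu hv huv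
    apply cph_inj hne h1 h2 (h.nr hu) (h.nr hv)
    rw [← hφ u (h.nr hu), ← hφ v (h.nr hv), huv]
  obtain ⟨H, Hf, hH, x, a1, a2⟩ := grp_of h KE hE hS hT hN hn φ (fun u hu v hv => inj u v (Or.inl hu) (Or.inl hv))
    (fun u hu v hv => inj u v (Or.inr hu) (Or.inr hv)) (by
      intro u hu v hv t ht hr
      apply Units.ext
      rw [Units.val_mul, hφ u (h.nr (.inl hu)), hφ v (h.nr (.inl hv)), hφ t (h.nr (.inr ht))]
      exact (cph_rel hne h1 h2 (h.nr (.inl hu)) (h.nr (.inl hv)) (h.nr (.inr ht))).2 hr)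
  have hm : 0 < Hf.card := card_pos.2 ⟨1, (hH 1).2 H.one_mem⟩
  have hcard : Nat.card H = Hf.card := by
    have : Nat.card H = Nat.card Hf := Nat.card_congr (Equiv.subtypeEquivRight fun g => (hH g).symm)
    rw [this, Nat.card_eq_fintype_card, Fintype.card_coe]
  have hpow : ∀ g : ℂˣ, g ∈ Hf ↔ g ^ Hf.card = 1 := by
    have hs : Hf.image (fun g : ℂˣ => (g : ℂ)) ⊆ Polynomial.nthRootsFinset Hf.card (1 : ℂ) := by
      intro y hy
      obtain ⟨g, hg, rfl⟩ := mem_image.1 hy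
      rw [Polynomial.mem_nthRootsFinset hm]
      have : (⟨g, (hH g).1 hg⟩ : H) ^ Nat.card H = 1 := pow_card_eq_one'
      rw [hcard] at this
      have := congrArg (fun z : H => ((z : ℂˣ) : ℂ)) this
      simpa using this
    have heq := eq_of_subset_of_card_le hs (by
      rw [card_image_of_injective _ Units.val_injective]
      exact (Multiset.toFinset_card_le _).trans (Polynomial.card_nthRoots _ _))
    intro g
    constructor
    · intro hg
      have := hs (mem_image_of_mem _ hg)
      rw [Polynomial.mem_nthRootsFinset hm] at this
      exact Units.ext (by simpa using this)
    · intro hg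
      have : (g : ℂ) ∈ Polynomial.nthRootsFinset Hf.card (1 : ℂ) := by
        rw [Polynomial.mem_nthRootsFinset hm]
        have := congrArg (fun z : ℂˣ => (z : ℂ)) hg
        simpa using this
      rw [← heq] at this
      obtain ⟨g', hg', hgg⟩ := mem_image.1 this
      rwa [← Units.ext hgg]
  have hiff : ∀ u ∈ S, (φ u * x⁻¹ ∈ Hf ↔ cph ω ω' u ^ Hf.card = (x : ℂ) ^ Hf.card) := by
    intro u hu
    rw [hpow, mul_pow, inv_pow, mul_inv_eq_one, ← hφ u (h.nr (.inl hu)), ← Units.val_pow_eq_pow_val, ← Units.val_pow_eq_pow_val, Units.val_inj]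
  refine ⟨Hf.card, (x : ℂ) ^ Hf.card, hm, pow_ne_zero _ x.ne_zero, ?_, ?_⟩
  · rw [filter_congr (q := fun u => φ u * x⁻¹ ∉ Hf) (fun u hu => not_congr (hiff u hu).symm)]
    convert a1
  · rw [filter_congr (q := fun u => φ u * x⁻¹ ∈ Hf) (fun u hu => (hiff u hu).symm)]
    convert a2

open Classical in
theorem no_hyp (h : Cfg X f α β S T E) (KE : ℕ) (hE : E.card ≤ KE) (hS : 9 * X.card ≤ 20 * S.card)
    (hT : 9 * X.card ≤ 20 * T.card) (hN : N2 X f ≤ X.card) (hn : 1000 * (100 * (3 + KE) + 1) ≤ X.card)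
    {ω ω' : ℝ} (hne : ω ≠ ω') (h1 : ω + ω' = α) (h2 : ω * ω' = -β) : False := by
  have g1 : (ω : ℂ) + ω' = α := by exact_mod_cast h1
  have g2 : (ω : ℂ) * ω' = -β := by exact_mod_cast h2
  have gne : (ω : ℂ) ≠ ω' := by exact_mod_cast hne
  obtain ⟨m, c, hm, hc, a1, a2⟩ := cpx h KE hE hS hT hN hn gne g1 g2
  have h3 := card_filter_add_card_filter_not (s := S) (fun u => cph ω ω' u ^ m = c)
  have h4 : (S.filter (fun u => cph ω ω' u ^ m = c)).card ≤ 2 := by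
    by_contra hcon
    push Not at hcon
    obtain ⟨u, v, w, hu, hv, hw, huv, huw, hvw⟩ := two_lt_card_iff.1 hcon
    obtain ⟨hu1, hu2⟩ := mem_filter.1 hu
    obtain ⟨hv1, hv2⟩ := mem_filter.1 hv
    obtain ⟨hw1, hw2⟩ := mem_filter.1 hw
    have hre : ∀ u : ℝ, cph ω ω' u = (((u - ω) / (u - ω') : ℝ) : ℂ) := by intro u; unfold cph; push_cast; rfl
    have habs : ∀ u v : ℝ, cph ω ω' u ^ m = c → cph ω ω' v ^ m = c → (u - ω) / (u - ω') = (v - ω) / (v - ω') ∨ (u - ω) / (u - ω') = - ((v - ω) / (v - ω')) := by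
      intro u v hu hv
      rw [hre] at hu hv
      have : ((u - ω) / (u - ω')) ^ m = ((v - ω) / (v - ω')) ^ m := by exact_mod_cast hu.trans hv.symm
      have : |(u - ω) / (u - ω')| ^ m = |(v - ω) / (v - ω')| ^ m := by rw [← abs_pow, ← abs_pow, this]
      exact abs_eq_abs.1 ((pow_left_inj₀ (abs_nonneg _) (abs_nonneg _) hm.ne').1 this)
    have inj : ∀ u ∈ S, ∀ v ∈ S, (u - ω) / (u - ω') = (v - ω) / (v - ω') → u = v := by
      intro u hu v hv huv
      apply cph_inj gne g1 g2 (h.nr (.inl hu)) (h.nr (.inl hv))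
      rw [hre, hre, huv]
    rcases habs u v hu2 hv2 with k | k
    · exact huv (inj u hu1 v hv1 k)
    rcases habs u w hu2 hw2 with k' | k'
    · exact huw (inj u hu1 w hw1 k')
    · exact hvw (inj v hv1 w hw1 (by linarith))
  have h5 : (S.filter (fun u => ¬ cph ω ω' u ^ m = c)).card ≤ 400 * (3 + KE) := by convert a1
  have h6 := h.card
  omega

open Classical in
theorem no_par (h : Cfg X f α β S T E) (KE : ℕ) (hE : E.card ≤ KE) (hS : 9 * X.card ≤ 20 * S.card)
    (hT : 9 * X.card ≤ 20 * T.card) (hN : N2 X f ≤ X.card) (hn : 1000 * (100 * (3 + KE) + 1) ≤ X.card)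
    {r : ℝ} (h1 : r + r = α) (h2 : r * r = -β) : False := by
  have hr : ∀ u, (u ∈ S ∨ u ∈ T) → u - r ≠ 0 := by
    intro u hu h0
    apply h.nr hu
    have : u = r := by linarith
    rw [this, ← h1]; linarith
  have inj : ∀ u v, (u ∈ S ∨ u ∈ T) → (v ∈ S ∨ v ∈ T) → Multiplicative.ofAdd (1 / (u - r)) = Multiplicative.ofAdd (1 / (v - r)) → u = v := by
    intro u v hu hv huv
    have := Multiplicative.ofAdd.injective huv
    rw [div_eq_div_iff (hr u hu) (hr v hv)] at this
    linarith
  obtain ⟨H, Hf, hH, x, a1, a2⟩ := grp_of h KE hE hS hT hN hn (fun u => Multiplicative.ofAdd (1 / (u - r))) (fun u hu v hv => inj u v (Or.inl hu) (Or.inl hv))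
    (fun u hu v hv => inj u v (Or.inr hu) (Or.inr hv)) (by
      intro u hu v hv t ht hre
      have a := hr u (.inl hu)
      have b := hr v (.inl hv)
      have c := hr t (.inr ht)
      rw [← ofAdd_add]
      congr 1
      rw [div_add_div _ _ a b, div_eq_div_iff (mul_ne_zero a b) c]
      have : β = - (r * r) := by linarith
      rw [this, ← h1] at hre
      linear_combination -hre)
  have hone : ∀ g ∈ Hf, g = 1 := by
    intro g hg
    by_contra hg1
    have hpow : ∀ k : ℕ, g ^ k ∈ Hf := fun k => (hH _).2 (H.pow_mem ((hH _).1 hg) k)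
    have hg0 : Multiplicative.toAdd g ≠ 0 := hg1
    have hinj : Function.Injective (fun k : ℕ => g ^ k) := by
      intro k l hkl
      have := congrArg Multiplicative.toAdd hkl
      simp only [toAdd_pow, nsmul_eq_mul] at this
      exact_mod_cast mul_right_cancel₀ hg0 this
    exact Set.infinite_of_injective_forall_mem hinj (fun k => mem_coe.2 (hpow k)) Hf.finite_toSet
  have h3 := card_filter_add_card_filter_not (s := S) (fun u => Multiplicative.ofAdd (1 / (u - r)) * x⁻¹ ∈ Hf)
  have h4 : (S.filter (fun u => Multiplicative.ofAdd (1 / (u - r)) * x⁻¹ ∈ Hf)).card ≤ 1 := by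
    rw [card_le_one]
    intro u hu v hv
    obtain ⟨hu1, hu2⟩ := mem_filter.1 hu
    obtain ⟨hv1, hv2⟩ := mem_filter.1 hv
    have := (hone _ hu2).trans (hone _ hv2).symm
    exact inj u v (.inl hu1) (.inl hv1) (mul_right_cancel this)
  have h5 : (S.filter (fun u => ¬ Multiplicative.ofAdd (1 / (u - r)) * x⁻¹ ∈ Hf)).card ≤ 400 * (3 + KE) := by convert a1
  have h6 := h.card
  omega

/-- the elliptic coordinate -/
def ph (p q u : ℝ) : ℂ := cph (⟨p, q⟩ : ℂ) ⟨p, -q⟩ u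

open Classical in
theorem ell : ∃ M2 n0 K : ℕ, ∀ X f, n0 ≤ X.card → M2 < (Par X f).card → N2 X f ≤ X.card →
    ∃ α β S T E, Cfg X f α β S T E ∧ E.card ≤ K ∧ 9 * X.card ≤ 20 * S.card ∧ 9 * X.card ≤ 20 * T.card ∧
    ∃ p q, 0 < q ∧ α = 2 * p ∧ β = -(p * p + q * q) ∧ ∃ (m : ℕ) (c : ℂ), 0 < m ∧ c ≠ 0 ∧
      (S.filter (fun u => ph p q u ^ m ≠ c)).card ≤ K ∧
      m ≤ (S.filter (fun u => ph p q u ^ m = c)).card + K := by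
  obtain ⟨M2, n0, KE, hs⟩ := sizes
  obtain ⟨N, hNN⟩ : ∃ N, N = 1000 * (100 * (3 + KE) + 1) := ⟨_, rfl⟩
  refine ⟨M2, n0 + N, 400 * (3 + KE), fun X f hn hM hN => ?_⟩
  have hn2 : 1000 * (100 * (3 + KE) + 1) ≤ X.card := hNN ▸ (Nat.le_add_left N n0).trans hn
  obtain ⟨α, β, S, T, E, h, hE, hS, hT⟩ := hs X f (by omega) hM hN
  refine ⟨α, β, S, T, E, h, by omega, hS, hT, ?_⟩
  rcases lt_trichotomy (α * α + 4 * β) 0 with hd | hd | hd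
  · have hq : 0 < √(-(α * α + 4 * β)) / 2 := by have := Real.sqrt_pos.2 (neg_pos.2 hd); linarith
    have hsq : √(-(α * α + 4 * β)) * √(-(α * α + 4 * β)) = -(α * α + 4 * β) := Real.mul_self_sqrt (by linarith)
    obtain ⟨q, hqd⟩ : ∃ q, q = √(-(α * α + 4 * β)) / 2 := ⟨_, rfl⟩
    rw [← hqd] at hq
    have hb : β = -(α / 2 * (α / 2) + q * q) := by rw [hqd]; linarith
    refine ⟨α / 2, q, hq, by ring, hb, ?_⟩
    exact cpx h KE hE hS hT hN hn2 (ω := ⟨α / 2, q⟩) (ω' := ⟨α / 2, -q⟩) (by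
      intro hc
      have := congrArg Complex.im hc
      simp only at this
      linarith) (by apply Complex.ext <;> simp) (by apply Complex.ext <;> simp <;> linarith)
  · exact (no_par h KE hE hS hT hN hn2 (r := α / 2) (by ring) (by linarith)).elim
  · have hsq : √(α * α + 4 * β) * √(α * α + 4 * β) = (α * α + 4 * β) := Real.mul_self_sqrt (by linarith)
    have hq := Real.sqrt_pos.2 hd
    exact (no_hyp h KE hE hS hT hN hn2 (ω := (α + √(α * α + 4 * β)) / 2) (ω' := (α - √(α * α + 4 * β)) / 2)
      (by intro hc; linarith) (by ring) (by linarith)).elim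

end GT

namespace GT

structure El (X : Fr) (f : Fn) (S T E : Fr) (p q : ℝ) (m : ℕ) (c : ℂ) : Prop where
  cfg : Cfg X f (2 * p) (-(p * p + q * q)) S T E
  hq : 0 < q
  hm : 0 < m
  hc : c ≠ 0

lemma om_ne {p q : ℝ} (hq : 0 < q) : (⟨p, q⟩ : ℂ) ≠ ⟨p, -q⟩ := by
  intro hc
  have := congrArg Complex.im hc
  simp only at this
  linarith
lemma om_add (p q : ℝ) : (⟨p, q⟩ : ℂ) + ⟨p, -q⟩ = ((2 * p : ℝ) : ℂ) := by
  apply Complex.ext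
  · simp; ring
  · simp
lemma om_mul (p q : ℝ) : (⟨p, q⟩ : ℂ) * ⟨p, -q⟩ = -((-(p * p + q * q) : ℝ) : ℂ) := by
  apply Complex.ext
  · simp
  · simp; ring
lemma quad_ne {p q : ℝ} (hq : 0 < q) (u : ℝ) : u * u - 2 * p * u - -(p * p + q * q) ≠ 0 := by
  have h1 := mul_self_nonneg (u - p)
  have h2 := mul_pos hq hq
  intro h
  linarith

section
variable {p q : ℝ}
lemma ph_ne (hq : 0 < q) (u : ℝ) : ph p q u ≠ 0 := cph_ne (om_add p q) (om_mul p q) (quad_ne hq u)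
lemma ph_inj (hq : 0 < q) {u v : ℝ} (h : ph p q u = ph p q v) : u = v :=
  cph_inj (om_ne hq) (om_add p q) (om_mul p q) (quad_ne hq u) (quad_ne hq v) h
lemma ph_rel (hq : 0 < q) (u v t : ℝ) : ph p q u * ph p q v = ph p q t ↔ u * v + -(p * p + q * q) = t * (u + v - 2 * p) :=
  cph_rel (om_ne hq) (om_add p q) (om_mul p q) (quad_ne hq u) (quad_ne hq v) (quad_ne hq t)

/-- the bilinear relation of a point `(a,b)` -/
lemma chord_rel (hq : 0 < q) (a b : ℝ) : ∃ A C : ℂ, A * C - ((-(p * p + q * q) + a * (2 * p) - b : ℝ) : ℂ) ^ 2 = ((⟨p, q⟩ : ℂ) - ⟨p, -q⟩) ^ 2 * (b - a ^ 2 : ℝ) ∧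
    (∀ u v : ℝ, u * v - a * (u + v) + b = 0 ↔
      A * (ph p q u * ph p q v) + ((-(p * p + q * q) + a * (2 * p) - b : ℝ) : ℂ) * (ph p q u + ph p q v) + C = 0) ∧
    ∀ u t : ℝ, (u * u - b) * (t - a) = (2 * p * t + -(p * p + q * q) - b) * (u - a) ↔
      A * (ph p q u * ph p q t) + ((-(p * p + q * q) + a * (2 * p) - b : ℝ) : ℂ) * (ph p q u ^ 2 + ph p q t) + C * ph p q u = 0 := by
  obtain ⟨ω, hω⟩ : ∃ ω : ℂ, ω = ⟨p, q⟩ := ⟨_, rfl⟩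
  obtain ⟨ω', hω'⟩ : ∃ ω : ℂ, ω = ⟨p, -q⟩ := ⟨_, rfl⟩
  have h1 : ω + ω' = ((2 * p : ℝ) : ℂ) := by rw [hω, hω', om_add]
  have h2 : - (ω * ω') = ((-(p * p + q * q) : ℝ) : ℂ) := by rw [hω, hω', om_mul, neg_neg]
  have hne : ω - ω' ≠ 0 := by rw [hω, hω']; exact sub_ne_zero.2 (om_ne hq)
  have hr : ∀ u : ℝ, (u : ℂ) - ω' ≠ 0 := fun u => by
    rw [hω']; exact (roots_ne (om_add p q) (om_mul p q) (quad_ne hq u)).2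
  have hph : ∀ u : ℝ, ph p q u = (u - ω) / (u - ω') := fun u => by rw [hω, hω']; rfl
  have hB : ((-(p * p + q * q) + a * (2 * p) - b : ℝ) : ℂ) = - (ω * ω') + a * (ω + ω') - b := by
    rw [h2, h1]; push_cast; ring
  have cst : ∀ y z : ℂ, ∀ x : ℝ, ∀ w : ℂ, w ≠ 0 → y * w = (ω - ω') ^ 2 * (x : ℂ) → (x = 0 ↔ y = 0) := by
    intro y z x w hw hy
    constructor
    · rintro rfl
      simp only [Complex.ofReal_zero, mul_zero] at hy
      exact (mul_eq_zero.1 hy).resolve_right hw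
    · rintro rfl
      rw [zero_mul] at hy
      have := (mul_eq_zero.1 hy.symm).resolve_left (pow_ne_zero 2 hne)
      exact_mod_cast this
  refine ⟨ω' ^ 2 - 2 * a * ω' + b, ω ^ 2 - 2 * a * ω + b, ?_, ?_, ?_⟩
  · rw [hB, ← hω, ← hω']; push_cast; ring
  · intro u v
    refine cst _ 0 _ ((u - ω') * (v - ω')) (mul_ne_zero (hr u) (hr v)) ?_
    rw [hB, hph, hph]
    have := hr u
    have := hr v
    push_cast
    field_simp
    ring
  · intro u t
    rw [← sub_eq_zero]
    refine cst _ 0 _ ((u - ω') ^ 2 * (t - ω')) (mul_ne_zero (pow_ne_zero 2 (hr u)) (hr t)) ?_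
    rw [hB, hph, hph]
    have := hr u
    have := hr t
    have e1 : (((u * u - b) * (t - a) - (2 * p * t + -(p * p + q * q) - b) * (u - a) : ℝ) : ℂ) =
      (u * u - b) * (t - a) - ((ω + ω') * t + -(ω * ω') - b) * (u - a) := by rw [h1, h2]; push_cast; ring
    rw [e1]
    field_simp
    ring
end

end GT

namespace GT
variable {X : Fr} {f : Fn} {S T E : Fr} {p q : ℝ} {m : ℕ} {c : ℂ}

lemma quad2 (hq : 0 < q) (F : Fr) (a b d : ℂ) (h : ∀ u ∈ F, a * ph p q u ^ 2 + b * ph p q u + d = 0)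
    (hne : ¬ (a = 0 ∧ b = 0 ∧ d = 0)) : F.card ≤ 2 := by
  by_contra hc
  push Not at hc
  obtain ⟨u, v, w, hu, hv, hw, huv, huw, hvw⟩ := two_lt_card_iff.1 hc
  have k1 : ph p q u - ph p q v ≠ 0 := sub_ne_zero.2 fun k => huv (ph_inj hq k)
  have k2 : ph p q u - ph p q w ≠ 0 := sub_ne_zero.2 fun k => huw (ph_inj hq k)
  have k3 : ph p q v - ph p q w ≠ 0 := sub_ne_zero.2 fun k => hvw (ph_inj hq k)
  have e1 := h u hu
  have e2 := h v hv
  have e3 := h w hw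
  have f1 : a * (ph p q u + ph p q v) + b = 0 := mul_left_cancel₀ k1 (by linear_combination e1 - e2)
  have f2 : a * (ph p q u + ph p q w) + b = 0 := mul_left_cancel₀ k2 (by linear_combination e1 - e3)
  have ha : a = 0 := mul_left_cancel₀ k3 (by linear_combination f1 - f2)
  subst ha
  have hb : b = 0 := by linear_combination f1
  subst hb
  exact hne ⟨rfl, rfl, by linear_combination e1⟩

/-- the set of `m`-th roots of `c` -/
def rt (m : ℕ) (c : ℂ) : Finset ℂ := (Polynomial.nthRoots m c).toFinset

lemma mem_rt (hm : 0 < m) {z : ℂ} : z ∈ rt m c ↔ z ^ m = c := by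
  unfold rt; rw [Multiset.mem_toFinset, Polynomial.mem_nthRoots hm]

lemma card_rt (hm : 0 < m) (hc : c ≠ 0) : (rt m c).card = m := by
  have hz := Complex.isPrimitiveRoot_exp m hm.ne'
  unfold rt
  rw [Multiset.toFinset_card_of_nodup (hz.nthRoots_nodup hc), hz.card_nthRoots, if_pos]
  exact IsAlgClosed.exists_pow_nat_eq c hm

open Classical in
lemma rt_disj (hq : 0 < q) (hm : 0 < m) (hc : c ≠ 0) (W : Fr) (hW : ∀ u ∈ W, ph p q u ^ m = c) (V : Finset ℂ)
    (hV : ∀ z ∈ V, z ^ m = c ∧ ∀ u ∈ W, ph p q u ≠ z) : V.card + W.card ≤ m := by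
  rw [← card_rt hm hc, ← card_image_of_injective W (fun u v h => ph_inj hq h : Function.Injective (ph p q)),
    ← card_union_of_disjoint]
  · refine card_le_card fun z hz => ?_
    rw [mem_rt hm]
    rcases mem_union.1 hz with hz | hz
    · exact (hV z hz).1
    · obtain ⟨u, hu, rfl⟩ := mem_image.1 hz
      exact hW u hu
  · rw [disjoint_left]
    intro z hz hz'
    obtain ⟨u, hu, rfl⟩ := mem_image.1 hz'
    exact (hV _ hz).2 u hu rfl

open Classical in
lemma rt_miss (hq : 0 < q) (hm : 0 < m) (hc : c ≠ 0) (W : Fr) (k : ℕ) (hk : W.card + k ≤ m) :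
    ∃ V : Finset ℂ, V.card = k ∧ ∀ z ∈ V, z ^ m = c ∧ ∀ u ∈ W, ph p q u ≠ z := by
  have h1 := Finset.le_card_sdiff (W.image (ph p q)) (rt m c)
  rw [card_rt hm hc, card_image_of_injective W (fun u v h => ph_inj hq h : Function.Injective (ph p q))] at h1
  obtain ⟨V, hV, hVc⟩ := Finset.exists_subset_card_eq (show k ≤ (rt m c \ W.image (ph p q)).card by omega)
  refine ⟨V, hVc, fun z hz => ?_⟩
  obtain ⟨a, b⟩ := mem_sdiff.1 (hV hz)
  exact ⟨(mem_rt hm).1 a, fun u hu he => b (mem_image.2 ⟨u, hu, he⟩)⟩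

open Classical in
lemma chg (F : Finset (ℝ × ℝ)) (E : Fr) (k : ℕ) (hno : ∀ r ∈ F, PR(r) ∉ ordPairs X f → ∃ e ∈ E, Co f e r.1 r.2)
    (hk : ∀ e ∈ E, (F.filter (fun r => Co f e r.1 r.2)).card ≤ k) :
    F.card ≤ (F.filter (fun r => PR(r) ∈ ordPairs X f)).card + E.card * k := by
  have h1 : F ⊆ F.filter (fun r => PR(r) ∈ ordPairs X f) ∪ E.biUnion (fun e => F.filter (fun r => Co f e r.1 r.2)) := by
    intro r hr
    by_cases h : PR(r) ∈ ordPairs X f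
    · exact mem_union_left _ (mem_filter.2 ⟨hr, h⟩)
    · obtain ⟨e, he, hc⟩ := hno r hr h
      exact mem_union_right _ (mem_biUnion.2 ⟨e, he, mem_filter.2 ⟨hr, hc⟩⟩)
  have h2 := (card_le_card h1).trans (card_union_le _ _)
  have h3 : (E.biUnion (fun e => F.filter (fun r => Co f e r.1 r.2))).card ≤ E.card * k :=
    card_biUnion_le_card_mul _ _ _ hk
  omega

namespace El
lemma eE (h : El X f S T E p q m c) {e : ℝ} (he : e ∈ E) : f e ≠ e * e ∧ f e ≠ 2 * p * e + -(p * p + q * q) := by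
  obtain ⟨h1, h2, h3⟩ := (h.cfg.mE e).1 he
  rw [h.cfg.mS] at h2
  rw [h.cfg.mT] at h3
  have h4 : ¬ (f e = e * e ∧ f e = 2 * p * e + -(p * p + q * q)) := by
    rintro ⟨h5, h6⟩
    exact quad_ne (p := p) h.hq e (by linarith)
  constructor
  · intro h5
    exact h2 ⟨h1, h5, fun h6 => h4 ⟨h5, h6⟩⟩
  · intro h5
    exact h3 ⟨h1, fun h6 => h4 ⟨h6, h5⟩, h5⟩

lemma coSS (h : El X f S T E p q m c) {u v t : ℝ} (hu : u ∈ S) (hv : v ∈ S) (ht : t ∈ T) (huv : u ≠ v) :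
    Co f t u v ↔ ph p q u * ph p q v = ph p q t := by
  rw [h.cfg.co3 hu hv ht huv, ph_rel h.hq]

lemma erel (h : El X f S T E p q m c) {e : ℝ} (he : e ∈ E) : ∃ A B C : ℂ, B ≠ 0 ∧ A * C - B ^ 2 ≠ 0 ∧
    (∀ u ∈ S, ∀ v ∈ S, u ≠ v → (Co f e u v ↔ A * (ph p q u * ph p q v) + B * (ph p q u + ph p q v) + C = 0)) ∧
    (∀ u ∈ S, ∀ t ∈ T, Co f e u t ↔ A * (ph p q u * ph p q t) + B * (ph p q u ^ 2 + ph p q t) + C * ph p q u = 0) := by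
  obtain ⟨h1, h2⟩ := h.eE he
  obtain ⟨A, C, a1, a2, a3⟩ := chord_rel (p := p) h.hq e (f e)
  refine ⟨A, ((-(p * p + q * q) + e * (2 * p) - f e : ℝ) : ℂ), C, ?_, ?_, fun u hu v hv huv => ?_, fun u hu t ht => ?_⟩
  · exact_mod_cast fun h0 => h2 (by linarith)
  · rw [a1]
    refine mul_ne_zero (pow_ne_zero 2 (sub_ne_zero.2 (om_ne h.hq))) ?_
    exact_mod_cast fun h0 => h1 (by linarith)
  · rw [← a2]
    unfold Co
    rw [((h.cfg.mS u).1 hu).2.1, ((h.cfg.mS v).1 hv).2.1]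
    constructor
    · intro hc
      exact mul_left_cancel₀ (sub_ne_zero.2 huv) (by linear_combination hc)
    · intro hc
      linear_combination (u - v) * hc
  · rw [← a3]
    unfold Co
    rw [((h.cfg.mS u).1 hu).2.1, ((h.cfg.mT t).1 ht).2.2]

/-- a family of ordinary pairs of three types -/
lemma cnt3 (h : El X f S T E p q m c) (F1 F2 F3 : Finset (ℝ × ℝ)) (h1 : ∀ r ∈ F1, r.1 ∈ S ∧ r.2 ∈ T ∧ PR(r) ∈ ordPairs X f)
    (h2 : ∀ r ∈ F2, r.1 ∈ S ∧ r.2 ∈ S ∧ r.1 < r.2 ∧ PR(r) ∈ ordPairs X f)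
    (h3 : ∀ r ∈ F3, r.1 ∈ E ∧ (r.2 ∈ S ∨ r.2 ∈ T) ∧ PR(r) ∈ ordPairs X f) :
    F1.card + F2.card + F3.card ≤ N2 X f := by
  classical
  have d1 : Disjoint F1 F2 := disjoint_left.2 fun r a b => h.cfg.ne_ST (h2 r b).2.1 (h1 r a).2.1 rfl
  have d2 : Disjoint (F1 ∪ F2) F3 := disjoint_left.2 fun r a b => by
    rcases mem_union.1 a with a | a
    · exact h.cfg.ne_SE (h1 r a).1 (h3 r b).1 rfl
    · exact h.cfg.ne_SE (h2 r a).1 (h3 r b).1 rfl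
  rw [← card_union_of_disjoint d1, ← card_union_of_disjoint d2]
  have hall : ∀ r, r ∈ F1 ∪ F2 ∪ F3 → r ∈ F1 ∨ r ∈ F2 ∨ r ∈ F3 := fun r hr => by
    simpa [or_assoc] using hr
  refine cnt _ (fun r hr => ?_) (fun r hr hr' => ?_)
  · rcases hall r hr with a | a | a
    exacts [(h1 r a).2.2, (h2 r a).2.2.2, (h3 r a).2.2]
  · rcases hall _ hr with a | a | a <;> rcases hall _ hr' with b | b | b
    · exact h.cfg.ne_ST (h1 _ b).1 (h1 _ a).2.1 rfl
    · exact h.cfg.ne_ST (h2 _ b).1 (h1 _ a).2.1 rfl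
    · exact h.cfg.ne_TE (h1 _ a).2.1 (h3 _ b).1 rfl
    · exact h.cfg.ne_ST (h2 _ a).1 (h1 _ b).2.1 rfl
    · exact lt_asymm (h2 _ a).2.2.1 (h2 _ b).2.2.1
    · exact h.cfg.ne_SE (h2 _ a).2.1 (h3 _ b).1 rfl
    · exact h.cfg.ne_TE (h1 _ b).2.1 (h3 _ a).1 rfl
    · exact h.cfg.ne_SE (h2 _ b).2.1 (h3 _ a).1 rfl
    · rcases (h3 _ a).2.1 with k | k
      · exact h.cfg.ne_SE k (h3 _ b).1 rfl
      · exact h.cfg.ne_TE k (h3 _ b).1 rfl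
end El

open Classical in
/-- tangent pairs -/
def tanF (p q : ℝ) (S T : Fr) : Finset (ℝ × ℝ) := (S ×ˢ T).filter (fun r => ph p q r.2 = ph p q r.1 ^ 2)

lemma mem_tanF {r : ℝ × ℝ} : r ∈ tanF p q S T ↔ r.1 ∈ S ∧ r.2 ∈ T ∧ ph p q r.2 = ph p q r.1 ^ 2 := by
  unfold tanF; rw [mem_filter, mem_product, and_assoc]

open Classical in
def tanMiss (p q : ℝ) (S T : Fr) : Fr := S.filter (fun u => ∀ t ∈ T, ph p q t ≠ ph p q u ^ 2)

lemma mem_tanMiss {u : ℝ} : u ∈ tanMiss p q S T ↔ u ∈ S ∧ ∀ t ∈ T, ph p q t ≠ ph p q u ^ 2 := by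
  unfold tanMiss; simp only [mem_filter]

lemma tanF_card (S T : Fr) : S.card ≤ (tanF p q S T).card + (tanMiss p q S T).card := by
  classical
  refine le_trans (card_le_card (t := (tanF p q S T).image Prod.fst ∪ tanMiss p q S T) fun u hu => ?_)
    ((card_union_le _ _).trans (Nat.add_le_add_right card_image_le _))
  by_cases h : ∀ t ∈ T, ph p q t ≠ ph p q u ^ 2
  · exact mem_union_right _ (mem_tanMiss.2 ⟨hu, h⟩)
  · push Not at h
    obtain ⟨t, ht, h⟩ := h
    exact mem_union_left _ (mem_image.2 ⟨(u, t), mem_tanF.2 ⟨hu, ht, h⟩, rfl⟩)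

lemma tanMiss_card (hq : 0 < q) (hm : 0 < m) (hc : c ≠ 0) (hS : ∀ u ∈ S, ph p q u ^ m = c) (hT : ∀ t ∈ T, ph p q t ^ m = c ^ 2) :
    (tanMiss p q S T).card + 2 * T.card ≤ 2 * m := by
  classical
  have h1 := Finset.card_le_mul_card_image (s := tanMiss p q S T) (f := fun u => ph p q u ^ 2) 2 (by
    intro z _
    exact quad2 (p := p) hq _ 1 0 (-z) (fun u hu => by linear_combination (mem_filter.1 hu).2) (by simp))
  have h2 := rt_disj hq hm (pow_ne_zero 2 hc) T hT ((tanMiss p q S T).image fun u => ph p q u ^ 2) (by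
    intro z hz
    obtain ⟨u, hu, rfl⟩ := mem_image.1 hz
    obtain ⟨hu1, hu2⟩ := mem_tanMiss.1 hu
    exact ⟨by rw [← hS u hu1]; ring, hu2⟩)
  omega

open Classical in
/-- chords with product `d` -/
def chF (p q : ℝ) (S : Fr) (V : Finset ℂ) : Finset (ℝ × ℝ) :=
  (S ×ˢ S).filter (fun r => r.1 < r.2 ∧ ph p q r.1 * ph p q r.2 ∈ V)

lemma mem_chF {r : ℝ × ℝ} {V : Finset ℂ} : r ∈ chF p q S V ↔ r.1 ∈ S ∧ r.2 ∈ S ∧ r.1 < r.2 ∧ ph p q r.1 * ph p q r.2 ∈ V := by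
  unfold chF; rw [mem_filter, mem_product, and_assoc]

open Classical in
lemma chF_card1 (hq : 0 < q) (hm : 0 < m) (hc : c ≠ 0) (hS : ∀ u ∈ S, ph p q u ^ m = c) (d : ℂ) (hd : d ^ m = c ^ 2) :
    2 * S.card ≤ 2 * (chF p q S {d}).card + (S.filter (fun u => ph p q u ^ 2 = d)).card + m := by
  obtain ⟨N, hN⟩ : ∃ N, N = S.filter (fun u => ∀ v ∈ S, ph p q u * ph p q v ≠ d) := ⟨_, rfl⟩
  have h2 := rt_disj hq hm hc S hS (N.image fun u => d / ph p q u) (by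
    intro z hz
    obtain ⟨u, hu, rfl⟩ := mem_image.1 hz
    rw [hN] at hu
    obtain ⟨hu1, hu2⟩ := mem_filter.1 hu
    refine ⟨?_, fun v hv hh => hu2 v hv ?_⟩
    · rw [div_pow, hd, hS u hu1]; field_simp
    · rw [hh]; field_simp [ph_ne hq u])
  rw [card_image_of_injOn] at h2
  · have h3 : S ⊆ ((chF p q S {d}).image Prod.fst ∪ (chF p q S {d}).image Prod.snd) ∪ (S.filter (fun u => ph p q u ^ 2 = d) ∪ N) := by
      intro u hu
      by_cases hn : u ∈ N
      · exact mem_union_right _ (mem_union_right _ hn)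
      rw [hN, mem_filter] at hn
      push Not at hn
      obtain ⟨v, hv, huv⟩ := hn hu
      rcases lt_trichotomy u v with hlt | heq | hlt
      · refine mem_union_left _ (mem_union_left _ (mem_image.2 ⟨(u, v), mem_chF.2 ⟨hu, hv, hlt, ?_⟩, rfl⟩))
        rw [mem_singleton]; exact huv
      · refine mem_union_right _ (mem_union_left _ (mem_filter.2 ⟨hu, ?_⟩))
        rw [← huv, ← heq]; ring
      · refine mem_union_left _ (mem_union_right _ (mem_image.2 ⟨(v, u), mem_chF.2 ⟨hv, hu, hlt, ?_⟩, rfl⟩))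
        rw [mem_singleton, mul_comm]; exact huv
    have h4 := (card_le_card h3).trans ((card_union_le _ _).trans (Nat.add_le_add (card_union_le _ _) (card_union_le _ _)))
    have h5 : ((chF p q S {d}).image Prod.fst).card ≤ (chF p q S {d}).card := card_image_le
    have h6 : ((chF p q S {d}).image Prod.snd).card ≤ (chF p q S {d}).card := card_image_le
    omega
  · intro u hu v hv huv
    have hd0 : d ≠ 0 := by rintro rfl; rw [zero_pow hm.ne'] at hd; exact pow_ne_zero 2 hc hd.symm
    beta_reduce at huv
    rw [div_eq_div_iff (ph_ne hq u) (ph_ne hq v)] at huv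
    exact (ph_inj hq (mul_left_cancel₀ hd0 huv)).symm

lemma sq_card (hq : 0 < q) (d : ℂ) (S : Fr) [DecidablePred (fun u => ph p q u ^ 2 = d)] : (S.filter (fun u => ph p q u ^ 2 = d)).card ≤ 2 :=
  quad2 (p := p) hq _ 1 0 (-d) (fun u hu => by linear_combination (mem_filter.1 hu).2) (by simp)

lemma chF_card (hq : 0 < q) (hm : 0 < m) (hc : c ≠ 0) (hS : ∀ u ∈ S, ph p q u ^ m = c) (V : Finset ℂ) (hd : ∀ d ∈ V, d ^ m = c ^ 2) :
    V.card * (2 * S.card) ≤ 2 * (chF p q S V).card + V.card * (2 + m) := by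
  classical
  have h1 : (chF p q S V).card = ∑ d ∈ V, (chF p q S {d}).card := by
    rw [Finset.card_eq_sum_card_fiberwise (f := fun r : ℝ × ℝ => ph p q r.1 * ph p q r.2) (t := V) (fun r hr => (mem_chF.1 hr).2.2.2)]
    refine sum_congr rfl fun d hd => ?_
    congr 1
    ext r
    rw [mem_filter, mem_chF, mem_chF, mem_singleton]
    constructor
    · rintro ⟨⟨a1, a2, a3, a4⟩, a5⟩
      exact ⟨a1, a2, a3, a5⟩
    · rintro ⟨a1, a2, a3, a5⟩
      exact ⟨⟨a1, a2, a3, a5 ▸ hd⟩, a5⟩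
  have h2 : ∑ d ∈ V, 2 * S.card ≤ ∑ d ∈ V, (2 * (chF p q S {d}).card + (2 + m)) := by
    refine sum_le_sum fun d hdV => ?_
    have := chF_card1 hq hm hc hS d (hd d hdV)
    have := sq_card (p := p) hq d S
    omega
  rw [sum_add_distrib, ← mul_sum V (fun d => (chF p q S {d}).card) 2, ← h1] at h2
  simpa using h2

namespace El
variable {S0 T0 : Fr}
open Classical in
lemma tan_no (h : El X f S T E p q m c) (hS0 : S0 ⊆ S) (hT0 : T0 ⊆ T) {r : ℝ × ℝ} (hr : r ∈ tanF p q S0 T0) (ho : PR(r) ∉ ordPairs X f) : ∃ e ∈ E, Co f e r.1 r.2 := by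
  obtain ⟨h1, h2, h3⟩ := mem_tanF.1 hr
  replace h1 := hS0 h1
  replace h2 := hT0 h2
  rcases h.cfg.st h1 h2 ho with h4 | ⟨v, hv, hvu, hco⟩
  · exact h4
  · exfalso
    rw [h.coSS h1 hv h2 hvu.symm, h3, sq] at hco
    exact hvu (ph_inj (p := p) h.hq (mul_left_cancel₀ (ph_ne h.hq _) hco))

lemma tan_eq (h : El X f S T E p q m c) (hS0 : S0 ⊆ S) (hT0 : T0 ⊆ T) {e : ℝ} (he : e ∈ E) : ∃ A B C : ℂ, B ≠ 0 ∧ ∀ r ∈ tanF p q S0 T0, Co f e r.1 r.2 →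
    A * ph p q r.1 ^ 2 + B * ph p q r.1 + C = 0 := by
  obtain ⟨A, B, C, hB, _, _, h2⟩ := h.erel he
  refine ⟨A, 2 * B, C, mul_ne_zero two_ne_zero hB, fun r hr hco => ?_⟩
  obtain ⟨a1, a2, a3⟩ := mem_tanF.1 hr
  rw [h2 _ (hS0 a1) _ (hT0 a2), a3] at hco
  exact mul_left_cancel₀ (ph_ne h.hq r.1) (by linear_combination hco)

open Classical in
lemma tan_k (h : El X f S T E p q m c) (hS0 : S0 ⊆ S) (hT0 : T0 ⊆ T) {e : ℝ} (he : e ∈ E) : ((tanF p q S0 T0).filter (fun r => Co f e r.1 r.2)).card ≤ 2 := by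
  obtain ⟨A, B, C, hB, h2⟩ := h.tan_eq hS0 hT0 he
  rw [← card_image_of_injOn (f := Prod.fst)]
  · refine quad2 (p := p) h.hq _ A B C (fun u hu => ?_) (fun hn => hB hn.2.1)
    obtain ⟨r, hr, rfl⟩ := mem_image.1 hu
    exact h2 r (mem_filter.1 hr).1 (mem_filter.1 hr).2
  · intro r hr r' hr' hrr
    have a := (mem_tanF.1 (mem_filter.1 hr).1).2.2
    have b := (mem_tanF.1 (mem_filter.1 hr').1).2.2
    refine Prod.ext hrr (ph_inj (p := p) h.hq ?_)
    rw [a, b, hrr]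

open Classical in
lemma tan_ord (h : El X f S T E p q m c) (hS0 : S0 ⊆ S) (hT0 : T0 ⊆ T) : (tanF p q S0 T0).card ≤ ((tanF p q S0 T0).filter (fun r => PR(r) ∈ ordPairs X f)).card + E.card * 2 :=
  chg _ E 2 (fun _ hr ho => h.tan_no hS0 hT0 hr ho) (fun _ he => h.tan_k hS0 hT0 he)

open Classical in
lemma ch_ord (h : El X f S T E p q m c) (hS0 : S0 ⊆ S) (V : Finset ℂ) (hV : ∀ d ∈ V, ∀ t ∈ T, ph p q t ≠ d) :
    (chF p q S0 V).card ≤ ((chF p q S0 V).filter (fun r => PR(r) ∈ ordPairs X f)).card + E.card * (V.card * 2) := by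
  refine chg _ E _ (fun r hr ho => ?_) (fun e he => ?_)
  · obtain ⟨h1, h2, h3, h4⟩ := mem_chF.1 hr
    replace h1 := hS0 h1
    replace h2 := hS0 h2
    rcases h.cfg.ss h1 h2 h3.ne ho with h5 | ⟨t, ht, hco⟩
    · exact h5
    · rw [h.coSS h1 h2 ht h3.ne] at hco
      exact absurd hco.symm (hV _ h4 t ht)
  · rw [mul_comm]
    obtain ⟨A, B, C, hB, _, h2, _⟩ := h.erel he
    refine Finset.card_le_mul_card_image_of_maps_to (f := fun r : ℝ × ℝ => ph p q r.1 * ph p q r.2) (fun r hr => (mem_chF.1 (mem_filter.1 hr).1).2.2.2) 2 ?_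
    intro d hd
    rw [← card_image_of_injOn (f := Prod.fst)]
    · refine quad2 (p := p) h.hq _ B (A * d + C) (B * d) (fun u hu => ?_) (fun hn => hB hn.1)
      obtain ⟨r, hr, rfl⟩ := mem_image.1 hu
      obtain ⟨hr, hrd⟩ := mem_filter.1 hr
      obtain ⟨hr, hco⟩ := mem_filter.1 hr
      obtain ⟨h1, h2', h3, h4⟩ := mem_chF.1 hr
      rw [h2 _ (hS0 h1) _ (hS0 h2') h3.ne] at hco
      rw [← hrd]
      linear_combination ph p q r.1 * hco
    · intro r hr r' hr' hrr
      have a := (mem_filter.1 hr).2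
      have b := (mem_filter.1 hr').2
      rw [← b, hrr] at a
      exact Prod.ext hrr (ph_inj h.hq (mul_left_cancel₀ (ph_ne h.hq _) a))
end El

open Classical in
def sf (p q : ℝ) (m : ℕ) (c : ℂ) (S : Fr) : Fr := S.filter (fun u => ph p q u ^ m = c)
lemma mem_sf {u : ℝ} : u ∈ sf p q m c S ↔ u ∈ S ∧ ph p q u ^ m = c := by unfold sf; rw [mem_filter]
lemma sf_sub : sf p q m c S ⊆ S := fun _ hu => (mem_sf.1 hu).1
lemma sf_card (hq : 0 < q) (hm : 0 < m) (hc : c ≠ 0) : (sf p q m c S).card ≤ m := by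
  have := rt_disj hq hm hc (sf p q m c S) (fun u hu => (mem_sf.1 hu).2) ∅ (by simp)
  simpa using this

namespace El
open Classical in
lemma tanOrd (h : El X f S T E p q m c) : ∃ F ⊆ tanF p q (sf p q m c S) (sf p q m (c ^ 2) T),
    (∀ r ∈ F, PR(r) ∈ ordPairs X f) ∧
    (sf p q m c S).card + 2 * (sf p q m (c ^ 2) T).card ≤ F.card + 2 * m + 2 * E.card := by
  have h1 := h.tan_ord (sf_sub (p := p) (q := q) (m := m) (c := c)) (sf_sub (p := p) (q := q) (m := m) (c := c ^ 2))
  have h2 := tanF_card (p := p) (q := q) (sf p q m c S) (sf p q m (c ^ 2) T)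
  have h3 := tanMiss_card h.hq h.hm h.hc (S := sf p q m c S) (T := sf p q m (c ^ 2) T) (fun u hu => (mem_sf.1 hu).2) (fun u hu => (mem_sf.1 hu).2)
  exact ⟨_, filter_subset _ _, fun r hr => (mem_filter.1 hr).2, by omega⟩

open Classical in
lemma cntU (h : El X f S T E p q m c) (F G : Finset (ℝ × ℝ)) (hF : ∀ r ∈ F, r.1 ∈ S ∧ r.2 ∈ T ∧ PR(r) ∈ ordPairs X f)
    (hG : ∀ r ∈ G, r.1 ∈ S ∧ r.2 ∈ T ∧ PR(r) ∈ ordPairs X f) (hd : ∀ r ∈ F, r ∉ G) : F.card + G.card ≤ N2 X f := by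
  have := h.cnt3 (F ∪ G) ∅ ∅ (fun r hr => (mem_union.1 hr).elim (hF r) (hG r)) (by simp) (by simp)
  rw [card_union_of_disjoint (disjoint_left.2 hd)] at this
  simpa using this

lemma stepA (h : El X f S T E p q m c) (hA : (sf p q m (c ^ 2) T).card + 4 ≤ m) :
    4 * (sf p q m c S).card ≤ N2 X f + 2 * m + 4 + 8 * E.card := by
  classical
  obtain ⟨V, hV, hV2⟩ := rt_miss h.hq h.hm (pow_ne_zero 2 h.hc) _ 4 hA
  have h1 := chF_card h.hq h.hm h.hc (S := sf p q m c S) (fun u hu => (mem_sf.1 hu).2) V (fun d hd => (hV2 d hd).1)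
  have h2 := h.ch_ord (sf_sub (p := p) (q := q) (m := m) (c := c)) V (fun d hd t ht hh => (hV2 d hd).2 t (mem_sf.2 ⟨ht, by rw [hh]; exact (hV2 d hd).1⟩) hh)
  have h3 := h.cnt3 ∅ ((chF p q (sf p q m c S) V).filter (fun r => PR(r) ∈ ordPairs X f)) ∅ (by simp) (fun r hr => by
    obtain ⟨hr, ho⟩ := mem_filter.1 hr
    obtain ⟨a1, a2, a3, -⟩ := mem_chF.1 hr
    exact ⟨sf_sub a1, sf_sub a2, a3, ho⟩) (by simp)
  rw [hV] at h1 h2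
  simp only [card_empty] at h3
  omega

lemma stepB (h : El X f S T E p q m c) {u : ℝ} (hu : u ∈ S) (hu2 : ph p q u ^ m ≠ c) :
    S.card + 3 * (sf p q m (c ^ 2) T).card ≤ N2 X f + 2 * m + 3 * E.card + 2 * (S.card - (sf p q m c S).card) := by
  classical
  obtain ⟨F, hF1, hF2, hF3⟩ := h.tanOrd
  obtain ⟨T0, hT0⟩ : ∃ T0, T0 = sf p q m (c ^ 2) T := ⟨_, rfl⟩
  rw [← hT0] at hF1 hF3 ⊢
  have hT0' : ∀ t ∈ T0, t ∈ T ∧ ph p q t ^ m = c ^ 2 := fun t ht => mem_sf.1 (hT0 ▸ ht)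
  have h1 := h.cntU F (({u} : Fr) ×ˢ T0.filter (fun t => ({u, t} : Fr) ∈ ordPairs X f))
    (fun r hr => ⟨sf_sub (mem_tanF.1 (hF1 hr)).1, (hT0' _ (mem_tanF.1 (hF1 hr)).2.1).1, hF2 r hr⟩)
    (fun r hr => by
      obtain ⟨a, b⟩ := mem_product.1 hr
      obtain ⟨b1, b2⟩ := mem_filter.1 b
      rw [mem_singleton] at a
      rw [a]
      exact ⟨hu, (hT0' _ b1).1, b2⟩)
    (fun r hr hr2 => by
      have a := (mem_product.1 hr2).1
      rw [mem_singleton] at a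
      exact hu2 (a ▸ (mem_sf.1 (mem_tanF.1 (hF1 hr)).1).2))
  have h2 : (T0.filter (fun t => ¬ ({u, t} : Fr) ∈ ordPairs X f)).card ≤ (T0.filter (fun t => ∃ e ∈ E, Co f e u t) ∪
      T0.filter (fun t => ∃ v ∈ S \ sf p q m c S, ph p q u * ph p q v = ph p q t)).card := by
    refine card_le_card fun t ht => ?_
    obtain ⟨ht, hno⟩ := mem_filter.1 ht
    rcases h.cfg.st hu (hT0' t ht).1 hno with hh | ⟨v, hv, hvu, hco⟩
    · exact mem_union_left _ (mem_filter.2 ⟨ht, hh⟩)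
    · rw [h.coSS hu hv (hT0' t ht).1 hvu.symm] at hco
      refine mem_union_right _ (mem_filter.2 ⟨ht, v, mem_sdiff.2 ⟨hv, fun hv2 => hu2 ?_⟩, hco⟩)
      have a := (hT0' t ht).2
      rw [← hco, mul_pow, (mem_sf.1 hv2).2, sq] at a
      exact mul_right_cancel₀ h.hc a
  have h3 : (T0.filter (fun t => ∃ e ∈ E, Co f e u t)).card ≤ E.card :=
    card_le_card_of_forall_subsingleton (fun t e => Co f e u t) (fun t ht => (mem_filter.1 ht).2)
      (fun e he t ht t' ht' => h.cfg.uniqT hu (hT0' _ (mem_filter.1 ht.1).1).1 (hT0' _ (mem_filter.1 ht'.1).1).1 (h.cfg.ne_SE hu he).symm ht.2 ht'.2)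
  have h4 : (T0.filter (fun t => ∃ v ∈ S \ sf p q m c S, ph p q u * ph p q v = ph p q t)).card ≤ (S \ sf p q m c S).card :=
    card_le_card_of_forall_subsingleton (fun t v => ph p q u * ph p q v = ph p q t) (fun t ht => (mem_filter.1 ht).2)
      (fun v _ t ht t' ht' => ph_inj (p := p) h.hq (ht.2.symm.trans ht'.2))
  have h5 := card_union_le (T0.filter (fun t => ∃ e ∈ E, Co f e u t)) (T0.filter (fun t => ∃ v ∈ S \ sf p q m c S, ph p q u * ph p q v = ph p q t))
  have h6 := card_filter_add_card_filter_not (s := T0) (fun t => ({u, t} : Fr) ∈ ordPairs X f)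
  have h7 := card_sdiff_of_subset (sf_sub (p := p) (q := q) (m := m) (c := c) (S := S))
  have h8 := card_le_card (sf_sub (p := p) (q := q) (m := m) (c := c) (S := S))
  rw [card_product, card_singleton] at h1
  omega

lemma stepC (h : El X f S T E p q m c) {z : ℂ} (hz : z ^ m = c) (hz2 : ∀ u ∈ S, ph p q u ≠ z) :
    2 * (sf p q m c S).card + 3 * (sf p q m (c ^ 2) T).card ≤ N2 X f + 3 * m + 4 * E.card := by
  classical
  obtain ⟨F, hF1, hF2, hF3⟩ := h.tanOrd
  obtain ⟨T0, hT0⟩ : ∃ T0, T0 = sf p q m (c ^ 2) T := ⟨_, rfl⟩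
  obtain ⟨S0, hS0⟩ : ∃ S0, S0 = sf p q m c S := ⟨_, rfl⟩
  rw [← hT0, ← hS0] at hF1 hF3 ⊢
  have hT0' : ∀ t ∈ T0, t ∈ T ∧ ph p q t ^ m = c ^ 2 := fun t ht => mem_sf.1 (hT0 ▸ ht)
  have hS0' : ∀ t ∈ S0, t ∈ S ∧ ph p q t ^ m = c := fun t ht => mem_sf.1 (hS0 ▸ ht)
  obtain ⟨G, hG⟩ : ∃ G, G = (S0 ×ˢ T0).filter (fun r => ph p q r.2 = z * ph p q r.1) := ⟨_, rfl⟩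
  have hz0 : z ≠ 0 := by rintro rfl; rw [zero_pow h.hm.ne'] at hz; exact h.hc hz.symm
  have hG' : ∀ r ∈ G, r.1 ∈ S ∧ r.2 ∈ T ∧ ph p q r.2 = z * ph p q r.1 := fun r hr => by
    rw [hG, mem_filter, mem_product] at hr
    exact ⟨(hS0' _ hr.1.1).1, (hT0' _ hr.1.2).1, hr.2⟩
  have h1 := h.cntU F (G.filter (fun r => PR(r) ∈ ordPairs X f))
    (fun r hr => ⟨(hS0' _ (mem_tanF.1 (hF1 hr)).1).1, (hT0' _ (mem_tanF.1 (hF1 hr)).2.1).1, hF2 r hr⟩)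
    (fun r hr => ⟨(hG' r (mem_filter.1 hr).1).1, (hG' r (mem_filter.1 hr).1).2.1, (mem_filter.1 hr).2⟩)
    (fun r hr hr2 => by
      obtain ⟨a1, -, a3⟩ := hG' r (mem_filter.1 hr2).1
      have a4 := (mem_tanF.1 (hF1 hr)).2.2
      rw [a3, sq] at a4
      exact hz2 _ a1 (mul_right_cancel₀ (ph_ne h.hq _) a4).symm)
  have h2 := chg (X := X) (f := f) G E 2 (fun r hr hno => by
      obtain ⟨a1, a2, a3⟩ := hG' r hr
      rcases h.cfg.st a1 a2 hno with hh | ⟨v, hv, hvu, hco⟩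
      · exact hh
      · rw [h.coSS a1 hv a2 hvu.symm, a3, mul_comm] at hco
        exact absurd (mul_right_cancel₀ (ph_ne h.hq _) hco) (hz2 v hv)) (fun e he => by
      obtain ⟨A, B, C, hB, hAC, -, hr⟩ := h.erel he
      rw [← card_image_of_injOn (f := Prod.fst)]
      · refine quad2 (p := p) h.hq _ 0 (A * z + B) (B * z + C) (fun u hu => ?_) (fun hn => hAC ?_)
        · obtain ⟨r, hr', rfl⟩ := mem_image.1 hu
          obtain ⟨a1, a2, a3⟩ := hG' r (mem_filter.1 hr').1
          have a4 := (mem_filter.1 hr').2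
          rw [hr _ a1 _ a2, a3] at a4
          exact mul_left_cancel₀ (ph_ne h.hq r.1) (by linear_combination a4)
        · linear_combination A * hn.2.2 - B * hn.2.1
      · intro r hr r' hr' hrr
        refine Prod.ext hrr (ph_inj (p := p) h.hq ?_)
        rw [(hG' r (mem_filter.1 hr).1).2.2, (hG' r' (mem_filter.1 hr').1).2.2, hrr])
  obtain ⟨N, hN⟩ : ∃ N, N = S0.filter (fun u => ∀ t ∈ T0, ph p q t ≠ z * ph p q u) := ⟨_, rfl⟩
  have hN' : ∀ u, u ∈ N ↔ u ∈ S0 ∧ ∀ t ∈ T0, ph p q t ≠ z * ph p q u := fun u => by rw [hN]; simp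
  have h3 := rt_disj h.hq h.hm (pow_ne_zero 2 h.hc) T0 (fun t ht => (hT0' t ht).2) (N.image fun u => z * ph p q u) (by
    intro w hw
    obtain ⟨u, hu, rfl⟩ := mem_image.1 hw
    rw [hN'] at hu
    exact ⟨by rw [mul_pow, hz, (hS0' u hu.1).2, sq], hu.2⟩)
  rw [card_image_of_injective _ (fun u v huv => ph_inj (p := p) h.hq (mul_left_cancel₀ hz0 huv))] at h3
  have h4 : S0.card ≤ G.card + N.card := by
    refine le_trans (card_le_card (t := G.image Prod.fst ∪ N) fun u hu => ?_)
      ((card_union_le _ _).trans (Nat.add_le_add_right card_image_le _))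
    by_cases hh : u ∈ N
    · exact mem_union_right _ hh
    · rw [hN'] at hh
      push Not at hh
      obtain ⟨t, ht, hh⟩ := hh hu
      refine mem_union_left _ (mem_image.2 ⟨(u, t), ?_, rfl⟩)
      rw [hG, mem_filter, mem_product]
      exact ⟨⟨hu, ht⟩, hh⟩
  omega

/-- a point off the conic is collinear with at most two points of `S` and a given point -/
lemma line2 (h : El X f S T E p q m c) (e t : ℝ) (F : Fr) (hF : F ⊆ S) (het : e ≠ t) (ht : t ∉ F) (hco : ∀ u ∈ F, Co f e t u) : F.card ≤ 2 := by
  by_contra hc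
  push Not at hc
  obtain ⟨u, v, w, hu, hv, hw, huv, huw, hvw⟩ := two_lt_card_iff.1 hc
  have h1 := (hco u hu).trans (hco v hv) het
  have h2 := (hco u hu).trans (hco w hw) het
  exact hvw (h.cfg.co1 (hF hu) (hF hv) (hF hw) (h1.trans h2 (fun hh => ht (hh ▸ hu))) huv huw)

lemma stepD (h : El X f S T E p q m c) (hS : ∀ u ∈ S, ph p q u ^ m = c) {t : ℝ} (ht : t ∈ T) (ht2 : ph p q t ^ m ≠ c ^ 2) :
    2 * S.card + 2 * (sf p q m (c ^ 2) T).card ≤ N2 X f + 2 * m + 4 * E.card := by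
  classical
  obtain ⟨F, hF1, hF2, hF3⟩ := h.tanOrd
  have hS0 : sf p q m c S = S := Finset.Subset.antisymm sf_sub fun u hu => mem_sf.2 ⟨hu, hS u hu⟩
  rw [hS0] at hF1 hF3
  have h1 := h.cntU F ((S ×ˢ {t}).filter (fun r => PR(r) ∈ ordPairs X f))
    (fun r hr => ⟨(mem_tanF.1 (hF1 hr)).1, sf_sub (mem_tanF.1 (hF1 hr)).2.1, hF2 r hr⟩)
    (fun r hr => by
      obtain ⟨a, b⟩ := mem_filter.1 hr
      rw [mem_product, mem_singleton] at a
      exact ⟨a.1, a.2.symm ▸ ht, b⟩)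
    (fun r hr hr2 => by
      have a := (mem_product.1 (mem_filter.1 hr2).1).2
      rw [mem_singleton] at a
      exact ht2 (a ▸ (mem_sf.1 (mem_tanF.1 (hF1 hr)).2.1).2))
  have h2 := chg (X := X) (f := f) (S ×ˢ {t}) E 2 (fun r hr hno => by
      obtain ⟨a1, a2⟩ := mem_product.1 hr
      rw [mem_singleton] at a2
      rw [a2] at hno ⊢
      rcases h.cfg.st a1 ht hno with hh | ⟨v, hv, hvu, hco⟩
      · exact hh
      · rw [h.coSS a1 hv ht hvu.symm] at hco
        exact absurd (by rw [← hco, mul_pow, hS _ a1, hS _ hv, sq]) ht2) (fun e he => by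
      rw [← card_image_of_injOn (f := Prod.fst)]
      · have key : ∀ u ∈ ((S ×ˢ {t}).filter (fun r : ℝ × ℝ => Co f e r.1 r.2)).image Prod.fst, u ∈ S ∧ Co f e t u := by
          intro u hu
          obtain ⟨r, hr, rfl⟩ := mem_image.1 hu
          obtain ⟨a, b⟩ := mem_filter.1 hr
          rw [mem_product, mem_singleton] at a
          rw [a.2] at b
          exact ⟨a.1, b.swap⟩
        exact h.line2 e t _ (fun u hu => (key u hu).1) (h.cfg.ne_TE ht he).symm (fun hh => h.cfg.ne_ST (key t hh).1 ht rfl) (fun u hu => (key u hu).2)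
      · intro r hr r' hr' hrr
        have a := (mem_product.1 (mem_filter.1 hr).1).2
        have b := (mem_product.1 (mem_filter.1 hr').1).2
        rw [mem_singleton] at a b
        exact Prod.ext hrr (a.trans b.symm))
  rw [card_product, card_singleton, mul_one] at h2
  omega
end El

open Classical in
/-- chords through `e` -/
def ce (f : Fn) (S : Fr) (e : ℝ) : Finset (ℝ × ℝ) := (S ×ˢ S).filter (fun r => r.1 < r.2 ∧ Co f e r.1 r.2)
open Classical in
/-- tangents through `e` -/
def tb (p q : ℝ) (f : Fn) (S T : Fr) (e : ℝ) : Fr := S.filter (fun u => ∃ t ∈ T, ph p q t = ph p q u ^ 2 ∧ Co f e u t)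
lemma mem_ce {e : ℝ} {r : ℝ × ℝ} : r ∈ ce f S e ↔ r.1 ∈ S ∧ r.2 ∈ S ∧ r.1 < r.2 ∧ Co f e r.1 r.2 := by
  unfold ce; simp only [mem_filter, mem_product, and_assoc]
lemma mem_tb {e u : ℝ} : u ∈ tb p q f S T e ↔ u ∈ S ∧ ∃ t ∈ T, ph p q t = ph p q u ^ 2 ∧ Co f e u t := by
  unfold tb; simp only [mem_filter]

/-- the algebraic argument excluding extra symmetries -/
lemma mob (hm : 3 ≤ m) (hc : c ≠ 0) (A B C : ℂ) (hB : B ≠ 0) (hAC : A * C - B ^ 2 ≠ 0)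
    (h : ∀ z : ℂ, z ^ m = c → (B * z + C) ^ m = c * (A * z + B) ^ m) : A = 0 ∧ C = 0 := by
  obtain ⟨P, hP⟩ : ∃ P : Polynomial ℂ, P = (Polynomial.C B * Polynomial.X + Polynomial.C C) ^ m - Polynomial.C c * (Polynomial.C A * Polynomial.X + Polynomial.C B) ^ m
     := ⟨_, rfl⟩
  have lin : ∀ a b : ℂ, ((Polynomial.C a * Polynomial.X + Polynomial.C b) ^ m).natDegree ≤ m := fun a b =>
    (Polynomial.natDegree_pow_le_of_le m (Polynomial.natDegree_linear_le)).trans (by omega)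
  have hPd : P.natDegree ≤ m := by
    rw [hP]
    refine (Polynomial.natDegree_sub_le _ _).trans (max_le (lin _ _) ?_)
    exact (Polynomial.natDegree_C_mul_le _ _).trans (lin _ _)
  have hPe : P = Polynomial.C (P.coeff m) * (Polynomial.X ^ m - Polynomial.C c) := by
    rw [← sub_eq_zero]
    apply Polynomial.eq_zero_of_degree_lt_of_eval_finset_eq_zero (rt m c)
    · rw [card_rt (by omega) hc]
      rw [Polynomial.degree_lt_iff_coeff_zero]
      intro k hk
      have hmc : (Polynomial.X ^ m - Polynomial.C c : Polynomial ℂ).coeff m = 1 := by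
        rw [Polynomial.coeff_sub, Polynomial.coeff_X_pow_self, Polynomial.coeff_C, if_neg (by omega), sub_zero]
      rcases hk.eq_or_lt with rfl | hlt
      · rw [Polynomial.coeff_sub, Polynomial.coeff_C_mul, hmc]; ring
      · rw [Polynomial.coeff_sub, Polynomial.coeff_C_mul, Polynomial.coeff_eq_zero_of_natDegree_lt (hPd.trans_lt hlt),
          Polynomial.coeff_sub, Polynomial.coeff_X_pow, if_neg (by omega), Polynomial.coeff_C, if_neg (by omega)]
        ring
    · intro z hz
      rw [mem_rt (by omega)] at hz
      rw [hP]
      simp [hz, h z hz]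
  obtain ⟨l, hl⟩ : ∃ l, l = P.coeff m := ⟨_, rfl⟩
  rw [← hl, hP] at hPe
  have hm0 : (m : ℂ) ≠ 0 := by exact_mod_cast (by omega : m ≠ 0)
  have hm1 : ((m - 1 : ℕ) : ℂ) ≠ 0 := by exact_mod_cast (by omega : m - 1 ≠ 0)
  have z1 : m - 1 ≠ 0 := by omega
  have z2 : m - 1 - 1 ≠ 0 := by omega
  have d1 := congrArg (fun Q => (Polynomial.derivative Q).eval 0) hPe
  have d2 := congrArg (fun Q => (Polynomial.derivative (Polynomial.derivative Q)).eval 0) hPe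
  simp [Polynomial.derivative_pow, z1, z2] at d1 d2
  have e1 : B * C ^ (m - 1) = c * (A * B ^ (m - 1)) := by
    apply mul_left_cancel₀ hm0; linear_combination d1
  have e2 : B ^ 2 * C ^ (m - 1 - 1) = c * (A ^ 2 * B ^ (m - 1 - 1)) := by
    apply mul_left_cancel₀ hm0; apply mul_left_cancel₀ hm1; linear_combination d2
  obtain ⟨k, hk⟩ : ∃ k, m - 1 - 1 = k + 1 := ⟨m - 3, by omega⟩
  rw [hk] at e2
  rw [show m - 1 = k + 2 by omega] at e1
  have e3 : (c * (A * B ^ (k + 1))) * (A * C - B ^ 2) = 0 := by linear_combination B * e1 - C * e2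
  have hA : A = 0 := by
    have := (mul_eq_zero.1 e3).resolve_right hAC
    exact (mul_eq_zero.1 ((mul_eq_zero.1 this).resolve_left hc)).resolve_right (pow_ne_zero _ hB)
  refine ⟨hA, ?_⟩
  rw [hA] at e1
  have := (mul_eq_zero.1 (e1.trans (by ring : _ = (0 : ℂ)))).resolve_left hB
  exact pow_eq_zero_iff (by omega) |>.1 this

/-- full configurations -/
structure Fu (X : Fr) (f : Fn) (S T E : Fr) (p q : ℝ) (m : ℕ) (c : ℂ) : Prop extends El X f S T E p q m c where
  hS : ∀ u ∈ S, ph p q u ^ m = c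
  hSm : S.card = m
  hT : ∀ t ∈ T, ph p q t ^ m = c ^ 2

namespace Fu
lemma full (h : Fu X f S T E p q m c) {z : ℂ} (hz : z ^ m = c) : ∃ u ∈ S, ph p q u = z := by
  by_contra hc
  push Not at hc
  have := rt_disj h.hq h.hm h.hc S h.hS {z} (by simpa using ⟨hz, hc⟩)
  rw [h.hSm, card_singleton] at this
  omega

lemma co2E (h : Fu X f S T E p q m c) {e t t' : ℝ} (he : e ∈ E) (ht : t ∈ T) (ht' : t' ∈ T) (hco : Co f e t t') : t = t' := by
  unfold Co at hco
  rw [((h.cfg.mT t).1 ht).2.2, ((h.cfg.mT t').1 ht').2.2] at hco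
  have : (t - t') * (f e - (2 * p * e + -(p * p + q * q))) = 0 := by linarith
  exact sub_eq_zero.1 ((mul_eq_zero.1 this).resolve_right (sub_ne_zero.2 (h.eE he).2))

lemma key (h : Fu X f S T E p q m c) {e u t : ℝ} (hu : u ∈ S) (ht : t ∈ T) (hco : Co f e u t) :
    (ph p q t = ph p q u ^ 2) ∨ ∃ v ∈ S, v ≠ u ∧ ph p q u * ph p q v = ph p q t ∧ Co f e u v := by
  obtain ⟨v, hv, hvz⟩ := h.full (z := ph p q t / ph p q u) (by
    rw [div_pow, h.hT t ht, h.hS u hu, sq, mul_div_assoc, div_self h.hc, mul_one])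
  have hp : ph p q u * ph p q v = ph p q t := by rw [hvz, mul_div_cancel₀ _ (ph_ne h.hq u)]
  by_cases hvu : v = u
  · left; rw [← hp, hvu, sq]
  · right
    refine ⟨v, hv, hvu, hp, ?_⟩
    have h1 := (h.coSS hu hv ht (Ne.symm hvu)).2 hp
    -- points `e`, `v` both lie on the line through `t`, `u`
    exact (hco.rot.rot.swap.trans h1 (h.cfg.ne_ST hu ht).symm).rot.swap

open Classical in
lemma e1 (h : Fu X f S T E p q m c) {e : ℝ} (he : e ∈ E) : 2 * (ce f S e).card + (tb p q f S T e).card ≤ m ∧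
    (2 * (ce f S e).card + (tb p q f S T e).card = m → ∀ u ∈ S, u ∈ tb p q f S T e ∨ ∃ v ∈ S, v ≠ u ∧ Co f e u v) := by
  have i1 : Set.InjOn Prod.fst (ce f S e : Set (ℝ × ℝ)) := fun r hr r' hr' hrr => by
    obtain ⟨a1, a2, a3, a4⟩ := mem_ce.1 hr
    obtain ⟨b1, b2, b3, b4⟩ := mem_ce.1 hr'
    rw [← hrr] at b3 b4
    exact Prod.ext hrr (h.cfg.uniqS a1 a2 b2 (h.cfg.ne_SE a1 he).symm a3.ne b3.ne a4 b4)
  have i2 : Set.InjOn Prod.snd (ce f S e : Set (ℝ × ℝ)) := fun r hr r' hr' hrr => by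
    obtain ⟨a1, a2, a3, a4⟩ := mem_ce.1 hr
    obtain ⟨b1, b2, b3, b4⟩ := mem_ce.1 hr'
    rw [← hrr] at b3 b4
    exact Prod.ext (h.cfg.uniqS a2 a1 b1 (h.cfg.ne_SE a2 he).symm a3.ne' b3.ne' a4.swap b4.swap) hrr
  have d1 : Disjoint ((ce f S e).image Prod.fst) ((ce f S e).image Prod.snd) := by
    rw [disjoint_left]
    intro u hu hu'
    obtain ⟨r, hr, rfl⟩ := mem_image.1 hu
    obtain ⟨r', hr', hrr⟩ := mem_image.1 hu'
    obtain ⟨a1, a2, a3, a4⟩ := mem_ce.1 hr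
    obtain ⟨b1, b2, b3, b4⟩ := mem_ce.1 hr'
    rw [hrr] at b3 b4
    have := h.cfg.uniqS a1 a2 b1 (h.cfg.ne_SE a1 he).symm a3.ne b3.ne' a4 b4.swap
    linarith
  have nt : ∀ u v, u ∈ tb p q f S T e → v ∈ S → v ≠ u → ¬ Co f e u v := by
    intro u v hu hv hvu hco
    obtain ⟨hu, t, ht, htt, hc2⟩ := mem_tb.1 hu
    have := hc2.trans hco (h.cfg.ne_SE hu he).symm
    have := (h.coSS hu hv ht hvu.symm).1 this.rot.swap
    rw [htt, sq] at this
    exact hvu (ph_inj (p := p) h.hq (mul_left_cancel₀ (ph_ne h.hq _) this))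
  have d2 : Disjoint ((ce f S e).image Prod.fst ∪ (ce f S e).image Prod.snd) (tb p q f S T e) := by
    rw [disjoint_left]
    intro u hu hu'
    rcases mem_union.1 hu with hu | hu
    · obtain ⟨r, hr, rfl⟩ := mem_image.1 hu
      obtain ⟨a1, a2, a3, a4⟩ := mem_ce.1 hr
      exact nt _ _ hu' a2 a3.ne' a4
    · obtain ⟨r, hr, rfl⟩ := mem_image.1 hu
      obtain ⟨a1, a2, a3, a4⟩ := mem_ce.1 hr
      exact nt _ _ hu' a1 a3.ne a4.swap
  have hc := card_union_of_disjoint d2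
  rw [card_union_of_disjoint d1, card_image_of_injOn i1, card_image_of_injOn i2] at hc
  have hsub : ((ce f S e).image Prod.fst ∪ (ce f S e).image Prod.snd) ∪ (tb p q f S T e) ⊆ S := by
    intro u hu
    rcases mem_union.1 hu with hu | hu
    · rcases mem_union.1 hu with hu | hu
      · obtain ⟨r, hr, rfl⟩ := mem_image.1 hu
        exact (mem_ce.1 hr).1
      · obtain ⟨r, hr, rfl⟩ := mem_image.1 hu
        exact (mem_ce.1 hr).2.1
    · exact (mem_tb.1 hu).1
  have hle := card_le_card hsub
  have hSm := h.hSm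
  refine ⟨by omega, fun hh u hu => ?_⟩
  rw [← eq_of_subset_of_card_le hsub (by omega)] at hu
  rcases mem_union.1 hu with hu | hu
  · right
    rcases mem_union.1 hu with hu | hu
    · obtain ⟨r, hr, rfl⟩ := mem_image.1 hu
      obtain ⟨a1, a2, a3, a4⟩ := mem_ce.1 hr
      exact ⟨_, a2, a3.ne', a4⟩
    · obtain ⟨r, hr, rfl⟩ := mem_image.1 hu
      obtain ⟨a1, a2, a3, a4⟩ := mem_ce.1 hr
      exact ⟨_, a1, a3.ne, a4.swap⟩
  · exact Or.inl hu
end Fu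

namespace Fu
lemma memX (h : Fu X f S T E p q m c) {x : ℝ} (hx : x ∈ X) : x ∈ S ∨ x ∈ T ∨ x ∈ E := by
  by_cases h1 : x ∈ S
  · exact Or.inl h1
  by_cases h2 : x ∈ T
  · exact Or.inr (Or.inl h2)
  · exact Or.inr (Or.inr ((h.cfg.mE x).2 ⟨hx, h1, h2⟩))

open Classical in
lemma e2 (h : Fu X f S T E p q m c) {e : ℝ} (he : e ∈ E) :
    m ≤ (S.filter (fun u => ({e, u} : Fr) ∈ ordPairs X f)).card + 2 * (ce f S e).card + (tb p q f S T e).card + (E.erase e).card * 2 := by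
  have hsub : S ⊆ (S.filter (fun u => ({e, u} : Fr) ∈ ordPairs X f) ∪ ((ce f S e).image Prod.fst ∪ (ce f S e).image Prod.snd)) ∪
      (tb p q f S T e ∪ (E.erase e).biUnion (fun x => S.filter (fun u => Co f x e u))) := by
    intro u hu
    have chord : ∀ v ∈ S, v ≠ u → Co f e u v → u ∈ (ce f S e).image Prod.fst ∪ (ce f S e).image Prod.snd := by
      intro v hv hvu hco
      rcases lt_or_gt_of_ne hvu with hlt | hlt
      · exact mem_union_right _ (mem_image.2 ⟨(v, u), mem_ce.2 ⟨hv, hu, hlt, hco.swap⟩, rfl⟩)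
      · exact mem_union_left _ (mem_image.2 ⟨(u, v), mem_ce.2 ⟨hu, hv, hlt, hco⟩, rfl⟩)
    by_cases ho : ({e, u} : Fr) ∈ ordPairs X f
    · exact mem_union_left _ (mem_union_left _ (mem_filter.2 ⟨hu, ho⟩))
    obtain ⟨x, hx, hxe, hxu, hco⟩ := not_ord ((h.cfg.mE e).1 he).1 ((h.cfg.mS u).1 hu).1 (h.cfg.ne_SE hu he).symm ho
    rcases h.memX hx with hS | hT | hE
    · exact mem_union_left _ (mem_union_right _ (chord x hS hxu hco.rot))
    · rcases h.key hu hT hco.rot with hh | ⟨v, hv, hvu, -, hco⟩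
      · exact mem_union_right _ (mem_union_left _ (mem_tb.2 ⟨hu, x, hT, hh, hco.rot⟩))
      · exact mem_union_left _ (mem_union_right _ (chord v hv hvu hco))
    · exact mem_union_right _ (mem_union_right _ (mem_biUnion.2 ⟨x, mem_erase.2 ⟨hxe, hE⟩, mem_filter.2 ⟨hu, hco⟩⟩))
  have h1 := (card_le_card hsub).trans ((card_union_le _ _).trans (Nat.add_le_add ((card_union_le _ _).trans
    (Nat.add_le_add_left (card_union_le _ _) _)) (card_union_le _ _)))
  have h2 : ((ce f S e).image Prod.fst).card ≤ (ce f S e).card := card_image_le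
  have h3 : ((ce f S e).image Prod.snd).card ≤ (ce f S e).card := card_image_le
  have h4 := card_biUnion_le_card_mul (E.erase e) (fun x => S.filter (fun u => Co f x e u)) 2 (fun x hx =>
    h.line2 x e _ (filter_subset _ _) (mem_erase.1 hx).1 (fun hh => h.cfg.ne_SE (mem_filter.1 hh).1 he rfl) (fun u hu => (mem_filter.1 hu).2))
  have := h.hSm
  omega

open Classical in
lemma e3 (h : Fu X f S T E p q m c) {e : ℝ} (he : e ∈ E) :
    T.card ≤ (T.filter (fun u => ({e, u} : Fr) ∈ ordPairs X f)).card + (ce f S e).card + (tb p q f S T e).card + (E.erase e).card := by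
  have hsub : T ⊆ (T.filter (fun u => ({e, u} : Fr) ∈ ordPairs X f) ∪ T.filter (fun t => ∃ r ∈ ce f S e, ph p q r.1 * ph p q r.2 = ph p q t)) ∪
      (T.filter (fun t => ∃ u ∈ tb p q f S T e, ph p q t = ph p q u ^ 2) ∪ T.filter (fun t => ∃ x ∈ E.erase e, Co f x e t)) := by
    intro t ht
    by_cases ho : ({e, t} : Fr) ∈ ordPairs X f
    · exact mem_union_left _ (mem_union_left _ (mem_filter.2 ⟨ht, ho⟩))
    obtain ⟨x, hx, hxe, hxu, hco⟩ := not_ord ((h.cfg.mE e).1 he).1 ((h.cfg.mT t).1 ht).1 (h.cfg.ne_TE ht he).symm ho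
    rcases h.memX hx with hS | hT | hE
    · rcases h.key hS ht hco.rot.swap with hh | ⟨v, hv, hvu, hp, hco'⟩
      · exact mem_union_right _ (mem_union_left _ (mem_filter.2 ⟨ht, x, mem_tb.2 ⟨hS, t, ht, hh, hco.rot.swap⟩, hh⟩))
      · refine mem_union_left _ (mem_union_right _ (mem_filter.2 ⟨ht, ?_⟩))
        rcases lt_or_gt_of_ne hvu with hlt | hlt
        · exact ⟨(v, x), mem_ce.2 ⟨hv, hS, hlt, hco'.swap⟩, by rw [← hp]; ring⟩
        · exact ⟨(x, v), mem_ce.2 ⟨hS, hv, hlt, hco'⟩, hp⟩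
    · exact absurd (h.co2E he ht hT hco.rot) hxu.symm
    · exact mem_union_right _ (mem_union_right _ (mem_filter.2 ⟨ht, x, mem_erase.2 ⟨hxe, hE⟩, hco⟩))
  have h1 := (card_le_card hsub).trans ((card_union_le _ _).trans (Nat.add_le_add (card_union_le _ _) (card_union_le _ _)))
  have h2 : (T.filter (fun t => ∃ r ∈ ce f S e, ph p q r.1 * ph p q r.2 = ph p q t)).card ≤ (ce f S e).card :=
    card_le_card_of_forall_subsingleton (fun (t : ℝ) (r : ℝ × ℝ) => ph p q r.1 * ph p q r.2 = ph p q t) (fun t ht => (mem_filter.1 ht).2)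
      (fun r _ t ht t' ht' => by
        have a : ph p q r.1 * ph p q r.2 = ph p q t := ht.2
        have b : ph p q r.1 * ph p q r.2 = ph p q t' := ht'.2
        exact ph_inj (p := p) h.hq (a.symm.trans b))
  have h3 : (T.filter (fun t => ∃ u ∈ tb p q f S T e, ph p q t = ph p q u ^ 2)).card ≤ (tb p q f S T e).card :=
    card_le_card_of_forall_subsingleton (fun t u => ph p q t = ph p q u ^ 2) (fun t ht => (mem_filter.1 ht).2)
      (fun r _ t ht t' ht' => ph_inj (p := p) h.hq (ht.2.trans ht'.2.symm))
  have h4 : (T.filter (fun t => ∃ x ∈ E.erase e, Co f x e t)).card ≤ (E.erase e).card :=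
    card_le_card_of_forall_subsingleton (fun t x => Co f x e t) (fun t ht => (mem_filter.1 ht).2)
      (fun x hx t ht t' ht' => h.co2E he (mem_filter.1 ht.1).1 (mem_filter.1 ht'.1).1 (ht.2.trans ht'.2 (mem_erase.1 hx).1))
  omega

lemma tb2 (h : Fu X f S T E p q m c) {e : ℝ} (he : e ∈ E) : (tb p q f S T e).card ≤ 2 := by
  obtain ⟨A, B, C, hB, h2⟩ := h.tan_eq subset_rfl subset_rfl he
  refine quad2 (p := p) h.hq _ A B C (fun u hu => ?_) (fun hn => hB hn.2.1)
  obtain ⟨hu, t, ht, htt, hco⟩ := mem_tb.1 hu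
  exact h2 (u, t) (mem_tanF.2 ⟨hu, ht, htt⟩) hco

open Classical in
/-- ordinary pairs through `e` -/
def oe (X : Fr) (f : Fn) (S T : Fr) (e : ℝ) : Finset (ℝ × ℝ) :=
  ({e} : Fr) ×ˢ ((S.filter (fun u => ({e, u} : Fr) ∈ ordPairs X f)) ∪ (T.filter (fun u => ({e, u} : Fr) ∈ ordPairs X f)))

lemma mem_oe {e : ℝ} {r : ℝ × ℝ} : r ∈ oe X f S T e ↔ r.1 = e ∧ (r.2 ∈ S ∨ r.2 ∈ T) ∧ ({e, r.2} : Fr) ∈ ordPairs X f := by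
  unfold oe
  simp only [mem_product, mem_union, mem_filter, mem_singleton, ← or_and_right]

lemma e4 (h : Fu X f S T E p q m c) {e : ℝ} (he : e ∈ E) : m + T.card + 3 ≤ (oe X f S T e).card + 3 * (ce f S e).card + 2 * (tb p q f S T e).card + 3 * E.card := by
  classical
  have h1 := h.e2 he
  have h2 := h.e3 he
  have h3 : (oe X f S T e).card = (S.filter (fun u => ({e, u} : Fr) ∈ ordPairs X f)).card + (T.filter (fun u => ({e, u} : Fr) ∈ ordPairs X f)).card := by
    unfold oe
    rw [card_product, card_singleton, one_mul, card_union_of_disjoint]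
    exact disjoint_left.2 fun u hu hu' => h.cfg.ne_ST (mem_filter.1 hu).1 (mem_filter.1 hu').1 rfl
  have h4 := Finset.card_erase_of_mem he
  have h5 := card_pos.2 ⟨e, he⟩
  omega

lemma sfS (h : Fu X f S T E p q m c) : sf p q m c S = S := Finset.Subset.antisymm sf_sub fun u hu => mem_sf.2 ⟨hu, h.hS u hu⟩
lemma sfT (h : Fu X f S T E p q m c) : sf p q m (c ^ 2) T = T := Finset.Subset.antisymm sf_sub fun u hu => mem_sf.2 ⟨hu, h.hT u hu⟩

lemma Tm (h : Fu X f S T E p q m c) : T.card ≤ m := h.sfT ▸ sf_card h.hq h.hm (pow_ne_zero 2 h.hc)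

lemma stepE (h : Fu X f S T E p q m c) (hT3 : m ≤ T.card + 3) :
    (m - T.card + E.card) * (m - (8 + 6 * E.card)) + 2 * m ≤ 2 * N2 X f + 4 * (m - T.card) + 4 * E.card := by
  classical
  obtain ⟨F, hF1, hF2, hF3⟩ := h.tanOrd
  rw [h.sfS, h.sfT] at hF1 hF3
  have hTm := h.Tm
  have hSm := h.hSm
  obtain ⟨k, hk⟩ : ∃ k, k = m - T.card := ⟨_, rfl⟩
  obtain ⟨V, hV, hV2⟩ := rt_miss h.hq h.hm (pow_ne_zero 2 h.hc) T k (by omega)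
  have c1 := chF_card h.hq h.hm h.hc h.hS V (fun d hd => (hV2 d hd).1)
  have c2 := h.ch_ord subset_rfl V (fun d hd t ht hh => (hV2 d hd).2 t ht hh)
  have c3 := h.cnt3 F ((chF p q S V).filter (fun r => PR(r) ∈ ordPairs X f)) (E.biUnion (oe X f S T))
    (fun r hr => ⟨(mem_tanF.1 (hF1 hr)).1, (mem_tanF.1 (hF1 hr)).2.1, hF2 r hr⟩)
    (fun r hr => by
      obtain ⟨hr, ho⟩ := mem_filter.1 hr
      obtain ⟨a1, a2, a3, -⟩ := mem_chF.1 hr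
      exact ⟨a1, a2, a3, ho⟩)
    (fun r hr => by
      obtain ⟨e, he, hr⟩ := mem_biUnion.1 hr
      obtain ⟨a1, a2, a3⟩ := mem_oe.1 hr
      rw [a1]
      exact ⟨he, a2, a3⟩)
  rw [Finset.card_biUnion (fun e _ e' _ hee => disjoint_left.2 fun r hr hr' => hee ((mem_oe.1 hr).1.symm.trans (mem_oe.1 hr').1))] at c3
  have c4 : E.card * (m - (8 + 6 * E.card)) ≤ ∑ e ∈ E, 2 * (oe X f S T e).card := by
    rw [← smul_eq_mul]
    refine card_nsmul_le_sum _ _ _ fun e he => ?_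
    have := h.e4 he
    have := h.tb2 he
    have := (h.e1 he).1
    omega
  rw [← mul_sum] at c4
  have c5 : k * (m - (8 + 6 * E.card)) ≤ 2 * ((chF p q S V).filter (fun r => PR(r) ∈ ordPairs X f)).card := by
    rw [hV] at c1 c2
    rw [hSm] at c1
    have : k * (m - (8 + 6 * E.card)) + (k * (2 + m) + 2 * (E.card * (k * 2))) ≤ k * (2 * m) ∨ m ≤ 8 + 6 * E.card := by
      rcases le_total m (8 + 6 * E.card) with h1 | h1
      · exact Or.inr h1
      · left
        obtain ⟨d, hd⟩ := Nat.exists_eq_add_of_le h1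
        rw [hd, Nat.add_sub_cancel_left]
        nlinarith [Nat.zero_le (k * E.card), Nat.zero_le k]
    rcases this with h1 | h1
    · omega
    · rw [Nat.sub_eq_zero_of_le h1]; omega
  rw [← hk, add_mul]
  omega

lemma fin0 (h : Fu X f S T E p q m c) (hT : T.card = m) (hE : E.card = 0) : m ≤ N2 X f := by
  obtain ⟨F, hF1, hF2, hF3⟩ := h.tanOrd
  rw [h.sfS, h.sfT] at hF1 hF3
  have c3 := h.cnt3 F ∅ ∅ (fun r hr => ⟨(mem_tanF.1 (hF1 hr)).1, (mem_tanF.1 (hF1 hr)).2.1, hF2 r hr⟩) (by simp) (by simp)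
  have := h.hSm
  simp only [card_empty] at c3
  omega

lemma fin1 (h : Fu X f S T E p q m c) (hT : T.card + 1 = m) (hE : E.card = 0) : ∃ δ ≤ 2, (δ ≤ 1 ∨ m % 2 = 0) ∧ 3 * m ≤ 2 * N2 X f + 3 * δ := by
  classical
  obtain ⟨V, hV, hV2⟩ := rt_miss h.hq h.hm (pow_ne_zero 2 h.hc) T 1 (by omega)
  obtain ⟨d, rfl⟩ := card_eq_one.1 hV
  obtain ⟨hd, hd2⟩ := hV2 d (mem_singleton_self d)
  have c1 := chF_card1 h.hq h.hm h.hc h.hS d hd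
  have c2 := h.ch_ord subset_rfl {d} (fun d hd t ht hh => (hV2 d hd).2 t ht hh)
  have t1 := h.tan_ord subset_rfl subset_rfl
  have t2 := tanF_card (p := p) (q := q) S T
  have t3 : (tanMiss p q S T).card ≤ (S.filter (fun u => ph p q u ^ 2 = d)).card := by
    refine card_le_card fun u hu => ?_
    obtain ⟨hu, hu2⟩ := mem_tanMiss.1 hu
    refine mem_filter.2 ⟨hu, ?_⟩
    by_contra hne
    have := rt_disj h.hq h.hm (pow_ne_zero 2 h.hc) T h.hT {ph p q u ^ 2, d} (by
      intro z hz
      rcases mem_insert.1 hz with rfl | hz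
      · exact ⟨by rw [← pow_mul, mul_comm, pow_mul, h.hS u hu], hu2⟩
      · rw [mem_singleton] at hz
        exact hz ▸ ⟨hd, hd2⟩)
    rw [Finset.card_pair hne] at this
    omega
  have c3 := h.cnt3 ((tanF p q S T).filter (fun r => PR(r) ∈ ordPairs X f)) ((chF p q S {d}).filter (fun r => PR(r) ∈ ordPairs X f)) ∅
    (fun r hr => by
      obtain ⟨hr, ho⟩ := mem_filter.1 hr
      obtain ⟨a1, a2, -⟩ := mem_tanF.1 hr
      exact ⟨a1, a2, ho⟩)
    (fun r hr => by
      obtain ⟨hr, ho⟩ := mem_filter.1 hr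
      obtain ⟨a1, a2, a3, -⟩ := mem_chF.1 hr
      exact ⟨a1, a2, a3, ho⟩) (by simp)
  have hSm := h.hSm
  rw [hE] at t1 c2
  simp only [card_empty] at c3
  refine ⟨(S.filter (fun u => ph p q u ^ 2 = d)).card, sq_card h.hq d S, ?_, by omega⟩
  by_contra hc
  push Not at hc
  obtain ⟨u, hu, v, hv, huv⟩ := one_lt_card.1 hc.1
  obtain ⟨hu, hu2⟩ := mem_filter.1 hu
  obtain ⟨hv, hv2⟩ := mem_filter.1 hv
  have hs := h.hS u hu
  rcases sq_eq_sq_iff_eq_or_eq_neg.1 (hu2.trans hv2.symm) with h1 | h1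
  · exact huv (ph_inj (p := p) h.hq h1)
  · rw [h1, Odd.neg_pow (Nat.odd_iff.2 (by omega)), h.hS v hv] at hs
    exact h.hc (by linear_combination (-1 / 2 : ℂ) * hs)

lemma fin2 (h : Fu X f S T E p q m c) (hT : T.card = m) (hE : E.card = 1) (hm3 : 3 ≤ m) : (if m % 2 = 0 then 3 * m else 3 * m - 3) ≤ 2 * N2 X f := by
  classical
  obtain ⟨e, rfl⟩ := card_eq_one.1 hE
  have he := mem_singleton_self e
  have h1 := h.e4 he
  have h2 := h.tb2 he
  have h3 := h.e1 he
  have t2 := tanF_card (p := p) (q := q) S T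
  have t3 := tanMiss_card h.hq h.hm h.hc h.hS h.hT
  have t4 : ((tanF p q S T).filter (fun r => ¬ PR(r) ∈ ordPairs X f)).card ≤ (tb p q f S T e).card := by
    rw [← card_image_of_injOn (f := Prod.fst)]
    · refine card_le_card fun u hu => ?_
      obtain ⟨r, hr, rfl⟩ := mem_image.1 hu
      obtain ⟨hr, ho⟩ := mem_filter.1 hr
      obtain ⟨e', he', hco⟩ := h.tan_no subset_rfl subset_rfl hr ho
      rw [mem_singleton] at he'
      obtain ⟨a1, a2, a3⟩ := mem_tanF.1 hr
      exact mem_tb.2 ⟨a1, r.2, a2, a3, he' ▸ hco⟩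
    · intro r hr r' hr' hrr
      refine Prod.ext hrr (ph_inj (p := p) h.hq ?_)
      rw [(mem_tanF.1 (mem_filter.1 hr).1).2.2, (mem_tanF.1 (mem_filter.1 hr').1).2.2, hrr]
  have t5 := card_filter_add_card_filter_not (s := tanF p q S T) (fun r => PR(r) ∈ ordPairs X f)
  have c3 := h.cnt3 ((tanF p q S T).filter (fun r => PR(r) ∈ ordPairs X f)) ∅ (oe X f S T e)
    (fun r hr => by
      obtain ⟨hr, ho⟩ := mem_filter.1 hr
      obtain ⟨a1, a2, -⟩ := mem_tanF.1 hr
      exact ⟨a1, a2, ho⟩) (by simp)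
    (fun r hr => by
      obtain ⟨a1, a2, a3⟩ := mem_oe.1 hr
      rw [a1]
      exact ⟨he, a2, a3⟩)
  have hSm := h.hSm
  simp only [card_empty] at c3
  by_cases hbad : m % 2 = 0 ∧ (tb p q f S T e).card = 2 ∧ 2 * (ce f S e).card + (tb p q f S T e).card = m
  · exfalso
    obtain ⟨hev, ht2, hfull⟩ := hbad
    have hall := h3.2 hfull
    obtain ⟨A, B, C, hB, hAC, r1, r2⟩ := h.erel he
    have htan : ∀ u ∈ tb p q f S T e, ph p q u * (A * ph p q u + B) = - (B * ph p q u + C) := by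
      intro u hu
      obtain ⟨hu, t, ht, htt, hco⟩ := mem_tb.1 hu
      rw [r2 u hu t ht, htt] at hco
      apply mul_left_cancel₀ (ph_ne (p := p) h.hq u)
      linear_combination hco
    have hA := mob hm3 h.hc A B C hB hAC (fun z hz => by
      obtain ⟨u, hu, rfl⟩ := h.full hz
      have : ∃ w : ℂ, w ^ m = c ∧ w * (A * ph p q u + B) = - (B * ph p q u + C) := by
        rcases hall u hu with hh | ⟨v, hv, hvu, hco⟩
        · exact ⟨_, hz, htan u hh⟩
        · rw [r1 u hu v hv hvu.symm] at hco
          exact ⟨_, h.hS v hv, by linear_combination hco⟩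
      obtain ⟨w, hw, hw2⟩ := this
      have := congrArg (fun y => y ^ m) hw2
      simp only [mul_pow, hw, Even.neg_pow (Nat.even_iff.2 hev)] at this
      exact this.symm)
    obtain ⟨u, hu⟩ := card_pos.1 (show 0 < (tb p q f S T e).card by omega)
    have := htan u hu
    rw [hA.1, hA.2] at this
    have : 2 * B * ph p q u = 0 := by linear_combination this
    exact mul_ne_zero (mul_ne_zero two_ne_zero hB) (ph_ne h.hq u) this
  · have h3' := h3.1
    have tb1 : (tb p q f S T e).card = 0 ∨ (tb p q f S T e).card = 1 ∨ (tb p q f S T e).card = 2 := by omega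
    have me : m % 2 = 0 ∨ m % 2 = 1 := by omega
    split_ifs with hpar <;> rcases tb1 with hh | hh | hh <;> omega
end Fu

end GT

namespace GT

lemma caseB : ∃ M n0 : ℕ, ∀ (X : Fr) (f : Fn), n0 ≤ X.card → M < (Par X f).card → dmBound X.card ≤ N2 X f := by
  classical
  obtain ⟨M, n0, K, hell⟩ := ell
  refine ⟨M, n0 + 1000 * K + 1000, fun X f hX hP => ?_⟩
  by_contra hlt
  push Not at hlt
  have hdm : 4 * N2 X f ≤ 3 * X.card := by
    unfold dmBound at hlt
    split_ifs at hlt <;> omega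
  obtain ⟨α, β, S, T, E, hcfg, hE, hS, hT, p, q, hq, rfl, rfl, m, c, hm, hc, hm1, hm2⟩ := hell X f (by omega) hP (by omega)
  have h : El X f S T E p q m c := ⟨hcfg, hq, hm, hc⟩
  have hcard := hcfg.card
  have e0 : (S.filter (fun u => ph p q u ^ m = c)).card = (sf p q m c S).card := by
    congr 1
  have e1 := card_filter_add_card_filter_not (s := S) (fun u => ph p q u ^ m = c)
  have e2 : (S.filter (fun u => ¬ ph p q u ^ m = c)).card ≤ K := by convert hm1
  have e3 : m ≤ (sf p q m c S).card + K := by rw [← e0]; convert hm2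
  have e4 := sf_card hq hm hc (p := p) (S := S)
  rw [e0] at e1
  have hA : m ≤ (sf p q m (c ^ 2) T).card + 3 := by
    by_contra hcon
    have := h.stepA (by omega)
    omega
  have hB : ∀ u ∈ S, ph p q u ^ m = c := by
    intro u hu
    by_contra hcon
    have := h.stepB hu hcon
    omega
  have hS0 : sf p q m c S = S := Finset.Subset.antisymm sf_sub fun u hu => mem_sf.2 ⟨hu, hB u hu⟩
  have hC : S.card = m := by
    by_contra hcon
    rw [hS0] at e4
    obtain ⟨V, hV, hV2⟩ := rt_miss hq hm hc S 1 (by omega)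
    obtain ⟨z, hz⟩ := card_pos.1 (by omega : 0 < V.card)
    have := h.stepC (hV2 z hz).1 (hV2 z hz).2
    omega
  have hD : ∀ t ∈ T, ph p q t ^ m = c ^ 2 := by
    intro t ht
    by_contra hcon
    have := h.stepD hB ht hcon
    omega
  have F : Fu X f S T E p q m c := { toEl := h, hS := hB, hSm := hC, hT := hD }
  rw [F.sfT] at hA
  have hTm := F.Tm
  have hE1 : m - T.card + E.card ≤ 1 := by
    by_contra hcon
    have h1 := F.stepE hA
    have h2 : 2 * (m - (8 + 6 * E.card)) ≤ (m - T.card + E.card) * (m - (8 + 6 * E.card)) := Nat.mul_le_mul_right _ (by omega)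
    omega
  unfold dmBound at hlt
  rcases Nat.lt_or_ge T.card m with h1 | h1
  · obtain ⟨δ, d1, d2, d3⟩ := F.fin1 (by omega) (by omega)
    rw [hcard] at hlt
    split_ifs at hlt <;> omega
  · rcases Nat.eq_zero_or_pos E.card with h2 | h2
    · have := F.fin0 (by omega) h2
      rw [hcard] at hlt
      split_ifs at hlt <;> omega
    · have h3 := F.fin2 (by omega) (by omega) (by omega)
      rw [hcard] at hlt
      split_ifs at hlt h3 <;> omega

end GT

namespace GT
open Polynomial

lemma lin18 {Q : PY} (hQ : Irreducible Q) (dQ : td Q = 2) {s : Fr} {f : Fn}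
    (h : ∀ x ∈ s, Q.evalEval x (f x) = 0) {a b c : ℝ} (h0 : a ≠ 0 ∨ b ≠ 0 ∨ c ≠ 0)
    (hl : ∀ x ∈ s, a * x + b * f x + c = 0) : s.card ≤ 18 := by
  have ev : ∀ x y, (sc c + sc a * C X + sc b * X).evalEval x y = a * x + b * y + c := by
    intro x y; simp [evalEval]; ring
  have hG : sc c + sc a * C X + sc b * X ≠ 0 := by
    intro h
    have e : ∀ x y, a * x + b * y + c = 0 := by
      intro x y; rw [← ev, h]; simp [evalEval]
    have e1 := e 0 0
    have e2 := e 1 0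
    have e3 := e 0 1
    grind
  have dG : td (sc c + sc a * C X + sc b * X) ≤ 1 := by
    rw [td_le_iff]
    intro i j h
    rcases i with _ | _ | i
    · simp [coeff_X, coeff_C]; grind
    · have h1 : j ≠ 0 := by omega
      simp [coeff_C, h1]
    · simp [coeff_X, coeff_C]
  refine bezout hQ (by omega) (G := sc c + sc a * C X + sc b * X) (by omega) (not_dvd_of_td hG (by omega)) s f fun x hx => ⟨h x hx, ?_⟩
  rw [ev]; exact hl x hx

lemma quad6 {Q : PY} (h : td Q ≤ 2) : ∃ c00 c10 c01 c20 c11 c02 : ℝ, ∀ x y,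
    Q.evalEval x y = c00 + c10 * x + c01 * y + c20 * x * x + c11 * x * y + c02 * y * y := by
  have hz := td_le_iff.1 h
  refine ⟨(Q.coeff 0).coeff 0, (Q.coeff 0).coeff 1, (Q.coeff 1).coeff 0, (Q.coeff 0).coeff 2,
    (Q.coeff 1).coeff 1, (Q.coeff 2).coeff 0, fun x y => ?_⟩
  have d : ∀ i, (Q.coeff i).natDegree < 3 := fun i =>
    Nat.lt_succ_of_le (natDegree_le_iff_coeff_eq_zero.2 fun N hN => hz _ _ (by omega))
  have dQ : Q.natDegree < 3 :=
    Nat.lt_succ_of_le (natDegree_le_iff_coeff_eq_zero.2 fun N hN => by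
      ext j; rw [hz _ _ (by omega)]; simp)
  rw [evalEval, eval_eq_sum_range' dQ]
  simp only [sum_range_succ, sum_range_zero, eval_add, eval_mul, eval_pow, eval_C,
    eval_eq_sum_range' (d _), hz 1 2 (by omega), hz 2 1 (by omega), hz 2 2 (by omega), eval_zero]
  ring

/-- a conic with many points on the graph of `f`, put in the form `ξ² = m η ζ` -/
lemma conic {Q : PY} (hQ : Irreducible Q) (dQ : td Q = 2) {s : Fr} {f : Fn}
    (h : ∀ x ∈ s, Q.evalEval x (f x) = 0) (hs : 36 < s.card) : ∃ t c x0 x1 k l m : ℝ, x0 ≠ x1 ∧ m ≠ 0 ∧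
    ∀ x ∈ s, (f x - t * x - c) ^ 2 = m * (x - x0 + k * (f x - t * x - c)) * (x - x1 + l * (f x - t * x - c)) := by
  classical
  obtain ⟨c00, c10, c01, c20, c11, c02, hq⟩ := quad6 dQ.le
  obtain ⟨x0, h0, x1, h1, hne⟩ := one_lt_card.1 (show 1 < s.card by omega)
  have two : ∀ a b c a' b' c' : ℝ, (a ≠ 0 ∨ b ≠ 0 ∨ c ≠ 0) → (a' ≠ 0 ∨ b' ≠ 0 ∨ c' ≠ 0) →
      ¬ ∀ x ∈ s, a * x + b * f x + c = 0 ∨ a' * x + b' * f x + c' = 0 := by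
    intro a b c a' b' c' g g' hh
    have e1 := lin18 hQ dQ (s := s.filter (fun x => a * x + b * f x + c = 0)) (f := f)
      (fun x hx => h x (mem_filter.1 hx).1) g (fun x hx => (mem_filter.1 hx).2)
    have e2 := lin18 hQ dQ (s := s.filter (fun x => a' * x + b' * f x + c' = 0)) (f := f)
      (fun x hx => h x (mem_filter.1 hx).1) g' (fun x hx => (mem_filter.1 hx).2)
    have e3 := card_union_le (s.filter (fun x => a * x + b * f x + c = 0)) (s.filter (fun x => a' * x + b' * f x + c' = 0))
    rw [← Finset.filter_or, Finset.filter_true_of_mem hh] at e3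
    omega
  have hd : x1 - x0 ≠ 0 := sub_ne_zero.2 (Ne.symm hne)
  obtain ⟨t, ht⟩ : ∃ t, t * (x1 - x0) = f x1 - f x0 := ⟨(f x1 - f x0) / (x1 - x0), by field_simp⟩
  obtain ⟨c, hc⟩ : ∃ c, c = f x0 - t * x0 := ⟨_, rfl⟩
  have f0 : f x0 = t * x0 + c := by linarith
  have f1 : f x1 = t * x1 + c := by linarith
  obtain ⟨α, hα⟩ : ∃ α, α = c20 + c11 * t + c02 * t ^ 2 := ⟨_, rfl⟩
  obtain ⟨p, hp⟩ : ∃ p, p * (x1 - x0) = c01 + 2 * c02 * c + (c11 + 2 * c02 * t) * x1 :=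
    ⟨(c01 + 2 * c02 * c + (c11 + 2 * c02 * t) * x1) / (x1 - x0), by field_simp⟩
  obtain ⟨r, hr⟩ : ∃ r, r * (x1 - x0) = -(c01 + 2 * c02 * c + (c11 + 2 * c02 * t) * x0) :=
    ⟨-(c01 + 2 * c02 * c + (c11 + 2 * c02 * t) * x0) / (x1 - x0), by field_simp⟩
  have q0 := h x0 h0
  have q1 := h x1 h1
  rw [hq, f0] at q0
  rw [hq, f1] at q1
  have pr : p + r = c11 + 2 * c02 * t := by
    apply mul_right_cancel₀ hd; linear_combination hp + hr
  have pr2 : -(p * x0) - r * x1 = c01 + 2 * c02 * c := by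
    apply mul_right_cancel₀ hd; linear_combination -x0 * hp - x1 * hr
  have s1 : c10 + c01 * t + c11 * c + 2 * c02 * t * c = - α * (x0 + x1) := by
    apply mul_right_cancel₀ hd; rw [hα]; linear_combination q1 - q0
  have s0 : c00 + c01 * c + c02 * c * c = α * x0 * x1 := by
    rw [hα]; rw [hα] at s1; linear_combination q0 - x0 * s1
  have key : ∀ x y, Q.evalEval x y = α * (x - x0) * (x - x1) +
      (y - t * x - c) * (p * (x - x0) + r * (x - x1) + c02 * (y - t * x - c)) := by
    intro x y
    rw [hq]
    linear_combination s0 + x * s1 - (y - t * x - c) * x * pr - (y - t * x - c) * pr2 - x * x * hα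
  have hα0 : α ≠ 0 := by
    intro ha
    have nz : p + r - c02 * t ≠ 0 ∨ c02 ≠ 0 ∨ -(p * x0) - r * x1 - c02 * c ≠ 0 := by
      by_contra hh
      push Not at hh
      obtain ⟨b1, b2, b3⟩ := hh
      rw [b2] at b1 b3
      have : ∀ x y, Q.evalEval x y = 0 := by
        intro x y
        rw [key, ha, b2]
        linear_combination (y - t * x - c) * x * b1 + (y - t * x - c) * b3
      have := lin18 hQ dQ (s := (range 19).image (fun n : ℕ => (n : ℝ))) (f := fun _ => 0)
        (fun x _ => this x _) (a := 0) (b := 1) (c := 0) (by simp) (by simp)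
      rw [card_image_of_injective _ Nat.cast_injective] at this
      simp at this
    refine two (-t) 1 (-c) _ _ _ (by simp) nz fun x hx => ?_
    have := h x hx
    rw [key, ha] at this
    have : (f x - t * x - c) * (p * (x - x0) + r * (x - x1) + c02 * (f x - t * x - c)) = 0 := by linarith
    rcases mul_eq_zero.1 this with e | e
    · left; linarith
    · right; linarith
  obtain ⟨l, hl⟩ : ∃ l, α * l = p := ⟨p / α, by field_simp⟩
  obtain ⟨k, hk⟩ : ∃ k, α * k = r := ⟨r / α, by field_simp⟩
  obtain ⟨μ, hμ⟩ : ∃ μ, μ = c02 - α * k * l := ⟨_, rfl⟩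
  have key2 : ∀ x ∈ s, α * (x - x0 + k * (f x - t * x - c)) * (x - x1 + l * (f x - t * x - c)) + μ * (f x - t * x - c) ^ 2 = 0 := by
    intro x hx
    rw [← h x hx, key, hμ, ← hl, ← hk]
    ring
  have hμ0 : μ ≠ 0 := by
    intro hm
    refine two (1 - k * t) k (- x0 - k * c) (1 - l * t) l (- x1 - l * c) ?_ ?_ fun x hx => ?_
    · by_contra hh; push Not at hh; rw [hh.2.1] at hh; simp at hh
    · by_contra hh; push Not at hh; rw [hh.2.1] at hh; simp at hh
    · have := key2 x hx
      rw [hm, mul_assoc] at this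
      have : (x - x0 + k * (f x - t * x - c)) * (x - x1 + l * (f x - t * x - c)) = 0 := by
        apply (mul_eq_zero.1 (show α * _ = 0 by linarith)).resolve_left hα0
      rcases mul_eq_zero.1 this with e | e
      · left; linarith
      · right; linarith
  refine ⟨t, c, x0, x1, k, l, -α / μ, hne, by simp [hα0, hμ0], fun x hx => ?_⟩
  have := key2 x hx
  field_simp
  linear_combination this

end GT

namespace GT

lemma rep_indep {p q : RP2} (h : p ≠ q) : LinearIndependent ℝ ![p.rep, q.rep] := by
  have := (Projectivization.independent_pair_iff_ne p q).2 h
  rw [Projectivization.independent_iff] at this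
  have e : Projectivization.rep ∘ ![p, q] = ![p.rep, q.rep] := by
    ext1 i; fin_cases i <;> rfl
  rw [e] at this
  exact this

lemma fin_OL {P : Set RP2} (hP : P.Finite) : {L : Set RP2 | IsProjLine L ∧ (P ∩ L).ncard = 2}.Finite := by
  refine Set.Finite.of_finite_image (f := fun L => P ∩ L) (hP.finite_subsets.subset ?_) ?_
  · rintro _ ⟨L, _, rfl⟩; exact Set.inter_subset_left
  · rintro L ⟨⟨W, hW, rfl⟩, h2⟩ L' ⟨⟨W', hW', rfl⟩, h2'⟩ he
    obtain ⟨p, q, hpq, hs⟩ := Set.ncard_eq_two.1 h2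
    have key : ∀ U : Submodule ℝ (Fin 3 → ℝ), Module.finrank ℝ U = 2 → P ∩ {x | x.submodule ≤ U} = {p, q} →
        Submodule.span ℝ (Set.range ![p.rep, q.rep]) = U := by
      intro U hU hPU
      apply Submodule.eq_of_le_of_finrank_eq
      · rw [Submodule.span_le]
        rintro _ ⟨i, rfl⟩
        have hp : p ∈ P ∩ {x | x.submodule ≤ U} := by rw [hPU]; simp
        have hq : q ∈ P ∩ {x | x.submodule ≤ U} := by rw [hPU]; simp
        fin_cases i
        · exact hp.2 (by rw [Projectivization.submodule_eq]; exact Submodule.mem_span_singleton_self _)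
        · exact hq.2 (by rw [Projectivization.submodule_eq]; exact Submodule.mem_span_singleton_self _)
      · rw [finrank_span_eq_card (rep_indep hpq), hU]; simp
    have e1 := key W hW hs
    have e2 := key W' hW' (by rw [← hs]; exact he.symm)
    rw [← e1, ← e2]

abbrev V3 := Fin 3 → ℝ

lemma surj3 {a b z : V3 →ₗ[ℝ] ℝ} (hi : ∀ v, a v = 0 → b v = 0 → z v = 0 → v = 0) (x y w : ℝ) :
    ∃ v, a v = x ∧ b v = y ∧ z v = w := by
  have h1 : Function.Injective (LinearMap.pi ![a, b, z] : V3 →ₗ[ℝ] V3) := by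
    rw [injective_iff_map_eq_zero]
    intro v hv
    exact hi v (congrFun hv 0) (congrFun hv 1) (congrFun hv 2)
  obtain ⟨v, hv⟩ := LinearMap.injective_iff_surjective.1 h1 ![x, y, w]
  exact ⟨v, congrFun hv 0, congrFun hv 1, congrFun hv 2⟩

lemma projline {a b z : V3 →ₗ[ℝ] ℝ} (hi : ∀ v, a v = 0 → b v = 0 → z v = 0 → v = 0) (t c : ℝ) :
    ∃ L, IsProjLine L ∧ ∀ p : RP2, p ∈ L ↔ b p.rep = t * a p.rep + c * z p.rep := by
  refine ⟨_, ⟨LinearMap.ker (b - t • a - c • z), ?_, rfl⟩, fun p => ?_⟩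
  · have h := LinearMap.finrank_range_add_finrank_ker (b - t • a - c • z)
    have h2 : LinearMap.range (b - t • a - c • z) = ⊤ := by
      rw [LinearMap.range_eq_top]
      intro y
      obtain ⟨v, h1, h2, h3⟩ := surj3 hi 0 y 0
      exact ⟨v, by simp [h1, h2, h3]⟩
    rw [h2, finrank_top, Module.finrank_self, Module.finrank_fin_fun] at h
    exact Nat.add_left_cancel (n := 1) h
  · rw [Set.mem_ofPred_eq, Projectivization.submodule_eq, Submodule.span_singleton_le_iff_mem, LinearMap.mem_ker]
    simp
    constructor <;> intro h <;> linarith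

lemma chart {P : Set RP2} (hP : P.Finite) {a b z : V3 →ₗ[ℝ] ℝ}
    (hi : ∀ v, a v = 0 → b v = 0 → z v = 0 → v = 0) (hz : ∀ p ∈ P, z p.rep ≠ 0)
    (ha : ∀ p ∈ P, ∀ q ∈ P, p ≠ q → a p.rep * z q.rep ≠ a q.rep * z p.rep)
    (hL : ¬ ∃ L, IsProjLine L ∧ P ⊆ L) :
    ∃ (X : Fr) (f : Fn), X.card = P.ncard ∧ N2 X f ≤ numOrdinaryLines P ∧
      (¬ ∃ t c, ∀ x ∈ X, f x = t * x + c) ∧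
      (∀ x, x ∈ X ↔ ∃ p ∈ P, a p.rep / z p.rep = x) ∧
      ∀ p ∈ P, f (a p.rep / z p.rep) = b p.rep / z p.rep := by
  classical
  have inj : Set.InjOn (fun p : RP2 => a p.rep / z p.rep) P := by
    intro p hp q hq h
    by_contra hne
    apply ha p hp q hq hne
    have h1 := hz p hp
    have h2 := hz q hq
    simp only at h
    field_simp at h
    linarith
  set φ : RP2 → ℝ := fun p : RP2 => a p.rep / z p.rep with hφ
  have hX : ∀ x, x ∈ hP.toFinset.image φ ↔ ∃ p ∈ P, a p.rep / z p.rep = x := by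
    intro x; simp [hφ]
  have hf : ∀ p ∈ P, (fun x => b (Function.invFunOn φ P x).rep / z (Function.invFunOn φ P x).rep) (a p.rep / z p.rep) = b p.rep / z p.rep := by
    intro p hp
    have : Function.invFunOn φ P (φ p) = p := inj.leftInvOn_invFunOn hp
    show b (Function.invFunOn φ P (φ p)).rep / z (Function.invFunOn φ P (φ p)).rep = _
    rw [this]
  generalize (fun x => b (Function.invFunOn φ P x).rep / z (Function.invFunOn φ P x).rep) = f at hf
  have on : ∀ p ∈ P, ∀ t c, (b p.rep = t * a p.rep + c * z p.rep ↔ f (φ p) = t * φ p + c) := by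
    intro p hp t c
    have h1 := hz p hp
    simp only [hφ]
    rw [hf p hp]
    field_simp
  refine ⟨hP.toFinset.image φ, f, ?_, ?_, ?_, hX, hf⟩
  · rw [card_image_of_injOn (by simpa using inj), Set.ncard_eq_toFinset_card P hP]
  · unfold N2 numOrdinaryLines
    have ex : ∀ s : Fr, ∃ L : Set RP2, s ∈ ordPairs (hP.toFinset.image φ) f →
        IsProjLine L ∧ ∀ p ∈ P, p ∈ L ↔ φ p ∈ s := by
      intro s
      by_cases hs : s ∈ ordPairs (hP.toFinset.image φ) f
      · simp only [ordPairs, mem_filter] at hs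
        obtain ⟨_, t, c, h⟩ := hs
        obtain ⟨L, h1, h2⟩ := projline hi t c
        refine ⟨L, fun _ => ⟨h1, fun p hp => ?_⟩⟩
        rw [h2, on p hp, h _ ((hX _).2 ⟨p, hp, rfl⟩)]
      · exact ⟨∅, fun h => absurd h hs⟩
    choose F hF using ex
    have im : ∀ s ∈ ordPairs (hP.toFinset.image φ) f, φ '' (P ∩ F s) = s := by
      intro s hs
      obtain ⟨h1, h2⟩ := hF s hs
      simp only [ordPairs, mem_filter, mem_powersetCard] at hs
      ext x
      constructor
      · rintro ⟨p, ⟨hp, hpL⟩, rfl⟩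
        exact (h2 p hp).1 hpL
      · intro hx
        obtain ⟨p, hp, rfl⟩ := (hX _).1 (hs.1.1 hx)
        exact ⟨p, ⟨hp, (h2 p hp).2 hx⟩, rfl⟩
    rw [← Set.ncard_coe_finset]
    refine Set.ncard_le_ncard_of_injOn F ?_ ?_ (fin_OL hP)
    · intro s hs
      have hs' := im s hs
      refine ⟨(hF s hs).1, ?_⟩
      rw [← Set.InjOn.ncard_image (inj.mono Set.inter_subset_left), hs', Set.ncard_coe_finset]
      have hs : s ∈ ordPairs (hP.toFinset.image φ) f := hs
      simp only [ordPairs, mem_filter, mem_powersetCard] at hs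
      exact hs.1.2
    · intro s hs s' hs' h
      have h1 := im s hs
      rw [h, im s' hs'] at h1
      exact (Finset.coe_injective h1).symm
  · rintro ⟨t, c, h⟩
    obtain ⟨L, h1, h2⟩ := projline hi t c
    refine hL ⟨L, h1, fun p hp => ?_⟩
    rw [h2, on p hp]
    exact h _ ((hX _).2 ⟨p, hp, rfl⟩)

lemma dualne {S : Set V3} (hS : S.Finite) : ∃ z : V3 →ₗ[ℝ] ℝ, ∀ v ∈ S, v ≠ 0 → z v ≠ 0 := by
  have : Finite ↥(S \ {0}) := (hS.subset Set.sdiff_subset).to_subtype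
  obtain ⟨z, hz⟩ := Module.exists_dual_forall_apply_ne_zero (K := ℝ) (fun v : ↥(S \ {0}) => (v : V3)) (fun v => v.2.2)
  exact ⟨z, fun v hv h0 => hz ⟨v, hv, h0⟩⟩

lemma meet3 {p q p' q' : RP2} (h : p ≠ q) (h' : p' ≠ q') :
    ∃ v : V3, v ≠ 0 ∧ v ∈ Submodule.span ℝ (Set.range ![p.rep, q.rep]) ∧
      v ∈ Submodule.span ℝ (Set.range ![p'.rep, q'.rep]) := by
  have e := Submodule.finrank_sup_add_finrank_inf_eq (Submodule.span ℝ (Set.range ![p.rep, q.rep]))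
    (Submodule.span ℝ (Set.range ![p'.rep, q'.rep]))
  rw [finrank_span_eq_card (rep_indep h), finrank_span_eq_card (rep_indep h')] at e
  have e2 := Submodule.finrank_le (Submodule.span ℝ (Set.range ![p.rep, q.rep]) ⊔
    Submodule.span ℝ (Set.range ![p'.rep, q'.rep]))
  rw [Module.finrank_fin_fun] at e2
  have e3 : (Submodule.span ℝ (Set.range ![p.rep, q.rep]) ⊓
    Submodule.span ℝ (Set.range ![p'.rep, q'.rep])) ≠ ⊥ := by
    intro hb
    rw [hb, finrank_bot, Fintype.card_fin] at e
    have : (2 + 2 : ℕ) ≤ 3 := le_of_eq_of_le e.symm e2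
    omega
  obtain ⟨v, hv, h0⟩ := Submodule.exists_mem_ne_zero_of_ne_bot e3
  exact ⟨v, h0, hv.1, hv.2⟩

lemma span_zero {g : V3 →ₗ[ℝ] ℝ} {u v w : V3} (hw : w ∈ Submodule.span ℝ (Set.range ![u, v]))
    (hu : g u = 0) (hv : g v = 0) : g w = 0 := by
  have : Submodule.span ℝ (Set.range ![u, v]) ≤ LinearMap.ker g := by
    rw [Submodule.span_le]
    rintro _ ⟨i, rfl⟩
    fin_cases i
    · exact hu
    · exact hv
  exact this hw

lemma chart1 {P : Set RP2} (hP : P.Finite) (h2 : 1 < P.ncard) : ∃ a b z : V3 →ₗ[ℝ] ℝ,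
    (∀ v, a v = 0 → b v = 0 → z v = 0 → v = 0) ∧ (∀ p ∈ P, z p.rep ≠ 0) ∧
    (∀ p ∈ P, ∀ q ∈ P, p ≠ q → a p.rep * z q.rep ≠ a q.rep * z p.rep) ∧
    ∀ p ∈ P, ∀ q ∈ P, p ≠ q → ∀ p' ∈ P, ∀ q' ∈ P, p' ≠ q' → ∃ v, z v ≠ 0 ∧
      v ∈ Submodule.span ℝ (Set.range ![p.rep, q.rep]) ∧
      v ∈ Submodule.span ℝ (Set.range ![p'.rep, q'.rep]) := by
  classical
  have ex : ∀ i : (RP2 × RP2) × (RP2 × RP2), ∃ v : V3, i.1.1 ≠ i.1.2 → i.2.1 ≠ i.2.2 → v ≠ 0 ∧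
      v ∈ Submodule.span ℝ (Set.range ![i.1.1.rep, i.1.2.rep]) ∧
      v ∈ Submodule.span ℝ (Set.range ![i.2.1.rep, i.2.2.rep]) := by
    intro i
    by_cases h : i.1.1 ≠ i.1.2 ∧ i.2.1 ≠ i.2.2
    · obtain ⟨v, hv⟩ := meet3 h.1 h.2
      exact ⟨v, fun _ _ => hv⟩
    · exact ⟨0, fun a b => absurd ⟨a, b⟩ h⟩
  choose w hw using ex
  obtain ⟨z, hz⟩ := dualne ((hP.image (fun p => p.rep)).union (((hP.prod hP).prod (hP.prod hP)).image w))
  have hzP : ∀ p ∈ P, z p.rep ≠ 0 := fun p hp => hz _ (Or.inl ⟨p, hp, rfl⟩) p.rep_nonzero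
  obtain ⟨a, ha⟩ := dualne ((hP.prod hP).image (fun i => z i.2.rep • i.1.rep - z i.1.rep • i.2.rep))
  have haP : ∀ p ∈ P, ∀ q ∈ P, p ≠ q → a p.rep * z q.rep ≠ a q.rep * z p.rep := by
    intro p hp q hq hne he
    refine ha _ ⟨(p, q), ⟨hp, hq⟩, rfl⟩ (fun h0 => ?_) ?_
    · have := LinearIndependent.pair_iff.1 (rep_indep hne) (z q.rep) (-z p.rep) (by rw [neg_smul, ← sub_eq_add_neg]; exact h0)
      exact hzP q hq this.1
    · simp; linarith
  obtain ⟨p, hp, q, hq, hpq⟩ := (Set.one_lt_ncard hP).1 h2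
  have hD := haP p hp q hq hpq
  have sur : Function.Surjective (a.prod z) := by
    rintro ⟨x, y⟩
    obtain ⟨i, hi⟩ : ∃ i, (a p.rep * z q.rep - a q.rep * z p.rep) * i = 1 := ⟨_, mul_inv_cancel₀ (sub_ne_zero.2 hD)⟩
    refine ⟨((x * z q.rep - a q.rep * y) * i) • p.rep + ((a p.rep * y - x * z p.rep) * i) • q.rep, Prod.ext ?_ ?_⟩
    · show a _ = x
      simp only [map_add, map_smul, smul_eq_mul]
      linear_combination x * hi
    · show z _ = y
      simp only [map_add, map_smul, smul_eq_mul]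
      linear_combination y * hi
  have fk := LinearMap.finrank_range_add_finrank_ker (a.prod z)
  rw [LinearMap.range_eq_top.2 sur, finrank_top, Module.finrank_prod, Module.finrank_self, Module.finrank_fin_fun] at fk
  have fk1 : Module.finrank ℝ (LinearMap.ker (a.prod z)) = 1 := Nat.add_left_cancel (n := 2) fk
  obtain ⟨k, hk0, hk⟩ := finrank_eq_one_iff'.1 fk1
  obtain ⟨b, hb⟩ := dualne (Set.finite_singleton (k : V3))
  have hbk := hb k rfl (by simpa using hk0)
  refine ⟨a, b, z, fun v h1 h2 h3 => ?_, hzP, haP, ?_⟩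
  · obtain ⟨c, hc⟩ := hk ⟨v, by simp [LinearMap.mem_ker, h1, h3]⟩
    have hc' : c • (k : V3) = v := congrArg Subtype.val hc
    rw [← hc', map_smul, smul_eq_mul] at h2
    rw [← hc', (mul_eq_zero.1 h2).resolve_right hbk, zero_smul]
  · intro p hp q hq hne p' hp' q' hq' hne'
    obtain ⟨e1, e2, e3⟩ := hw ((p, q), (p', q')) hne hne'
    exact ⟨_, hz _ (Or.inr ⟨((p, q), (p', q')), ⟨⟨hp, hq⟩, ⟨hp', hq'⟩⟩, rfl⟩) e1, e2, e3⟩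

lemma quadfin {A B C : ℝ} (h : A ≠ 0 ∨ B ≠ 0 ∨ C ≠ 0) : {τ : ℝ | A + B * τ + C * τ ^ 2 = 0}.Finite := by
  have h0 : Polynomial.C A + Polynomial.C B * Polynomial.X + Polynomial.C C * Polynomial.X ^ 2 ≠ 0 := by
    intro e
    have e0 := congrArg (fun p => Polynomial.coeff p 0) e
    have e1 := congrArg (fun p => Polynomial.coeff p 1) e
    have e2 := congrArg (fun p => Polynomial.coeff p 2) e
    simp [Polynomial.coeff_X, Polynomial.coeff_C] at e0 e1 e2
    tauto
  refine (Polynomial.finite_setOfPred_isRoot h0).subset fun τ hτ => ?_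
  simpa [Polynomial.IsRoot] using hτ

lemma chart2 {P : Set RP2} (hP : P.Finite) {ξ η ζ : V3 →ₗ[ℝ] ℝ}
    (hi : ∀ v, ξ v = 0 → η v = 0 → ζ v = 0 → v = 0) : ∃ a z : V3 →ₗ[ℝ] ℝ,
    (∀ v, a v = 0 → η v = 0 → z v = 0 → v = 0) ∧ (∀ p ∈ P, z p.rep ≠ 0) ∧
    (∀ p ∈ P, ∀ q ∈ P, p ≠ q → a p.rep * z q.rep ≠ a q.rep * z p.rep) ∧
    ∀ v, ξ v ^ 2 = η v * ζ v → a v ^ 2 = η v * z v := by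
  have b1 : ∀ p : RP2, {τ : ℝ | ζ p.rep + (2 * ξ p.rep) * τ + η p.rep * τ ^ 2 = 0}.Finite := by
    refine fun p => quadfin ?_
    by_contra h
    push Not at h
    exact p.rep_nonzero (hi _ (by linarith [h.2.1]) h.2.2 h.1)
  have b2 : ∀ p q : RP2, p ≠ q → {τ : ℝ | (ξ p.rep * ζ q.rep - ξ q.rep * ζ p.rep) +
      (η p.rep * ζ q.rep - η q.rep * ζ p.rep) * τ + (η p.rep * ξ q.rep - η q.rep * ξ p.rep) * τ ^ 2 = 0}.Finite := by
    refine fun p q hne => quadfin ?_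
    by_contra h
    push Not at h
    obtain ⟨h1, h2, h3⟩ := h
    have par : ∀ x y : ℝ, ξ p.rep * y = ξ q.rep * x → η p.rep * y = η q.rep * x → ζ p.rep * y = ζ q.rep * x → x = 0 := by
      intro x y e1 e2 e3
      have := LinearIndependent.pair_iff.1 (rep_indep hne) y (-x) (hi _ ?_ ?_ ?_)
      · linarith [this.2]
      all_goals simp only [map_add, map_smul, smul_eq_mul]; linarith
    exact p.rep_nonzero (hi _ (par _ (ξ q.rep) (by ring) (by linarith) (by linarith))
      (par _ (η q.rep) (by linarith) (by ring) (by linarith)) (par _ (ζ q.rep) (by linarith) (by linarith) (by ring)))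
  have b3 := (hP.biUnion fun p _ => b1 p).union (hP.biUnion fun p _ => hP.biUnion fun q _ =>
    Set.finite_iUnion fun h : p ≠ q => b2 p q h)
  obtain ⟨τ, hτ⟩ := b3.exists_notMem
  simp only [Set.mem_union, Set.mem_iUnion, Set.mem_ofPred_eq, not_or, not_exists] at hτ
  refine ⟨ξ + τ • η, ζ + (2 * τ) • ξ + τ ^ 2 • η, fun v => ?_, fun p hp h => ?_, fun p hp q hq hne h => ?_, fun v h => ?_⟩
  · simp only [LinearMap.add_apply, LinearMap.smul_apply, smul_eq_mul]
    intro h1 h2 h3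
    rw [h2] at h1 h3
    have h1 : ξ v = 0 := by linarith
    rw [h1] at h3
    exact hi v h1 h2 (by linarith)
  · refine hτ.1 p hp ?_
    simp only [LinearMap.add_apply, LinearMap.smul_apply, smul_eq_mul] at h
    linarith
  · refine hτ.2 p hp q hq hne ?_
    simp only [LinearMap.add_apply, LinearMap.smul_apply, smul_eq_mul] at h
    linear_combination h
  · simp only [LinearMap.add_apply, LinearMap.smul_apply, smul_eq_mul]
    linear_combination h

lemma second {P : Set RP2} (hP : P.Finite) (hL : ¬ ∃ L, IsProjLine L ∧ P ⊆ L) {ξ η ζ : V3 →ₗ[ℝ] ℝ}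
    (hi : ∀ v, ξ v = 0 → η v = 0 → ζ v = 0 → v = 0) {S : Set RP2} (hS : S ⊆ P)
    (hc : ∀ p ∈ S, ξ p.rep ^ 2 = η p.rep * ζ p.rep) : ∃ (X : Fr) (f : Fn),
    X.card = P.ncard ∧ N2 X f ≤ numOrdinaryLines P ∧ S.ncard ≤ (Par X f).card := by
  obtain ⟨a, z, h1, h2, h3, h4⟩ := chart2 hP hi
  obtain ⟨X, f, g1, g2, -, g4, g5⟩ := chart hP h1 h2 h3 hL
  refine ⟨X, f, g1, g2, ?_⟩
  rw [← Set.ncard_coe_finset]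
  refine Set.ncard_le_ncard_of_injOn (fun p : RP2 => a p.rep / z p.rep) (fun p hp => ?_) ?_ (Finset.finite_toSet _)
  · have hz := h2 p (hS hp)
    refine mem_Par.2 ⟨(g4 _).2 ⟨p, hS hp, rfl⟩, ?_⟩
    show f (a p.rep / z p.rep) = _
    rw [g5 p (hS hp)]
    have := h4 _ (hc p hp)
    field_simp
    exact this.symm
  · intro p hp q hq h
    by_contra hne
    have z1 := h2 p (hS hp)
    have z2 := h2 q (hS hq)
    apply h3 p (hS hp) q (hS hq) hne
    simp only at h
    field_simp at h
    linarith

theorem main : ∃ n₀ : ℕ, 0 < n₀ ∧ ∀ n, n₀ ≤ n → ∀ P : Set RP2, P.Finite → P.ncard = n →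
    ¬ (∃ L, IsProjLine L ∧ P ⊆ L) → dmBound n ≤ numOrdinaryLines P := by
  classical
  obtain ⟨M, n1, hB⟩ := caseB
  obtain ⟨n2, hT⟩ := trich (M + 36)
  refine ⟨n1 + n2 + 2, by omega, fun n hn P hP hPn hL => ?_⟩
  obtain ⟨a, b, z, h1, h2, h3, h4⟩ := chart1 hP (by omega)
  obtain ⟨X, f, g1, g2, g3, g4, g5⟩ := chart hP h1 h2 h3 hL
  have np : NoPar X f := by
    rintro t s s' ⟨u, hu, v, hv, huv, fu, fv⟩ ⟨u', hu', v', hv', huv', fu', fv'⟩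
    obtain ⟨p, hp, rfl⟩ := (g4 _).1 hu
    obtain ⟨q, hq, rfl⟩ := (g4 _).1 hv
    obtain ⟨p', hp', rfl⟩ := (g4 _).1 hu'
    obtain ⟨q', hq', rfl⟩ := (g4 _).1 hv'
    have on : ∀ p ∈ P, ∀ s, f (a p.rep / z p.rep) = t * (a p.rep / z p.rep) + s → (b - t • a - s • z) p.rep = 0 := by
      intro p hp s h
      have := h2 p hp
      rw [g5 p hp] at h
      field_simp at h
      simp only [LinearMap.sub_apply, LinearMap.smul_apply, smul_eq_mul]
      linarith
    obtain ⟨w, w0, w1, w2⟩ := h4 p hp q hq (by rintro rfl; exact huv rfl) p' hp' q' hq' (by rintro rfl; exact huv' rfl)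
    have e1 := span_zero w1 (on p hp s fu) (on q hq s fv)
    have e2 := span_zero w2 (on p' hp' s' fu') (on q' hq' s' fv')
    simp only [LinearMap.sub_apply, LinearMap.smul_apply, smul_eq_mul] at e1 e2
    apply mul_right_cancel₀ w0
    linarith
  by_cases hN : N2 X f ≤ X.card
  swap
  · unfold dmBound; split_ifs <;> omega
  rcases hT X f (by omega) np g3 hN with h | ⟨Q, q1, q2, q3⟩
  · unfold dmBound; split_ifs <;> omega
  obtain ⟨t, c, x0, x1, k, l, m, hx, hm, hc⟩ := conic q1 q2 (s := X.filter (fun x => Q.evalEval x (f x) = 0)) (f := f)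
    (fun x hx => (mem_filter.1 hx).2) (by omega)
  obtain ⟨Y, g, e1, e2, e3⟩ := second hP hL (ξ := b - t • a - c • z)
    (η := m • (a - x0 • z + k • (b - t • a - c • z))) (ζ := a - x1 • z + l • (b - t • a - c • z))
    (by
      simp only [LinearMap.add_apply, LinearMap.sub_apply, LinearMap.smul_apply, smul_eq_mul]
      intro v i1 i2 i3
      rw [i1] at i2 i3
      have i2 := (mul_eq_zero.1 i2).resolve_left hm
      have zz : z v = 0 := (mul_eq_zero.1 (show (x0 - x1) * z v = 0 by linarith)).resolve_left (sub_ne_zero.2 hx)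
      rw [zz] at i1 i2
      have aa : a v = 0 := by linarith
      rw [aa] at i1
      exact h1 v aa (by linarith) zz)
    (S := {p ∈ P | a p.rep / z p.rep ∈ X.filter (fun x => Q.evalEval x (f x) = 0)}) (Set.sep_subset _ _)
    (by
      rintro p ⟨hp, hps⟩
      have := hc _ hps
      rw [g5 p hp] at this
      have hz := h2 p hp
      simp only [LinearMap.add_apply, LinearMap.sub_apply, LinearMap.smul_apply, smul_eq_mul]
      field_simp at this
      linarith)
  have hS : (X.filter (fun x => Q.evalEval x (f x) = 0)).card ≤
      {p ∈ P | a p.rep / z p.rep ∈ X.filter (fun x => Q.evalEval x (f x) = 0)}.ncard := by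
    have hfin := hP.subset (Set.sep_subset P (fun p => a p.rep / z p.rep ∈ X.filter (fun x => Q.evalEval x (f x) = 0)))
    refine le_trans ?_ (Set.ncard_image_le (f := fun p : RP2 => a p.rep / z p.rep) hfin)
    rw [← Set.ncard_coe_finset]
    refine Set.ncard_le_ncard (fun x hx => ?_) (hfin.image _)
    obtain ⟨p, hp, rfl⟩ := (g4 x).1 (mem_filter.1 hx).1
    exact ⟨p, ⟨hp, hx⟩, rfl⟩
  have := hB Y g (by omega) (by omega)
  rw [e1, hPn] at this
  omega

end GT
end

/-- The sharp Dirac–Motzkin theorem for large `n`: any set of `n` points of `ℝP²`,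
not all on one line, spans at least `f(n)` ordinary lines. -/
theorem sharp_dirac_motzkin :
    ∃ n₀ : ℕ, 0 < n₀ ∧ ∀ n : ℕ, n₀ ≤ n →
      ∀ P : Set RP2, P.Finite → P.ncard = n →
        ¬ (∃ L : Set RP2, IsProjLine L ∧ P ⊆ L) →
          dmBound n ≤ numOrdinaryLines P := by
  exact GT.main
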